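/- For every ε > 0 there exist 0 < δ₀ < 1 and C > 1 with the following property. Let 0 < δ < δ₀ and let u be a classical solution of the one-phase free boundary problem in B₁ ∖ closure(B_δ) ⊆ ℝ² satisfying condition (A). Let T be the connected component of {z : δ < |z| < 1/C, u(z) > 0} whose closure intersects ∂B_δ. Then for every r ∈ (Cδ, 1/C] there is a rotation ρ of ℝ² such that |u(ρx)·1_T(ρx) − P(x)| ≤ ε r for all x ∈ B_r ∖ B_{Cδ}. -/

import Mathlib

open Complex Metric Set Filter MeasureTheory
open scoped Topology Classical NNReal

noncomputable section

/-- The positive phase of `u` in `Ω`. -/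
def posSet (Ω : Set ℂ) (u : ℂ → ℝ) : Set ℂ := {z ∈ Ω | 0 < u z}

/-- The free boundary of `u` in `Ω`. -/
def FB (Ω : Set ℂ) (u : ℂ → ℝ) : Set ℂ := Ω ∩ frontier (posSet Ω u)

/-- The gradient of `u : ℂ → ℝ`, viewed as a complex number `∂ₓu + i ∂ᵧu`. -/
def grad2 (u : ℂ → ℝ) (z : ℂ) : ℂ :=
  ((fderiv ℝ u z 1 : ℝ) : ℂ) + ((fderiv ℝ u z Complex.I : ℝ) : ℂ) * Complex.I

/-- Second derivative (Hessian) of `u : ℂ → ℝ` at `z` in directions `v, w`. -/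
def hess (u : ℂ → ℝ) (z v w : ℂ) : ℝ := fderiv ℝ (fun x => fderiv ℝ u x v) z w

/-- `u` is harmonic on `s`: twice continuously differentiable with vanishing Laplacian. -/
def HarmonicOn2 (u : ℂ → ℝ) (s : Set ℂ) : Prop :=
  ContDiffOn ℝ 2 u s ∧ ∀ z ∈ s, hess u z 1 1 + hess u z Complex.I Complex.I = 0

/-- A classical solution of the one-phase free boundary problem `Δu = 0` in `{u>0}`,
`|∇u| = 1` on the free boundary, in the open set `Ω ⊆ ℝ² ≅ ℂ`. -/
structure IsClassicalSolution (Ω : Set ℂ) (u : ℂ → ℝ) : Prop where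
  contOn : ContinuousOn u Ω
  nonneg : ∀ z ∈ Ω, 0 ≤ u z
  harm : HarmonicOn2 u (posSet Ω u)
  smooth_ext : ∃ v : ℂ → ℝ, ContDiffOn ℝ (⊤ : ℕ∞) v (Ω ∩ closure (posSet Ω u)) ∧
    Set.EqOn u v (Ω ∩ closure (posSet Ω u))
  fb_manifold : ∀ z ∈ FB Ω u, ∃ V : Set ℂ, IsOpen V ∧ z ∈ V ∧ V ⊆ Ω ∧
    ∃ φ : ℂ → ℝ, ContDiffOn ℝ (⊤ : ℕ∞) φ V ∧ (∀ w ∈ V, fderiv ℝ φ w ≠ 0) ∧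
      V ∩ posSet Ω u = {w ∈ V | 0 < φ w} ∧
      V ∩ {w | u w = 0} = {w ∈ V | φ w ≤ 0} ∧
      V ∩ FB Ω u = {w ∈ V | φ w = 0}
  grad_one : ∀ z ∈ FB Ω u,
    Filter.Tendsto (fun w => ‖grad2 u w‖) (nhdsWithin z (posSet Ω u)) (nhds 1)

/-- One-plane solution `P(z) = max (Re z) 0`. -/
def Pfun (z : ℂ) : ℝ := max z.re 0

/-- Wedge solution `W_s(z) = s |Re z|`. -/
def Wfun (s : ℝ) (z : ℂ) : ℝ := s * |z.re|

/-- Two-plane solution `TP_a`. -/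
def TPfun (a : ℝ) (z : ℂ) : ℝ := max z.re 0 + max (-z.re - a) 0

/-- Rotation of the plane by angle `θ`. -/
def rot (θ : ℝ) (z : ℂ) : ℂ := Complex.exp (θ * Complex.I) * z

/-- The strip `S = {|Im ζ| < π/2}`. -/
def Sstrip : Set ℂ := {ζ : ℂ | |ζ.im| < Real.pi / 2}

/-- The hairpin domain `Ω₁ = {|x₂| < π/2 + cosh x₁}`. -/
def Omega1 : Set ℂ := {z : ℂ | |z.im| < Real.pi / 2 + Real.cosh z.re}

/-- Dilated hairpin domain `Ω_a = aΩ₁`. -/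
def OmegaA (a : ℝ) : Set ℂ := {z : ℂ | z / (a : ℂ) ∈ Omega1}

/-- The Hauswirth–Hélein–Pacard double hairpin solution `H = H₁`:
`H(z) = Re (cosh w)` where `w` is the unique point of the strip `S` with `w + sinh w = z`,
and `H(z) = 0` if there is no such point. -/
def hairpinH (z : ℂ) : ℝ :=
  if h : ∃ w : ℂ, w ∈ Sstrip ∧ w + Complex.sinh w = z then (Complex.cosh h.choose).re else 0

/-- The double hairpin solution `H_a(z) = a H(z/a)`. -/
def hairpin (a : ℝ) (z : ℂ) : ℝ := a * hairpinH (z / (a : ℂ))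

/-- Euclidean dot product of two complex numbers viewed as vectors in ℝ². -/
def dot2 (a b : ℂ) : ℝ := a.re * b.re + a.im * b.im

/-- Divergence of a vector field `ψ : ℂ → ℂ` on ℝ². -/
def div2 (ψ : ℂ → ℂ) (z : ℂ) : ℝ := (fderiv ℝ ψ z 1).re + (fderiv ℝ ψ z Complex.I).im

/-- A variational (weak) solution of the one-phase free boundary problem in `Ω`:
`u ∈ H¹_loc(Ω) ∩ C(Ω)`, `u ≥ 0`, `u ∈ C²({u>0})`, and the domain-variation
Euler–Lagrange identity holds for all compactly supported smooth vector fields. -/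
def VariationalSolution (Ω : Set ℂ) (u : ℂ → ℝ) : Prop :=
  ContinuousOn u Ω ∧ (∀ z ∈ Ω, 0 ≤ u z) ∧
  (∀ K : Set ℂ, K ⊆ Ω → IsCompact K →
    MeasureTheory.IntegrableOn (fun z => (u z) ^ 2 + ‖grad2 u z‖ ^ 2) K) ∧
  ContDiffOn ℝ 2 u (posSet Ω u) ∧
  ∀ ψ : ℂ → ℂ, ContDiff ℝ (⊤ : ℕ∞) ψ → HasCompactSupport ψ → tsupport ψ ⊆ Ω →
    ∫ z in Ω, ((‖grad2 u z‖ ^ 2 + Set.indicator {w | 0 < u w} (fun _ => (1 : ℝ)) z) * div2 ψ z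
      - 2 * dot2 (grad2 u z) (fderiv ℝ ψ z (grad2 u z))) = 0

/-- Average of `w` over the circle of radius `r` around `z`. -/
def circleAvg (w : ℂ → ℝ) (z : ℂ) (r : ℝ) : ℝ :=
  (1 / (2 * Real.pi)) * ∫ θ in (0 : ℝ)..(2 * Real.pi), w (z + r * Complex.exp (θ * Complex.I))

/-- Superharmonicity on `s` via the super-mean-value property. -/
def SuperharmonicOn2 (w : ℂ → ℝ) (s : Set ℂ) : Prop :=
  ∀ z ∈ s, ∀ r : ℝ, 0 < r → Metric.closedBall z r ⊆ s → circleAvg w z r ≤ w z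

/-- Subharmonicity on `s` via the sub-mean-value property. -/
def SubharmonicOn2 (w : ℂ → ℝ) (s : Set ℂ) : Prop :=
  ∀ z ∈ s, ∀ r : ℝ, 0 < r → Metric.closedBall z r ⊆ s → w z ≤ circleAvg w z r

/-- Non-tangential approach region in `B` at `x₀` with aperture `C`. -/
def NontangentialIn (B : Set ℂ) (x₀ : ℂ) (C : ℝ) : Set ℂ :=
  {x ∈ B | ‖x - x₀‖ ≤ C * Metric.infDist x Bᶜ}

/-- `w(x) = α ⟨x − x₀, ν⟩⁺ + o(|x − x₀|)` as `x → x₀` within the region `R`. -/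
def HasSlopeAt (w : ℂ → ℝ) (x₀ ν : ℂ) (α : ℝ) (R : Set ℂ) : Prop :=
  Filter.Tendsto (fun x => (w x - α * max (dot2 (x - x₀) ν) 0) / ‖x - x₀‖)
    (nhdsWithin x₀ R) (nhds 0)

/-- Viscosity supersolution of the one-phase free boundary problem in `Ω`. -/
structure ViscositySupersolution (Ω : Set ℂ) (w : ℂ → ℝ) : Prop where
  contOn : ContinuousOn w Ω
  nonneg : ∀ z ∈ Ω, 0 ≤ w z
  superharm : SuperharmonicOn2 w (posSet Ω w)
  slope : ∀ x₀ ∈ FB Ω w, ∀ (y : ℂ) (ρ : ℝ), 0 < ρ → Metric.ball y ρ ⊆ posSet Ω w →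
    dist x₀ y = ρ → ∃ α : ℝ, α ≤ 1 ∧ ∀ C : ℝ, 1 < C →
      HasSlopeAt w x₀ ((y - x₀) / (ρ : ℂ)) α (NontangentialIn (Metric.ball y ρ) x₀ C)

/-- Viscosity subsolution of the one-phase free boundary problem in `Ω`. -/
structure ViscositySubsolution (Ω : Set ℂ) (w : ℂ → ℝ) : Prop where
  contOn : ContinuousOn w Ω
  nonneg : ∀ z ∈ Ω, 0 ≤ w z
  subharm : SubharmonicOn2 w (posSet Ω w)
  slope : ∀ x₀ ∈ FB Ω w, ∀ (y : ℂ) (ρ : ℝ), 0 < ρ →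
    Metric.ball y ρ ⊆ {z ∈ Ω | w z = 0} → dist x₀ y = ρ →
    ∃ α : ℝ, 1 ≤ α ∧ ∀ C : ℝ, 1 < C →
      HasSlopeAt w x₀ ((x₀ - y) / (ρ : ℂ)) α
        (NontangentialIn (closure (Metric.ball y ρ))ᶜ x₀ C)

/-- Viscosity solution: both a supersolution and a subsolution. -/
def ViscositySolution (Ω : Set ℂ) (w : ℂ → ℝ) : Prop :=
  ViscositySupersolution Ω w ∧ ViscositySubsolution Ω w

/-- Non-degeneracy with constant `c`: linear growth away from the free boundary. -/
def Nondegenerate (Ω : Set ℂ) (w : ℂ → ℝ) (c : ℝ) : Prop :=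
  ∀ x ∈ FB Ω w, ∀ r : ℝ, 0 < r → Metric.ball x r ⊆ Ω → c * r ≤ sSup (w '' Metric.ball x r)

/-- The open annulus `{δ < |z| < R}`. -/
def ann (δ R : ℝ) : Set ℂ := {z : ℂ | δ < ‖z‖ ∧ ‖z‖ < R}

/-- Condition (A): the free boundary of `u` in the annulus `{δ < |z| < R}` consists of
exactly two connected components, each non-compact with closure meeting both boundary
circles. -/
def ConditionA (δ R : ℝ) (u : ℂ → ℝ) : Prop :=
  ∃ F₁ F₂ : Set ℂ,
    F₁.Nonempty ∧ F₂.Nonempty ∧ Disjoint F₁ F₂ ∧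
    F₁ ∪ F₂ = FB (ann δ R) u ∧
    (∀ z ∈ F₁, connectedComponentIn (FB (ann δ R) u) z = F₁) ∧
    (∀ z ∈ F₂, connectedComponentIn (FB (ann δ R) u) z = F₂) ∧
    ¬ IsCompact F₁ ∧ ¬ IsCompact F₂ ∧
    (closure F₁ ∩ Metric.sphere 0 δ).Nonempty ∧
    (closure F₁ ∩ Metric.sphere 0 R).Nonempty ∧
    (closure F₂ ∩ Metric.sphere 0 δ).Nonempty ∧
    (closure F₂ ∩ Metric.sphere 0 R).Nonempty

/-- `k` is the curvature of the set `S` at the point `p`, computed via an arc-length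
parametrization. -/
def IsCurvatureAt (S : Set ℂ) (p : ℂ) (k : ℝ) : Prop :=
  ∃ γ : ℝ → ℂ, ContDiff ℝ 2 γ ∧ γ 0 = p ∧ (∀ s : ℝ, ‖deriv γ s‖ = 1) ∧
    (∃ ε > 0, ∀ s ∈ Set.Ioo (-ε) ε, γ s ∈ S) ∧ ‖deriv (deriv γ) 0‖ = k

/-- A set has exactly two connected components. -/
def HasExactlyTwoComponents (S : Set ℂ) : Prop :=
  ∃ z₁ ∈ S, ∃ z₂ ∈ S, connectedComponentIn S z₁ ≠ connectedComponentIn S z₂ ∧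
    ∀ z ∈ S, connectedComponentIn S z = connectedComponentIn S z₁ ∨
      connectedComponentIn S z = connectedComponentIn S z₂

end

/-! ### Primitives on plane open sets with connected complement -/

lemma int_fun_const_of_step {α : Type*} (d : ℤ → α) (h : ∀ j, d j = d (j - 1)) (j k : ℤ) :
    d j = d k := by
  have key : ∀ j : ℤ, d j = d 0 := by
    intro j
    induction j using Int.induction_on with
    | zero => rfl
    | succ i hi => rw [← hi, h]; congr 1; ring
    | pred i hi => rw [← hi, h (-(i : ℤ))]
  rw [key j, key k]

lemma exists_dual_comp_eq_of_ker_le {K V₁ V₂ : Type*} [Field K] [AddCommGroup V₁] [Module K V₁]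
    [AddCommGroup V₂] [Module K V₂] (f : V₁ →ₗ[K] V₂) (g : V₁ →ₗ[K] K)
    (h : ∀ x, f x = 0 → g x = 0) : ∃ V : V₂ →ₗ[K] K, V ∘ₗ f = g := by
  have : g ∈ LinearMap.range f.dualMap := by
    rw [LinearMap.range_dualMap_eq_dualAnnihilator_ker, Submodule.mem_dualAnnihilator]
    exact fun x hx => h x hx
  exact this

/-- A closed edge form on the faces `S` of the square grid has a vertex potential, provided the
complement of `S` has no bounded component. -/
lemma exists_grid_potential {K : Type*} [Field K] (S : Set (ℤ × ℤ)) (ωH ωV : ℤ × ℤ → K)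
    (hclosed : ∀ q ∈ S, ωH q - ωH (q + (0, 1)) + ωV (q + (1, 0)) - ωV q = 0)
    (hS : ∀ n : ℤ × ℤ →₀ K,
      (∀ q, q ∉ S → q - (0, 1) ∉ S → n q = n (q - (0, 1))) →
      (∀ q, q ∉ S → q - (1, 0) ∉ S → n q = n (q - (1, 0))) → ∀ q ∉ S, n q = 0) :
    ∃ V : ℤ × ℤ → K,
      (∀ q, (q ∈ S ∨ q - (0, 1) ∈ S) → V (q + (1, 0)) - V q = ωH q) ∧
      (∀ q, (q ∈ S ∨ q - (1, 0) ∈ S) → V (q + (0, 1)) - V q = ωV q) := by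
  set e₁ : ℤ × ℤ → ℤ × ℤ := fun q => q + (1, 0)
  set e₂ : ℤ × ℤ → ℤ × ℤ := fun q => q + (0, 1)
  have he₁ : Function.Injective e₁ := add_left_injective _
  have he₂ : Function.Injective e₂ := add_left_injective _
  have ap₁ : ∀ (a : ℤ × ℤ →₀ K) q, Finsupp.mapDomain e₁ a q = a (q - (1, 0)) := by
    intro a q
    conv_lhs => rw [show q = e₁ (q - (1, 0)) by simp [e₁]]
    exact Finsupp.mapDomain_apply he₁ a _
  have ap₂ : ∀ (a : ℤ × ℤ →₀ K) q, Finsupp.mapDomain e₂ a q = a (q - (0, 1)) := by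
    intro a q
    conv_lhs => rw [show q = e₂ (q - (0, 1)) by simp [e₂]]
    exact Finsupp.mapDomain_apply he₂ a _
  set EH : Set (ℤ × ℤ) := {q | q ∈ S ∨ q - (0, 1) ∈ S}
  set EV : Set (ℤ × ℤ) := {q | q ∈ S ∨ q - (1, 0) ∈ S}
  set A : Submodule K ((ℤ × ℤ →₀ K) × (ℤ × ℤ →₀ K)) :=
    (Finsupp.supported K K EH).prod (Finsupp.supported K K EV)
  set bd : ((ℤ × ℤ →₀ K) × (ℤ × ℤ →₀ K)) →ₗ[K] (ℤ × ℤ →₀ K) :=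
    (Finsupp.lmapDomain K K e₁ - LinearMap.id).coprod (Finsupp.lmapDomain K K e₂ - LinearMap.id)
  set om : ((ℤ × ℤ →₀ K) × (ℤ × ℤ →₀ K)) →ₗ[K] K :=
    (Finsupp.linearCombination K ωH).coprod (Finsupp.linearCombination K ωV)
  have hmem : ∃ V : (ℤ × ℤ →₀ K) →ₗ[K] K, V ∘ₗ (bd.domRestrict A) = om.domRestrict A := by
    apply exists_dual_comp_eq_of_ker_le (V₁ := A)
    rintro ⟨⟨a, b⟩, hab⟩ hker
    obtain ⟨ha, hb⟩ : a ∈ Finsupp.supported K K EH ∧ b ∈ Finsupp.supported K K EV := hab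
    have ha0 : ∀ q, q ∉ EH → a q = 0 := fun q hq => by
      by_contra h
      exact hq ((Finsupp.mem_supported K a).1 ha (by simpa using h))
    have hb0 : ∀ q, q ∉ EV → b q = 0 := fun q hq => by
      by_contra h
      exact hq ((Finsupp.mem_supported K b).1 hb (by simpa using h))
    have hbd : ∀ i j : ℤ, a (i - 1, j) - a (i, j) + b (i, j - 1) - b (i, j) = 0 := by
      intro i j
      have := DFunLike.congr_fun hker (i, j)
      simp only [bd, LinearMap.domRestrict_apply, LinearMap.coprod_apply, LinearMap.sub_apply,
        Finsupp.lmapDomain_apply, LinearMap.id_apply, Finsupp.add_apply, Finsupp.sub_apply,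
        Finsupp.zero_apply, ap₁, ap₂, Prod.mk_sub_mk, sub_zero] at this
      linear_combination this
    obtain ⟨N, hN⟩ : ∃ N : ℤ, ∀ i j : ℤ, (a (i, j) ≠ 0 ∨ b (i, j) ≠ 0) →
        -N ≤ i ∧ i ≤ N ∧ -N ≤ j ∧ j ≤ N := by
      set T : Finset (ℤ × ℤ) := a.support ∪ b.support
      refine ⟨∑ q ∈ T, (|q.1| + |q.2|), fun i j hij => ?_⟩
      have hT : (i, j) ∈ T := by simpa [T] using hij
      have := Finset.single_le_sum (f := fun q : ℤ × ℤ => |q.1| + |q.2|)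
        (fun q _ => by positivity) hT
      simp only at this
      have h1 := abs_nonneg i
      have h2 := abs_nonneg j
      have := neg_abs_le i
      have := le_abs_self i
      have := neg_abs_le j
      have := le_abs_self j
      refine ⟨?_, ?_, ?_, ?_⟩ <;> linarith
    set n : ℤ → ℤ → K := fun i j => ∑ l ∈ Finset.Icc (-N) N, if l ≤ j then a (i, l) else 0
    have hna : ∀ i j, n i j - n i (j - 1) = a (i, j) := by
      intro i j
      simp only [n]
      rw [← Finset.sum_sub_distrib]
      have : ∀ l ∈ Finset.Icc (-N) N, ((if l ≤ j then a (i, l) else 0) -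
          (if l ≤ j - 1 then a (i, l) else 0)) = if l = j then a (i, j) else 0 := by
        intro l _
        rcases lt_trichotomy l j with h | h | h
        · rw [if_pos h.le, if_pos (by omega), if_neg h.ne, sub_self]
        · subst h; simp
        · rw [if_neg (by omega), if_neg (by omega), if_neg (by omega), sub_zero]
      rw [Finset.sum_congr rfl this, Finset.sum_ite_eq' (Finset.Icc (-N) N) j]
      split_ifs with h
      · rfl
      · by_contra hne
        have := hN i j (Or.inl (Ne.symm hne))
        exact h (Finset.mem_Icc.2 ⟨this.2.2.1, this.2.2.2⟩)
    have hnlow : ∀ i j, j < -N → n i j = 0 := by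
      intro i j hj
      refine Finset.sum_eq_zero fun l hl => ?_
      rw [if_neg]
      have := (Finset.mem_Icc.1 hl).1
      omega
    have hnb : ∀ i j, n (i - 1) j - n i j = b (i, j) := by
      intro i j
      have hstep : ∀ k, n (i - 1) k - n i k - b (i, k) =
          n (i - 1) (k - 1) - n i (k - 1) - b (i, k - 1) := by
        intro k
        linear_combination hna (i - 1) k - hna i k + hbd i k
      have := int_fun_const_of_step (fun k => n (i - 1) k - n i k - b (i, k)) hstep j (-N - 1)
      simp only [hnlow _ (-N - 1) (by omega)] at this
      have hb' : b (i, -N - 1) = 0 := by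
        by_contra h
        have := hN _ _ (Or.inr h)
        omega
      rw [hb'] at this
      linear_combination this
    have hnside : ∀ i j, (i < -N ∨ N < i) → n i j = 0 := by
      intro i j hi
      refine Finset.sum_eq_zero fun l _ => ?_
      split_ifs
      · by_contra h
        have := hN _ _ (Or.inl h)
        omega
      · rfl
    have hnhigh : ∀ i j, N < j → n i j = 0 := by
      intro i j hj
      have hstep : ∀ k, n k j = n (k - 1) j := by
        intro k
        have hb' : b (k, j) = 0 := by
          by_contra h
          have := hN _ _ (Or.inr h)
          omega
        linear_combination -hnb k j - hb'
      rw [int_fun_const_of_step (fun k => n k j) hstep i (-N - 1)]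
      exact hnside _ _ (Or.inl (by omega))
    set ν : ℤ × ℤ →₀ K := Finsupp.onFinset (Finset.Icc (-N) N ×ˢ Finset.Icc (-N) N)
      (fun q => n q.1 q.2) (by
        rintro ⟨i, j⟩ hq
        simp only [Finset.mem_product, Finset.mem_Icc]
        by_contra hcon
        apply hq
        by_cases h1 : i < -N ∨ N < i
        · exact hnside _ _ h1
        · by_cases h2 : j < -N
          · exact hnlow _ _ h2
          · exact hnhigh _ _ (by omega))
    have hν : ∀ i j, ν (i, j) = n i j := fun i j => rfl
    have haν : a = ν - Finsupp.mapDomain e₂ ν := by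
      ext ⟨i, j⟩
      rw [Finsupp.sub_apply, ap₂, Prod.mk_sub_mk, sub_zero, hν, hν, hna]
    have hbν : b = Finsupp.mapDomain e₁ ν - ν := by
      ext ⟨i, j⟩
      rw [Finsupp.sub_apply, ap₁, Prod.mk_sub_mk, sub_zero, hν, hν, hnb]
    have hν0 : ∀ q ∉ S, ν q = 0 := by
      apply hS ν
      · rintro ⟨i, j⟩ h1 h2
        have := ha0 (i, j) (by rintro (h | h); exacts [h1 h, h2 h])
        rw [← hna] at this
        simpa [hν, sub_eq_zero] using this
      · rintro ⟨i, j⟩ h1 h2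
        have := hb0 (i, j) (by rintro (h | h); exacts [h1 h, h2 h])
        rw [← hnb] at this
        rw [Prod.mk_sub_mk, sub_zero, hν, hν]
        exact (sub_eq_zero.1 this).symm
    have homega : om (a, b) = ν.sum fun q c =>
        c * (ωH q - ωH (q + (0, 1)) + ωV (q + (1, 0)) - ωV q) := by
      have h1 : om (a, b) = Finsupp.linearCombination K
          (fun q => ωH q - ωH (q + (0, 1)) + ωV (q + (1, 0)) - ωV q) ν := by
        simp only [om, LinearMap.coprod_apply]
        rw [haν, hbν, map_sub, map_sub, Finsupp.linearCombination_mapDomain,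
          Finsupp.linearCombination_mapDomain]
        simp only [Finsupp.linearCombination_apply, Finsupp.sum, ← Finset.sum_sub_distrib,
          ← Finset.sum_add_distrib, smul_eq_mul, Function.comp, e₁, e₂]
        refine Finset.sum_congr rfl fun q _ => ?_
        ring
      rw [h1, Finsupp.linearCombination_apply]
      rfl
    rw [LinearMap.domRestrict_apply]
    change om (a, b) = 0
    rw [homega]
    refine Finset.sum_eq_zero fun q _ => ?_
    by_cases hq : q ∈ S
    · simp only [hclosed q hq, mul_zero]
    · simp only [hν0 q hq, zero_mul]
  obtain ⟨V, hV⟩ := hmem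
  have hV' : ∀ a b, (a, b) ∈ A → V (bd (a, b)) = om (a, b) := by
    intro a b hab
    exact LinearMap.congr_fun hV ⟨(a, b), hab⟩
  refine ⟨fun q => V (Finsupp.single q 1), fun q hq => ?_, fun q hq => ?_⟩
  · have := hV' (Finsupp.single q 1) 0
      ⟨Finsupp.single_mem_supported K 1 hq, Submodule.zero_mem _⟩
    simpa [bd, om, Finsupp.mapDomain_single, e₁] using this
  · have := hV' 0 (Finsupp.single q 1)
      ⟨Submodule.zero_mem _, Finsupp.single_mem_supported K 1 hq⟩
    simpa [bd, om, Finsupp.mapDomain_single, e₂] using this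

/-- A property that is locally constant along a preconnected set is constant on it. -/
lemma IsPreconnected.iff_of_eventually_iff {α : Type*} [TopologicalSpace α] {s : Set α}
    (hs : IsPreconnected s) {p : α → Prop} (hp : ∀ x ∈ s, ∀ᶠ y in 𝓝[s] x, (p y ↔ p x))
    {x y : α} (hx : x ∈ s) (hy : y ∈ s) : p x ↔ p y := by
  have hc : ContinuousOn (fun x => decide (p x)) s := by
    intro x hx
    refine ContinuousWithinAt.congr_of_eventuallyEq (continuousWithinAt_const (b := decide (p x)))
      ?_ rfl
    filter_upwards [hp x hx] with y hy
    simp [hy]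
  have := hs.constant hc hx hy
  simpa using this

/-- The closed square of side `h` with lower left corner `h • q`. -/
def gridSq (h : ℝ) (q : ℤ × ℤ) : Set ℂ :=
  {z | h * q.1 ≤ z.re ∧ z.re ≤ h * (q.1 + 1) ∧ h * q.2 ≤ z.im ∧ z.im ≤ h * (q.2 + 1)}

/-- The vertex `h • q` of the square grid of side `h`. -/
def gridVert (h : ℝ) (q : ℤ × ℤ) : ℂ := ⟨h * q.1, h * q.2⟩

/-- The index of a square of the grid containing `z`. -/
noncomputable def gridIdx (h : ℝ) (z : ℂ) : ℤ × ℤ := (⌊z.re / h⌋, ⌊z.im / h⌋)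

lemma convex_gridSq (h : ℝ) (q : ℤ × ℤ) : Convex ℝ (gridSq h q) := by
  have : gridSq h q = Complex.re ⁻¹' (Icc (h * q.1) (h * (q.1 + 1))) ∩
      Complex.im ⁻¹' (Icc (h * q.2) (h * (q.2 + 1))) := by
    ext z; simp [gridSq, and_assoc]
  rw [this]
  exact ((convex_Icc _ _).linear_preimage Complex.reLm).inter
    ((convex_Icc _ _).linear_preimage Complex.imLm)

lemma mem_gridSq_gridIdx {h : ℝ} (hh : 0 < h) (z : ℂ) : z ∈ gridSq h (gridIdx h z) := by
  have a1 := Int.floor_le (z.re / h)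
  have a2 := (Int.lt_floor_add_one (z.re / h)).le
  have b1 := Int.floor_le (z.im / h)
  have b2 := (Int.lt_floor_add_one (z.im / h)).le
  rw [le_div_iff₀ hh] at a1 b1
  rw [div_le_iff₀ hh] at a2 b2
  refine ⟨?_, ?_, ?_, ?_⟩ <;> simp only [gridIdx] <;> linarith

lemma gridIdx_interval {h : ℝ} (hh : 0 < h) (x : ℝ) :
    ∀ᶠ y in 𝓝 x, h * ⌊y / h⌋ ≤ x ∧ x ≤ h * (⌊y / h⌋ + 1) := by
  have h1 : ∀ᶠ y in 𝓝 x, y / h < ⌊x / h⌋ + 1 :=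
    (by fun_prop : Continuous fun y : ℝ => y / h).continuousAt.eventually_lt
      continuousAt_const (Int.lt_floor_add_one _)
  have h2 : ∀ᶠ y in 𝓝 x, (⌈x / h⌉ : ℝ) - 1 < y / h :=
    continuousAt_const.eventually_lt
      (by fun_prop : Continuous fun y : ℝ => y / h).continuousAt
      (by linarith [Int.ceil_lt_add_one (x / h)])
  filter_upwards [h1, h2] with y h1 h2
  have i1 : ⌊y / h⌋ ≤ ⌊x / h⌋ := by
    have : ⌊y / h⌋ < ⌊x / h⌋ + 1 := Int.floor_lt.2 (by push_cast; exact h1)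
    omega
  have i2 : ⌈x / h⌉ ≤ ⌊y / h⌋ + 1 := by
    have : ⌈x / h⌉ - 1 ≤ ⌊y / h⌋ := Int.le_floor.2 (by push_cast; exact h2.le)
    omega
  have j1 : (⌊y / h⌋ : ℝ) ≤ x / h := le_trans (by exact_mod_cast i1) (Int.floor_le _)
  have j2 : x / h ≤ (⌊y / h⌋ : ℝ) + 1 := le_trans (Int.le_ceil _) (by exact_mod_cast i2)
  rw [le_div_iff₀ hh] at j1
  rw [div_le_iff₀ hh] at j2
  constructor <;> linarith

lemma eventually_mem_gridSq_gridIdx {h : ℝ} (hh : 0 < h) (z : ℂ) :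
    ∀ᶠ w in 𝓝 z, z ∈ gridSq h (gridIdx h w) := by
  filter_upwards [Complex.continuous_re.continuousAt.eventually (gridIdx_interval hh z.re),
    Complex.continuous_im.continuousAt.eventually (gridIdx_interval hh z.im)] with w h1 h2
  exact ⟨h1.1, h1.2, h2.1, h2.2⟩

lemma index_close_of_mem {h : ℝ} (hh : 0 < h) {x : ℝ} {i k : ℤ} (h1 : h * i ≤ x)
    (h2 : x ≤ h * (k + 1)) : i ≤ k + 1 := by
  have : h * (i : ℝ) ≤ h * (k + 1) := h1.trans h2
  have := le_of_mul_le_mul_left this hh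
  exact_mod_cast this

lemma gridSq_subset_ball {h : ℝ} (hh : 0 < h) {z : ℂ} {q : ℤ × ℤ} (hz : z ∈ gridSq h q) :
    gridSq h q ⊆ ball z (2 * h) := by
  intro w hw
  obtain ⟨a1, a2, a3, a4⟩ := hz
  obtain ⟨b1, b2, b3, b4⟩ := hw
  rw [mem_ball, Complex.dist_eq]
  rw [Complex.norm_eq_sqrt_sq_add_sq, Real.sqrt_lt' (by positivity)]
  simp only [sub_re, sub_im]
  have c1 : |w.re - z.re| ≤ h := abs_le.2 ⟨by linarith, by linarith⟩
  have c2 : |w.im - z.im| ≤ h := abs_le.2 ⟨by linarith, by linarith⟩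
  have d1 := sq_le_sq' (by linarith [neg_abs_le (w.re - z.re)]) (le_trans (le_abs_self _) c1)
  have d2 := sq_le_sq' (by linarith [neg_abs_le (w.im - z.im)]) (le_trans (le_abs_self _) c2)
  nlinarith

lemma finite_gridSq_mem {h : ℝ} (hh : 0 < h) (z : ℂ) : {q : ℤ × ℤ | z ∈ gridSq h q}.Finite := by
  refine (Set.finite_Icc (gridIdx h z - (1, 1)) (gridIdx h z + (1, 1))).subset ?_
  intro q hq
  obtain ⟨a1, a2, a3, a4⟩ := hq
  obtain ⟨b1, b2, b3, b4⟩ := mem_gridSq_gridIdx hh z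
  have c1 := index_close_of_mem hh a1 b2
  have c2 := index_close_of_mem hh b1 a2
  have c3 := index_close_of_mem hh a3 b4
  have c4 := index_close_of_mem hh b3 a4
  refine ⟨⟨?_, ?_⟩, ⟨?_, ?_⟩⟩ <;> simp <;> omega

/-- On an open bounded set with preconnected complement a holomorphic function has a primitive
away from the `2 * h`-neighbourhood of the complement. -/
lemma exists_primitive_away {X : Set ℂ} (hXb : Bornology.IsBounded X) (hXc : IsPreconnected Xᶜ)
    {f : ℂ → ℂ} (hf : DifferentiableOn ℂ f X) {h : ℝ} (hh : 0 < h) :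
    ∃ P : ℂ → ℂ, ∀ z, ball z (2 * h) ⊆ X → HasDerivAt P (f z) z := by
  set S : Set (ℤ × ℤ) := {q | gridSq h q ⊆ X}
  have hp : ∀ q : ℤ × ℤ, ∃ p : ℂ → ℂ, q ∈ S →
      ∀ a ∈ gridSq h q, HasDerivWithinAt p (f a) (gridSq h q) a := by
    intro q
    by_cases hq : q ∈ S
    · obtain ⟨p, hp⟩ := (convex_gridSq h q).exists_forall_hasDerivWithinAt (hf.mono hq)
      exact ⟨p, fun _ => hp⟩
    · exact ⟨0, fun h => absurd h hq⟩
  choose p hp using hp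
  have hpp : ∀ q ∈ S, ∀ q' ∈ S, ∀ x y, x ∈ gridSq h q → x ∈ gridSq h q' → y ∈ gridSq h q →
      y ∈ gridSq h q' → p q x - p q y = p q' x - p q' y := by
    intro q hq q' hq' x y hx hx' hy hy'
    have := ((convex_gridSq h q).inter (convex_gridSq h q')).norm_image_sub_le_of_norm_hasDerivWithin_le
      (f := fun z => p q z - p q' z) (f' := fun z => f z - f z) (C := 0)
      (fun z hz => ((hp q hq z hz.1).mono inter_subset_left).sub
        ((hp q' hq' z hz.2).mono inter_subset_right)) (by simp) ⟨hy, hy'⟩ ⟨hx, hx'⟩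
    rw [zero_mul, norm_le_zero_iff] at this
    linear_combination this
  have hv : ∀ q c : ℤ × ℤ, (c.1 = 0 ∨ c.1 = 1) → (c.2 = 0 ∨ c.2 = 1) →
      gridVert h (q + c) ∈ gridSq h q := by
    rintro ⟨i, j⟩ ⟨k, l⟩ hk hl
    simp only at hk hl
    simp only [gridSq, gridVert, Prod.mk_add_mk, mem_ofPred_eq, Int.cast_add]
    rcases hk with rfl | rfl <;> rcases hl with rfl | rfl <;> push_cast <;>
      refine ⟨?_, ?_, ?_, ?_⟩ <;> nlinarith
  set ωH : ℤ × ℤ → ℂ := fun q => if q ∈ S then p q (gridVert h (q + (1, 0))) - p q (gridVert h q)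
    else p (q - (0, 1)) (gridVert h (q + (1, 0))) - p (q - (0, 1)) (gridVert h q)
  set ωV : ℤ × ℤ → ℂ := fun q => if q ∈ S then p q (gridVert h (q + (0, 1))) - p q (gridVert h q)
    else p (q - (1, 0)) (gridVert h (q + (0, 1))) - p (q - (1, 0)) (gridVert h q)
  have v00 : ∀ q, gridVert h q ∈ gridSq h q := fun q => by
    have := hv q 0 (Or.inl rfl) (Or.inl rfl)
    simpa using this
  have v10 : ∀ q, gridVert h (q + (1, 0)) ∈ gridSq h q := fun q =>
    hv q (1, 0) (Or.inr rfl) (Or.inl rfl)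
  have v01 : ∀ q, gridVert h (q + (0, 1)) ∈ gridSq h q := fun q =>
    hv q (0, 1) (Or.inl rfl) (Or.inr rfl)
  have v11 : ∀ q, gridVert h (q + (1, 1)) ∈ gridSq h q := fun q =>
    hv q (1, 1) (Or.inr rfl) (Or.inr rfl)
  have hωH0 : ∀ q ∈ S, ωH q = p q (gridVert h (q + (1, 0))) - p q (gridVert h q) :=
    fun q hq => if_pos hq
  have hωV0 : ∀ q ∈ S, ωV q = p q (gridVert h (q + (0, 1))) - p q (gridVert h q) :=
    fun q hq => if_pos hq
  have hωH1 : ∀ q ∈ S, ωH (q + (0, 1)) =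
      p q (gridVert h (q + (1, 1))) - p q (gridVert h (q + (0, 1))) := by
    intro q hq
    have e : q + (0, 1) + (1, 0) = q + (1, 1) := by ext <;> simp
    by_cases hq' : q + (0, 1) ∈ S
    · rw [hωH0 _ hq', e]
      refine hpp _ hq' _ hq _ _ ?_ (v11 q) (v00 _) (v01 q)
      rw [← e]; exact v10 _
    · simp only [ωH]
      rw [if_neg hq', e, add_sub_cancel_right]
  have hωV1 : ∀ q ∈ S, ωV (q + (1, 0)) =
      p q (gridVert h (q + (1, 1))) - p q (gridVert h (q + (1, 0))) := by
    intro q hq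
    have e : q + (1, 0) + (0, 1) = q + (1, 1) := by ext <;> simp
    by_cases hq' : q + (1, 0) ∈ S
    · rw [hωV0 _ hq', e]
      refine hpp _ hq' _ hq _ _ ?_ (v11 q) (v00 _) (v10 q)
      rw [← e]; exact v01 _
    · simp only [ωV]
      rw [if_neg hq', e, add_sub_cancel_right]
  obtain ⟨V, hVH, hVV⟩ := exists_grid_potential S ωH ωV
    (fun q hq => by rw [hωH0 q hq, hωV0 q hq, hωH1 q hq, hωV1 q hq]; ring)
    (by
      intro n hn1 hn2
      have hnot : ∀ x ∉ X, ∀ q, x ∈ gridSq h q → q ∉ S := fun x hx q hq hS => hx (hS hq)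
      have st1 : ∀ x ∉ X, ∀ i j j', x ∈ gridSq h (i, j) → x ∈ gridSq h (i, j') →
          n (i, j) = n (i, j') := by
        intro x hx i j j' h1 h2
        have c1 := index_close_of_mem hh h1.2.2.1 h2.2.2.2
        have c2 := index_close_of_mem hh h2.2.2.1 h1.2.2.2
        simp only at c1 c2
        obtain h | h | h : j = j' ∨ j = j' + 1 ∨ j' = j + 1 := by omega
        · rw [h]
        · subst h
          have := hn1 (i, j' + 1) (hnot x hx _ h1) (by simpa using hnot x hx _ h2)
          simpa using this
        · subst h
          have := hn1 (i, j + 1) (hnot x hx _ h2) (by simpa using hnot x hx _ h1)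
          simpa using this.symm
      have st2 : ∀ x ∉ X, ∀ i i' j, x ∈ gridSq h (i, j) → x ∈ gridSq h (i', j) →
          n (i, j) = n (i', j) := by
        intro x hx i i' j h1 h2
        have c1 := index_close_of_mem hh h1.1 h2.2.1
        have c2 := index_close_of_mem hh h2.1 h1.2.1
        simp only at c1 c2
        obtain h | h | h : i = i' ∨ i = i' + 1 ∨ i' = i + 1 := by omega
        · rw [h]
        · subst h
          have := hn2 (i' + 1, j) (hnot x hx _ h1) (by simpa using hnot x hx _ h2)
          simpa using this
        · subst h
          have := hn2 (i + 1, j) (hnot x hx _ h2) (by simpa using hnot x hx _ h1)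
          simpa using this.symm
      have st : ∀ x ∉ X, ∀ q q', x ∈ gridSq h q → x ∈ gridSq h q' → n q = n q' := by
        rintro x hx ⟨i, j⟩ ⟨i', j'⟩ h1 h2
        have h3 : x ∈ gridSq h (i, j') := ⟨h1.1, h1.2.1, h2.2.2.1, h2.2.2.2⟩
        rw [st1 x hx i j j' h1 h3, st2 x hx i i' j' h3 h2]
      obtain ⟨R, hR⟩ := hXb.subset_ball 0
      obtain ⟨M, hM⟩ : ∃ M : ℤ, ∀ q, n q ≠ 0 → q.1 < M := by
        refine ⟨∑ q ∈ n.support, |q.1| + 1, fun q hq => ?_⟩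
        have := Finset.single_le_sum (f := fun q : ℤ × ℤ => |q.1|)
          (fun q _ => by positivity) (Finsupp.mem_support_iff.2 hq)
        linarith [le_abs_self q.1]
      obtain ⟨K, hK⟩ := exists_nat_gt (R / h)
      set k : ℤ := max M K
      set y : ℂ := ((h * k : ℝ) : ℂ)
      have hyX : y ∈ Xᶜ := by
        intro hy
        have := hR hy
        rw [mem_ball_zero_iff, Complex.norm_real, Real.norm_eq_abs] at this
        have h1 : R < h * k := by
          rw [div_lt_iff₀ hh] at hK
          have : (K : ℝ) ≤ k := by exact_mod_cast le_max_right M (K : ℤ)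
          nlinarith
        linarith [le_abs_self (h * k)]
      have hy0 : n (gridIdx h y) = 0 := by
        by_contra hne
        have := hM _ hne
        have h2 : gridIdx h y = (k, 0) := by
          simp [gridIdx, y, hh.ne']
        rw [h2] at this
        exact absurd (le_max_left M (K : ℤ)) (not_le.2 this)
      intro q hq
      obtain ⟨x, hx, hxX⟩ := Set.not_subset.1 hq
      rw [st x hxX q (gridIdx h x) hx (mem_gridSq_gridIdx hh x)]
      refine (hXc.iff_of_eventually_iff (p := fun x => n (gridIdx h x) = 0) ?_ hxX hyX).2 hy0
      intro x hx
      filter_upwards [mem_nhdsWithin_of_mem_nhds (eventually_mem_gridSq_gridIdx hh x)] with w hw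
      rw [st x hx _ _ hw (mem_gridSq_gridIdx hh x)])
  set Pq : ℤ × ℤ → ℂ → ℂ := fun q z => V q + (p q z - p q (gridVert h q))
  have hcorner : ∀ q ∈ S, ∀ c : ℤ × ℤ, (c.1 = 0 ∨ c.1 = 1) → (c.2 = 0 ∨ c.2 = 1) →
      Pq q (gridVert h (q + c)) = V (q + c) := by
    intro q hq c hc1 hc2
    have a1 := hVH q (Or.inl hq)
    have a2 := hVV q (Or.inl hq)
    have a3 := hVV (q + (1, 0)) (Or.inr (by simpa using hq))
    rw [hωH0 q hq] at a1
    rw [hωV0 q hq] at a2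
    rw [hωV1 q hq, show q + (1, 0) + (0, 1) = q + (1, 1) by ext <;> simp] at a3
    obtain ⟨c1, c2⟩ := c
    simp only at hc1 hc2
    simp only [Pq]
    rcases hc1 with rfl | rfl <;> rcases hc2 with rfl | rfl
    · rw [show q + ((0 : ℤ), (0 : ℤ)) = q by ext <;> simp]; ring
    · linear_combination -a2
    · linear_combination -a1
    · linear_combination -a1 - a3
  have hcons : ∀ q ∈ S, ∀ q' ∈ S, ∀ z, z ∈ gridSq h q → z ∈ gridSq h q' → Pq q z = Pq q' z := by
    intro q hq q' hq' z hz hz'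
    have c1 := index_close_of_mem hh hz.1 hz'.2.1
    have c2 := index_close_of_mem hh hz'.1 hz.2.1
    have c3 := index_close_of_mem hh hz.2.2.1 hz'.2.2.2
    have c4 := index_close_of_mem hh hz'.2.2.1 hz.2.2.2
    set r : ℤ × ℤ := (max q.1 q'.1, max q.2 q'.2)
    have e1 : q + (r - q) = r := by abel
    have e2 : q' + (r - q') = r := by abel
    have b1 : ((r - q).1 = 0 ∨ (r - q).1 = 1) ∧ ((r - q).2 = 0 ∨ (r - q).2 = 1) := by
      simp only [r, Prod.fst_sub, Prod.snd_sub]; omega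
    have b2 : ((r - q').1 = 0 ∨ (r - q').1 = 1) ∧ ((r - q').2 = 0 ∨ (r - q').2 = 1) := by
      simp only [r, Prod.fst_sub, Prod.snd_sub]; omega
    have k1 := hcorner q hq (r - q) b1.1 b1.2
    have k2 := hcorner q' hq' (r - q') b2.1 b2.2
    have m1 := hv q (r - q) b1.1 b1.2
    have m2 := hv q' (r - q') b2.1 b2.2
    rw [e1] at k1 m1
    rw [e2] at k2 m2
    have := hpp q hq q' hq' z _ hz hz' m1 m2
    simp only [Pq] at k1 k2 ⊢
    linear_combination this + k1 - k2
  refine ⟨fun z => Pq (gridIdx h z) z, fun z hz => ?_⟩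
  have hSz : ∀ q, z ∈ gridSq h q → q ∈ S := fun q hq => (gridSq_subset_ball hh hq).trans hz
  rw [hasDerivAt_iff_isLittleO, Asymptotics.isLittleO_iff]
  intro c hc
  have hfin : ∀ᶠ w in 𝓝 z, ∀ q ∈ {q : ℤ × ℤ | z ∈ gridSq h q}, w ∈ gridSq h q →
      ‖Pq q w - Pq q z - (w - z) • f z‖ ≤ c * ‖w - z‖ := by
    rw [Filter.eventually_all_finite (finite_gridSq_mem hh z)]
    intro q hq
    have := ((hp q (hSz q hq) z hq).sub_const (p q (gridVert h q))).const_add (V q)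
    rw [hasDerivWithinAt_iff_isLittleO, Asymptotics.isLittleO_iff] at this
    exact eventually_nhdsWithin_iff.1 (this hc)
  filter_upwards [hfin, eventually_mem_gridSq_gridIdx hh z] with w h1 h2
  have := h1 _ h2 (mem_gridSq_gridIdx hh w)
  rwa [hcons _ (hSz _ h2) _ (hSz _ (mem_gridSq_gridIdx hh z)) z h2 (mem_gridSq_gridIdx hh z)]
    at this

/-- Two functions with the same derivative along an open preconnected set differ by a constant. -/
lemma IsPreconnected.sub_eq_sub_of_hasDerivAt {U : Set ℂ} (hU : IsPreconnected U)
    {P Q f : ℂ → ℂ} (hP : ∀ z ∈ U, HasDerivAt P (f z) z)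
    (hQ : ∀ z ∈ U, HasDerivAt Q (f z) z) {x y : ℂ} (hx : x ∈ U) (hy : y ∈ U) (hUo : IsOpen U) :
    P x - P y = Q x - Q y := by
  have := hUo.is_const_of_deriv_eq_zero (f := fun z => P z - Q z) hU
    (fun z hz => ((hP z hz).sub (hQ z hz)).differentiableAt.differentiableWithinAt)
    (fun z hz => (((hP z hz).sub (hQ z hz)).deriv).trans (sub_self _)) hx hy
  linear_combination this

/-- On a bounded open plane set with preconnected complement every holomorphic function has a
primitive. -/
lemma exists_primitive_of_isPreconnected_compl {X : Set ℂ} (hXo : IsOpen X)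
    (hXb : Bornology.IsBounded X) (hXc : IsPreconnected Xᶜ) {f : ℂ → ℂ}
    (hf : DifferentiableOn ℂ f X) : ∃ P : ℂ → ℂ, ∀ z ∈ X, HasDerivAt P (f z) z := by
  have hne : (Xᶜ).Nonempty := by
    rw [Set.nonempty_compl]
    rintro rfl
    exact NormedSpace.unbounded_univ ℝ ℂ hXb
  set O : ℕ → Set ℂ := fun n => {z | 2 * (1 / ((n : ℝ) + 1)) < infDist z Xᶜ}
  have hOo : ∀ n, IsOpen (O n) := fun n =>
    isOpen_lt continuous_const (continuous_infDist_pt _)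
  have hOm : ∀ m n, m ≤ n → O m ⊆ O n := by
    intro m n hmn z hz
    have : 1 / ((n : ℝ) + 1) ≤ 1 / ((m : ℝ) + 1) := Nat.one_div_le_one_div hmn
    have hz' : 2 * (1 / ((m : ℝ) + 1)) < infDist z Xᶜ := hz
    exact (show 2 * (1 / ((n : ℝ) + 1)) < infDist z Xᶜ by linarith)
  have hball : ∀ n, ∀ z ∈ O n, ball z (2 * (1 / ((n : ℝ) + 1))) ⊆ X := by
    intro n z hz w hw
    by_contra h
    have h1 := infDist_le_dist_of_mem (s := Xᶜ) (x := z) h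
    rw [mem_ball, dist_comm] at hw
    exact absurd (hz.trans_le h1) (not_lt.2 hw.le)
  have hP : ∀ n : ℕ, ∃ P : ℂ → ℂ, ∀ z ∈ O n, HasDerivAt P (f z) z := by
    intro n
    obtain ⟨P, hP⟩ := exists_primitive_away hXb hXc hf (h := 1 / ((n : ℝ) + 1)) (by positivity)
    exact ⟨P, fun z hz => hP z (hball n z hz)⟩
  choose P hP using hP
  set base : Set ℂ → ℂ := fun s => if h : s.Nonempty then h.some else 0
  set b : ℂ → ℂ := fun z => base (connectedComponentIn X z)
  have hb : ∀ z ∈ X, b z ∈ connectedComponentIn X z := by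
    intro z hz
    have : (connectedComponentIn X z).Nonempty := ⟨z, mem_connectedComponentIn hz⟩
    simp only [b, base, dif_pos this]
    exact this.some_mem
  have hex : ∀ z ∈ X, ∃ n, z ∈ connectedComponentIn (O n) (b z) := by
    intro z hz
    have hcc : IsPathConnected (connectedComponentIn X z) :=
      (hXo.connectedComponentIn.isConnected_iff_isPathConnected).1
        (isConnected_connectedComponentIn_iff.2 hz)
    obtain ⟨p, hp⟩ := hcc.joinedIn (b z) (hb z hz) z (mem_connectedComponentIn hz)
    have hpX : ∀ t, p t ∈ X := fun t => connectedComponentIn_subset X z (hp t)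
    obtain ⟨t₀, -, ht₀⟩ := isCompact_univ.exists_isMinOn univ_nonempty
      ((continuous_infDist_pt (Xᶜ)).comp p.continuous).continuousOn
    have hpos : 0 < infDist (p t₀) Xᶜ := by
      rw [← hXo.isClosed_compl.notMem_iff_infDist_pos hne]
      exact fun h => h (hpX t₀)
    obtain ⟨n, hn⟩ := exists_nat_one_div_lt (half_pos hpos)
    refine ⟨n, ?_⟩
    have hr : range p ⊆ O n := by
      rintro _ ⟨t, rfl⟩
      have : infDist (p t₀) Xᶜ ≤ infDist (p t) Xᶜ := ht₀ (mem_univ t)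
      exact (show 2 * (1 / ((n : ℝ) + 1)) < infDist (p t) Xᶜ by linarith)
    exact (isPreconnected_range p.continuous).subset_connectedComponentIn ⟨0, p.source⟩ hr
      ⟨1, p.target⟩
  set N : ℂ → ℕ := fun z => if h : ∃ n, z ∈ connectedComponentIn (O n) (b z) then Nat.find h else 0
  have hN : ∀ z ∈ X, z ∈ connectedComponentIn (O (N z)) (b z) := by
    intro z hz
    simp only [N, dif_pos (hex z hz)]
    exact Nat.find_spec (hex z hz)
  have hNle : ∀ z ∈ X, ∀ n, z ∈ connectedComponentIn (O n) (b z) → N z ≤ n := by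
    intro z hz n hn
    simp only [N, dif_pos (hex z hz)]
    exact Nat.find_min' (hex z hz) hn
  refine ⟨fun z => P (N z) z - P (N z) (b z), fun z hz => ?_⟩
  have hzO : z ∈ O (N z) := connectedComponentIn_subset _ _ (hN z hz)
  refine ((hP (N z) z hzO).sub_const (P (N z) (b z))).congr_of_eventuallyEq ?_
  have h1 := (hOo (N z)).connectedComponentIn.mem_nhds (hN z hz)
  have h2 := (hXo.connectedComponentIn (x := z)).mem_nhds (mem_connectedComponentIn hz)
  filter_upwards [h1, h2] with w hw1 hw2
  have hwX : w ∈ X := connectedComponentIn_subset _ _ hw2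
  have hbw : b w = b z := by simp only [b, connectedComponentIn_eq hw2]
  have hle : N w ≤ N z := hNle w hwX _ (by rwa [hbw])
  have hwN := hN w hwX
  have hbO : b w ∈ O (N w) := by
    by_contra h
    rw [connectedComponentIn_eq_empty h] at hwN
    exact hwN
  rw [hbw] at hwN hbO ⊢
  exact isPreconnected_connectedComponentIn.sub_eq_sub_of_hasDerivAt
    (fun x hx => hP (N w) x (connectedComponentIn_subset _ _ hx))
    (fun x hx => hP (N z) x (hOm _ _ hle (connectedComponentIn_subset _ _ hx)))
    hwN (mem_connectedComponentIn hbO) (hOo _).connectedComponentIn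

/-- Maximum principle for holomorphic functions with a boundary bound in the limit sense. -/
lemma norm_le_of_frontier_limsup {U : Set ℂ} (hUo : IsOpen U) (hUb : Bornology.IsBounded U)
    {Q : ℂ → ℂ} (hQ : DifferentiableOn ℂ Q U) {c : ℝ}
    (hc : ∀ ζ ∈ frontier U, ∀ ε > 0, ∀ᶠ z in 𝓝[U] ζ, ‖Q z‖ ≤ c + ε) {z : ℂ} (hz : z ∈ U) :
    ‖Q z‖ ≤ c := by
  refine le_of_forall_pos_le_add fun ε hε => ?_
  by_contra! hlt
  set V : Set ℂ := {w ∈ U | c + ε < ‖Q w‖}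
  have hVo : IsOpen V := by
    have := hQ.continuousOn.norm.isOpen_inter_preimage hUo (isOpen_Ioi (a := c + ε))
    exact this
  have hcl : closure V ⊆ U := by
    intro ζ hζ
    by_contra hζU
    have hfr : ζ ∈ frontier U :=
      ⟨closure_mono (fun w hw => hw.1) hζ, fun h => hζU (interior_subset h)⟩
    have h1 := eventually_nhdsWithin_iff.1 (hc ζ hfr ε hε)
    obtain ⟨w, hw, hwV⟩ := mem_closure_iff_nhds.1 hζ _ h1
    exact absurd (hw hwV.1) (not_le.2 hwV.2)
  have hd : DiffContOnCl ℂ Q V :=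
    ⟨hQ.mono fun w hw => hw.1, hQ.continuousOn.mono hcl⟩
  have := Complex.norm_le_of_forall_mem_frontier_norm_le (hUb.subset fun w hw => hw.1) hd
    (C := c + ε) (fun ζ hζ => by
      by_contra! hlt'
      have : ζ ∈ V := ⟨hcl hζ.1, hlt'⟩
      rw [hVo.frontier_eq] at hζ
      exact hζ.2 this) (subset_closure (show z ∈ V from ⟨hz, hlt⟩))
  linarith

/-- There is no continuous square root on a circle around the origin. -/
lemma not_exists_continuous_sqrt_circle {ρ : ℝ} (hρ : 0 < ρ) {S : ℂ → ℂ}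
    (hS : ContinuousOn S (sphere 0 ρ)) (hS2 : ∀ z ∈ sphere (0 : ℂ) ρ, S z ^ 2 = z) : False := by
  have hm : ∀ θ : ℝ, (ρ : ℂ) * exp (θ * I) ∈ sphere (0 : ℂ) ρ := fun θ => by
    simp [Complex.norm_exp_ofReal_mul_I, abs_of_pos hρ]
  set b : ℝ → ℂ := fun θ => exp (θ / 2 * I)
  set q : ℝ → ℂ := fun θ => S (ρ * exp (θ * I)) / b θ
  have hq : Continuous q := by
    refine Continuous.div ?_ (by fun_prop) (fun θ => exp_ne_zero _)
    exact hS.comp_continuous (by fun_prop) hm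
  have hb2 : ∀ θ, b θ ^ 2 = exp (θ * I) := fun θ => by
    simp only [b]; rw [← exp_nat_mul]; congr 1; push_cast; ring
  have hq2 : ∀ θ, q θ ^ 2 = ρ := fun θ => by
    simp only [q]
    rw [div_pow, hS2 _ (hm θ), hb2, mul_div_cancel_right₀ _ (exp_ne_zero _)]
  have hiff : q (2 * Real.pi) = q 0 ↔ q 0 = q 0 := by
    refine isPreconnected_univ.iff_of_eventually_iff (p := fun θ => q θ = q 0) ?_
      (mem_univ _) (mem_univ _)
    intro θ _
    have h0 : q θ ≠ 0 := fun h => by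
      have := hq2 θ; rw [h] at this; simp at this; exact hρ.ne' (by exact_mod_cast this.symm)
    have : ∀ᶠ t in 𝓝 θ, q t ≠ - q θ :=
      hq.continuousAt.eventually_ne (fun h => h0 (self_eq_neg.1 h))
    rw [nhdsWithin_univ]
    filter_upwards [this] with t ht
    have : q t = q θ := by
      rcases sq_eq_sq_iff_eq_or_eq_neg.1 ((hq2 t).trans (hq2 θ).symm) with h | h
      · exact h
      · exact absurd h ht
    rw [this]
  have h1 := hiff.2 rfl
  have h0 : q 0 ≠ 0 := fun h => by
    have := hq2 0; rw [h] at this; simp at this; exact hρ.ne' (by exact_mod_cast this.symm)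
  have h2 : q (2 * Real.pi) = - q 0 := by
    have e1 : exp (((2 * Real.pi : ℝ) : ℂ) * I) = 1 := by
      push_cast; exact Complex.exp_two_pi_mul_I
    have e2 : exp (((2 * Real.pi : ℝ) : ℂ) / 2 * I) = -1 := by
      rw [← Complex.exp_pi_mul_I]; congr 1; push_cast; ring
    simp only [q, b, e1, e2]
    simp [div_neg]
  rw [h2] at h1
  exact h0 (neg_eq_self.1 h1)

/-! ### Holomorphic functions with positive real part, critical points, isometric sections -/

lemma normSq_add_conj_sub (p a : ℂ) :
    ‖p + (starRingEnd ℂ) a‖ ^ 2 - ‖p - a‖ ^ 2 = 4 * p.re * a.re := by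
  rw [← Complex.normSq_eq_norm_sq, ← Complex.normSq_eq_norm_sq, Complex.normSq_apply,
    Complex.normSq_apply]
  simp
  ring

lemma schwarz_right_half_plane {z : ℂ} {d : ℝ} {W : ℂ → ℂ}
    (hW : DifferentiableOn ℂ W (ball z d)) (hpos : ∀ x ∈ ball z d, 0 < (W x).re) :
    ∀ x ∈ ball z d, ‖(W x - W z) / (W x + (starRingEnd ℂ) (W z))‖ ≤ dist x z / d := by
  intro x hx
  have hd : 0 < d := pos_of_mem_ball hx
  have hz0 := hpos z (mem_ball_self hd)
  have hlt : ∀ x ∈ ball z d, ‖W x - W z‖ < ‖W x + (starRingEnd ℂ) (W z)‖ := by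
    intro x hx
    have h := normSq_add_conj_sub (W x) (W z)
    have : 0 < 4 * (W x).re * (W z).re := mul_pos (mul_pos (by norm_num) (hpos x hx)) hz0
    exact lt_of_pow_lt_pow_left₀ 2 (norm_nonneg _) (by linarith)
  have hne : ∀ x ∈ ball z d, W x + (starRingEnd ℂ) (W z) ≠ 0 := fun x hx h => by
    have := hlt x hx
    rw [h, norm_zero] at this
    exact absurd this (not_lt.2 (norm_nonneg _))
  have := Complex.dist_le_div_mul_dist_of_mapsTo_ball (R₁ := d) (R₂ := 1) (c := z) (z := x)
    (f := fun x => (W x - W z) / (W x + (starRingEnd ℂ) (W z)))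
    ((hW.sub_const _).div (hW.add_const _) hne) (fun x hx => by
      simp only [sub_self, zero_div, mem_closedBall_zero_iff, norm_div]
      exact div_le_one_of_le₀ (hlt x hx).le (norm_nonneg _)) hx
  simp only [sub_self, zero_div, dist_zero_right] at this
  rw [div_mul_eq_mul_div, one_mul] at this
  exact this

lemma norm_deriv_le_of_re_pos {z : ℂ} {d : ℝ} (hd : 0 < d) {W : ℂ → ℂ}
    (hW : DifferentiableOn ℂ W (ball z d)) (hpos : ∀ x ∈ ball z d, 0 < (W x).re) :
    ‖deriv W z‖ ≤ 2 * (W z).re / d := by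
  have hz0 := hpos z (mem_ball_self hd)
  have hWz : HasDerivAt W (deriv W z) z :=
    (hW.differentiableAt (ball_mem_nhds z hd)).hasDerivAt
  have hsum : W z + (starRingEnd ℂ) (W z) = ((2 * (W z).re : ℝ) : ℂ) := by
    rw [Complex.add_conj]
  have hne : W z + (starRingEnd ℂ) (W z) ≠ 0 := by
    rw [hsum]; exact_mod_cast (by positivity : 2 * (W z).re ≠ 0)
  have hder : HasDerivAt (fun x => (W x - W z) / (W x + (starRingEnd ℂ) (W z)))
      (deriv W z / ((2 * (W z).re : ℝ) : ℂ)) z := by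
    have := (hWz.sub_const (W z)).div (hWz.add_const ((starRingEnd ℂ) (W z))) hne
    rw [hsum] at this
    have h2 : ((2 * (W z).re : ℝ) : ℂ) ≠ 0 := by rw [← hsum]; exact hne
    rw [sub_self, zero_mul, sub_zero, pow_two, mul_div_mul_right _ _ h2] at this
    exact this
  have hb := hder.le_of_lip' (C := 1 / d) (by positivity) (by
    filter_upwards [ball_mem_nhds z hd] with x hx
    have := schwarz_right_half_plane hW hpos x hx
    simp only [sub_self, zero_div, sub_zero]
    rw [dist_eq_norm] at this
    rw [one_div_mul_eq_div]
    exact this)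
  rw [norm_div, Complex.norm_real, Real.norm_eq_abs, abs_of_pos (by positivity),
    div_le_div_iff₀ (by positivity) hd] at hb
  rw [le_div_iff₀ hd]
  linarith

lemma re_ge_of_re_pos {z x : ℂ} {d : ℝ} {W : ℂ → ℂ}
    (hW : DifferentiableOn ℂ W (ball z d)) (hpos : ∀ x ∈ ball z d, 0 < (W x).re)
    (hx : x ∈ ball z d) : (W z).re * (1 - dist x z / d) / 2 ≤ (W x).re := by
  have hd : 0 < d := pos_of_mem_ball hx
  have hz0 := hpos z (mem_ball_self hd)
  have hx0 := hpos x hx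
  have h1 := schwarz_right_half_plane hW hpos x hx
  have h2 := normSq_add_conj_sub (W x) (W z)
  have h3 : 2 * (W z).re ≤ ‖W x + (starRingEnd ℂ) (W z)‖ + ‖W x - W z‖ := by
    have e : W z + (starRingEnd ℂ) (W z) = ((2 * (W z).re : ℝ) : ℂ) := by rw [Complex.add_conj]
    have := norm_sub_le (W x + (starRingEnd ℂ) (W z)) (W x - W z)
    rw [show W x + (starRingEnd ℂ) (W z) - (W x - W z) = W z + (starRingEnd ℂ) (W z) by ring, e,
      Complex.norm_real, Real.norm_eq_abs, abs_of_pos (by positivity)] at this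
    exact this
  set A := ‖W x + (starRingEnd ℂ) (W z)‖
  set B := ‖W x - W z‖
  have hA : 0 < A := by
    have hA0 : 0 ≤ A := norm_nonneg _
    have hB0 : 0 ≤ B := norm_nonneg _
    rcases hA0.eq_or_lt with h | h
    · rw [← h] at h2
      have : 0 < 4 * (W x).re * (W z).re := by positivity
      nlinarith
    · exact h
  rw [norm_div] at h1
  set t := dist x z / d
  have ht : t < 1 := by rw [div_lt_one hd]; exact hx
  have hB0 : 0 ≤ B := norm_nonneg _
  have h4 : B ≤ t * A := by rwa [div_le_iff₀ hA] at h1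
  have ht0 : 0 ≤ t := by positivity
  -- 4 Re W(x) Re W(z) = (A - B)(A + B)
  have h5 : A * (1 - t) ≤ A - B := by linarith
  have h6 : (W z).re ≤ A := by nlinarith
  have h7 : 0 ≤ A * (1 - t) := mul_nonneg hA.le (by linarith)
  have h8 : A * (1 - t) * (2 * (W z).re) ≤ (A - B) * (A + B) :=
    mul_le_mul h5 h3 (by positivity) (by linarith)
  have h9 : (W z).re * (1 - t) * (2 * (W z).re) ≤ 4 * (W x).re * (W z).re := by
    have : (W z).re * (1 - t) ≤ A * (1 - t) := mul_le_mul_of_nonneg_right h6 (by linarith)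
    nlinarith
  have : (W z).re * (1 - t) ≤ 2 * (W x).re := by
    by_contra! hlt
    nlinarith [mul_lt_mul_of_pos_right hlt hz0]
  linarith

/-- Near a critical point a nonconstant holomorphic function takes every nearby value at least
twice. -/
lemma exists_two_preimages_of_deriv_eq_zero {W : ℂ → ℂ} {z₀ : ℂ} (hW : AnalyticAt ℂ W z₀)
    (hd : deriv W z₀ = 0) (hnc : ¬ ∀ᶠ z in 𝓝 z₀, W z = W z₀) {V : Set ℂ} (hV : V ∈ 𝓝 z₀) :
    ∀ᶠ w in 𝓝[≠] (W z₀), ∃ x ∈ V, ∃ x' ∈ V, x ≠ x' ∧ W x = w ∧ W x' = w := by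
  obtain ⟨k, h, hh, hh0, hk⟩ := (hW.sub (analyticAt_const (v := W z₀))
    ).exists_eventuallyEq_pow_smul_nonzero_iff.2 (fun hcon => hnc (by
      filter_upwards [hcon] with z hz
      simpa [sub_eq_zero] using hz))
  have hk2 : 2 ≤ k := by
    by_contra! hlt
    obtain rfl | rfl : k = 0 ∨ k = 1 := by omega
    · have := hk.self_of_nhds
      simp at this
      exact hh0 this.symm
    · have h1 : HasDerivAt (fun z => (z - z₀) ^ 1 • h z) (h z₀) z₀ := by
        have := ((hasDerivAt_id z₀).sub_const z₀).mul hh.differentiableAt.hasDerivAt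
        simpa [Pi.mul_def] using this
      have h2 := h1.congr_of_eventuallyEq hk
      have h3 := (hW.differentiableAt.hasDerivAt.sub_const (W z₀))
      have h4 := h2.unique h3
      rw [hd] at h4
      exact hh0 h4
  obtain ⟨a, ha⟩ := IsAlgClosed.exists_pow_nat_eq (h z₀) (n := k) (by omega)
  have ha0 : a ≠ 0 := by
    rintro rfl
    rw [zero_pow (by omega)] at ha
    exact hh0 ha.symm
  set e : ℂ → ℂ := fun z => (h z / h z₀) ^ ((k : ℂ)⁻¹)
  have he : AnalyticAt ℂ e z₀ := by
    refine AnalyticAt.cpow (hh.div analyticAt_const hh0) analyticAt_const ?_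
    rw [div_self hh0]; exact Complex.one_mem_slitPlane
  have he0 : e z₀ = 1 := by simp only [e]; rw [div_self hh0, one_cpow]
  have hek : ∀ z, e z ^ k = h z / h z₀ := fun z => by
    simp only [e]
    rw [Complex.cpow_nat_inv_pow _ (by omega)]
  set φ : ℂ → ℂ := fun z => (z - z₀) * (a * e z)
  have hφ : HasStrictDerivAt φ a z₀ := by
    have h1 : HasStrictDerivAt (fun z : ℂ => z - z₀) 1 z₀ := (hasStrictDerivAt_id z₀).sub_const z₀
    have h2 : HasStrictDerivAt (fun z => a * e z) (a * deriv e z₀) z₀ :=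
      he.hasStrictDerivAt.const_mul a
    have h3 := h1.mul h2
    simp only [he0, sub_self, zero_mul, one_mul, mul_one, add_zero] at h3
    exact h3
  have hmap := hφ.map_nhds_eq ha0
  have hφ0 : φ z₀ = 0 := by simp [φ]
  rw [hφ0] at hmap
  have hgood : {z | z ∈ V ∧ W z = W z₀ + φ z ^ k} ∈ 𝓝 z₀ := by
    filter_upwards [hV, hk] with z hzV hz
    refine ⟨hzV, ?_⟩
    simp only [φ]
    rw [mul_pow, mul_pow, hek, ha, mul_div_cancel₀ _ hh0]
    have hz' : W z - W z₀ = (z - z₀) ^ k * h z := hz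
    rw [← hz']; ring
  have himg := Filter.image_mem_map (m := φ) hgood
  rw [hmap] at himg
  obtain ⟨r, hr, hball⟩ := Metric.mem_nhds_iff.1 himg
  have hnear : ∀ᶠ w in 𝓝[≠] (W z₀), w ∈ ball (W z₀) (r ^ k) :=
    mem_nhdsWithin_of_mem_nhds (ball_mem_nhds _ (by positivity))
  filter_upwards [hnear, self_mem_nhdsWithin] with w hw hne
  obtain ⟨ξ, hξ⟩ := IsAlgClosed.exists_pow_nat_eq (w - W z₀) (n := k) (by omega)
  have hξr : ‖ξ‖ < r := by
    rw [mem_ball, dist_eq_norm, ← hξ, norm_pow] at hw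
    exact lt_of_pow_lt_pow_left₀ k hr.le hw
  have hξ0 : ξ ≠ 0 := by
    rintro rfl
    rw [zero_pow (by omega)] at hξ
    exact hne (sub_eq_zero.1 hξ.symm)
  have hprim := Complex.isPrimitiveRoot_exp k (by omega)
  set ζ := cexp (2 * Real.pi * I / k)
  have hζ1 : ζ ≠ 1 := hprim.ne_one (by omega)
  have hζn : ‖ζ‖ = 1 := hprim.norm'_eq_one (by omega)
  obtain ⟨x, hx, hxξ⟩ := hball (mem_ball_zero_iff.2 hξr)
  obtain ⟨x', hx', hxξ'⟩ := hball (show ζ * ξ ∈ ball (0 : ℂ) r by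
    rw [mem_ball_zero_iff, norm_mul, hζn, one_mul]; exact hξr)
  refine ⟨x, hx.1, x', hx'.1, ?_, ?_, ?_⟩
  · rintro rfl
    rw [hxξ] at hxξ'
    exact hζ1 (mul_right_cancel₀ hξ0 (by rw [one_mul]; exact hxξ'.symm))
  · rw [hx.2, hxξ, hξ]; ring
  · rw [hx'.2, hxξ', mul_pow, hprim.pow_eq_one, one_mul, hξ]; ring

/-- A connected plane set that is locally a curve parametrised by a function `p` with
locally almost `1`-Lipschitz inverse is globally a `1`-Lipschitz curve in the parameter `p`. -/
lemma IsPreconnected.dist_le_of_local_section {M : Set ℂ} (hM : IsPreconnected M) {p : ℂ → ℝ}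
    (hp : ContinuousOn p M)
    (h1 : ∀ y ∈ M, ∀ ε > 0, ∃ r > 0, ∀ z ∈ M ∩ ball y r, ∀ z' ∈ M ∩ ball y r,
      dist z z' ≤ (1 + ε) * |p z - p z'|)
    (h2 : ∀ y ∈ M, ∀ r > 0, ∃ η > 0, ∀ s, |s - p y| < η → ∃ z ∈ M ∩ ball y r, p z = s)
    {x y : ℂ} (hx : x ∈ M) (hy : y ∈ M) : dist x y ≤ |p x - p y| := by
  suffices key : ∀ ε > 0, dist x y ≤ (1 + ε) * |p x - p y| by
    have hlim : Tendsto (fun ε : ℝ => (1 + ε) * |p x - p y|) (𝓝[>] 0) (𝓝 ((1 + 0) * |p x - p y|)) :=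
      ((tendsto_id.const_add 1).mul_const _).mono_left nhdsWithin_le_nhds
    rw [add_zero, one_mul] at hlim
    exact ge_of_tendsto hlim (by filter_upwards [self_mem_nhdsWithin] with ε hε using key ε hε)
  intro ε hε
  set Sec : ℂ → Prop := fun z => ∃ a b : ℝ, ∃ σ : ℝ → ℂ, p x ∈ Icc a b ∧ p z ∈ Icc a b ∧
    (∀ s ∈ Icc a b, σ s ∈ M ∧ p (σ s) = s) ∧
    (∀ s ∈ Icc a b, ∀ t ∈ Icc a b, dist (σ s) (σ t) ≤ (1 + ε) * |s - t|) ∧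
    σ (p x) = x ∧ σ (p z) = z with hSec
  have hstep : ∀ z ∈ M, ∀ᶠ w in 𝓝[M] z, (Sec w ↔ Sec z) := by
    intro z hz
    obtain ⟨r, hr, hr1⟩ := h1 z hz ε hε
    obtain ⟨η, hη, hη1⟩ := h2 z hz r hr
    have hinj : ∀ w ∈ M ∩ ball z r, ∀ w' ∈ M ∩ ball z r, p w = p w' → w = w' := by
      intro w hw w' hw' h
      have := hr1 w hw w' hw'
      rw [h, sub_self, abs_zero, mul_zero] at this
      exact dist_le_zero.1 this
    have hmove : ∀ y₁ ∈ M ∩ ball z (r / 2), ∀ y₂ ∈ M ∩ ball z (r / 2), |p y₁ - p z| < η →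
        |p y₂ - p z| < η → (1 + ε) * |p y₁ - p y₂| < r / 2 → Sec y₁ → Sec y₂ := by
      rintro y₁ ⟨hy₁, hb₁⟩ y₂ ⟨hy₂, hb₂⟩ hp₁ hp₂ hpp ⟨a, b, σ, hxa, hya, hσ, hL, hσx, hσy⟩
      have hmem₂ : y₂ ∈ M ∩ ball z r := ⟨hy₂, ball_subset_ball (by linarith) hb₂⟩
      have hτ : ∀ s : ℝ, ∃ w, |s - p z| < η → w ∈ M ∩ ball z r ∧ p w = s := by
        intro s
        by_cases hs : |s - p z| < η
        · obtain ⟨w, hw⟩ := hη1 s hs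
          exact ⟨w, fun _ => hw⟩
        · exact ⟨0, fun h => absurd h hs⟩
      choose τ hτ using hτ
      have hbet : ∀ s ∈ uIcc (p y₁) (p y₂), |s - p z| < η := by
        intro s hs
        rw [mem_uIcc] at hs
        rw [abs_lt] at *
        rcases hs with hs | hs <;> constructor <;> linarith
      -- parts of `σ` with parameters between `p y₁` and `p y₂` stay close to `z`
      have hclose : ∀ s ∈ Icc a b, s ∈ uIcc (p y₁) (p y₂) → σ s ∈ M ∩ ball z r := by
        intro s hs hs'
        refine ⟨(hσ s hs).1, ?_⟩
        have h3 := hL s hs _ hya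
        rw [hσy] at h3
        have h4 : |s - p y₁| ≤ |p y₁ - p y₂| := by
          have := Set.abs_sub_left_of_mem_uIcc hs'
          rw [abs_sub_comm (p y₁)]
          exact this
        have h5 : (1 + ε) * |s - p y₁| ≤ (1 + ε) * |p y₁ - p y₂| :=
          mul_le_mul_of_nonneg_left h4 (by linarith)
        rw [mem_ball] at hb₁ ⊢
        linarith [dist_triangle (σ s) y₁ z]
      set σ' : ℝ → ℂ := fun s => if s ∈ Icc a b then σ s else τ s
      have hout : ∀ s ∈ Icc (min a (p y₂)) (max b (p y₂)), s ∉ Icc a b →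
          s ∈ uIcc (p y₁) (p y₂) := by
        intro s hs hns
        rw [mem_uIcc]
        have hs1 := hs.1
        have hs2 := hs.2
        rw [min_le_iff] at hs1
        rw [le_max_iff] at hs2
        simp only [mem_Icc, not_and_or, not_le] at hns hya
        rcases hns with h | h
        · right
          exact ⟨hs1.resolve_left (not_le.2 h), by linarith⟩
        · left
          exact ⟨by linarith, hs2.resolve_left (not_le.2 h)⟩
      have hin : ∀ s ∈ Icc a b, σ' s = σ s := fun s hs => if_pos hs
      have hno : ∀ s, s ∉ Icc a b → σ' s = τ s := fun s hs => if_neg hs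
      have hmem' : ∀ s ∈ Icc (min a (p y₂)) (max b (p y₂)), σ' s ∈ M ∧ p (σ' s) = s := by
        intro s hs
        by_cases h : s ∈ Icc a b
        · rw [hin s h]; exact hσ s h
        · rw [hno s h]
          have := hτ s (hbet s (hout s hs h))
          exact ⟨this.1.1, this.2⟩
      have hmix : ∀ s ∈ Icc a b, ∀ t ∈ Icc (min a (p y₂)) (max b (p y₂)), t ∉ Icc a b →
          dist (σ' s) (σ' t) ≤ (1 + ε) * |s - t| := by
        intro s hs t ht hnt
        have htu := hout t ht hnt
        obtain ⟨e, he, heu, hsum⟩ : ∃ e ∈ Icc a b, e ∈ uIcc (p y₁) (p y₂) ∧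
            |s - e| + |e - t| = |s - t| := by
          have h := hnt
          simp only [mem_Icc, not_and_or, not_le] at h
          rw [mem_uIcc] at htu
          have hs1 := hs.1
          have hs2 := hs.2
          have hy1 := hya.1
          have hy2 := hya.2
          rcases h with h | h
          · refine ⟨a, ⟨le_rfl, hs1.trans hs2⟩, ?_, ?_⟩
            · rw [mem_uIcc]; right
              rcases htu with h' | h' <;> constructor <;> linarith
            · rw [abs_of_nonneg (by linarith), abs_of_nonneg (by linarith),
                abs_of_nonneg (by linarith)]; ring
          · refine ⟨b, ⟨hs1.trans hs2, le_rfl⟩, ?_, ?_⟩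
            · rw [mem_uIcc]; left
              rcases htu with h' | h' <;> constructor <;> linarith
            · rw [abs_of_nonpos (by linarith), abs_of_nonpos (by linarith),
                abs_of_nonpos (by linarith)]; ring
        rw [hin s hs, hno t hnt]
        have ht' := hτ t (hbet t htu)
        have h3 := hL s hs e he
        have h4 := hr1 (σ e) (hclose e he heu) (τ t) ht'.1
        rw [(hσ e he).2, ht'.2] at h4
        calc dist (σ s) (τ t) ≤ dist (σ s) (σ e) + dist (σ e) (τ t) := dist_triangle _ _ _
          _ ≤ (1 + ε) * |s - e| + (1 + ε) * |e - t| := add_le_add h3 h4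
          _ = (1 + ε) * |s - t| := by rw [← hsum]; ring
      refine ⟨min a (p y₂), max b (p y₂), σ', ⟨?_, ?_⟩, ⟨?_, ?_⟩, hmem', ?_, ?_, ?_⟩
      · exact (min_le_left _ _).trans hxa.1
      · exact hxa.2.trans (le_max_left _ _)
      · exact min_le_right _ _
      · exact le_max_right _ _
      · intro s hs t ht
        by_cases h : s ∈ Icc a b <;> by_cases h' : t ∈ Icc a b
        · rw [hin s h, hin t h']; exact hL s h t h'
        · exact hmix s h t ht h'
        · rw [dist_comm, abs_sub_comm]; exact hmix t h' s hs h
        · rw [hno s h, hno t h']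
          have hs' := hτ s (hbet s (hout s hs h))
          have ht' := hτ t (hbet t (hout t ht h'))
          have := hr1 _ hs'.1 _ ht'.1
          rwa [hs'.2, ht'.2] at this
      · rw [hin _ hxa, hσx]
      · by_cases h : p y₂ ∈ Icc a b
        · rw [hin _ h]
          exact hinj _ (hclose _ h right_mem_uIcc) _ hmem₂ (hσ _ h).2
        · rw [hno _ h]
          have := hτ (p y₂) hp₂
          exact hinj _ this.1 _ hmem₂ this.2
    have hc := hp z hz
    have hpz : ∀ κ > 0, ∀ᶠ w in 𝓝[M] z, |p w - p z| < κ := fun κ hκ =>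
      hc.eventually (Metric.ball_mem_nhds (p z) hκ)
    filter_upwards [hpz η hη, hpz (r / 2 / (1 + ε)) (by positivity), self_mem_nhdsWithin,
      mem_nhdsWithin_of_mem_nhds (ball_mem_nhds z (half_pos hr))] with w hw1 hw2 hw3 hw4
    have hzz : z ∈ M ∩ ball z (r / 2) := ⟨hz, mem_ball_self (half_pos hr)⟩
    have hz0 : |p z - p z| < η := by simpa using hη
    rw [lt_div_iff₀ (by linarith)] at hw2
    constructor
    · exact hmove w ⟨hw3, hw4⟩ z hzz hw1 hz0 (by linarith)
    · exact hmove z hzz w ⟨hw3, hw4⟩ hz0 hw1 (by rw [abs_sub_comm]; linarith)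
  have hx0 : Sec x := ⟨p x, p x, fun _ => x, ⟨le_rfl, le_rfl⟩, ⟨le_rfl, le_rfl⟩,
    fun s hs => ⟨hx, le_antisymm hs.1 hs.2⟩,
    fun s _ t _ => by rw [dist_self]; positivity, rfl, rfl⟩
  obtain ⟨a, b, σ, hxa, hya, -, hL, hσx, hσy⟩ := (hM.iff_of_eventually_iff hstep hx hy).1 hx0
  have := hL _ hxa _ hya
  rwa [hσx, hσy] at this

/-! ### Two arcs crossing an annulus -/

/-- `X` has small connected pieces at `y` filling up a neighbourhood of `y` in `X`. -/
def LocConnAt (X : Set ℂ) (y : ℂ) : Prop :=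
  ∀ r > 0, ∃ s > 0, ∃ C ⊆ X ∩ ball y r, IsPreconnected C ∧ X ∩ ball y s ⊆ C

/-- The annulus `ann δ 1` is divided by two crossing curves `F₁`, `F₂` into open sets `D`, `E`
that both are adjacent to every point of the curves. -/
structure TwoArcs (δ : ℝ) (D E F₁ F₂ : Set ℂ) : Prop where
  pos : 0 < δ
  lt_one : δ < 1
  openD : IsOpen D
  openE : IsOpen E
  union_eq : D ∪ E ∪ (F₁ ∪ F₂) = ann δ 1
  disjDE : Disjoint D E
  disjDF : Disjoint D (F₁ ∪ F₂)
  disjEF : Disjoint E (F₁ ∪ F₂)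
  disjF : Disjoint F₁ F₂
  conn₁ : IsPreconnected F₁
  conn₂ : IsPreconnected F₂
  inner₁ : (closure F₁ ∩ sphere 0 δ).Nonempty
  inner₂ : (closure F₂ ∩ sphere 0 δ).Nonempty
  outer₁ : (closure F₁ ∩ sphere 0 1).Nonempty
  outer₂ : (closure F₂ ∩ sphere 0 1).Nonempty
  sep₁ : ∀ y ∈ F₁, ∃ r > 0, Disjoint F₂ (ball y r)
  sep₂ : ∀ y ∈ F₂, ∃ r > 0, Disjoint F₁ (ball y r)
  locD : ∀ y ∈ F₁ ∪ F₂, LocConnAt D y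
  locE : ∀ y ∈ F₁ ∪ F₂, LocConnAt E y
  clD : F₁ ∪ F₂ ⊆ closure D
  clE : F₁ ∪ F₂ ⊆ closure E

namespace TwoArcs

variable {δ : ℝ} {D E F₁ F₂ : Set ℂ}

lemma symm (h : TwoArcs δ D E F₁ F₂) : TwoArcs δ E D F₁ F₂ where
  pos := h.pos
  lt_one := h.lt_one
  openD := h.openE
  openE := h.openD
  union_eq := by rw [union_comm E D]; exact h.union_eq
  disjDE := h.disjDE.symm
  disjDF := h.disjEF
  disjEF := h.disjDF
  disjF := h.disjF
  conn₁ := h.conn₁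
  conn₂ := h.conn₂
  inner₁ := h.inner₁
  inner₂ := h.inner₂
  outer₁ := h.outer₁
  outer₂ := h.outer₂
  sep₁ := h.sep₁
  sep₂ := h.sep₂
  locD := h.locE
  locE := h.locD
  clD := h.clE
  clE := h.clD

lemma swap (h : TwoArcs δ D E F₁ F₂) : TwoArcs δ D E F₂ F₁ where
  pos := h.pos
  lt_one := h.lt_one
  openD := h.openD
  openE := h.openE
  union_eq := by rw [union_comm F₂ F₁]; exact h.union_eq
  disjDE := h.disjDE
  disjDF := by rw [union_comm F₂ F₁]; exact h.disjDF
  disjEF := by rw [union_comm F₂ F₁]; exact h.disjEF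
  disjF := h.disjF.symm
  conn₁ := h.conn₂
  conn₂ := h.conn₁
  inner₁ := h.inner₂
  inner₂ := h.inner₁
  outer₁ := h.outer₂
  outer₂ := h.outer₁
  sep₁ := h.sep₂
  sep₂ := h.sep₁
  locD := by rw [union_comm F₂ F₁]; exact h.locD
  locE := by rw [union_comm F₂ F₁]; exact h.locE
  clD := by rw [union_comm F₂ F₁]; exact h.clD
  clE := by rw [union_comm F₂ F₁]; exact h.clE

lemma D_subset (h : TwoArcs δ D E F₁ F₂) : D ⊆ ann δ 1 := fun z hz => by
  rw [← h.union_eq]; exact Or.inl (Or.inl hz)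

lemma F_subset (h : TwoArcs δ D E F₁ F₂) : F₁ ∪ F₂ ⊆ ann δ 1 := fun z hz => by
  rw [← h.union_eq]; exact Or.inr hz

lemma mem_cases (h : TwoArcs δ D E F₁ F₂) {z : ℂ} (hz : z ∈ ann δ 1) :
    z ∈ D ∨ z ∈ E ∨ z ∈ F₁ ∪ F₂ := by
  rw [← h.union_eq] at hz
  rcases hz with (h1 | h1) | h1
  exacts [Or.inl h1, Or.inr (Or.inl h1), Or.inr (Or.inr h1)]

lemma mem_of_mem_closure (h : TwoArcs δ D E F₁ F₂) {z : ℂ} (hz : z ∈ ann δ 1)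
    (hc : z ∈ closure D) : z ∈ D ∪ (F₁ ∪ F₂) := by
  rcases h.mem_cases hz with h1 | h1 | h1
  · exact Or.inl h1
  · obtain ⟨w, hw1, hw2⟩ := mem_closure_iff.1 hc E h.openE h1
    exact absurd hw1 (disjoint_left.1 h.disjDE hw2)
  · exact Or.inr h1

end TwoArcs

lemma isOpen_ann (δ R : ℝ) : IsOpen (ann δ R) :=
  (isOpen_lt continuous_const continuous_norm).inter (isOpen_lt continuous_norm continuous_const)

lemma isBounded_ann (δ R : ℝ) : Bornology.IsBounded (ann δ R) :=
  (isBounded_ball (x := (0 : ℂ)) (r := R)).subset fun _ hz => mem_ball_zero_iff.2 hz.2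

/-- The union of a closed connected set and a connected set accumulating at it is connected. -/
lemma IsPreconnected.union_of_closure_inter {A B : Set ℂ} (hA : IsPreconnected A)
    (hB : IsPreconnected B) (h : (closure B ∩ A).Nonempty) : IsPreconnected (A ∪ B) := by
  have h1 : IsPreconnected (B ∪ (closure B ∩ A)) :=
    hB.subset_closure subset_union_left (union_subset subset_closure inter_subset_left)
  have h2 : A ∪ B = A ∪ (B ∪ (closure B ∩ A)) := by
    ext z; simp only [mem_union, mem_inter_iff]; tauto
  rw [h2]
  obtain ⟨p, hp⟩ := h
  exact IsPreconnected.union p hp.2 (Or.inr hp) hA h1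

lemma isPreconnected_norm_ge (R : ℝ) : IsPreconnected {z : ℂ | R ≤ ‖z‖} := by
  have : {z : ℂ | R ≤ ‖z‖} = (fun q : ℝ × ℝ => (q.1 : ℂ) * exp (q.2 * I)) ''
      (Ici (max R 0) ×ˢ univ) := by
    ext z
    constructor
    · intro hz
      exact ⟨(‖z‖, arg z), ⟨max_le hz (norm_nonneg z), mem_univ _⟩, norm_mul_exp_arg_mul_I z⟩
    · rintro ⟨⟨t, θ⟩, ⟨ht, -⟩, rfl⟩
      have ht' : max R 0 ≤ t := ht
      have h1 : ‖(t : ℂ) * exp (θ * I)‖ = t := by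
        rw [norm_mul, norm_exp_ofReal_mul_I, mul_one, Complex.norm_real, Real.norm_eq_abs,
          abs_of_nonneg ((le_max_right _ _).trans ht')]
      change R ≤ ‖(t : ℂ) * exp (θ * I)‖
      rw [h1]
      exact (le_max_left _ _).trans ht'
  rw [this]
  exact (isPreconnected_Ici.prod isPreconnected_univ).image _ (by fun_prop)

namespace TwoArcs

variable {δ : ℝ} {D E F₁ F₂ : Set ℂ}

lemma isPreconnected_compl (h : TwoArcs δ D E F₁ F₂) : IsPreconnected Dᶜ := by
  set K : Set ℂ := closedBall 0 δ ∪ F₁ ∪ F₂ ∪ {z | 1 ≤ ‖z‖}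
  have hsph : ∀ r : ℝ, sphere (0 : ℂ) r ⊆ closedBall 0 r := fun r => sphere_subset_closedBall
  have hK : IsPreconnected K := by
    have hA : IsPreconnected (closedBall (0 : ℂ) δ ∪ F₁) :=
      (convex_closedBall (0 : ℂ) δ).isPreconnected.union_of_closure_inter h.conn₁
        (h.inner₁.mono (inter_subset_inter_right _ (hsph δ)))
    have hB : IsPreconnected (closedBall (0 : ℂ) δ ∪ F₁ ∪ F₂) :=
      hA.union_of_closure_inter h.conn₂ (h.inner₂.mono (inter_subset_inter_right _
        ((hsph δ).trans subset_union_left)))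
    have hC : IsPreconnected ({z : ℂ | 1 ≤ ‖z‖} ∪ (closedBall (0 : ℂ) δ ∪ F₁ ∪ F₂)) := by
      refine (isPreconnected_norm_ge 1).union_of_closure_inter hB ?_
      obtain ⟨p, hp1, hp2⟩ := h.outer₁
      refine ⟨p, closure_mono (subset_union_right.trans subset_union_left) hp1, ?_⟩
      exact (mem_sphere_zero_iff_norm.1 hp2).ge
    rwa [union_comm] at hC
  have hKD : K ⊆ Dᶜ := by
    rintro z (((hz | hz) | hz) | hz) hD
    · exact absurd (h.D_subset hD).1 (not_lt.2 (mem_closedBall_zero_iff.1 hz))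
    · exact disjoint_left.1 h.disjDF hD (Or.inl hz)
    · exact disjoint_left.1 h.disjDF hD (Or.inr hz)
    · exact absurd (h.D_subset hD).2 (not_lt.2 hz)
  have h0K : (0 : ℂ) ∈ K := Or.inl (Or.inl (Or.inl (mem_closedBall_self h.pos.le)))
  refine isPreconnected_of_forall 0 fun p hp => ?_
  by_cases hpE : p ∈ E
  · -- go radially towards the origin until leaving `E`
    set J : Set ℝ := {t | t ∈ Icc (0 : ℝ) 1 ∧ (t : ℂ) * p ∉ E}
    have hcont : Continuous fun t : ℝ => (t : ℂ) * p := by fun_prop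
    have hJc : IsCompact J := by
      have : J = Icc (0 : ℝ) 1 ∩ (fun t : ℝ => (t : ℂ) * p) ⁻¹' Eᶜ := rfl
      rw [this]
      exact isCompact_Icc.inter_right (h.openE.isClosed_compl.preimage hcont)
    have h0 : (0 : ℝ) ∈ J := by
      refine ⟨⟨le_rfl, zero_le_one⟩, fun h1 => ?_⟩
      have := (h.symm.D_subset h1).1
      simp at this
      exact absurd this (not_lt.2 h.pos.le)
    obtain ⟨t₀, ht₀, hmax⟩ := hJc.exists_isGreatest ⟨0, h0⟩
    have ht1 : ∀ t ∈ Ioc t₀ 1, (t : ℂ) * p ∈ E := by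
      intro t ht
      by_contra hcon
      exact absurd (hmax ⟨⟨ht₀.1.1.trans ht.1.le, ht.2⟩, hcon⟩) (not_le.2 ht.1)
    have hlt : t₀ < 1 := by
      refine lt_of_le_of_ne ht₀.1.2 fun h1 => ht₀.2 ?_
      rw [h1]; simpa using hpE
    have hlim : (t₀ : ℂ) * p ∈ closure E := by
      have : (fun t : ℝ => (t : ℂ) * p) t₀ ∈ closure ((fun t : ℝ => (t : ℂ) * p) '' Ioc t₀ 1) := by
        apply image_closure_subset_closure_image hcont
        refine ⟨t₀, ?_, rfl⟩
        rw [closure_Ioc hlt.ne]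
        exact ⟨le_rfl, hlt.le⟩
      refine closure_mono ?_ this
      rintro _ ⟨t, ht, rfl⟩
      exact ht1 t ht
    have hnD : (t₀ : ℂ) * p ∉ D := by
      intro hD
      obtain ⟨w, hw1, hw2⟩ := mem_closure_iff.1 hlim D h.openD hD
      exact disjoint_left.1 h.disjDE hw1 hw2
    have hseg : IsPreconnected ((fun t : ℝ => (t : ℂ) * p) '' Icc t₀ 1) :=
      isPreconnected_Icc.image _ hcont.continuousOn
    have hmemK : (t₀ : ℂ) * p ∈ K := by
      have hn : ‖(t₀ : ℂ) * p‖ < 1 := by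
        rw [norm_mul, Complex.norm_real, Real.norm_eq_abs, abs_of_nonneg ht₀.1.1]
        have := (h.symm.D_subset hpE).2
        have h3 := norm_nonneg p
        nlinarith [ht₀.1.1, ht₀.1.2]
      by_cases hδ : δ < ‖(t₀ : ℂ) * p‖
      · rcases h.mem_cases (⟨hδ, hn⟩ : (t₀ : ℂ) * p ∈ ann δ 1) with h1 | h1 | h1 | h1
        · exact absurd h1 hnD
        · exact absurd h1 ht₀.2
        · exact Or.inl (Or.inl (Or.inr h1))
        · exact Or.inl (Or.inr h1)
      · exact Or.inl (Or.inl (Or.inl (mem_closedBall_zero_iff.2 (not_lt.1 hδ))))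
    refine ⟨K ∪ (fun t : ℝ => (t : ℂ) * p) '' Icc t₀ 1, union_subset hKD ?_, Or.inl h0K,
      Or.inr ⟨1, ⟨hlt.le, le_rfl⟩, by simp⟩,
      IsPreconnected.union _ hmemK ⟨t₀, ⟨le_rfl, hlt.le⟩, rfl⟩ hK hseg⟩
    rintro _ ⟨t, ht, rfl⟩
    rcases ht.1.eq_or_lt with h1 | h1
    · subst h1; exact hnD
    · exact fun hD => disjoint_left.1 h.disjDE hD (ht1 t ⟨h1, ht.2⟩)
  · refine ⟨K, hKD, h0K, ?_, hK⟩
    by_cases hδ : δ < ‖p‖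
    · by_cases h1 : ‖p‖ < 1
      · rcases h.mem_cases (⟨hδ, h1⟩ : p ∈ ann δ 1) with h2 | h2 | h2 | h2
        · exact absurd h2 hp
        · exact absurd h2 hpE
        · exact Or.inl (Or.inl (Or.inr h2))
        · exact Or.inl (Or.inr h2)
      · exact Or.inr (not_lt.1 h1)
    · exact Or.inl (Or.inl (Or.inl (mem_closedBall_zero_iff.2 (not_lt.1 hδ))))

lemma exists_primitive (h : TwoArcs δ D E F₁ F₂) {f : ℂ → ℂ} (hf : DifferentiableOn ℂ f D) :
    ∃ P : ℂ → ℂ, ∀ z ∈ D, HasDerivAt P (f z) z :=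
  exists_primitive_of_isPreconnected_compl h.openD ((isBounded_ann δ 1).subset h.D_subset)
    h.isPreconnected_compl hf

end TwoArcs

/-- A holomorphic square root on a bounded open set with connected complement containing `0`. -/
lemma exists_sqrt_of_primitive {X : Set ℂ} (hXo : IsOpen X) (h0 : (0 : ℂ) ∉ X)
    (hprim : ∃ P : ℂ → ℂ, ∀ z ∈ X, HasDerivAt P z⁻¹ z) :
    ∃ S : ℂ → ℂ, ContinuousOn S X ∧ ∀ z ∈ X, S z ^ 2 = z := by
  obtain ⟨P, hP⟩ := hprim
  -- `q = exp P / z` is locally constant and nonzero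
  set q : ℂ → ℂ := fun z => exp (P z) / z
  have hq : ∀ z ∈ X, HasDerivAt q 0 z := by
    intro z hz
    have hz0 : z ≠ 0 := fun h => h0 (h ▸ hz)
    have := (hP z hz).cexp.div (hasDerivAt_id z) hz0
    have e : (exp (P z) * z⁻¹ * id z - exp (P z) * 1) / id z ^ 2 = 0 := by
      simp only [id]
      rw [mul_assoc, inv_mul_cancel₀ hz0, sub_self, zero_div]
    rw [e] at this
    exact this
  have hq0 : ∀ z ∈ X, q z ≠ 0 := fun z hz =>
    div_ne_zero (exp_ne_zero _) (fun h => h0 (h ▸ hz))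
  set rt : ℂ → ℂ := fun w => (IsAlgClosed.exists_pow_nat_eq w (n := 2) (by norm_num)).choose
  have hrt : ∀ w, rt w ^ 2 = w := fun w =>
    (IsAlgClosed.exists_pow_nat_eq w (n := 2) (by norm_num)).choose_spec
  refine ⟨fun z => exp (P z / 2) / rt (q z), fun z hz => ?_, fun z hz => ?_⟩
  · have hloc : ∀ᶠ w in 𝓝 z, q w = q z := by
      obtain ⟨r, hr, hb⟩ := Metric.isOpen_iff.1 hXo z hz
      filter_upwards [ball_mem_nhds z hr] with w hw
      exact isOpen_ball.is_const_of_deriv_eq_zero (convex_ball z r).isPreconnected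
        (fun x hx => (hq x (hb hx)).differentiableAt.differentiableWithinAt)
        (fun x hx => (hq x (hb hx)).deriv) hw (mem_ball_self hr)
    have hc : ContinuousAt (fun w => exp (P w / 2) / rt (q z)) z :=
      (((hP z hz).continuousAt.div_const 2).cexp).div_const _
    refine (hc.congr_of_eventuallyEq ?_).continuousWithinAt
    filter_upwards [hloc] with w hw
    rw [hw]
  · have hz0 : z ≠ 0 := fun h => h0 (h ▸ hz)
    have e : exp (P z / 2) ^ 2 = exp (P z) := by
      rw [← exp_nat_mul]; congr 1; push_cast; ring
    simp only
    rw [div_pow, hrt, e]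
    simp only [q]
    rw [div_div_cancel₀ (exp_ne_zero _)]

/-! ### Local geometry of a smooth superlevel set -/

/-- A `C¹` function with nonzero differential at `y` is strictly increasing along a cone of
directions near `y`. -/
lemma exists_cone_monotone {V : Set ℂ} (hV : IsOpen V) {φ : ℂ → ℝ} (hφ : ContDiffOn ℝ 1 φ V)
    {y : ℂ} (hy : y ∈ V) (hd : fderiv ℝ φ y ≠ 0) :
    ∃ r₀ > 0, ∃ n : ℂ, ‖n‖ = 1 ∧ ball y r₀ ⊆ V ∧ ∀ v : ℂ, ‖v - 2 * n‖ ≤ 1 → ∀ z ∈ ball y r₀,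
      ∀ t : ℝ, 0 < t → z + (t : ℂ) * v ∈ ball y r₀ → φ z < φ (z + t * v) := by
  set L := fderiv ℝ φ y
  set g : ℂ := (L 1 : ℂ) + (L I : ℂ) * I
  have hL : ∀ v : ℂ, L v = L 1 * v.re + L I * v.im := by
    intro v
    conv_lhs => rw [show v = v.re • (1 : ℂ) + v.im • I by
      simp only [Complex.real_smul, mul_one]; exact (Complex.re_add_im v).symm]
    rw [map_add, map_smul, map_smul]
    simp only [smul_eq_mul]; ring
  have hg : g ≠ 0 := by
    intro h0
    apply hd
    ext v
    have h1 : g.re = L 1 := by simp [g]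
    have h2 : g.im = L I := by simp [g]
    rw [h0] at h1 h2
    change L v = 0
    rw [hL, ← h1, ← h2]; simp
  have hgn : 0 < ‖g‖ := norm_pos_iff.2 hg
  have hLg : ∀ v : ℂ, L v = ((starRingEnd ℂ) g * v).re := by
    intro v; rw [hL]; simp [g]
  have hc : ContinuousAt (fderiv ℝ φ) y :=
    ((hφ.fderiv_of_isOpen hV (m := 0) (by norm_num)).continuousOn.continuousAt (hV.mem_nhds hy))
  obtain ⟨r₁, hr₁, hb₁⟩ := Metric.continuousAt_iff.1 hc (‖g‖ / 4) (by positivity)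
  obtain ⟨r₂, hr₂, hb₂⟩ := Metric.isOpen_iff.1 hV y hy
  refine ⟨min r₁ r₂, lt_min hr₁ hr₂, g / ‖g‖, ?_, ?_, ?_⟩
  · rw [norm_div, Complex.norm_real, norm_norm, div_self hgn.ne']
  · exact (ball_subset_ball (min_le_right _ _)).trans hb₂
  intro v hv z hz t ht hzt
  have hdpos : ∀ x ∈ ball y (min r₁ r₂), 0 < fderiv ℝ φ x v := by
    intro x hx
    have h1 : dist (fderiv ℝ φ x) L < ‖g‖ / 4 :=
      hb₁ (lt_of_lt_of_le hx (min_le_left _ _))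
    have hn1 : ‖(2 : ℂ) * (g / ‖g‖)‖ = 2 := by
      rw [norm_mul, norm_div, Complex.norm_real, norm_norm, div_self hgn.ne']; norm_num
    have hvn : ‖v‖ ≤ 3 := by
      have := norm_add_le (v - 2 * (g / ‖g‖)) (2 * (g / ‖g‖))
      rw [sub_add_cancel, hn1] at this
      linarith
    have h2 : ‖g‖ ≤ L v := by
      have e : v = (v - 2 * (g / ‖g‖)) + 2 * (g / ‖g‖) := by ring
      rw [e, map_add, hLg, hLg]
      have e2 : ((starRingEnd ℂ) g * (2 * (g / ‖g‖))).re = 2 * ‖g‖ := by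
        have : (starRingEnd ℂ) g * (2 * (g / ‖g‖)) = ((2 * ‖g‖ : ℝ) : ℂ) := by
          have h3 : (starRingEnd ℂ) g * g = ((‖g‖ ^ 2 : ℝ) : ℂ) := by
            rw [mul_comm, Complex.mul_conj, Complex.normSq_eq_norm_sq]
          have h4 : (‖g‖ : ℂ) ≠ 0 := by exact_mod_cast hgn.ne'
          calc (starRingEnd ℂ) g * (2 * (g / ‖g‖)) = 2 * ((starRingEnd ℂ) g * g) / ‖g‖ := by ring
            _ = _ := by rw [h3]; push_cast; field_simp
        rw [this, Complex.ofReal_re]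
      rw [e2]
      have h5 := Complex.abs_re_le_norm ((starRingEnd ℂ) g * (v - 2 * (g / ‖g‖)))
      rw [norm_mul, Complex.norm_conj] at h5
      have h6 : ‖g‖ * ‖v - 2 * (g / ‖g‖)‖ ≤ ‖g‖ * 1 := mul_le_mul_of_nonneg_left hv hgn.le
      have h7 := neg_abs_le ((starRingEnd ℂ) g * (v - 2 * (g / ‖g‖))).re
      linarith
    have h3 : ‖(fderiv ℝ φ x - L) v‖ ≤ ‖g‖ / 4 * 3 := by
      refine (ContinuousLinearMap.le_opNorm _ _).trans ?_
      rw [dist_eq_norm] at h1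
      exact mul_le_mul h1.le hvn (norm_nonneg _) (by positivity)
    rw [sub_apply, Real.norm_eq_abs] at h3
    linarith [neg_abs_le (fderiv ℝ φ x v - L v)]
  have hconv : ∀ s ∈ Icc (0 : ℝ) t, z + (s : ℂ) * v ∈ ball y (min r₁ r₂) := by
    intro s hs
    have := (convex_ball y (min r₁ r₂)).add_smul_sub_mem hz hzt
      (t := s / t) ⟨div_nonneg hs.1 ht.le, div_le_one_of_le₀ hs.2 ht.le⟩
    convert this using 1
    rw [add_sub_cancel_left, Complex.real_smul, ← mul_assoc]
    congr 2
    have : (t : ℂ) ≠ 0 := by exact_mod_cast ht.ne'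
    push_cast
    field_simp
  have hder : ∀ s ∈ Icc (0 : ℝ) t,
      HasDerivAt (fun s : ℝ => φ (z + (s : ℂ) * v)) (fderiv ℝ φ (z + (s : ℂ) * v) v) s := by
    intro s hs
    have hx := hconv s hs
    have h1 : HasFDerivAt φ (fderiv ℝ φ (z + (s : ℂ) * v)) (z + (s : ℂ) * v) := by
      have hxV : z + (s : ℂ) * v ∈ V := hb₂ (ball_subset_ball (min_le_right _ _) hx)
      exact ((hφ.differentiableOn (by norm_num)).differentiableAt
        (hV.mem_nhds hxV)).hasFDerivAt
    have h2 : HasDerivAt (fun s : ℝ => z + (s : ℂ) * v) v s := by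
      have := (((hasDerivAt_id (s : ℂ)).comp_ofReal).mul_const v).const_add z
      simpa using this
    exact h1.comp_hasDerivAt s h2
  have hmono := strictMonoOn_of_deriv_pos (convex_Icc 0 t)
    (f := fun s : ℝ => φ (z + (s : ℂ) * v))
    (fun s hs => (hder s hs).continuousAt.continuousWithinAt) (fun s hs => by
      rw [interior_Icc] at hs
      have hs' := Ioo_subset_Icc_self hs
      rw [(hder s hs').deriv]
      exact hdpos _ (hconv s hs'))
  have := hmono ⟨le_rfl, ht.le⟩ ⟨ht.le, le_rfl⟩ ht
  simpa using this

/-- Quasiconvexity of a set near `y`: two nearby points are joined in the set by three segments,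
along a common direction `n`. -/
def ThreeLegs (X : Set ℂ) (y : ℂ) : Prop :=
  ∃ r₀ : ℝ, 0 < r₀ ∧ ∃ n : ℂ, ‖n‖ = 1 ∧ (∀ t : ℝ, 0 < t → 2 * t < r₀ → y + (t : ℂ) * (2 * n) ∈ X) ∧
    ∀ r : ℝ, 7 * r ≤ r₀ → ∀ z ∈ X ∩ ball y r, ∀ z' ∈ X ∩ ball y r,
    segment ℝ z (z + (dist z z' : ℂ) * (2 * n)) ⊆ X ∩ ball y (7 * r) ∧
    segment ℝ (z + (dist z z' : ℂ) * (2 * n)) (z' + (dist z z' : ℂ) * (2 * n)) ⊆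
      X ∩ ball y (7 * r) ∧
    segment ℝ z' (z' + (dist z z' : ℂ) * (2 * n)) ⊆ X ∩ ball y (7 * r)

lemma threeLegs_of_superlevel {V : Set ℂ} (hV : IsOpen V) {φ : ℂ → ℝ} (hφ : ContDiffOn ℝ 1 φ V)
    {y : ℂ} (hy : y ∈ V) (hd : fderiv ℝ φ y ≠ 0) (hy0 : φ y = 0) {X : Set ℂ}
    (hX : V ∩ X = {w ∈ V | 0 < φ w}) : ThreeLegs X y := by
  obtain ⟨r₀, hr₀, n, hn, hbV, hmono⟩ := exists_cone_monotone hV hφ hy hd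
  have hmemX : ∀ x ∈ ball y r₀, 0 < φ x → x ∈ X := fun x hx h => by
    have : x ∈ V ∩ X := by rw [hX]; exact ⟨hbV hx, h⟩
    exact this.2
  have hposX : ∀ x ∈ ball y r₀, x ∈ X → 0 < φ x := fun x hx h => by
    have : x ∈ {w ∈ V | 0 < φ w} := by rw [← hX]; exact ⟨hbV hx, h⟩
    exact this.2
  refine ⟨r₀, hr₀, n, hn, ?_, ?_⟩
  · intro t ht htr
    have hb : y + (t : ℂ) * (2 * n) ∈ ball y r₀ := by
      rw [mem_ball, dist_eq_norm, add_sub_cancel_left, norm_mul, norm_mul, hn,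
        Complex.norm_real, Real.norm_eq_abs, abs_of_pos ht]
      norm_num; linarith
    refine hmemX _ hb ?_
    rw [← hy0]
    exact hmono _ (by simp) y (mem_ball_self hr₀) t ht hb
  intro r hr z hz z' hz'
  set l := dist z z'
  have hl0 : 0 ≤ l := dist_nonneg
  have hl : l < 2 * r := by
    have := dist_triangle_right z z' y
    have h1 : dist z y < r := hz.2
    have h2 : dist z' y < r := hz'.2
    linarith
  have hrpos : 0 < r := pos_of_mem_ball hz.2
  have gen : ∀ x ∈ X ∩ ball y r, ∀ v : ℂ, ‖v - 2 * n‖ ≤ 1 → ∀ t : ℝ, 0 ≤ t → t ≤ l →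
      x + (t : ℂ) * v ∈ X ∩ ball y (7 * r) := by
    intro x hx v hv t ht htl
    have hvn : ‖v‖ ≤ 3 := by
      have := norm_add_le (v - 2 * n) (2 * n)
      rw [sub_add_cancel, norm_mul, hn] at this
      norm_num at this
      linarith
    have hb : x + (t : ℂ) * v ∈ ball y (7 * r) := by
      rw [mem_ball]
      have h1 : dist (x + (t : ℂ) * v) x ≤ l * 3 := by
        rw [dist_eq_norm, add_sub_cancel_left, norm_mul, Complex.norm_real, Real.norm_eq_abs,
          abs_of_nonneg ht]
        exact mul_le_mul htl hvn (norm_nonneg _) hl0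
      have h2 : dist x y < r := hx.2
      linarith [dist_triangle (x + (t : ℂ) * v) x y]
    refine ⟨?_, hb⟩
    rcases ht.eq_or_lt with h | h
    · rw [← h]; simpa using hx.1
    · have hxb : x ∈ ball y r₀ := ball_subset_ball (by linarith) hx.2
      have hb' := ball_subset_ball hr hb
      exact hmemX _ hb' ((hposX x hxb hx.1).trans (hmono v hv x hxb t h hb'))
  have leg : ∀ x ∈ X ∩ ball y r, segment ℝ x (x + (l : ℂ) * (2 * n)) ⊆ X ∩ ball y (7 * r) := by
    intro x hx
    rw [segment_eq_image']
    rintro _ ⟨s, hs, rfl⟩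
    simp only [add_sub_cancel_left, Complex.real_smul, ← mul_assoc]
    have := gen x hx (2 * n) (by simp) (s * l) (mul_nonneg hs.1 hl0)
      (mul_le_of_le_one_left hl0 hs.2)
    simpa [mul_assoc] using this
  refine ⟨leg z hz, ?_, leg z' hz'⟩
  rw [segment_eq_image']
  rintro _ ⟨s, hs, rfl⟩
  rcases hl0.eq_or_lt with h | h
  · have hzz : z = z' := dist_le_zero.1 h.ge
    simp only [← h, ← hzz]
    simpa using (⟨hz.1, ball_subset_ball (by linarith) hz.2⟩ : z ∈ X ∩ ball y (7 * r))
  · have hlc : (l : ℂ) ≠ 0 := by exact_mod_cast h.ne'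
    have := gen z hz (2 * n + s * ((z' - z) / l)) (by
      rw [add_sub_cancel_left, norm_mul, norm_div, Complex.norm_real, Complex.norm_real,
        Real.norm_eq_abs, Real.norm_eq_abs, abs_of_nonneg hs.1, abs_of_pos h,
        ← dist_eq_norm, dist_comm, div_self h.ne', mul_one]
      exact hs.2) l hl0 le_rfl
    convert this using 1
    simp only [Complex.real_smul]
    field_simp
    ring

lemma ThreeLegs.mem_closure {X : Set ℂ} {y : ℂ} (h : ThreeLegs X y) : y ∈ closure X := by
  obtain ⟨r₀, hr₀, n, hn, hin, -⟩ := h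
  rw [Metric.mem_closure_iff]
  intro ε hε
  refine ⟨y + ((min (r₀ / 4) (ε / 4) : ℝ) : ℂ) * (2 * n), hin _ (by positivity) ?_, ?_⟩
  · linarith [min_le_left (r₀ / 4) (ε / 4)]
  · rw [dist_comm, dist_eq_norm, add_sub_cancel_left, norm_mul, norm_mul, hn,
      Complex.norm_real, Real.norm_eq_abs, abs_of_pos (by positivity)]
    norm_num
    linarith [min_le_right (r₀ / 4) (ε / 4)]

lemma ThreeLegs.locConnAt {X : Set ℂ} {y : ℂ} (h : ThreeLegs X y) : LocConnAt X y := by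
  obtain ⟨r₀, hr₀, n, hn, hin, hleg⟩ := h
  intro r hr
  set ρ := min (r / 7) (r₀ / 7)
  have hρ : 0 < ρ := by positivity
  have hρr : 7 * ρ ≤ r := by linarith [min_le_left (r / 7) (r₀ / 7)]
  have hρr₀ : 7 * ρ ≤ r₀ := by linarith [min_le_right (r / 7) (r₀ / 7)]
  refine ⟨ρ, hρ, ?_⟩
  by_cases hne : (X ∩ ball y ρ).Nonempty
  · obtain ⟨z₀, hz₀⟩ := hne
    set P : ℂ → Set ℂ := fun z' =>
      segment ℝ z₀ (z₀ + (dist z₀ z' : ℂ) * (2 * n)) ∪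
      (segment ℝ (z₀ + (dist z₀ z' : ℂ) * (2 * n)) (z' + (dist z₀ z' : ℂ) * (2 * n)) ∪
      segment ℝ z' (z' + (dist z₀ z' : ℂ) * (2 * n)))
    refine ⟨⋃ z' : ↥(X ∩ ball y ρ), P z', ?_, ?_, ?_⟩
    · refine iUnion_subset fun z' => ?_
      obtain ⟨h1, h2, h3⟩ := hleg ρ hρr₀ z₀ hz₀ z' z'.2
      have hsub : X ∩ ball y (7 * ρ) ⊆ X ∩ ball y r :=
        inter_subset_inter_right _ (ball_subset_ball hρr)
      exact union_subset (h1.trans hsub) (union_subset (h2.trans hsub) (h3.trans hsub))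
    · refine isPreconnected_iUnion ⟨z₀, mem_iInter.2 fun z' => Or.inl (left_mem_segment _ _ _)⟩
        fun z' => ?_
      refine IsPreconnected.union _ (right_mem_segment ℝ _ _)
        (Or.inl (left_mem_segment ℝ _ _)) (convex_segment _ _).isPreconnected ?_
      exact IsPreconnected.union _ (right_mem_segment ℝ _ _) (right_mem_segment ℝ _ _)
        (convex_segment _ _).isPreconnected (convex_segment _ _).isPreconnected
    · intro z' hz'
      exact mem_iUnion.2 ⟨⟨z', hz'⟩, Or.inr (Or.inr (left_mem_segment ℝ _ _))⟩
  · rw [not_nonempty_iff_eq_empty] at hne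
    exact ⟨∅, empty_subset _, isPreconnected_empty, by rw [hne]⟩

/-- If the derivative of `W` tends to `c` at `y`, then `W` is nearly affine near `y`. -/
lemma ThreeLegs.norm_sub_sub_mul_le {X : Set ℂ} {y c : ℂ} (h : ThreeLegs X y) {W f : ℂ → ℂ}
    (hW : ∀ z ∈ X, HasDerivAt W (f z) z) (hf : Tendsto f (𝓝[X] y) (𝓝 c)) {ε : ℝ} (hε : 0 < ε) :
    ∃ r > 0, ∀ z ∈ X ∩ ball y r, ∀ z' ∈ X ∩ ball y r,
      ‖W z - W z' - c * (z - z')‖ ≤ ε * ‖z - z'‖ := by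
  obtain ⟨r₀, hr₀, n, hn, hin, hleg⟩ := h
  have h1 : ∀ᶠ z in 𝓝[X] y, ‖f z - c‖ < ε / 5 := by
    have := Metric.tendsto_nhds.1 hf (ε / 5) (by positivity)
    simpa [dist_eq_norm] using this
  obtain ⟨r₁, hr₁, hb₁⟩ := Metric.mem_nhdsWithin_iff.1 h1
  refine ⟨min (r₀ / 7) (r₁ / 7), by positivity, fun z hz z' hz' => ?_⟩
  obtain ⟨a1, a2, a3⟩ := hleg _ (by linarith [min_le_left (r₀ / 7) (r₁ / 7)]) z hz z' hz'
  have hsub : X ∩ ball y (7 * min (r₀ / 7) (r₁ / 7)) ⊆ ball y r₁ ∩ X := by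
    rw [inter_comm]
    exact inter_subset_inter_left _
      (ball_subset_ball (by linarith [min_le_right (r₀ / 7) (r₁ / 7)]))
  set l := dist z z'
  have hseg : ∀ p q : ℂ, segment ℝ p q ⊆ X ∩ ball y (7 * min (r₀ / 7) (r₁ / 7)) →
      ‖(W q - c * q) - (W p - c * p)‖ ≤ ε / 5 * ‖q - p‖ := by
    intro p q hpq
    refine Convex.norm_image_sub_le_of_norm_hasDerivWithin_le (f := fun z => W z - c * z)
      (f' := fun z => f z - c) (s := segment ℝ p q)
      (fun x hx => ?_) (fun x hx => ?_) (convex_segment _ _) (left_mem_segment _ _ _)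
      (right_mem_segment _ _ _)
    · have := ((hW x (hpq hx).1).sub ((hasDerivAt_id x).const_mul c))
      rw [mul_one] at this
      exact this.hasDerivWithinAt
    · exact le_of_lt (hb₁ (hsub (hpq hx)))
  have b1 := hseg _ _ a1
  have b2 := hseg _ _ a2
  have b3 := hseg _ _ a3
  have hn2 : ‖(l : ℂ) * (2 * n)‖ = 2 * l := by
    rw [norm_mul, norm_mul, hn, Complex.norm_real, Real.norm_eq_abs, abs_of_nonneg dist_nonneg]
    norm_num; ring
  rw [add_sub_cancel_left, hn2] at b1 b3
  have hl : ‖z' + (l : ℂ) * (2 * n) - (z + (l : ℂ) * (2 * n))‖ = l := by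
    rw [add_sub_add_right_eq_sub, ← dist_eq_norm, dist_comm]
  rw [hl] at b2
  set p := z + (l : ℂ) * (2 * n)
  set q := z' + (l : ℂ) * (2 * n)
  have e : W z - W z' - c * (z - z') = ((W q - c * q) - (W z' - c * z')) -
      ((W q - c * q) - (W p - c * p)) - ((W p - c * p) - (W z - c * z)) := by ring
  rw [e]
  have t1 := norm_sub_le (((W q - c * q) - (W z' - c * z')) - ((W q - c * q) - (W p - c * p)))
    ((W p - c * p) - (W z - c * z))
  have t2 := norm_sub_le ((W q - c * q) - (W z' - c * z')) ((W q - c * q) - (W p - c * p))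
  have hll : ‖z - z'‖ = l := (dist_eq_norm z z').symm
  rw [hll]
  linarith

/-! ### The complex potential of a classical solution -/

/-- A complex potential `W` with `Re W > 0` in `D`, `Re W = 0` and `|W'| = 1` along the two
arcs. The last condition is stated as near-isometry at each boundary point. -/
structure Potential (δ : ℝ) (D E F₁ F₂ : Set ℂ) (f W : ℂ → ℂ) : Prop
    extends TwoArcs δ D E F₁ F₂ where
  contW : ContinuousOn W (D ∪ (F₁ ∪ F₂))
  derivW : ∀ z ∈ D, HasDerivAt W (f z) z
  re_pos : ∀ z ∈ D, 0 < (W z).re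
  re_zero : ∀ z ∈ F₁ ∪ F₂, (W z).re = 0
  star : ∀ y ∈ F₁ ∪ F₂, ∃ c : ℂ, ‖c‖ = 1 ∧ ∀ ε > 0, ∃ r > 0,
    ∀ z ∈ (D ∪ (F₁ ∪ F₂)) ∩ ball y r, ∀ z' ∈ (D ∪ (F₁ ∪ F₂)) ∩ ball y r,
      ‖W z - W z' - c * (z - z')‖ ≤ ε * ‖z - z'‖

lemma HarmonicOn2.harmonicAt {u : ℂ → ℝ} {D : Set ℂ} (hD : IsOpen D) (h : HarmonicOn2 u D) {z : ℂ}
    (hz : z ∈ D) : InnerProductSpace.HarmonicAt u z := by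
  refine ⟨h.1.contDiffAt (hD.mem_nhds hz), ?_⟩
  filter_upwards [hD.mem_nhds hz] with w hw
  have hd : DifferentiableAt ℝ (fderiv ℝ u) w :=
    ((h.1.fderiv_of_isOpen hD (m := 1) (by norm_num)).differentiableOn (by norm_num)
      ).differentiableAt (hD.mem_nhds hw)
  have hh : ∀ v : ℂ, hess u w v v = fderiv ℝ (fderiv ℝ u) w v v := by
    intro v
    simp only [hess]
    rw [fderiv_clm_apply hd (differentiableAt_const v)]
    simp
  rw [InnerProductSpace.laplacian_eq_iteratedFDeriv_complexPlane]
  simp only [iteratedFDeriv_two_apply, Matrix.cons_val_zero, Matrix.cons_val_one, Pi.zero_apply]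
  rw [← hh, ← hh]
  exact h.2 w hw

lemma fderiv_apply_eq (L : ℂ →L[ℝ] ℝ) (v : ℂ) : L v = L 1 * v.re + L I * v.im := by
  conv_lhs => rw [show v = v.re • (1 : ℂ) + v.im • I by
    simp only [Complex.real_smul, mul_one]; exact (Complex.re_add_im v).symm]
  rw [map_add, map_smul, map_smul]
  simp only [smul_eq_mul]; ring

namespace IsClassicalSolution

variable {δ : ℝ} {u : ℂ → ℝ}

lemma isOpen_posSet {Ω : Set ℂ} (hΩ : IsOpen Ω) (h : IsClassicalSolution Ω u) :
    IsOpen (posSet Ω u) :=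
  h.contOn.isOpen_inter_preimage hΩ isOpen_Ioi

lemma eq_zero_of_notMem {Ω : Set ℂ} (h : IsClassicalSolution Ω u) {z : ℂ} (hz : z ∈ Ω)
    (hn : z ∉ posSet Ω u) : u z = 0 :=
  le_antisymm (not_lt.1 fun hlt => hn ⟨hz, hlt⟩) (h.nonneg z hz)

lemma mem_FB_iff {Ω : Set ℂ} (hΩ : IsOpen Ω) (h : IsClassicalSolution Ω u) {z : ℂ} :
    z ∈ FB Ω u ↔ z ∈ Ω ∧ z ∈ closure (posSet Ω u) ∧ z ∉ posSet Ω u := by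
  rw [FB, (h.isOpen_posSet hΩ).frontier_eq]
  rfl

/-- Both phases are quasiconvex near a free boundary point. -/
lemma threeLegs {Ω : Set ℂ} (hΩ : IsOpen Ω) (h : IsClassicalSolution Ω u) {y : ℂ}
    (hy : y ∈ FB Ω u) :
    ThreeLegs (posSet Ω u) y ∧ ThreeLegs (Ω \ closure (posSet Ω u)) y := by
  obtain ⟨V, hVo, hyV, hVΩ, φ, hφ, hφd, h1, h2, h3⟩ := h.fb_manifold y hy
  have hφ1 : ContDiffOn ℝ 1 φ V := hφ.of_le (by exact_mod_cast le_top)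
  have hy0 : φ y = 0 := by
    have : y ∈ {w ∈ V | φ w = 0} := by rw [← h3]; exact ⟨hyV, hy⟩
    exact this.2
  refine ⟨threeLegs_of_superlevel hVo hφ1 hyV (hφd y hyV) hy0 h1, ?_⟩
  refine threeLegs_of_superlevel hVo hφ1.neg hyV (φ := fun w => -φ w) ?_ (by simp [hy0]) ?_
  · rw [fderiv_fun_neg]
    exact neg_ne_zero.2 (hφd y hyV)
  · ext w
    constructor
    · rintro ⟨hwV, hwΩ, hwc⟩
      refine ⟨hwV, ?_⟩
      have hnD : w ∉ posSet Ω u := fun hD => hwc (subset_closure hD)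
      have a1 : w ∈ {w ∈ V | φ w ≤ 0} := by
        rw [← h2]; exact ⟨hwV, h.eq_zero_of_notMem hwΩ hnD⟩
      have a2 : φ w ≠ 0 := fun h0 => by
        have : w ∈ V ∩ FB Ω u := by rw [h3]; exact ⟨hwV, h0⟩
        exact hwc ((h.mem_FB_iff hΩ).1 this.2).2.1
      exact neg_pos.2 (lt_of_le_of_ne a1.2 a2)
    · rintro ⟨hwV, hw⟩
      have hw' : φ w < 0 := neg_pos.1 hw
      refine ⟨hwV, hVΩ hwV, fun hc => ?_⟩
      have hnD : w ∉ posSet Ω u := fun hD => by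
        have : w ∈ {w ∈ V | 0 < φ w} := by rw [← h1]; exact ⟨hwV, hD⟩
        exact absurd this.2 (not_lt.2 hw'.le)
      have : w ∈ {w ∈ V | φ w = 0} := by
        rw [← h3]; exact ⟨hwV, (h.mem_FB_iff hΩ).2 ⟨hVΩ hwV, hc, hnD⟩⟩
      exact hw'.ne this.2

lemma tendsto_complex_gradient {Ω : Set ℂ} (hΩ : IsOpen Ω) (h : IsClassicalSolution Ω u) {y : ℂ}
    (hy : y ∈ FB Ω u) : ∃ c : ℂ, ‖c‖ = 1 ∧
      Tendsto (fun z => ((fderiv ℝ u z 1 : ℝ) : ℂ) - I * ((fderiv ℝ u z I : ℝ) : ℂ))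
        (𝓝[posSet Ω u] y) (𝓝 c) := by
  obtain ⟨v, hv, huv⟩ := h.smooth_ext
  have hyB := (h.mem_FB_iff hΩ).1 hy
  have hDo := h.isOpen_posSet hΩ
  have hDS : posSet Ω u ⊆ Ω ∩ closure (posSet Ω u) := fun z hz => ⟨hz.1, subset_closure hz⟩
  have hv1 : ContDiffWithinAt ℝ (0 + 1) v (Ω ∩ closure (posSet Ω u)) y :=
    (hv y ⟨hyB.1, hyB.2.1⟩).of_le (by norm_num)
  obtain ⟨N, hN, -, f', hf', hf'c⟩ :=
    (contDiffWithinAt_succ_iff_hasFDerivWithinAt (by simp)).1 hv1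
  rw [insert_eq_of_mem (show y ∈ Ω ∩ closure (posSet Ω u) from ⟨hyB.1, hyB.2.1⟩)] at hN
  obtain ⟨O, hO, hyO, hON⟩ := mem_nhdsWithin.1 hN
  have hlim : Tendsto (fderiv ℝ u) (𝓝[posSet Ω u] y) (𝓝 (f' y)) := by
    have h1 : Tendsto f' (𝓝[posSet Ω u] y) (𝓝 (f' y)) := by
      refine hf'c.continuousWithinAt.tendsto.mono_left ?_
      exact nhdsWithin_le_of_mem (nhdsWithin_mono y hDS hN)
    refine h1.congr' ?_
    filter_upwards [self_mem_nhdsWithin, mem_nhdsWithin_of_mem_nhds (hO.mem_nhds hyO)]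
      with x hxD hxO
    have hsub : posSet Ω u ∩ O ⊆ N := fun w hw => hON ⟨hw.2, hDS hw.1⟩
    have hnb : posSet Ω u ∩ O ∈ 𝓝 x := (hDo.inter hO).mem_nhds ⟨hxD, hxO⟩
    have h2 : HasFDerivAt v (f' x) x :=
      (hf' x (hsub ⟨hxD, hxO⟩)).hasFDerivAt (mem_of_superset hnb hsub)
    refine (h2.congr_of_eventuallyEq ?_).fderiv.symm
    filter_upwards [hnb] with w hw
    exact huv (hDS hw.1)
  set G : (ℂ →L[ℝ] ℝ) → ℂ := fun L => ((L 1 : ℝ) : ℂ) - I * ((L I : ℝ) : ℂ)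
  have hG : Continuous G := by
    have a1 : Continuous fun L : ℂ →L[ℝ] ℝ => L 1 := (ContinuousLinearMap.apply ℝ ℝ (1 : ℂ)).continuous
    have a2 : Continuous fun L : ℂ →L[ℝ] ℝ => L I := (ContinuousLinearMap.apply ℝ ℝ I).continuous
    exact (continuous_ofReal.comp a1).sub (continuous_const.mul (continuous_ofReal.comp a2))
  have hlim2 : Tendsto (fun z => G (fderiv ℝ u z)) (𝓝[posSet Ω u] y) (𝓝 (G (f' y))) :=
    (hG.tendsto _).comp hlim
  refine ⟨G (f' y), ?_, hlim2⟩
  have hne : (𝓝[posSet Ω u] y).NeBot := mem_closure_iff_nhdsWithin_neBot.1 hyB.2.1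
  have h3 := h.grad_one y hy
  have h4 : (fun w => ‖grad2 u w‖) = fun w => ‖G (fderiv ℝ u w)‖ := by
    ext w
    rw [← Complex.norm_conj (G _)]
    congr 1
    simp [G, grad2]
    ring
  rw [h4] at h3
  exact tendsto_nhds_unique hlim2.norm h3

lemma twoArcs (hδ : 0 < δ) (hδ1 : δ < 1) (h : IsClassicalSolution (ann δ 1) u)
    {F₁ F₂ : Set ℂ} (hne₁ : F₁.Nonempty) (hne₂ : F₂.Nonempty) (hdisj : Disjoint F₁ F₂)
    (hF : F₁ ∪ F₂ = FB (ann δ 1) u)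
    (hc₁ : ∀ z ∈ F₁, connectedComponentIn (FB (ann δ 1) u) z = F₁)
    (hc₂ : ∀ z ∈ F₂, connectedComponentIn (FB (ann δ 1) u) z = F₂)
    (hi₁ : (closure F₁ ∩ sphere 0 δ).Nonempty) (ho₁ : (closure F₁ ∩ sphere 0 1).Nonempty)
    (hi₂ : (closure F₂ ∩ sphere 0 δ).Nonempty) (ho₂ : (closure F₂ ∩ sphere 0 1).Nonempty) :
    TwoArcs δ (posSet (ann δ 1) u) (ann δ 1 \ closure (posSet (ann δ 1) u)) F₁ F₂ := by
  have hΩ := isOpen_ann δ 1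
  have hmem := fun z => h.mem_FB_iff hΩ (z := z)
  have hconn : ∀ F : Set ℂ, F.Nonempty → (∀ z ∈ F, connectedComponentIn (FB (ann δ 1) u) z = F) →
      IsPreconnected F := by
    rintro F ⟨z, hz⟩ hF
    rw [← hF z hz]
    exact isPreconnected_connectedComponentIn
  have hsep : ∀ F F' : Set ℂ, Disjoint F F' → F ⊆ FB (ann δ 1) u → F'.Nonempty → F' ⊆ FB (ann δ 1) u →
      (∀ z ∈ F', connectedComponentIn (FB (ann δ 1) u) z = F') →
      ∀ y ∈ F, ∃ r > 0, Disjoint F' (ball y r) := by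
    intro F F' hd hFB hne hFB' hcc y hy
    by_contra! hcon
    have hycl : y ∈ closure F' := by
      rw [Metric.mem_closure_iff]
      intro ε hε
      obtain ⟨w, hw1, hw2⟩ := Set.not_disjoint_iff.1 (hcon ε hε)
      exact ⟨w, hw1, by rw [dist_comm]; exact hw2⟩
    obtain ⟨z, hz⟩ := hne
    have h1 : IsPreconnected (insert y F') :=
      (hconn F' ⟨z, hz⟩ hcc).subset_closure (subset_insert _ _)
        (insert_subset hycl subset_closure)
    have h2 := h1.subset_connectedComponentIn (F := FB (ann δ 1) u) (x := z)
      (mem_insert_of_mem _ hz) (insert_subset (hFB hy) hFB')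
    rw [hcc z hz] at h2
    exact disjoint_left.1 hd hy (h2 (mem_insert _ _))
  exact
  { pos := hδ
    lt_one := hδ1
    openD := h.isOpen_posSet hΩ
    openE := hΩ.sdiff isClosed_closure
    union_eq := by
      rw [hF]
      ext z
      simp only [mem_union, hmem, Set.mem_sdiff]
      constructor
      · rintro ((h1 | h1) | h1)
        exacts [h1.1, h1.1, h1.1]
      · intro h1
        by_cases h2 : z ∈ posSet (ann δ 1) u
        · exact Or.inl (Or.inl h2)
        · by_cases h3 : z ∈ closure (posSet (ann δ 1) u)
          · exact Or.inr ⟨h1, h3, h2⟩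
          · exact Or.inl (Or.inr ⟨h1, h3⟩)
    disjDE := disjoint_left.2 fun z hz hz' => hz'.2 (subset_closure hz)
    disjDF := by rw [hF]; exact disjoint_left.2 fun z hz hz' => ((hmem z).1 hz').2.2 hz
    disjEF := by rw [hF]; exact disjoint_left.2 fun z hz hz' => hz.2 ((hmem z).1 hz').2.1
    disjF := hdisj
    conn₁ := hconn F₁ hne₁ hc₁
    conn₂ := hconn F₂ hne₂ hc₂
    inner₁ := hi₁
    inner₂ := hi₂
    outer₁ := ho₁
    outer₂ := ho₂
    sep₁ := hsep F₁ F₂ hdisj (by rw [← hF]; exact subset_union_left) hne₂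
      (by rw [← hF]; exact subset_union_right) hc₂
    sep₂ := hsep F₂ F₁ hdisj.symm (by rw [← hF]; exact subset_union_right) hne₁
      (by rw [← hF]; exact subset_union_left) hc₁
    locD := fun y hy => (h.threeLegs hΩ (hF ▸ hy)).1.locConnAt
    locE := fun y hy => (h.threeLegs hΩ (hF ▸ hy)).2.locConnAt
    clD := fun y hy => (h.threeLegs hΩ (hF ▸ hy)).1.mem_closure
    clE := fun y hy => (h.threeLegs hΩ (hF ▸ hy)).2.mem_closure }

/-- A classical solution satisfying condition (A) is the real part of a complex potential. -/
theorem exists_potential (hδ : 0 < δ) (hδ1 : δ < 1) (h : IsClassicalSolution (ann δ 1) u)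
    (hA : ConditionA δ 1 u) : ∃ F₁ F₂ : Set ℂ, ∃ f W : ℂ → ℂ,
      Potential δ (posSet (ann δ 1) u) (ann δ 1 \ closure (posSet (ann δ 1) u)) F₁ F₂ f W ∧
      ∀ z ∈ posSet (ann δ 1) u, (W z).re = u z := by
  obtain ⟨F₁, F₂, hne₁, hne₂, hdisj, hF, hc₁, hc₂, -, -, hi₁, ho₁, hi₂, ho₂⟩ := hA
  have hT := h.twoArcs hδ hδ1 hne₁ hne₂ hdisj hF hc₁ hc₂ hi₁ ho₁ hi₂ ho₂
  have hΩ := isOpen_ann δ 1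
  set D := posSet (ann δ 1) u with hD
  set f : ℂ → ℂ := fun z => ((fderiv ℝ u z 1 : ℝ) : ℂ) - I * ((fderiv ℝ u z I : ℝ) : ℂ)
  have hDo : IsOpen D := h.isOpen_posSet hΩ
  have hf : DifferentiableOn ℂ f D := fun z hz =>
    (HarmonicAt.differentiableAt_complex_partial (h.harm.harmonicAt hDo hz)
      ).differentiableWithinAt
  obtain ⟨P, hP⟩ := hT.exists_primitive hf
  set k : ℂ → ℝ := fun z => (P z).re - u z
  have hk : ∀ z ∈ D, ∀ᶠ w in 𝓝 z, k w = k z := by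
    intro z hz
    obtain ⟨r, hr, hb⟩ := Metric.isOpen_iff.1 hDo z hz
    have hder : ∀ x ∈ ball z r, HasFDerivAt k (0 : ℂ →L[ℝ] ℝ) x := by
      intro x hx
      have h1 : HasFDerivAt (fun z => (P z).re)
          (reCLM.comp ((ContinuousLinearMap.toSpanSingleton ℂ (f x)).restrictScalars ℝ)) x :=
        reCLM.hasFDerivAt.comp x ((hP x (hb hx)).hasFDerivAt.restrictScalars ℝ)
      have h2 : HasFDerivAt u (fderiv ℝ u x) x :=
        ((h.harm.1.differentiableOn (by norm_num)).differentiableAt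
          (hDo.mem_nhds (hb hx))).hasFDerivAt
      have h3 := h1.sub h2
      have h4 : reCLM.comp ((ContinuousLinearMap.toSpanSingleton ℂ (f x)).restrictScalars ℝ) -
          fderiv ℝ u x = 0 := by
        rw [sub_eq_zero]
        ext v
        rw [fderiv_apply_eq (fderiv ℝ u x) v]
        simp [f]
        ring
      rw [h4] at h3
      exact h3
    filter_upwards [ball_mem_nhds z hr] with w hw
    exact isOpen_ball.is_const_of_fderiv_eq_zero (𝕜 := ℝ) (convex_ball z r).isPreconnected
      (fun x hx => (hder x hx).differentiableAt.differentiableWithinAt)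
      (fun x hx => (hder x hx).fderiv) hw (mem_ball_self hr)
  set W₀ : ℂ → ℂ := fun z => P z - (k z : ℂ)
  have hW₀ : ∀ z ∈ D, HasDerivAt W₀ (f z) z := by
    intro z hz
    refine ((hP z hz).sub_const (k z : ℂ)).congr_of_eventuallyEq ?_
    filter_upwards [hk z hz] with w hw
    simp only [W₀, hw]
  have hW₀re : ∀ z, (W₀ z).re = u z := fun z => by simp [W₀, k]
  have hstar : ∀ y ∈ F₁ ∪ F₂, ∃ c : ℂ, ‖c‖ = 1 ∧ ∀ ε > 0, ∃ r > 0,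
      ∀ z ∈ D ∩ ball y r, ∀ z' ∈ D ∩ ball y r,
        ‖W₀ z - W₀ z' - c * (z - z')‖ ≤ ε * ‖z - z'‖ := by
    intro y hy
    rw [hF] at hy
    obtain ⟨c, hc1, hc2⟩ := h.tendsto_complex_gradient hΩ hy
    exact ⟨c, hc1, fun ε hε => (h.threeLegs hΩ hy).1.norm_sub_sub_mul_le hW₀ hc2 hε⟩
  have hlim : ∀ y ∈ D ∪ (F₁ ∪ F₂), ∃ w, Tendsto W₀ (𝓝[D] y) (𝓝 w) := by
    rintro y (hy | hy)
    · exact ⟨W₀ y, (hW₀ y hy).continuousAt.continuousWithinAt⟩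
    · obtain ⟨c, hc1, hc2⟩ := hstar y hy
      obtain ⟨r, hr, hb⟩ := hc2 1 one_pos
      have hLip : LipschitzOnWith 2 W₀ (D ∩ ball y r) := by
        refine LipschitzOnWith.of_dist_le_mul fun z hz z' hz' => ?_
        have h1 := hb z hz z' hz'
        have h2 := norm_add_le (W₀ z - W₀ z' - c * (z - z')) (c * (z - z'))
        rw [sub_add_cancel, norm_mul, hc1] at h2
        rw [dist_eq_norm, dist_eq_norm]
        push_cast
        linarith
      obtain ⟨g, hg, hgeq⟩ := hLip.extend_finite_dimension
      refine ⟨g y, ((hg.continuous.tendsto y).mono_left nhdsWithin_le_nhds).congr' ?_⟩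
      filter_upwards [self_mem_nhdsWithin, mem_nhdsWithin_of_mem_nhds (ball_mem_nhds y hr)]
        with z hz1 hz2
      exact (hgeq ⟨hz1, hz2⟩).symm
  have hcl : D ∪ (F₁ ∪ F₂) ⊆ closure D := union_subset subset_closure hT.clD
  set W := extendFrom D W₀
  have hWD : ∀ z ∈ D, W z = W₀ z := fun z hz =>
    extendFrom_eq (subset_closure hz) (hW₀ z hz).continuousAt.continuousWithinAt
  have hWc : ContinuousOn W (D ∪ (F₁ ∪ F₂)) := continuousOn_extendFrom hcl hlim
  have hWt : ∀ y ∈ D ∪ (F₁ ∪ F₂), Tendsto W₀ (𝓝[D] y) (𝓝 (W y)) := fun y hy =>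
    tendsto_extendFrom (hlim y hy)
  have hneb : ∀ y ∈ D ∪ (F₁ ∪ F₂), (𝓝[D] y).NeBot := fun y hy =>
    mem_closure_iff_nhdsWithin_neBot.1 (hcl hy)
  refine ⟨F₁, F₂, f, W, { hT with contW := hWc, derivW := ?_, re_pos := ?_, re_zero := ?_, star := ?_ }, ?_⟩
  · intro z hz
    refine (hW₀ z hz).congr_of_eventuallyEq ?_
    filter_upwards [hDo.mem_nhds hz] with w hw using hWD w hw
  · intro z hz
    rw [hWD z hz, hW₀re]
    exact hz.2
  · intro y hy
    have hyB := (h.mem_FB_iff hΩ).1 (hF ▸ hy)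
    have h1 : Tendsto (fun z => (W₀ z).re) (𝓝[D] y) (𝓝 (W y).re) :=
      (continuous_re.tendsto _).comp (hWt y (Or.inr hy))
    have h2 : Tendsto u (𝓝[D] y) (𝓝 (u y)) :=
      (h.contOn y hyB.1).mono_left (nhdsWithin_mono y hT.D_subset)
    simp only [hW₀re] at h1
    have := hneb y (Or.inr hy)
    rw [tendsto_nhds_unique h1 h2]
    exact h.eq_zero_of_notMem hyB.1 hyB.2.2
  · intro y hy
    obtain ⟨c, hc1, hc2⟩ := hstar y hy
    refine ⟨c, hc1, fun ε hε => ?_⟩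
    obtain ⟨r, hr, hb⟩ := hc2 ε hε
    refine ⟨r, hr, ?_⟩
    have step1 : ∀ z ∈ (D ∪ (F₁ ∪ F₂)) ∩ ball y r, ∀ z' ∈ D ∩ ball y r,
        ‖W z - W₀ z' - c * (z - z')‖ ≤ ε * ‖z - z'‖ := by
      intro z hz z' hz'
      have := hneb z hz.1
      have ht1 : Tendsto (fun x => ‖W₀ x - W₀ z' - c * (x - z')‖) (𝓝[D] z)
          (𝓝 ‖W z - W₀ z' - c * (z - z')‖) :=
        ((((hWt z hz.1).sub_const _).sub ((continuous_const.mul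
          (continuous_id.sub continuous_const)).continuousWithinAt.tendsto))).norm
      have ht2 : Tendsto (fun x => ε * ‖x - z'‖) (𝓝[D] z) (𝓝 (ε * ‖z - z'‖)) :=
        Continuous.continuousWithinAt (by fun_prop)
      refine le_of_tendsto_of_tendsto ht1 ht2 ?_
      filter_upwards [self_mem_nhdsWithin, mem_nhdsWithin_of_mem_nhds (isOpen_ball.mem_nhds hz.2)]
        with x hx1 hx2 using hb x ⟨hx1, hx2⟩ z' hz'
    intro z hz z' hz'
    have := hneb z' hz'.1
    have ht1 : Tendsto (fun x => ‖W z - W₀ x - c * (z - x)‖) (𝓝[D] z')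
        (𝓝 ‖W z - W z' - c * (z - z')‖) :=
      ((((hWt z' hz'.1).const_sub _).sub ((continuous_const.mul
        (continuous_const.sub continuous_id)).continuousWithinAt.tendsto))).norm
    have ht2 : Tendsto (fun x => ε * ‖z - x‖) (𝓝[D] z') (𝓝 (ε * ‖z - z'‖)) :=
      Continuous.continuousWithinAt (by fun_prop)
    refine le_of_tendsto_of_tendsto ht1 ht2 ?_
    filter_upwards [self_mem_nhdsWithin, mem_nhdsWithin_of_mem_nhds (isOpen_ball.mem_nhds hz'.2)]
      with x hx1 hx2 using step1 z hz x ⟨hx1, hx2⟩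
  · intro z hz
    rw [hWD z hz, hW₀re]

end IsClassicalSolution

/-! ### The potential near the free boundary -/

namespace TwoArcs

variable {δ : ℝ} {D E F₁ F₂ : Set ℂ}

lemma closure_inter_eq (h : TwoArcs δ D E F₁ F₂) {K : Set ℂ} (hK : K ⊆ ann δ 1) :
    (D ∪ (F₁ ∪ F₂)) ∩ K = closure D ∩ K := by
  ext z
  constructor
  · rintro ⟨h1, h2⟩
    exact ⟨union_subset subset_closure h.clD h1, h2⟩
  · rintro ⟨h1, h2⟩
    exact ⟨h.mem_of_mem_closure (hK h2) h1, h2⟩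

lemma isCompact_inter (h : TwoArcs δ D E F₁ F₂) {K : Set ℂ} (hK : K ⊆ ann δ 1)
    (hc : IsCompact K) : IsCompact ((D ∪ (F₁ ∪ F₂)) ∩ K) := by
  rw [h.closure_inter_eq hK]
  exact hc.inter_left isClosed_closure

lemma mem_union_of_mem_closure (h : TwoArcs δ D E F₁ F₂) {X : Set ℂ} (hX : X ⊆ D) {z : ℂ}
    (hz : z ∈ ann δ 1) (hc : z ∈ closure X) : z ∈ D ∪ (F₁ ∪ F₂) :=
  h.mem_of_mem_closure hz (closure_mono hX hc)

end TwoArcs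

namespace Potential

variable {δ : ℝ} {D E F₁ F₂ : Set ℂ} {f W : ℂ → ℂ}

lemma swap (h : Potential δ D E F₁ F₂ f W) : Potential δ D E F₂ F₁ f W :=
  { h.toTwoArcs.swap with
    contW := by rw [union_comm F₂ F₁]; exact h.contW
    derivW := h.derivW
    re_pos := h.re_pos
    re_zero := by rw [union_comm F₂ F₁]; exact h.re_zero
    star := by rw [union_comm F₂ F₁]; exact h.star }

lemma differentiableOn (h : Potential δ D E F₁ F₂ f W) : DifferentiableOn ℂ W D := fun z hz =>
  (h.derivW z hz).differentiableAt.differentiableWithinAt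

lemma deriv_eq (h : Potential δ D E F₁ F₂ f W) {z : ℂ} (hz : z ∈ D) : deriv W z = f z :=
  (h.derivW z hz).deriv

lemma differentiableOn_f (h : Potential δ D E F₁ F₂ f W) : DifferentiableOn ℂ f D :=
  (h.differentiableOn.deriv h.openD).congr fun _ hz => (h.deriv_eq hz).symm

lemma notMem_F (h : Potential δ D E F₁ F₂ f W) {z : ℂ} (hz : z ∈ D) : z ∉ F₁ ∪ F₂ :=
  disjoint_left.1 h.disjDF hz

lemma mem_D_of_re_pos (h : Potential δ D E F₁ F₂ f W) {z : ℂ} (hz : z ∈ D ∪ (F₁ ∪ F₂))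
    (hp : 0 < (W z).re) : z ∈ D :=
  hz.resolve_right fun hF => hp.ne' (h.re_zero z hF)

lemma mem_F_of_re_zero (h : Potential δ D E F₁ F₂ f W) {z : ℂ} (hz : z ∈ D ∪ (F₁ ∪ F₂))
    (hp : (W z).re = 0) : z ∈ F₁ ∪ F₂ :=
  hz.resolve_left fun hD => (h.re_pos z hD).ne' hp

/-- The near-isometry at a free boundary point in two-sided form. -/
lemma near_isometry (h : Potential δ D E F₁ F₂ f W) {y : ℂ} (hy : y ∈ F₁ ∪ F₂) {ε : ℝ}
    (hε : 0 < ε) : ∃ r > 0, ball y r ⊆ ann δ 1 ∧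
      (∀ z ∈ (D ∪ (F₁ ∪ F₂)) ∩ ball y r, ∀ z' ∈ (D ∪ (F₁ ∪ F₂)) ∩ ball y r,
        (1 - ε) * dist z z' ≤ dist (W z) (W z') ∧ dist (W z) (W z') ≤ (1 + ε) * dist z z') ∧
      ∀ z ∈ D ∩ ball y r, 1 - ε ≤ ‖f z‖ ∧ ‖f z‖ ≤ 1 + ε := by
  obtain ⟨c, hc1, hc2⟩ := h.star y hy
  obtain ⟨r₁, hr₁, hb₁⟩ := hc2 ε hε
  obtain ⟨r₂, hr₂, hb₂⟩ := Metric.isOpen_iff.1 (isOpen_ann δ 1) y (h.F_subset hy)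
  refine ⟨min r₁ r₂, lt_min hr₁ hr₂, (ball_subset_ball (min_le_right _ _)).trans hb₂, ?_, ?_⟩
  · intro z hz z' hz'
    have h1 := hb₁ z ⟨hz.1, ball_subset_ball (min_le_left _ _) hz.2⟩ z'
      ⟨hz'.1, ball_subset_ball (min_le_left _ _) hz'.2⟩
    have h2 := norm_add_le (W z - W z' - c * (z - z')) (c * (z - z'))
    have h3 := norm_sub_le (W z - W z') (W z - W z' - c * (z - z'))
    rw [sub_add_cancel, norm_mul, hc1, one_mul] at h2
    rw [sub_sub_cancel, norm_mul, hc1, one_mul] at h3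
    rw [dist_eq_norm, dist_eq_norm]
    constructor <;> linarith
  · intro z hz
    have hder : HasDerivAt (fun x => W x - c * x) (f z - c) z := by
      have := (h.derivW z hz.1).sub ((hasDerivAt_id z).const_mul c)
      rw [mul_one] at this
      exact this
    have h1 := hder.le_of_lip' hε.le (by
      filter_upwards [h.openD.mem_nhds hz.1, isOpen_ball.mem_nhds hz.2] with x hx1 hx2
      have := hb₁ x ⟨Or.inl hx1, ball_subset_ball (min_le_left _ _) hx2⟩ z
        ⟨Or.inl hz.1, ball_subset_ball (min_le_left _ _) hz.2⟩
      have e : W x - c * x - (W z - c * z) = W x - W z - c * (x - z) := by ring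
      rw [e]
      exact this)
    have h2 := norm_add_le (f z - c) c
    have h3 := norm_sub_le (f z) (f z - c)
    rw [sub_add_cancel, hc1] at h2
    rw [sub_sub_cancel, hc1] at h3
    constructor <;> linarith

lemma hasStrictDerivAt (h : Potential δ D E F₁ F₂ f W) {z : ℂ} (hz : z ∈ D) :
    HasStrictDerivAt W (f z) z := by
  have := (h.differentiableOn.analyticAt (h.openD.mem_nhds hz)).hasStrictDerivAt
  rwa [h.deriv_eq hz] at this

/-- `W` covers a half-disc near a free boundary point. -/
lemma local_image (h : Potential δ D E F₁ F₂ f W) {y : ℂ} (hy : y ∈ F₁ ∪ F₂) {r : ℝ}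
    (hr : 0 < r) : ∃ η > 0, ∀ w : ℂ, 0 ≤ w.re → dist w (W y) < η →
      ∃ z ∈ (D ∪ (F₁ ∪ F₂)) ∩ ball y r, W z = w := by
  obtain ⟨r₁, hr₁, hbΩ, hiso, hfz⟩ := h.near_isometry hy (ε := 1 / 2) (by norm_num)
  set ρ := min r₁ r with hρ
  have hρ0 : 0 < ρ := lt_min hr₁ hr
  have hρ1 : ρ ≤ r₁ := min_le_left _ _
  set K := (D ∪ (F₁ ∪ F₂)) ∩ closedBall y (ρ / 2)
  have hsubball : closedBall y (ρ / 2) ⊆ ball y ρ := closedBall_subset_ball (by linarith)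
  have hKc : IsCompact K :=
    h.isCompact_inter (hsubball.trans ((ball_subset_ball hρ1).trans hbΩ)) (isCompact_closedBall _ _)
  have hWK : IsClosed (W '' K) :=
    (hKc.image_of_continuousOn (h.contW.mono inter_subset_left)).isClosed
  set H : Set ℂ := {w | 0 < w.re} ∩ ball (W y) (ρ / 4)
  have hH : IsPreconnected H :=
    ((convex_halfSpace_re_gt 0).inter (convex_ball _ _)).isPreconnected
  have hyb : y ∈ (D ∪ (F₁ ∪ F₂)) ∩ ball y r₁ := ⟨Or.inr hy, mem_ball_self hr₁⟩
  have hclose : ∀ z ∈ (D ∪ (F₁ ∪ F₂)) ∩ ball y ρ, W z ∈ ball (W y) (ρ / 4) → z ∈ K := by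
    intro z hz hzW
    have h1 := (hiso z ⟨hz.1, ball_subset_ball hρ1 hz.2⟩ y hyb).1
    rw [mem_ball] at hzW
    exact ⟨hz.1, mem_closedBall.2 (by linarith)⟩
  have hopen : ∀ w ∈ H, w ∈ W '' K → ∀ᶠ w' in 𝓝[H] w, w' ∈ W '' K := by
    rintro w hw ⟨z, hz, rfl⟩
    have hzD : z ∈ D := h.mem_D_of_re_pos hz.1 hw.1
    have hzb := hsubball hz.2
    have hf0 : f z ≠ 0 := fun h0 => by
      have := (hfz z ⟨hzD, ball_subset_ball hρ1 hzb⟩).1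
      rw [h0, norm_zero] at this
      norm_num at this
    have hmap := (h.hasStrictDerivAt hzD).map_nhds_eq hf0
    have himg := image_mem_map (m := W) ((h.openD.inter isOpen_ball).mem_nhds ⟨hzD, hzb⟩)
    rw [hmap] at himg
    filter_upwards [mem_nhdsWithin_of_mem_nhds himg, self_mem_nhdsWithin] with w' h1 h2
    obtain ⟨x, hx, rfl⟩ := h1
    exact ⟨x, hclose x ⟨Or.inl hx.1, hx.2⟩ h2.2, rfl⟩
  have hstep : ∀ w ∈ H, ∀ᶠ w' in 𝓝[H] w, (w' ∈ W '' K ↔ w ∈ W '' K) := by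
    intro w hw
    by_cases hwK : w ∈ W '' K
    · filter_upwards [hopen w hw hwK] with w' hw'
      exact iff_of_true hw' hwK
    · filter_upwards [mem_nhdsWithin_of_mem_nhds (hWK.isOpen_compl.mem_nhds hwK)] with w' hw'
      exact iff_of_false hw' hwK
  obtain ⟨w₀, hw₀H, hw₀K⟩ : ∃ w₀ ∈ H, w₀ ∈ W '' K := by
    have := mem_closure_iff_nhdsWithin_neBot.1 (h.clD hy)
    have hc : Tendsto W (𝓝[D] y) (𝓝 (W y)) :=
      (h.contW y (Or.inr hy)).mono_left (nhdsWithin_mono y subset_union_left)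
    have h1 := hc.eventually (ball_mem_nhds (W y) (show 0 < ρ / 4 by linarith))
    have h2 : ∀ᶠ z in 𝓝[D] y, z ∈ D := self_mem_nhdsWithin
    have h3 : ∀ᶠ z in 𝓝[D] y, z ∈ ball y ρ := mem_nhdsWithin_of_mem_nhds (ball_mem_nhds y hρ0)
    obtain ⟨z, hz1, hz2, hz3⟩ := (h1.and (h2.and h3)).exists
    exact ⟨W z, ⟨h.re_pos z hz2, hz1⟩, z, hclose z ⟨Or.inl hz2, hz3⟩ hz1, rfl⟩
  have hall : H ⊆ W '' K := fun w hw =>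
    (hH.iff_of_eventually_iff (p := fun w => w ∈ W '' K) hstep hw₀H hw).1 hw₀K
  refine ⟨ρ / 4, by linarith, fun w hw hwd => ?_⟩
  have hwcl : w ∈ closure H := by
    rw [Metric.mem_closure_iff]
    intro ε hε
    set t := min (ε / 2) ((ρ / 4 - dist w (W y)) / 2)
    have ht : 0 < t := lt_min (by linarith) (by linarith)
    have hd : dist (w + (t : ℂ)) w = t := by
      rw [dist_eq_norm, add_sub_cancel_left, Complex.norm_real, Real.norm_eq_abs, abs_of_pos ht]
    refine ⟨w + t, ⟨?_, ?_⟩, ?_⟩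
    · change 0 < (w + (t : ℂ)).re
      simp only [add_re, ofReal_re]; linarith
    · rw [mem_ball]
      have h1 := dist_triangle (w + (t : ℂ)) w (W y)
      have h2 : t ≤ (ρ / 4 - dist w (W y)) / 2 := min_le_right _ _
      linarith
    · rw [dist_comm, hd]
      have : t ≤ ε / 2 := min_le_left _ _
      linarith
  obtain ⟨z, hz, hzw⟩ := closure_minimal hall hWK hwcl
  exact ⟨z, ⟨hz.1, ball_subset_ball (min_le_right _ _) (hsubball hz.2)⟩, hzw⟩

/-- Along each arc, `Im W` is an arc length parameter: chords are shorter than parameter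
differences. -/
lemma dist_le₁ (h : Potential δ D E F₁ F₂ f W) {y y' : ℂ} (hy : y ∈ F₁) (hy' : y' ∈ F₁) :
    dist y y' ≤ |(W y).im - (W y').im| := by
  have himd : ∀ z ∈ F₁ ∪ F₂, ∀ z' ∈ F₁ ∪ F₂, dist (W z) (W z') = |(W z).im - (W z').im| := by
    intro z hz z' hz'
    rw [Complex.dist_eq_re_im, h.re_zero z hz, h.re_zero z' hz', sub_self]
    rw [zero_pow (by norm_num), zero_add, Real.sqrt_sq_eq_abs]
  refine h.conn₁.dist_le_of_local_section (p := fun z => (W z).im)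
    (continuous_im.comp_continuousOn (h.contW.mono fun z hz => Or.inr (Or.inl hz))) ?_ ?_ hy hy'
  · intro y hy ε hε
    obtain ⟨r, hr, -, hiso, -⟩ := h.near_isometry (Or.inl hy) (ε := ε / (1 + ε)) (by positivity)
    refine ⟨r, hr, fun z hz z' hz' => ?_⟩
    have h1 := (hiso z ⟨Or.inr (Or.inl hz.1), hz.2⟩ z' ⟨Or.inr (Or.inl hz'.1), hz'.2⟩).1
    rw [himd z (Or.inl hz.1) z' (Or.inl hz'.1)] at h1
    have e : 1 - ε / (1 + ε) = 1 / (1 + ε) := by field_simp; ring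
    rw [e, one_div_mul_eq_div, div_le_iff₀ (by linarith)] at h1
    linarith
  · intro y hy r hr
    obtain ⟨r₁, hr₁, hd⟩ := h.sep₁ y hy
    obtain ⟨η, hη, himg⟩ := h.local_image (Or.inl hy) (lt_min hr hr₁)
    refine ⟨η, hη, fun s hs => ?_⟩
    obtain ⟨z, hz, hzw⟩ := himg (s * I) (by simp) (by
      rw [Complex.dist_eq_re_im, h.re_zero y (Or.inl hy)]
      simpa [Real.sqrt_sq_eq_abs] using hs)
    have hzF : z ∈ F₁ ∪ F₂ := h.mem_F_of_re_zero hz.1 (by rw [hzw]; simp)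
    have hz1 : z ∈ F₁ := hzF.resolve_right fun h2 =>
      disjoint_left.1 hd h2 (ball_subset_ball (min_le_right _ _) hz.2)
    exact ⟨z, ⟨hz1, ball_subset_ball (min_le_left _ _) hz.2⟩, by simp [hzw]⟩

lemma dist_le₂ (h : Potential δ D E F₁ F₂ f W) {y y' : ℂ} (hy : y ∈ F₂) (hy' : y' ∈ F₂) :
    dist y y' ≤ |(W y).im - (W y').im| := h.swap.dist_le₁ hy hy'

lemma norm_f_le (h : Potential δ D E F₁ F₂ f W) {z : ℂ} {d : ℝ} (hd : 0 < d)
    (hb : ball z d ⊆ D) : ‖f z‖ ≤ 2 * (W z).re / d := by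
  have := norm_deriv_le_of_re_pos hd (h.differentiableOn.mono hb) (fun x hx => h.re_pos x (hb hx))
  rwa [h.deriv_eq (hb (mem_ball_self hd))] at this

/-- If a disc in `D` touches the free boundary, then `Re W` at its center is at most the
diameter. -/
lemma re_le_of_touching (h : Potential δ D E F₁ F₂ f W) {z y : ℂ} {d : ℝ} (hd : 0 < d)
    (hb : ball z d ⊆ D) (hy : y ∈ F₁ ∪ F₂) (hyz : dist y z ≤ d) : (W z).re ≤ 2 * d := by
  have key : ∀ ε > 0, (W z).re ≤ (1 + ε) * (2 * d) := by
    intro ε hε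
    obtain ⟨r, hr, -, hiso, -⟩ := h.near_isometry hy hε
    set s : ℝ := min (1 / 2) (r / (2 * d))
    have hs : 0 < s := by positivity
    have hs1 : s ≤ 1 / 2 := min_le_left _ _
    have hs2 : s * d ≤ r / 2 := by
      have : s ≤ r / (2 * d) := min_le_right _ _
      calc s * d ≤ r / (2 * d) * d := mul_le_mul_of_nonneg_right this hd.le
        _ = r / 2 := by field_simp
    set x : ℂ := y + (s : ℂ) * (z - y)
    have hxy : dist x y ≤ s * d := by
      rw [dist_eq_norm, add_sub_cancel_left, norm_mul, Complex.norm_real, Real.norm_eq_abs,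
        abs_of_pos hs, ← dist_eq_norm, dist_comm]
      exact mul_le_mul_of_nonneg_left hyz hs.le
    have hxz : dist x z ≤ (1 - s) * d := by
      have e : x - z = ((1 - s : ℝ) : ℂ) * (y - z) := by simp only [x]; push_cast; ring
      rw [dist_eq_norm, e, norm_mul, Complex.norm_real, Real.norm_eq_abs,
        abs_of_pos (by linarith), ← dist_eq_norm]
      exact mul_le_mul_of_nonneg_left hyz (by linarith)
    have hxb : x ∈ ball z d := by
      rw [mem_ball]; nlinarith
    have h1 := re_ge_of_re_pos (h.differentiableOn.mono hb) (fun x hx => h.re_pos x (hb hx)) hxb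
    have h2 := (hiso x ⟨Or.inl (hb hxb), by rw [mem_ball]; linarith⟩ y
      ⟨Or.inr hy, mem_ball_self hr⟩).2
    have h3 : (W x).re ≤ dist (W x) (W y) := by
      have := Complex.abs_re_le_norm (W x - W y)
      rw [sub_re, h.re_zero y hy, sub_zero] at this
      rw [dist_eq_norm]
      exact (le_abs_self _).trans this
    have h4 : dist x z / d ≤ 1 - s := by rwa [div_le_iff₀ hd]
    have hz0 := h.re_pos z (hb (mem_ball_self hd))
    have h5 : (W z).re * s / 2 ≤ (1 + ε) * (s * d) := by
      have : (W z).re * s ≤ (W z).re * (1 - dist x z / d) :=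
        mul_le_mul_of_nonneg_left (by linarith) hz0.le
      have : (1 + ε) * dist x y ≤ (1 + ε) * (s * d) :=
        mul_le_mul_of_nonneg_left hxy (by linarith)
      linarith
    have h6 : (W z).re * s ≤ (1 + ε) * (2 * d) * s := by linarith
    exact le_of_mul_le_mul_right h6 hs
  have hlim : Tendsto (fun ε : ℝ => (1 + ε) * (2 * d)) (𝓝[>] 0) (𝓝 ((1 + 0) * (2 * d))) :=
    ((tendsto_id.const_add 1).mul_const _).mono_left nhdsWithin_le_nhds
  rw [add_zero, one_mul] at hlim
  exact ge_of_tendsto hlim (by filter_upwards [self_mem_nhdsWithin] with ε hε using key ε hε)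

/-- Near a free boundary point there are points of `D` where `Re W` is almost the distance. -/
lemma exists_steep_point (h : Potential δ D E F₁ F₂ f W) {y : ℂ} (hy : y ∈ F₁ ∪ F₂) {ε r : ℝ}
    (hε : 0 < ε) (hr : 0 < r) :
    ∃ z ∈ D ∩ ball y r, (1 - ε) * dist z y ≤ (W z).re := by
  obtain ⟨r₁, hr₁, -, hiso, -⟩ := h.near_isometry hy hε
  obtain ⟨η, hη, himg⟩ := h.local_image hy (lt_min hr hr₁)
  obtain ⟨z, hz, hzw⟩ := himg (W y + ((η / 2 : ℝ) : ℂ)) (by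
    rw [add_re, h.re_zero y hy, ofReal_re]; linarith) (by
    rw [dist_eq_norm, add_sub_cancel_left, Complex.norm_real, Real.norm_eq_abs,
      abs_of_pos (by linarith)]; linarith)
  have hre : (W z).re = η / 2 := by rw [hzw, add_re, h.re_zero y hy, ofReal_re, zero_add]
  have h1 := (hiso z ⟨hz.1, ball_subset_ball (min_le_right _ _) hz.2⟩ y
    ⟨Or.inr hy, mem_ball_self hr₁⟩).1
  rw [hzw, dist_eq_norm (W y + _), add_sub_cancel_left, Complex.norm_real, Real.norm_eq_abs,
    abs_of_pos (by linarith)] at h1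
  exact ⟨z, ⟨h.mem_D_of_re_pos hz.1 (by linarith), ball_subset_ball (min_le_left _ _) hz.2⟩,
    by linarith⟩

end Potential

/-! ### Crosscuts -/

/-- The point of the circle of radius `ρ` around `0` with argument `θ`. -/
noncomputable def cir (ρ θ : ℝ) : ℂ := ρ * exp (θ * I)

lemma continuous_cir (ρ : ℝ) : Continuous (cir ρ) := by unfold cir; fun_prop

lemma norm_cir {ρ : ℝ} (hρ : 0 ≤ ρ) (θ : ℝ) : ‖cir ρ θ‖ = ρ := by
  rw [cir, norm_mul, norm_exp_ofReal_mul_I, mul_one, Complex.norm_real, Real.norm_eq_abs,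
    abs_of_nonneg hρ]

lemma cir_add_two_pi (ρ θ : ℝ) : cir ρ (θ + 2 * Real.pi) = cir ρ θ := by
  rw [cir, cir]
  congr 1
  push_cast
  rw [add_mul, exp_add, exp_two_pi_mul_I, mul_one]

lemma exists_cir_eq (z : ℂ) : ∃ θ : ℝ, cir ‖z‖ θ = z := ⟨arg z, norm_mul_exp_arg_mul_I z⟩

/-- A local continuous square root near a nonzero point. -/
lemma exists_local_sqrt {y : ℂ} (hy : y ≠ 0) :
    ∃ b : ℂ → ℂ, ContinuousOn b (ball y ‖y‖) ∧ ∀ z, b z ^ 2 = z := by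
  obtain ⟨r, hr⟩ := IsAlgClosed.exists_pow_nat_eq y (n := 2) (by norm_num)
  refine ⟨fun z => r * (z / y) ^ ((2 : ℕ) : ℂ)⁻¹, fun z hz => ?_, fun z => ?_⟩
  · refine ContinuousAt.continuousWithinAt ?_
    refine continuousAt_const.mul (ContinuousAt.cpow (by fun_prop) continuousAt_const ?_)
    have h1 : ‖z / y - 1‖ < 1 := by
      have : z / y - 1 = (z - y) / y := by field_simp
      rw [this, norm_div, div_lt_one (norm_pos_iff.2 hy), ← dist_eq_norm]
      exact hz
    left
    have := (abs_le.1 (Complex.abs_re_le_norm (z / y - 1))).1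
    simp only [sub_re, one_re] at this
    linarith
  · rw [mul_pow, hr, cpow_nat_inv_pow _ (by norm_num), mul_div_cancel₀ _ hy]

namespace TwoArcs

variable {δ : ℝ} {D E F₁ F₂ : Set ℂ}

lemma ne_zero_of_mem_ann (h : TwoArcs δ D E F₁ F₂) {z : ℂ} (hz : z ∈ ann δ 1) : z ≠ 0 := by
  rintro rfl
  have := hz.1
  rw [norm_zero] at this
  exact absurd this (not_lt.2 h.pos.le)

lemma subset_ann (h : TwoArcs δ D E F₁ F₂) : D ∪ (F₁ ∪ F₂) ⊆ ann δ 1 :=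
  union_subset h.D_subset h.F_subset

/-- A continuous square root of the coordinate on one phase up to the arcs. -/
lemma exists_sqrt (h : TwoArcs δ D E F₁ F₂) : ∃ S : ℂ → ℂ, ContinuousOn S (D ∪ (F₁ ∪ F₂)) ∧
    ∀ z ∈ D ∪ (F₁ ∪ F₂), S z ^ 2 = z := by
  have h0 : (0 : ℂ) ∉ D := fun h0 => h.ne_zero_of_mem_ann (h.D_subset h0) rfl
  obtain ⟨S₀, hS₀, hS₀2⟩ := exists_sqrt_of_primitive h.openD h0 (h.exists_primitive
    (f := fun z => z⁻¹) (fun z hz =>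
      (differentiableAt_inv (fun hz0 => h0 (hz0 ▸ hz))).differentiableWithinAt))
  have hlim : ∀ y ∈ D ∪ (F₁ ∪ F₂), ∃ w, Tendsto S₀ (𝓝[D] y) (𝓝 w) := by
    rintro y (hy | hy)
    · exact ⟨S₀ y, hS₀ y hy⟩
    · have hy0 := h.ne_zero_of_mem_ann (h.F_subset hy)
      obtain ⟨b, hb, hb2⟩ := exists_local_sqrt hy0
      obtain ⟨r', hr', C, hC, hCp, hCs⟩ := h.locD y hy ‖y‖ (norm_pos_iff.2 hy0)
      have hbc : ContinuousAt b y := hb.continuousAt (ball_mem_nhds y (norm_pos_iff.2 hy0))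
      have hCne : ∀ z ∈ C, b z ≠ 0 := fun z hz h0' => by
        have := hb2 z
        rw [h0', zero_pow (by norm_num)] at this
        exact h0 (this ▸ (hC hz).1)
      have hev : ∀ᶠ z in 𝓝[D] y, z ∈ C := by
        filter_upwards [self_mem_nhdsWithin, mem_nhdsWithin_of_mem_nhds (ball_mem_nhds y hr')]
          with z h1 h2 using hCs ⟨h1, h2⟩
      rcases hCp.eq_or_eq_neg_of_sq_eq (hS₀.mono fun z hz => (hC hz).1)
        (hb.mono fun z hz => (hC hz).2)
        (fun z hz => by simp only [Pi.pow_apply]; rw [hS₀2 z (hC hz).1, hb2]) (hCne _) with he | he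
      · exact ⟨b y, (hbc.tendsto.mono_left nhdsWithin_le_nhds).congr' (by
          filter_upwards [hev] with z hz using (he hz).symm)⟩
      · exact ⟨-b y, (hbc.tendsto.neg.mono_left nhdsWithin_le_nhds).congr' (by
          filter_upwards [hev] with z hz using (he hz).symm)⟩
  have hcl : D ∪ (F₁ ∪ F₂) ⊆ closure D := union_subset subset_closure h.clD
  refine ⟨extendFrom D S₀, continuousOn_extendFrom hcl hlim, fun z hz => ?_⟩
  have := mem_closure_iff_nhdsWithin_neBot.1 (hcl hz)
  have h1 := (tendsto_extendFrom (hlim z hz)).pow 2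
  have h2 : Tendsto (fun x : ℂ => x) (𝓝[D] z) (𝓝 z) := tendsto_id.mono_left nhdsWithin_le_nhds
  refine tendsto_nhds_unique (h1.congr' ?_) h2
  filter_upwards [self_mem_nhdsWithin] with x hx using hS₀2 x hx

lemma exists_norm_eq (h : TwoArcs δ D E F₁ F₂) {ρ : ℝ} (h1 : δ < ρ) (h2 : ρ < 1) :
    ∃ y ∈ F₁, ‖y‖ = ρ := by
  obtain ⟨p, hp, hp'⟩ := h.inner₁
  obtain ⟨q, hq, hq'⟩ := h.outer₁
  rw [mem_sphere_zero_iff_norm] at hp' hq'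
  obtain ⟨a, ha1, ha2⟩ := mem_closure_iff.1 hp {z | ‖z‖ < ρ}
    (isOpen_lt continuous_norm continuous_const) (by simpa [hp'] using h1)
  obtain ⟨b, hb1, hb2⟩ := mem_closure_iff.1 hq {z | ρ < ‖z‖}
    (isOpen_lt continuous_const continuous_norm) (by simpa [hq'] using h2)
  obtain ⟨y, hy, hyρ⟩ := h.conn₁.intermediate_value ha2 hb2 continuous_norm.continuousOn
    (⟨le_of_lt ha1, le_of_lt hb1⟩ : ρ ∈ Icc ‖a‖ ‖b‖)
  exact ⟨y, hy, hyρ⟩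

/-- Every concentric circle contains an open arc in `D` joining the two curves. -/
lemma exists_crosscut (h : TwoArcs δ D E F₁ F₂) {ρ : ℝ} (hδρ : δ < ρ) (hρ1 : ρ < 1) :
    ∃ α β : ℝ, α < β ∧ β ≤ α + 2 * Real.pi ∧ (∀ θ ∈ Ioo α β, cir ρ θ ∈ D) ∧
      ((cir ρ α ∈ F₁ ∧ cir ρ β ∈ F₂) ∨ (cir ρ α ∈ F₂ ∧ cir ρ β ∈ F₁)) := by
  have hρ0 : 0 < ρ := h.pos.trans hδρ
  have hcann : ∀ θ, cir ρ θ ∈ ann δ 1 := fun θ => by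
    refine ⟨?_, ?_⟩ <;> rw [norm_cir hρ0.le] <;> assumption
  by_contra! hno
  obtain ⟨SD, hSD, hSD2⟩ := h.exists_sqrt
  obtain ⟨SE, hSE, hSE2⟩ := h.symm.exists_sqrt
  set J : Set ℝ := {θ | cir ρ θ ∈ D}
  set N : Set ℝ := Jᶜ
  have hJo : IsOpen J := h.openD.preimage (continuous_cir ρ)
  have hNc : IsClosed N := hJo.isClosed_compl
  have hNmem : ∀ θ ∈ N, cir ρ θ ∈ E ∪ (F₁ ∪ F₂) := fun θ hθ =>
    (h.mem_cases (hcann θ)).resolve_left hθ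
  have hper : ∀ θ, θ + 2 * Real.pi ∈ N ↔ θ ∈ N := fun θ => by
    simp only [N, J, mem_compl_iff, mem_ofPred_eq, cir_add_two_pi]
  obtain ⟨y₀, hy₀, hy₀n⟩ := h.exists_norm_eq hδρ hρ1
  obtain ⟨θ₀, hθ₀⟩ := exists_cir_eq y₀
  rw [hy₀n] at hθ₀
  have hθ₀N : θ₀ ∈ N := fun hJ => disjoint_left.1 h.disjDF hJ (Or.inl (by rw [hθ₀]; exact hy₀))
  have hperk : ∀ k : ℕ, θ₀ + k * (2 * Real.pi) ∈ N := by
    intro k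
    induction k with
    | zero => simpa using hθ₀N
    | succ k ih =>
      have := (hper _).2 ih
      convert this using 1
      push_cast; ring
  have hpermk : ∀ k : ℕ, θ₀ - k * (2 * Real.pi) ∈ N := by
    intro k
    induction k with
    | zero => simpa using hθ₀N
    | succ k ih =>
      rw [← hper]
      convert ih using 1
      push_cast; ring
  have hpi := Real.two_pi_pos
  -- next and previous points outside `D`
  have hnext : ∀ θ, ∃ β, θ ≤ β ∧ β ∈ N ∧ ∀ t ∈ N, θ ≤ t → β ≤ t := by
    intro θ
    obtain ⟨k, hk⟩ := exists_nat_ge ((θ - θ₀) / (2 * Real.pi))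
    rw [div_le_iff₀ hpi] at hk
    have hc : IsClosed (N ∩ Ici θ) := hNc.inter isClosed_Ici
    have hb : BddBelow (N ∩ Ici θ) := ⟨θ, fun t ht => ht.2⟩
    have hm := hc.csInf_mem ⟨θ₀ + k * (2 * Real.pi), hperk k,
      (show θ ≤ θ₀ + k * (2 * Real.pi) by linarith)⟩ hb
    exact ⟨_, hm.2, hm.1, fun t ht hθt => csInf_le hb ⟨ht, hθt⟩⟩
  have hprev : ∀ θ, ∃ α, α ≤ θ ∧ α ∈ N ∧ ∀ t ∈ N, t ≤ θ → t ≤ α := by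
    intro θ
    obtain ⟨k, hk⟩ := exists_nat_ge ((θ₀ - θ) / (2 * Real.pi))
    rw [div_le_iff₀ hpi] at hk
    have hc : IsClosed (N ∩ Iic θ) := hNc.inter isClosed_Iic
    have hb : BddAbove (N ∩ Iic θ) := ⟨θ, fun t ht => ht.2⟩
    have hm := hc.csSup_mem ⟨θ₀ - k * (2 * Real.pi), hpermk k,
      (show θ₀ - k * (2 * Real.pi) ≤ θ by linarith)⟩ hb
    exact ⟨_, hm.2, hm.1, fun t ht hθt => le_csSup hb ⟨ht, hθt⟩⟩
  choose β hβ1 hβ2 hβ3 using hnext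
  choose α hα1 hα2 hα3 using hprev
  set b : ℝ → ℂ := fun θ => (Real.sqrt ρ : ℂ) * exp (θ / 2 * I)
  have hbc : Continuous b := by simp only [b]; fun_prop
  have hsq : (Real.sqrt ρ : ℂ) ^ 2 = ρ := by
    rw [← ofReal_pow, Real.sq_sqrt hρ0.le]
  have hb2 : ∀ θ, b θ ^ 2 = cir ρ θ := fun θ => by
    simp only [b, cir]
    rw [mul_pow, hsq, ← exp_nat_mul]
    congr 2
    push_cast; ring
  have hb0 : ∀ θ, b θ ≠ 0 := fun θ =>
    mul_ne_zero (by exact_mod_cast (Real.sqrt_pos.2 hρ0).ne') (exp_ne_zero _)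
  have hbper : ∀ θ, b (θ + 2 * Real.pi) = - b θ := fun θ => by
    simp only [b]
    have : ((θ + 2 * Real.pi : ℝ) : ℂ) / 2 * I = θ / 2 * I + Real.pi * I := by push_cast; ring
    rw [this, exp_add, exp_pi_mul_I]; ring
  set σ : ℝ → Prop := fun t => SE (cir ρ t) = b t
  have hσN : ∀ t ∈ N, ¬ σ t → SE (cir ρ t) = - b t := by
    intro t ht hn
    have : SE (cir ρ t) ^ 2 = b t ^ 2 := by rw [hSE2 _ (hNmem t ht), hb2]
    exact (sq_eq_sq_iff_eq_or_eq_neg.1 this).resolve_left hn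
  have hσloc : ∀ t₀ ∈ N, ∀ᶠ t in 𝓝[N] t₀, (σ t ↔ σ t₀) := by
    intro t₀ ht₀
    have hc : ContinuousWithinAt (fun t => SE (cir ρ t)) N t₀ :=
      ContinuousOn.comp hSE (continuous_cir ρ).continuousOn hNmem t₀ ht₀
    have hcb : ContinuousWithinAt b N t₀ := hbc.continuousAt.continuousWithinAt
    by_cases h1 : σ t₀
    · have hne : (fun t => SE (cir ρ t) + b t) t₀ ≠ 0 := by
        have h1' : SE (cir ρ t₀) = b t₀ := h1
        simp only [h1', ← two_mul]
        exact mul_ne_zero two_ne_zero (hb0 t₀)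
      filter_upwards [(hc.add hcb).eventually_ne hne, self_mem_nhdsWithin] with t ht htN
      refine iff_of_true ?_ h1
      by_contra hn
      exact ht (by rw [Pi.add_apply, hσN t htN hn]; ring)
    · have hne : (fun t => SE (cir ρ t) - b t) t₀ ≠ 0 := fun h0 => h1 (sub_eq_zero.1 h0)
      filter_upwards [(hc.sub hcb).eventually_ne hne] with t ht
      exact iff_of_false (fun hs => ht (sub_eq_zero.2 hs)) h1
  -- signs agree at the two ends of an arc in `D`
  have hσarc : ∀ a c : ℝ, a < c → a ∈ N → c ∈ N → (∀ θ ∈ Ioo a c, θ ∈ J) → (σ a ↔ σ c) := by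
    intro a c hac haN hcN harc
    have hclos : ∀ t ∈ Icc a c, cir ρ t ∈ closure D := by
      intro t ht
      have h1 : t ∈ closure (Ioo a c) := by rw [closure_Ioo hac.ne]; exact ht
      have h2 := image_closure_subset_closure_image (continuous_cir ρ) (s := Ioo a c) ⟨t, h1, rfl⟩
      refine closure_mono ?_ h2
      rintro _ ⟨s, hs, rfl⟩
      exact harc s hs
    have hDF : ∀ t ∈ Icc a c, cir ρ t ∈ D ∪ (F₁ ∪ F₂) := fun t ht =>
      h.mem_of_mem_closure (hcann t) (hclos t ht)
    have haF : cir ρ a ∈ F₁ ∪ F₂ := (hDF a ⟨le_rfl, hac.le⟩).resolve_left haN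
    have hcF : cir ρ c ∈ F₁ ∪ F₂ := (hDF c ⟨hac.le, le_rfl⟩).resolve_left hcN
    have hca : c ≤ a + 2 * Real.pi := by
      by_contra! hlt
      exact (hper a).2 haN (harc _ ⟨by linarith, hlt⟩)
    have hno' := hno a c hac hca harc
    have hsign := isPreconnected_Icc.eq_or_eq_neg_of_sq_eq (S := Icc a c)
      (ContinuousOn.comp hSD (continuous_cir ρ).continuousOn hDF) hbc.continuousOn
      (fun t ht => by
        simp only [Pi.pow_apply, Function.comp]; rw [hSD2 _ (hDF t ht), hb2]) (fun {t} _ => hb0 t)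
    have hF : ∀ F : Set ℂ, IsPreconnected F → F ⊆ F₁ ∪ F₂ → cir ρ a ∈ F → cir ρ c ∈ F →
        (σ a ↔ σ c) := by
      intro F hFp hFs ha hc
      have ha' : a ∈ Icc a c := ⟨le_rfl, hac.le⟩
      have hc' : c ∈ Icc a c := ⟨hac.le, le_rfl⟩
      have hse0 : ∀ z ∈ F, SE z ≠ 0 := fun z hz h0 => by
        have := hSE2 z (Or.inr (hFs hz))
        rw [h0, zero_pow (by norm_num)] at this
        exact h.ne_zero_of_mem_ann (h.F_subset (hFs hz)) this.symm
      have hde := hFp.eq_or_eq_neg_of_sq_eq (hSD.mono fun z hz => Or.inr (hFs hz))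
        (hSE.mono fun z hz => Or.inr (hFs hz)) (fun z hz => by
          simp only [Pi.pow_apply]
          rw [hSD2 z (Or.inr (hFs hz)), hSE2 z (Or.inr (hFs hz))]) (hse0 _)
      have hba := hb0 a
      have hbc := hb0 c
      simp only [σ]
      rcases hsign with h1 | h1 <;> rcases hde with h2 | h2
      · rw [← h2 ha, ← h2 hc]; exact iff_of_true (h1 ha') (h1 hc')
      · have e1 := h1 ha'
        have e2 := h1 hc'
        have e3 := h2 ha
        have e4 := h2 hc
        simp only [Function.comp, Pi.neg_apply] at e1 e2 e3 e4
        rw [e1] at e3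
        rw [e2] at e4
        refine iff_of_false (fun h3 => ?_) (fun h3 => ?_)
        · rw [h3] at e3; exact hba (self_eq_neg.1 e3)
        · rw [h3] at e4; exact hbc (self_eq_neg.1 e4)
      · have e1 := h1 ha'
        have e2 := h1 hc'
        have e3 := h2 ha
        have e4 := h2 hc
        simp only [Function.comp, Pi.neg_apply] at e1 e2 e3 e4
        rw [e1] at e3
        rw [e2] at e4
        refine iff_of_false (fun h3 => ?_) (fun h3 => ?_)
        · rw [h3] at e3; exact hba (neg_eq_self.1 e3)
        · rw [h3] at e4; exact hbc (neg_eq_self.1 e4)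
      · have e1 := h1 ha'
        have e2 := h1 hc'
        have e3 := h2 ha
        have e4 := h2 hc
        simp only [Function.comp, Pi.neg_apply] at e1 e2 e3 e4
        rw [e1] at e3
        rw [e2] at e4
        exact iff_of_true (neg_injective e3).symm (neg_injective e4).symm
    rcases haF with ha | ha <;> rcases hcF with hc | hc
    · exact hF F₁ h.conn₁ subset_union_left ha hc
    · exact absurd hc (hno'.1 ha)
    · exact absurd hc (hno'.2 ha)
    · exact hF F₂ h.conn₂ subset_union_right ha hc
  have hbetw : ∀ θ ∈ J, ∀ t ∈ Ioo (α θ) (β θ), t ∈ J := by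
    intro θ _ t ht
    by_contra hn
    rcases le_total θ t with h1 | h1
    · exact absurd (hβ3 θ t hn h1) (not_le.2 ht.2)
    · exact absurd (hα3 θ t hn h1) (not_le.2 ht.1)
  set p : ℝ → Prop := fun θ => if θ ∈ N then σ θ else σ (β θ)
  have hpN : ∀ θ ∈ N, (p θ ↔ σ θ) := fun θ hθ => by simp only [p, if_pos hθ]
  have hpJ : ∀ θ ∈ J, (p θ ↔ σ (β θ)) := fun θ hθ => by
    simp only [p, if_neg (show θ ∉ N from fun hN => hN hθ)]
  have hploc : ∀ t₀ ∈ (univ : Set ℝ), ∀ᶠ θ in 𝓝[univ] t₀, (p θ ↔ p t₀) := by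
    intro t₀ _
    rw [nhdsWithin_univ]
    by_cases ht₀ : t₀ ∈ J
    · obtain ⟨ε, hε, hball⟩ := Metric.isOpen_iff.1 hJo t₀ ht₀
      have hnot : ∀ t ∈ N, ε ≤ |t - t₀| := fun t ht => by
        by_contra! hlt
        exact ht (hball hlt)
      filter_upwards [ball_mem_nhds t₀ hε] with θ hθ
      rw [hpJ θ (hball hθ), hpJ t₀ ht₀]
      have hθ' := abs_lt.1 (show |θ - t₀| < ε from hθ)
      have e : β θ = β t₀ := by
        apply le_antisymm
        · refine hβ3 θ _ (hβ2 t₀) ?_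
          have h1 := hnot _ (hβ2 t₀)
          rw [abs_of_nonneg (by linarith [hβ1 t₀])] at h1
          linarith
        · refine hβ3 t₀ _ (hβ2 θ) ?_
          by_contra! hlt
          have h1 := hnot _ (hβ2 θ)
          rw [abs_of_neg (by linarith)] at h1
          linarith [hβ1 θ]
      rw [e]
    · have ht₀N : t₀ ∈ N := ht₀
      obtain ⟨ε, hε, hb⟩ := Metric.mem_nhdsWithin_iff.1 (hσloc t₀ ht₀N)
      have hσe : ∀ t ∈ N, |t - t₀| < ε → (σ t ↔ σ t₀) := fun t ht hlt => hb ⟨hlt, ht⟩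
      filter_upwards [ball_mem_nhds t₀ hε] with θ hθ
      have hθ' := abs_lt.1 (show |θ - t₀| < ε from hθ)
      rw [hpN t₀ ht₀N]
      by_cases hθN : θ ∈ N
      · rw [hpN θ hθN]; exact hσe θ hθN hθ
      · have hθJ : θ ∈ J := not_not.1 hθN
        rw [hpJ θ hθJ]
        rcases le_total θ t₀ with h1 | h1
        · refine hσe _ (hβ2 θ) ?_
          rw [abs_lt]
          constructor <;> linarith [hβ1 θ, hβ3 θ t₀ ht₀N h1]
        · have hα := hα3 θ t₀ ht₀N h1
          rw [← hσe _ (hα2 θ) (by rw [abs_lt]; constructor <;> linarith [hα1 θ])]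
          have hne1 : α θ ≠ θ := fun h2 => (h2 ▸ hα2 θ) hθJ
          have hne2 : θ ≠ β θ := fun h2 => (h2.symm ▸ hβ2 θ) hθJ
          exact (hσarc _ _ (lt_of_lt_of_le (lt_of_le_of_ne (hα1 θ) hne1) (hβ1 θ)) (hα2 θ) (hβ2 θ)
            (hbetw θ hθJ)).symm
  have hiff := isPreconnected_univ.iff_of_eventually_iff hploc (mem_univ θ₀)
    (mem_univ (θ₀ + 2 * Real.pi))
  rw [hpN _ hθ₀N, hpN _ ((hper θ₀).2 hθ₀N)] at hiff
  simp only [σ, cir_add_two_pi, hbper] at hiff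
  by_cases h1 : SE (cir ρ θ₀) = b θ₀
  · have h2 := hiff.1 h1
    rw [h1] at h2
    exact hb0 θ₀ (self_eq_neg.1 h2)
  · exact h1 (hiff.2 (hσN θ₀ hθ₀N h1))

end TwoArcs

/-! ### Arcs parametrised by arc length -/

section Arc

variable {F : Set ℂ} {s : ℂ → ℝ}

lemma exists_arc_parametrization (hd : ∀ y ∈ F, ∀ y' ∈ F, dist y y' ≤ |s y - s y'|) :
    ∃ σ : ℝ → ℂ, (∀ y ∈ F, σ (s y) = y) ∧ ContinuousOn σ (s '' F) := by
  have hinj : InjOn s F := fun y hy y' hy' hs => by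
    have := hd y hy y' hy'
    rw [hs, sub_self, abs_zero] at this
    exact dist_le_zero.1 this
  have hσ : ∀ y ∈ F, Function.invFunOn s F (s y) = y := fun y hy => hinj.leftInvOn_invFunOn hy
  refine ⟨Function.invFunOn s F, hσ, ?_⟩
  refine (LipschitzOnWith.of_dist_le_mul (K := 1) ?_).continuousOn
  rintro _ ⟨y, hy, rfl⟩ _ ⟨y', hy', rfl⟩
  rw [hσ y hy, hσ y' hy', Real.dist_eq, NNReal.coe_one, one_mul]
  exact hd y hy y' hy'

lemma isPreconnected_arc (hF : IsPreconnected F) (hs : ContinuousOn s F)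
    (hd : ∀ y ∈ F, ∀ y' ∈ F, dist y y' ≤ |s y - s y'|) {J : Set ℝ} (hJ : J.OrdConnected) :
    IsPreconnected {y ∈ F | s y ∈ J} := by
  obtain ⟨σ, hσ, hσc⟩ := exists_arc_parametrization hd
  have h1 : {y ∈ F | s y ∈ J} = σ '' (s '' F ∩ J) := by
    ext y
    constructor
    · rintro ⟨hy, hyJ⟩
      exact ⟨s y, ⟨⟨y, hy, rfl⟩, hyJ⟩, hσ y hy⟩
    · rintro ⟨_, ⟨⟨x, hx, rfl⟩, hxJ⟩, rfl⟩
      rw [hσ x hx]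
      exact ⟨hx, hxJ⟩
  rw [h1]
  have h2 : (s '' F).OrdConnected := (hF.image s hs).ordConnected
  exact ((h2.inter hJ).isPreconnected).image _ (hσc.mono inter_subset_left)

lemma exists_compact_subarc (hF : IsPreconnected F) (hs : ContinuousOn s F)
    (hd : ∀ y ∈ F, ∀ y' ∈ F, dist y y' ≤ |s y - s y'|) {K : Set ℂ} (hK : IsCompact K)
    (hKF : K ⊆ F) (hne : K.Nonempty) :
    ∃ A, K ⊆ A ∧ A ⊆ F ∧ IsCompact A ∧ IsPreconnected A := by
  obtain ⟨σ, hσ, hσc⟩ := exists_arc_parametrization hd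
  obtain ⟨a, ha, hamin⟩ := hK.exists_isMinOn hne (hs.mono hKF)
  obtain ⟨b, hb, hbmax⟩ := hK.exists_isMaxOn hne (hs.mono hKF)
  have hI : Icc (s a) (s b) ⊆ s '' F :=
    (hF.image s hs).ordConnected.out ⟨a, hKF ha, rfl⟩ ⟨b, hKF hb, rfl⟩
  refine ⟨{y ∈ F | s y ∈ Icc (s a) (s b)}, fun y hy => ⟨hKF hy, hamin hy, hbmax hy⟩,
    fun y hy => hy.1, ?_, isPreconnected_arc hF hs hd ordConnected_Icc⟩
  have h1 : {y ∈ F | s y ∈ Icc (s a) (s b)} = σ '' Icc (s a) (s b) := by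
    ext y
    constructor
    · rintro ⟨hy, hyJ⟩
      exact ⟨s y, hyJ, hσ y hy⟩
    · rintro ⟨t, ht, rfl⟩
      obtain ⟨x, hx, rfl⟩ := hI ht
      rw [hσ x hx]
      exact ⟨hx, ht⟩
  rw [h1]
  exact isCompact_Icc.image_of_continuousOn (hσc.mono hI)

end Arc

lemma isOpen_setOf_connectedComponentIn {X : Set ℂ} (hX : IsOpen X) (p : Set ℂ → Prop) :
    IsOpen {z ∈ X | p (connectedComponentIn X z)} := by
  rw [Metric.isOpen_iff]
  rintro z ⟨hz, hp⟩
  obtain ⟨r, hr, hb⟩ := Metric.isOpen_iff.1 (hX.connectedComponentIn (x := z)) z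
    (mem_connectedComponentIn hz)
  refine ⟨r, hr, fun w hw => ⟨connectedComponentIn_subset _ _ (hb hw), ?_⟩⟩
  rw [← connectedComponentIn_eq (hb hw)]
  exact hp

namespace Potential

variable {δ : ℝ} {D E F₁ F₂ : Set ℂ} {f W : ℂ → ℂ}

lemma continuousOn_im (h : Potential δ D E F₁ F₂ f W) : ContinuousOn (fun z => (W z).im) F₁ :=
  continuous_im.comp_continuousOn (h.contW.mono fun _ hz => Or.inr (Or.inl hz))

lemma isClosed_sphere_inter (h : TwoArcs δ D E F₁ F₂) {ρ : ℝ} (hδρ : δ < ρ) (hρ1 : ρ < 1) :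
    IsClosed ((D ∪ (F₁ ∪ F₂)) ∩ sphere 0 ρ) :=
  (h.isCompact_inter (fun z hz => by
    rw [mem_sphere_zero_iff_norm] at hz
    exact ⟨by rw [hz]; exact hδρ, by rw [hz]; exact hρ1⟩) (isCompact_sphere 0 ρ)).isClosed

lemma exists_core (h : Potential δ D E F₁ F₂ f W) {ρ : ℝ} (hδρ : δ < ρ) (hρ1 : ρ < 1) :
    ∃ A, F₁ ∩ sphere 0 ρ ⊆ A ∧ A ⊆ F₁ ∧ IsCompact A ∧ IsPreconnected A := by
  have hc1 := isClosed_sphere_inter h.toTwoArcs hδρ hρ1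
  have hc2 := isClosed_sphere_inter h.toTwoArcs.symm hδρ hρ1
  have hcF : IsCompact (F₁ ∩ sphere (0 : ℂ) ρ) := by
    refine (isCompact_sphere (0 : ℂ) ρ).of_isClosed_subset ?_ inter_subset_right
    rw [← isOpen_compl_iff, Metric.isOpen_iff]
    intro z hz
    have hFc : IsClosed ((F₁ ∪ F₂) ∩ sphere (0 : ℂ) ρ) := by
      have e : (F₁ ∪ F₂) ∩ sphere (0 : ℂ) ρ =
          ((D ∪ (F₁ ∪ F₂)) ∩ sphere 0 ρ) ∩ ((E ∪ (F₁ ∪ F₂)) ∩ sphere 0 ρ) := by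
        ext z
        have hDE := fun hD : z ∈ D => disjoint_left.1 h.disjDE hD
        simp only [mem_inter_iff, mem_union] at hDE ⊢
        tauto
      rw [e]
      exact hc1.inter hc2
    by_cases hzF : z ∈ (F₁ ∪ F₂) ∩ sphere (0 : ℂ) ρ
    · have hz2 : z ∈ F₂ := hzF.1.resolve_left fun h1 => hz ⟨h1, hzF.2⟩
      obtain ⟨r, hr, hd⟩ := h.sep₂ z hz2
      exact ⟨r, hr, fun w hw hw' => disjoint_left.1 hd hw'.1 hw⟩
    · obtain ⟨r, hr, hb⟩ := Metric.isOpen_iff.1 hFc.isOpen_compl z hzF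
      exact ⟨r, hr, fun w hw hw' => hb hw ⟨Or.inl hw'.1, hw'.2⟩⟩
  obtain ⟨y, hy, hyn⟩ := h.exists_norm_eq hδρ hρ1
  exact exists_compact_subarc h.conn₁ h.continuousOn_im (fun y hy y' hy' => h.dist_le₁ hy hy')
    hcF inter_subset_left ⟨y, hy, mem_sphere_zero_iff_norm.2 hyn⟩

/-- A crosscut separates the inner from the outer part of `D`. -/
lemma exists_separation (h : Potential δ D E F₁ F₂ f W) {ρ : ℝ} (hδρ : δ < ρ) (hρ1 : ρ < 1)
    {Γ : Set ℂ} {y₁ y₂ : ℂ} (hΓc : IsCompact Γ) (hΓp : IsPreconnected Γ) (hΓs : Γ ⊆ sphere 0 ρ)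
    (hΓD : Γ ⊆ D ∪ (F₁ ∪ F₂)) (h₁ : y₁ ∈ F₁ ∩ Γ) (h₂ : y₂ ∈ F₂ ∩ Γ) :
    ∃ a b : ℝ, δ < a ∧ a < ρ ∧ ρ < b ∧ b < 1 ∧ ∀ z ∈ D \ Γ, ‖z‖ ≤ a →
      ∀ z' ∈ connectedComponentIn (D \ Γ) z, ‖z'‖ < b := by
  obtain ⟨A₁, hA₁, hA₁F, hA₁c, hA₁p⟩ := h.exists_core hδρ hρ1
  obtain ⟨A₂, hA₂, hA₂F, hA₂c, hA₂p⟩ := h.swap.exists_core hδρ hρ1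
  have hρ0 : 0 < ρ := h.pos.trans hδρ
  set A := A₁ ∪ Γ ∪ A₂
  have hAc : IsCompact A := (hA₁c.union hΓc).union hA₂c
  have hAp : IsPreconnected A := by
    have h3 : IsPreconnected (A₁ ∪ Γ) :=
      IsPreconnected.union y₁ (hA₁ ⟨h₁.1, hΓs h₁.2⟩) h₁.2 hA₁p hΓp
    exact IsPreconnected.union y₂ (Or.inr h₂.2) (hA₂ ⟨h₂.1, hΓs h₂.2⟩) h3 hA₂p
  have hADF : A ⊆ D ∪ (F₁ ∪ F₂) := by
    rintro z ((hz | hz) | hz)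
    exacts [Or.inr (Or.inl (hA₁F hz)), hΓD hz, Or.inr (Or.inr (hA₂F hz))]
  have hAne : A.Nonempty := ⟨y₁, Or.inl (Or.inr h₁.2)⟩
  have hy₁ρ : ‖y₁‖ = ρ := mem_sphere_zero_iff_norm.1 (hΓs h₁.2)
  have hy₁A : y₁ ∈ A := Or.inl (Or.inr h₁.2)
  obtain ⟨p, hp, hpmin⟩ := hAc.exists_isMinOn hAne continuous_norm.continuousOn
  obtain ⟨q, hq, hqmax⟩ := hAc.exists_isMaxOn hAne continuous_norm.continuousOn
  have hp1 := (h.subset_ann (hADF hp)).1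
  have hq1 := (h.subset_ann (hADF hq)).2
  have hpρ : ‖p‖ ≤ ρ := by rw [← hy₁ρ]; exact hpmin hy₁A
  have hqρ : ρ ≤ ‖q‖ := by rw [← hy₁ρ]; exact hqmax hy₁A
  obtain ⟨a, ha1, ha2⟩ := exists_between hp1
  obtain ⟨b, hb1, hb2⟩ := exists_between hq1
  have hAab : ∀ z ∈ A, a < ‖z‖ ∧ ‖z‖ < b := fun z hz =>
    ⟨lt_of_lt_of_le ha2 (hpmin hz), lt_of_le_of_lt (hqmax hz) hb1⟩
  have haρ : a < ρ := by linarith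
  have hρb : ρ < b := by linarith
  refine ⟨a, b, ha1, haρ, hρb, hb2, ?_⟩
  intro z hz hza z' hz'
  by_contra! hzb
  have hDΓ : IsOpen (D \ Γ) := h.openD.sdiff hΓc.isClosed
  have hpath : IsPathConnected (connectedComponentIn (D \ Γ) z) :=
    (hDΓ.connectedComponentIn.isConnected_iff_isPathConnected).1
      (isConnected_connectedComponentIn_iff.2 hz)
  obtain ⟨φ, hφ⟩ := hpath.joinedIn z (mem_connectedComponentIn hz) z' hz'
  set P : Set ℂ := range φ
  have hPD : P ⊆ D \ Γ := by
    rintro _ ⟨t, rfl⟩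
    exact connectedComponentIn_subset _ _ (hφ t)
  have hPc : IsCompact P := isCompact_range φ.continuous
  set X : Set ℂ := {w | a < ‖w‖ ∧ ‖w‖ < b} \ P
  have hXo : IsOpen X := (isOpen_ann a b).sdiff hPc.isClosed
  have hXb : Bornology.IsBounded X := (isBounded_ann a b).subset sdiff_subset
  have hXc : Xᶜ = closedBall 0 a ∪ P ∪ {w | b ≤ ‖w‖} := by
    ext w
    simp only [X, mem_compl_iff, Set.mem_sdiff, mem_ofPred_eq, mem_union, mem_closedBall_zero_iff]
    constructor
    · intro h3
      by_cases h4 : w ∈ P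
      · exact Or.inl (Or.inr h4)
      · by_cases h5 : a < ‖w‖
        · exact Or.inr (not_lt.1 fun h6 => h3 ⟨⟨h5, h6⟩, h4⟩)
        · exact Or.inl (Or.inl (not_lt.1 h5))
    · rintro ((h3 | h3) | h3) ⟨h4, h5⟩
      · linarith [h4.1]
      · exact h5 h3
      · linarith [h4.2]
  have hXcp : IsPreconnected Xᶜ := by
    rw [hXc]
    have h3 : IsPreconnected (closedBall (0 : ℂ) a ∪ P) :=
      IsPreconnected.union z (mem_closedBall_zero_iff.2 hza) ⟨0, φ.source⟩
        (convex_closedBall _ _).isPreconnected (isPreconnected_range φ.continuous)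
    exact IsPreconnected.union z' (Or.inr ⟨1, φ.target⟩) hzb h3 (isPreconnected_norm_ge b)
  have h0X : (0 : ℂ) ∉ X := fun h3 => by
    have := h3.1.1
    rw [norm_zero] at this
    linarith [h.pos]
  obtain ⟨S₀, hS₀, hS₀2⟩ := exists_sqrt_of_primitive hXo h0X
    (exists_primitive_of_isPreconnected_compl hXo hXb hXcp (f := fun z => z⁻¹) (fun w hw =>
      (differentiableAt_inv (fun hw0 => h0X (hw0 ▸ hw))).differentiableWithinAt))
  obtain ⟨SD, hSD, hSD2⟩ := h.exists_sqrt
  have hAX : A ⊆ X := fun w hw => ⟨hAab w hw, fun hP => by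
    rcases hw with (h3 | h3) | h3
    · exact h.notMem_F (hPD hP).1 (Or.inl (hA₁F h3))
    · exact (hPD hP).2 h3
    · exact h.notMem_F (hPD hP).1 (Or.inr (hA₂F h3))⟩
  obtain ⟨S, hS, hS2, hSA⟩ : ∃ S : ℂ → ℂ, ContinuousOn S X ∧ (∀ z ∈ X, S z ^ 2 = z) ∧
      EqOn SD S A := by
    rcases hAp.eq_or_eq_neg_of_sq_eq (hSD.mono hADF) (hS₀.mono hAX)
      (fun w hw => by simp only [Pi.pow_apply]; rw [hSD2 w (hADF hw), hS₀2 w (hAX hw)])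
      (fun {w} hw h3 => by
        have := hS₀2 w (hAX hw)
        rw [h3, zero_pow (by norm_num)] at this
        exact h0X (this ▸ hAX hw)) with h3 | h3
    · exact ⟨S₀, hS₀, hS₀2, h3⟩
    · exact ⟨-S₀, hS₀.neg, fun w hw => by rw [Pi.neg_apply, neg_sq, hS₀2 w hw], h3⟩
  set B₁ := (D ∪ (F₁ ∪ F₂)) ∩ sphere (0 : ℂ) ρ
  set B₂ := (E ∪ (F₁ ∪ F₂)) ∩ sphere (0 : ℂ) ρ
  have hB₁ : IsClosed B₁ := isClosed_sphere_inter h.toTwoArcs hδρ hρ1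
  have hB₂ : IsClosed B₂ := isClosed_sphere_inter h.toTwoArcs.symm hδρ hρ1
  have hFA : (F₁ ∪ F₂) ∩ sphere 0 ρ ⊆ A := by
    rintro w ⟨h3 | h3, h4⟩
    · exact Or.inl (Or.inl (hA₁ ⟨h3, h4⟩))
    · exact Or.inr (hA₂ ⟨h3, h4⟩)
  have hB₂X : B₂ ⊆ X := by
    rintro w ⟨h3, h4⟩
    rw [mem_sphere_zero_iff_norm] at h4
    refine ⟨⟨by rw [h4]; exact haρ, by rw [h4]; exact hρb⟩, fun hP => ?_⟩
    rcases h3 with h3 | h3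
    · exact disjoint_left.1 h.disjDE (hPD hP).1 h3
    · exact h.notMem_F (hPD hP).1 h3
  have hB : sphere (0 : ℂ) ρ = B₁ ∪ B₂ := by
    ext w
    constructor
    · intro hw
      have hw' := mem_sphere_zero_iff_norm.1 hw
      rcases h.mem_cases (⟨by rw [hw']; exact hδρ, by rw [hw']; exact hρ1⟩ : w ∈ ann δ 1)
        with h3 | h3 | h3
      · exact Or.inl ⟨Or.inl h3, hw⟩
      · exact Or.inr ⟨Or.inl h3, hw⟩
      · exact Or.inl ⟨Or.inr h3, hw⟩
    · rintro (h3 | h3)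
      exacts [h3.2, h3.2]
  set T : ℂ → ℂ := fun w => if w ∈ D ∪ (F₁ ∪ F₂) then SD w else S w
  have hT₁ : ∀ w ∈ B₁, T w = SD w := fun w hw => if_pos hw.1
  have hT₂ : ∀ w ∈ B₂, T w = S w := by
    rintro w ⟨h3, h4⟩
    by_cases h5 : w ∈ D ∪ (F₁ ∪ F₂)
    · have h6 : w ∈ F₁ ∪ F₂ := by
        rcases h3 with h3 | h3
        · exact h5.resolve_left fun hD => disjoint_left.1 h.disjDE hD h3
        · exact h3
      simp only [T, if_pos h5]
      exact hSA (hFA ⟨h6, h4⟩)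
    · simp only [T, if_neg h5]
  refine not_exists_continuous_sqrt_circle hρ0 (S := T) ?_ ?_
  · rw [hB]
    exact ContinuousOn.union_of_isClosed ((hSD.mono inter_subset_left).congr hT₁)
      ((hS.mono hB₂X).congr hT₂) hB₁ hB₂
  · intro w hw
    rw [hB] at hw
    rcases hw with hw | hw
    · rw [hT₁ w hw]; exact hSD2 w hw.1
    · rw [hT₂ w hw]; exact hS2 w (hB₂X hw)

end Potential

/-- A crosscut `Γ` on the circle of radius `2 * δ`, joining `y₁ ∈ F₁` to `y₂ ∈ F₂` in `D` and
dividing `D` into an outer part `G` and an inner part `L`. -/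
structure Cut (δ : ℝ) (D E F₁ F₂ : Set ℂ) (f W : ℂ → ℂ) (y₁ y₂ : ℂ) (Γ G L : Set ℂ) : Prop
    extends Potential δ D E F₁ F₂ f W where
  two_lt : 2 * δ < 1
  arc : ∃ α β : ℝ, α < β ∧ β ≤ α + 2 * Real.pi ∧ Γ = cir (2 * δ) '' Icc α β ∧
    ∀ θ ∈ Ioo α β, cir (2 * δ) θ ∈ D
  subΓ : Γ ⊆ D ∪ {y₁, y₂}
  memF₁ : y₁ ∈ F₁
  memF₂ : y₂ ∈ F₂
  memΓ₁ : y₁ ∈ Γ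
  memΓ₂ : y₂ ∈ Γ
  openG : IsOpen G
  openL : IsOpen L
  disjGL : Disjoint G L
  union_GL : G ∪ L = D \ Γ
  innerG : ∃ a, δ < a ∧ a < 2 * δ ∧ ∀ z ∈ G, a < ‖z‖
  outerL : ∃ b, b < 1 ∧ ∀ z ∈ L, ‖z‖ < b

theorem Potential.exists_cut {δ : ℝ} {D E F₁ F₂ : Set ℂ} {f W : ℂ → ℂ}
    (h : Potential δ D E F₁ F₂ f W) (hδ : 2 * δ < 1) :
    ∃ y₁ y₂ Γ G L, Cut δ D E F₁ F₂ f W y₁ y₂ Γ G L := by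
  have hδρ : δ < 2 * δ := by linarith [h.pos]
  obtain ⟨α, β, hαβ, hβ, harc, hends⟩ := h.exists_crosscut hδρ hδ
  set Γ := cir (2 * δ) '' Icc α β with hΓ
  have hαm : cir (2 * δ) α ∈ Γ := ⟨α, ⟨le_rfl, hαβ.le⟩, rfl⟩
  have hβm : cir (2 * δ) β ∈ Γ := ⟨β, ⟨hαβ.le, le_rfl⟩, rfl⟩
  have hsub : ∀ z ∈ Γ, z ∈ D ∨ z = cir (2 * δ) α ∨ z = cir (2 * δ) β := by
    rintro _ ⟨θ, hθ, rfl⟩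
    rcases hθ.1.eq_or_lt with h1 | h1
    · exact Or.inr (Or.inl (by rw [h1]))
    · rcases hθ.2.eq_or_lt with h2 | h2
      · exact Or.inr (Or.inr (by rw [h2]))
      · exact Or.inl (harc θ ⟨h1, h2⟩)
  obtain ⟨y₁, y₂, hy₁, hy₂, hy₁Γ, hy₂Γ, hΓsub⟩ : ∃ y₁ y₂, y₁ ∈ F₁ ∧ y₂ ∈ F₂ ∧ y₁ ∈ Γ ∧ y₂ ∈ Γ ∧
      Γ ⊆ D ∪ {y₁, y₂} := by
    rcases hends with ⟨h1, h2⟩ | ⟨h1, h2⟩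
    · exact ⟨_, _, h1, h2, hαm, hβm, fun z hz => hsub z hz⟩
    · refine ⟨_, _, h2, h1, hβm, hαm, fun z hz => ?_⟩
      rcases hsub z hz with h3 | h3 | h3
      exacts [Or.inl h3, Or.inr (Or.inr h3), Or.inr (Or.inl h3)]
  have hΓc : IsCompact Γ := isCompact_Icc.image (continuous_cir _)
  have hΓs : Γ ⊆ sphere 0 (2 * δ) := by
    rintro _ ⟨θ, -, rfl⟩
    exact mem_sphere_zero_iff_norm.2 (norm_cir (by linarith [h.pos]) θ)
  have hΓD : Γ ⊆ D ∪ (F₁ ∪ F₂) := fun z hz => by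
    rcases hΓsub hz with h1 | h1 | h1
    · exact Or.inl h1
    · exact Or.inr (Or.inl (h1 ▸ hy₁))
    · exact Or.inr (Or.inr (h1 ▸ hy₂))
  obtain ⟨a, b, ha1, ha2, hb1, hb2, hsep⟩ := h.exists_separation hδρ hδ hΓc
    (isPreconnected_Icc.image _ (continuous_cir _).continuousOn) hΓs hΓD ⟨hy₁, hy₁Γ⟩ ⟨hy₂, hy₂Γ⟩
  have hDΓ : IsOpen (D \ Γ) := h.openD.sdiff hΓc.isClosed
  set p : Set ℂ → Prop := fun C => ∃ z' ∈ C, b ≤ ‖z'‖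
  refine ⟨y₁, y₂, Γ, {z ∈ D \ Γ | p (connectedComponentIn (D \ Γ) z)},
    {z ∈ D \ Γ | ¬ p (connectedComponentIn (D \ Γ) z)}, { h with
      two_lt := hδ
      arc := ⟨α, β, hαβ, hβ, rfl, harc⟩
      subΓ := hΓsub
      memF₁ := hy₁
      memF₂ := hy₂
      memΓ₁ := hy₁Γ
      memΓ₂ := hy₂Γ
      openG := isOpen_setOf_connectedComponentIn hDΓ p
      openL := isOpen_setOf_connectedComponentIn hDΓ fun C => ¬ p C
      disjGL := disjoint_left.2 fun z hz hz' => hz'.2 hz.2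
      union_GL := ?_
      innerG := ⟨a, ha1, ha2, ?_⟩
      outerL := ⟨b, hb2, ?_⟩ }⟩
  · ext z
    constructor
    · rintro (h1 | h1)
      exacts [h1.1, h1.1]
    · intro h1
      by_cases h2 : p (connectedComponentIn (D \ Γ) z)
      exacts [Or.inl ⟨h1, h2⟩, Or.inr ⟨h1, h2⟩]
  · rintro z ⟨hz, z', hz', hzb⟩
    by_contra! hza
    exact absurd (hsep z hz hza z' hz') (not_lt.2 hzb)
  · rintro z ⟨hz, hn⟩
    by_contra! hzb
    exact hn ⟨z, mem_connectedComponentIn hz, hzb⟩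

namespace Cut

variable {δ : ℝ} {D E F₁ F₂ : Set ℂ} {f W : ℂ → ℂ} {y₁ y₂ : ℂ} {Γ G L : Set ℂ}

lemma swap (h : Cut δ D E F₁ F₂ f W y₁ y₂ Γ G L) : Cut δ D E F₂ F₁ f W y₂ y₁ Γ G L :=
  { h.toPotential.swap with
    two_lt := h.two_lt
    arc := h.arc
    subΓ := by rw [pair_comm]; exact h.subΓ
    memF₁ := h.memF₂
    memF₂ := h.memF₁
    memΓ₁ := h.memΓ₂
    memΓ₂ := h.memΓ₁
    openG := h.openG
    openL := h.openL
    disjGL := h.disjGL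
    union_GL := h.union_GL
    innerG := h.innerG
    outerL := h.outerL }

lemma isCompactΓ (h : Cut δ D E F₁ F₂ f W y₁ y₂ Γ G L) : IsCompact Γ := by
  obtain ⟨α, β, -, -, rfl, -⟩ := h.arc
  exact isCompact_Icc.image (continuous_cir _)

lemma norm_Γ (h : Cut δ D E F₁ F₂ f W y₁ y₂ Γ G L) {z : ℂ} (hz : z ∈ Γ) : ‖z‖ = 2 * δ := by
  obtain ⟨α, β, -, -, rfl, -⟩ := h.arc
  obtain ⟨θ, -, rfl⟩ := hz
  exact norm_cir (by linarith [h.pos]) θ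

lemma subΓ' (h : Cut δ D E F₁ F₂ f W y₁ y₂ Γ G L) : Γ ⊆ D ∪ (F₁ ∪ F₂) := fun z hz => by
  rcases h.subΓ hz with h1 | h1 | h1
  · exact Or.inl h1
  · exact Or.inr (Or.inl (h1 ▸ h.memF₁))
  · exact Or.inr (Or.inr (h1 ▸ h.memF₂))

lemma G_subset (h : Cut δ D E F₁ F₂ f W y₁ y₂ Γ G L) : G ⊆ D := fun z hz => by
  have : z ∈ G ∪ L := Or.inl hz
  rw [h.union_GL] at this
  exact this.1

lemma L_subset (h : Cut δ D E F₁ F₂ f W y₁ y₂ Γ G L) : L ⊆ D := fun z hz => by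
  have : z ∈ G ∪ L := Or.inr hz
  rw [h.union_GL] at this
  exact this.1

lemma mem_GL (h : Cut δ D E F₁ F₂ f W y₁ y₂ Γ G L) {z : ℂ} (hz : z ∈ D) (hΓ : z ∉ Γ) :
    z ∈ G ∨ z ∈ L := by
  have : z ∈ D \ Γ := ⟨hz, hΓ⟩
  rw [← h.union_GL] at this
  exact this

lemma subset_or (h : Cut δ D E F₁ F₂ f W y₁ y₂ Γ G L) {C : Set ℂ} (hC : IsPreconnected C)
    (hCD : C ⊆ D \ Γ) : C ⊆ G ∨ C ⊆ L := by
  rw [← h.union_GL] at hCD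
  exact hC.subset_or_subset h.openG h.openL h.disjGL hCD

/-- A free boundary point off the crosscut is adjacent to only one of the two parts. -/
lemma adjacent (h : Cut δ D E F₁ F₂ f W y₁ y₂ Γ G L) {y : ℂ} (hy : y ∈ F₁ ∪ F₂) (hyΓ : y ∉ Γ) :
    ∃ r > 0, D ∩ ball y r ⊆ G ∨ D ∩ ball y r ⊆ L := by
  obtain ⟨r₁, hr₁, hb₁⟩ := Metric.isOpen_iff.1 h.isCompactΓ.isClosed.isOpen_compl y hyΓ
  obtain ⟨r, hr, C, hC, hCp, hCs⟩ := h.locD y hy r₁ hr₁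
  refine ⟨r, hr, ?_⟩
  rcases h.subset_or hCp (fun z hz => ⟨(hC hz).1, hb₁ (hC hz).2⟩) with h1 | h1
  · exact Or.inl (hCs.trans h1)
  · exact Or.inr (hCs.trans h1)

lemma mem_closure_of_ball (h : Cut δ D E F₁ F₂ f W y₁ y₂ Γ G L) {y y' : ℂ} {X : Set ℂ} {r : ℝ}
    (hb : D ∩ ball y r ⊆ X) (hy' : y' ∈ F₁ ∪ F₂) (hyy' : y' ∈ ball y r) : y' ∈ closure X := by
  rw [mem_closure_iff_nhds]
  intro t ht
  obtain ⟨z, hz, hzD⟩ := mem_closure_iff_nhds.1 (h.clD hy') _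
    (inter_mem ht (isOpen_ball.mem_nhds hyy'))
  exact ⟨z, hz.1, hb ⟨hzD, hz.2⟩⟩

lemma notMem_closure_of_ball (h : Cut δ D E F₁ F₂ f W y₁ y₂ Γ G L) {y y' : ℂ} {r : ℝ}
    (hb : D ∩ ball y r ⊆ L) (hyy' : y' ∈ ball y r) : y' ∉ closure G := by
  intro hc
  obtain ⟨z, hz, hzG⟩ := mem_closure_iff_nhds.1 hc _ (isOpen_ball.mem_nhds hyy')
  exact disjoint_left.1 h.disjGL hzG (hb ⟨h.G_subset hzG, hz⟩)

lemma eventually_mem_closure_iff (h : Cut δ D E F₁ F₂ f W y₁ y₂ Γ G L) {M : Set ℂ}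
    (hM : M ⊆ F₁ ∪ F₂) {y : ℂ} (hy : y ∈ M) (hyΓ : y ∉ Γ) :
    ∀ᶠ y' in 𝓝[M] y, (y' ∈ closure G ↔ y ∈ closure G) := by
  obtain ⟨r, hr, hb⟩ := h.adjacent (hM hy) hyΓ
  filter_upwards [self_mem_nhdsWithin, mem_nhdsWithin_of_mem_nhds (ball_mem_nhds y hr)]
    with y' h1 h2
  rcases hb with hb | hb
  · exact iff_of_true (h.mem_closure_of_ball hb (hM h1) h2)
      (h.mem_closure_of_ball hb (hM hy) (mem_ball_self hr))
  · exact iff_of_false (h.notMem_closure_of_ball hb h2)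
      (h.notMem_closure_of_ball hb (mem_ball_self hr))

lemma notMem_Γ_of_ne (h : Cut δ D E F₁ F₂ f W y₁ y₂ Γ G L) {y : ℂ} (hy : y ∈ F₁) (hne : y ≠ y₁) :
    y ∉ Γ := by
  intro hΓ
  rcases h.subΓ hΓ with h1 | h1 | h1
  · exact h.notMem_F h1 (Or.inl hy)
  · exact hne h1
  · exact disjoint_left.1 h.disjF hy (h1 ▸ h.memF₂)

/-- The part of `F₁` adjacent to `G` is one of the two halves of `F₁` beyond `y₁`, and it is
long. -/
lemma one_sided (h : Cut δ D E F₁ F₂ f W y₁ y₂ Γ G L) : ∃ τ : ℝ, (τ = 1 ∨ τ = -1) ∧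
    (∀ y ∈ F₁, y ∈ closure G → 0 ≤ τ * ((W y).im - (W y₁).im)) ∧
    ∀ t, 0 < t → t < 1 - 2 * δ → ∃ y ∈ F₁, y ∈ closure G ∧ (W y).im - (W y₁).im = τ * t := by
  set s : ℂ → ℝ := fun z => (W z).im
  have hd : ∀ y ∈ F₁, ∀ y' ∈ F₁, dist y y' ≤ |s y - s y'| := fun y hy y' hy' => h.dist_le₁ hy hy'
  have hhalf : ∀ J : Set ℝ, J.OrdConnected → s y₁ ∉ J → ∀ x ∈ F₁, s x ∈ J → ∀ y ∈ F₁, s y ∈ J →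
      (x ∈ closure G ↔ y ∈ closure G) := by
    intro J hJ hJ1 x hx hxJ y hy hyJ
    refine (isPreconnected_arc h.conn₁ h.continuousOn_im hd hJ).iff_of_eventually_iff
      (p := fun y => y ∈ closure G) (fun z hz => ?_) ⟨hx, hxJ⟩ ⟨hy, hyJ⟩
    exact h.eventually_mem_closure_iff (fun w hw => Or.inl hw.1) hz
      (h.notMem_Γ_of_ne hz.1 fun hz1 => hJ1 (hz1 ▸ hz.2))
  obtain ⟨a, ha, ha2, haG⟩ := h.innerG
  obtain ⟨b, hb, hbL⟩ := h.outerL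
  -- a point of `F₁` near the inner circle
  obtain ⟨p, hp, hpa, hpG⟩ : ∃ p ∈ F₁, ‖p‖ < a ∧ p ∉ closure G := by
    obtain ⟨q, hq, hqs⟩ := h.inner₁
    rw [mem_sphere_zero_iff_norm] at hqs
    obtain ⟨p, hp1, hp2⟩ := mem_closure_iff.1 hq {z | ‖z‖ < a}
      (isOpen_lt continuous_norm continuous_const)
      (show ‖q‖ < a by rw [hqs]; exact ha)
    refine ⟨p, hp2, hp1, fun hc => ?_⟩
    obtain ⟨z, hz1, hz2⟩ := mem_closure_iff.1 hc {z | ‖z‖ < a}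
      (isOpen_lt continuous_norm continuous_const) hp1
    have hz1' : ‖z‖ < a := hz1
    exact absurd (haG z hz2) (not_lt.2 hz1'.le)
  have houter : ∀ t, 0 ≤ t → t < 1 - 2 * δ → ∃ q ∈ F₁, q ∈ closure G ∧ t < |s q - s y₁| := by
    intro t ht0 ht
    obtain ⟨q, hq, hqs⟩ := h.outer₁
    rw [mem_sphere_zero_iff_norm] at hqs
    have hmax : max b (t + 2 * δ) < 1 := max_lt hb (by linarith)
    obtain ⟨p, hp1, hp2⟩ := mem_closure_iff.1 hq {z | max b (t + 2 * δ) < ‖z‖}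
      (isOpen_lt continuous_const continuous_norm)
      (show max b (t + 2 * δ) < ‖q‖ by rw [hqs]; exact hmax)
    have hp1' : max b (t + 2 * δ) < ‖p‖ := hp1
    refine ⟨p, hp2, ?_, ?_⟩
    · have hpcl := h.clD (Or.inl hp2)
      rw [_root_.mem_closure_iff] at hpcl ⊢
      intro o ho hpo
      have hpΓ : p ∉ Γ := by
        refine h.notMem_Γ_of_ne hp2 fun hpy => ?_
        subst hpy
        rw [h.norm_Γ h.memΓ₁] at hp1'
        linarith [le_max_right b (t + 2 * δ)]
      obtain ⟨z, hz1, hz2⟩ := hpcl (o ∩ ({z | max b (t + 2 * δ) < ‖z‖} ∩ Γᶜ))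
        (ho.inter ((isOpen_lt continuous_const continuous_norm).inter
          h.isCompactΓ.isClosed.isOpen_compl)) ⟨hpo, hp1, hpΓ⟩
      refine ⟨z, hz1.1, (h.mem_GL hz2 hz1.2.2).resolve_right fun hL => ?_⟩
      have h3 : max b (t + 2 * δ) < ‖z‖ := hz1.2.1
      exact absurd (hbL z hL) (not_lt.2 ((le_max_left _ _).trans h3.le))
    · have h1 := hd p hp2 y₁ h.memF₁
      have h2 := norm_sub_norm_le p y₁
      rw [h.norm_Γ h.memΓ₁, ← dist_eq_norm] at h2
      have h3 := le_max_right b (t + 2 * δ)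
      linarith
  have hinj : ∀ y ∈ F₁, y ≠ y₁ → s y ≠ s y₁ := fun y hy hne hs => by
    have := hd y hy y₁ h.memF₁
    rw [hs, sub_self, abs_zero] at this
    exact hne (dist_le_zero.1 this)
  have hpy : p ≠ y₁ := fun hpy => by
    rw [hpy, h.norm_Γ h.memΓ₁] at hpa
    linarith
  have hoc : (s '' F₁).OrdConnected := (h.conn₁.image s h.continuousOn_im).ordConnected
  rcases lt_or_gt_of_ne (hinj p hp hpy) with hlt | hgt
  · have hno : ∀ y ∈ F₁, y ∈ closure G → s y₁ ≤ s y := fun y hy hyG => by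
      by_contra! hcon
      exact hpG ((hhalf (Iio (s y₁)) ordConnected_Iio self_notMem_Iio y hy hcon p hp hlt).1 hyG)
    refine ⟨1, Or.inl rfl, fun y hy hyG => by linarith [hno y hy hyG], fun t ht0 ht => ?_⟩
    obtain ⟨q, hq, hqG, hqt⟩ := houter t ht0.le ht
    rw [abs_of_nonneg (by linarith [hno q hq hqG])] at hqt
    obtain ⟨y, hy, hys⟩ := hoc.out ⟨y₁, h.memF₁, rfl⟩ ⟨q, hq, rfl⟩
      (⟨by linarith, by linarith⟩ : s y₁ + t ∈ Icc (s y₁) (s q))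
    refine ⟨y, hy, (hhalf (Ioi (s y₁)) ordConnected_Ioi self_notMem_Ioi q hq
      (show s y₁ < s q by linarith) y hy (show s y₁ < s y by linarith)).1 hqG, ?_⟩
    change s y - s y₁ = 1 * t
    linarith
  · have hno : ∀ y ∈ F₁, y ∈ closure G → s y ≤ s y₁ := fun y hy hyG => by
      by_contra! hcon
      exact hpG ((hhalf (Ioi (s y₁)) ordConnected_Ioi self_notMem_Ioi y hy hcon p hp hgt).1 hyG)
    refine ⟨-1, Or.inr rfl, fun y hy hyG => by linarith [hno y hy hyG], fun t ht0 ht => ?_⟩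
    obtain ⟨q, hq, hqG, hqt⟩ := houter t ht0.le ht
    rw [abs_of_nonpos (by linarith [hno q hq hqG])] at hqt
    obtain ⟨y, hy, hys⟩ := hoc.out ⟨q, hq, rfl⟩ ⟨y₁, h.memF₁, rfl⟩
      (⟨by linarith, by linarith⟩ : s y₁ - t ∈ Icc (s q) (s y₁))
    refine ⟨y, hy, (hhalf (Iio (s y₁)) ordConnected_Iio self_notMem_Iio q hq
      (show s q < s y₁ by linarith) y hy (show s y < s y₁ by linarith)).1 hqG, ?_⟩
    change s y - s y₁ = -1 * t
    linarith

end Cut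

/-! ### Universal gradient bound -/

/-- Gronwall's inequality in both directions. -/
lemma norm_le_exp_mul_of_norm_deriv_le {A A' : ℝ → ℂ} {a b K : ℝ} (hab : a ≤ b)
    (hA : ∀ t ∈ Icc a b, HasDerivAt A (A' t) t) (hK : ∀ t ∈ Icc a b, ‖A' t‖ ≤ K * ‖A t‖) :
    ‖A b‖ ≤ ‖A a‖ * Real.exp (K * (b - a)) ∧ ‖A a‖ ≤ ‖A b‖ * Real.exp (K * (b - a)) := by
  constructor
  · have := norm_le_gronwallBound_of_norm_deriv_right_le (f := A) (f' := A') (δ := ‖A a‖) (K := K)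
      (ε := 0) (a := a) (b := b) (fun t ht => (hA t ht).continuousAt.continuousWithinAt)
      (fun t ht => (hA t (Ico_subset_Icc_self ht)).hasDerivWithinAt) le_rfl
      (fun t ht => by rw [add_zero]; exact hK t (Ico_subset_Icc_self ht)) b ⟨hab, le_rfl⟩
    rwa [gronwallBound_ε0] at this
  · have hmem : ∀ t ∈ Icc a b, a + b - t ∈ Icc a b := fun t ht =>
      ⟨by linarith [ht.2], by linarith [ht.1]⟩
    have hder : ∀ t ∈ Icc a b, HasDerivAt (fun t => A (a + b - t)) (-A' (a + b - t)) t := by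
      intro t ht
      have h1 : HasDerivAt (fun t : ℝ => a + b - t) (-1) t := (hasDerivAt_id t).const_sub (a + b)
      have := (hA _ (hmem t ht)).scomp t h1
      rw [neg_one_smul] at this
      exact this
    have := norm_le_gronwallBound_of_norm_deriv_right_le (f := fun t => A (a + b - t))
      (f' := fun t => -A' (a + b - t)) (δ := ‖A b‖) (K := K)
      (ε := 0) (a := a) (b := b) (fun t ht => (hder t ht).continuousAt.continuousWithinAt)
      (fun t ht => (hder t (Ico_subset_Icc_self ht)).hasDerivWithinAt)
      (by simp)
      (fun t ht => by rw [add_zero, norm_neg]; exact hK _ (hmem t (Ico_subset_Icc_self ht)))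
      b ⟨hab, le_rfl⟩
    rwa [gronwallBound_ε0, show a + b - b = a by ring] at this

lemma hasDerivAt_cir (ρ θ : ℝ) : HasDerivAt (cir ρ) (cir ρ θ * I) θ := by
  have h1 : HasDerivAt (fun θ : ℝ => (θ : ℂ) * I) I θ := by
    simpa using ((hasDerivAt_id (θ : ℂ)).comp_ofReal).mul_const I
  have h2 := (h1.cexp).const_mul (ρ : ℂ)
  rw [← mul_assoc] at h2
  exact h2

/-- The universal bound for the gradient. -/
noncomputable def gradBound : ℝ := 4 * Real.exp (16 * Real.pi)

lemma four_le_gradBound : 4 ≤ gradBound := by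
  have : 1 ≤ Real.exp (16 * Real.pi) := Real.one_le_exp (by positivity)
  unfold gradBound
  linarith

namespace Potential

variable {δ : ℝ} {D E F₁ F₂ : Set ℂ} {f W : ℂ → ℂ}

lemma F_nonempty (h : Potential δ D E F₁ F₂ f W) : (F₁ ∪ F₂).Nonempty := by
  obtain ⟨m, hm1, hm2⟩ := exists_between h.lt_one
  obtain ⟨y, hy, -⟩ := h.exists_norm_eq hm1 hm2
  exact ⟨y, Or.inl hy⟩

lemma infDist_pos (h : Potential δ D E F₁ F₂ f W) {z : ℂ} (hz : z ∈ D) :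
    0 < infDist z (F₁ ∪ F₂) := by
  obtain ⟨r, hr, hb⟩ := Metric.isOpen_iff.1 h.openD z hz
  refine lt_of_lt_of_le hr ?_
  rw [le_infDist h.F_nonempty]
  intro y hy
  by_contra! hlt
  exact h.notMem_F (hb (by rw [mem_ball, dist_comm]; exact hlt)) hy

lemma subset_D (h : Potential δ D E F₁ F₂ f W) {C : Set ℂ} (hC : IsPreconnected C)
    (hCa : C ⊆ ann δ 1) (hF : Disjoint C (F₁ ∪ F₂)) {z : ℂ} (hz : z ∈ C) (hzD : z ∈ D) : C ⊆ D := by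
  have hcov : C ⊆ D ∪ E := fun w hw => by
    rcases h.mem_cases (hCa hw) with h1 | h1 | h1
    · exact Or.inl h1
    · exact Or.inr h1
    · exact absurd h1 (disjoint_left.1 hF hw)
  rcases hC.subset_or_subset h.openD h.openE h.disjDE hcov with h1 | h1
  · exact h1
  · exact absurd (h1 hz) (disjoint_left.1 h.disjDE hzD)

lemma ball_subset (h : Potential δ D E F₁ F₂ f W) {z : ℂ} (hz : z ∈ D) {d : ℝ} (hd : 0 < d)
    (h1 : d ≤ infDist z (F₁ ∪ F₂)) (h2 : d ≤ ‖z‖ - δ) (h3 : d ≤ 1 - ‖z‖) : ball z d ⊆ D := by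
  refine h.subset_D (convex_ball z d).isPreconnected (fun w hw => ?_) ?_ (mem_ball_self hd) hz
  · rw [mem_ball, dist_eq_norm] at hw
    have a1 := norm_sub_norm_le w z
    have a2 := norm_sub_norm_le z w
    rw [norm_sub_rev] at a2
    exact ⟨by linarith, by linarith⟩
  · rw [disjoint_left]
    intro w hw hF
    have := infDist_le_dist_of_mem (x := z) hF
    rw [mem_ball, dist_comm] at hw
    linarith

lemma exists_nearest (h : Potential δ D E F₁ F₂ f W) {z : ℂ} {κ : ℝ}
    (hd : infDist z (F₁ ∪ F₂) < κ) (h2 : κ < ‖z‖ - δ) (h3 : κ < 1 - ‖z‖) :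
    ∃ y ∈ F₁ ∪ F₂, dist y z = infDist z (F₁ ∪ F₂) := by
  have hK : closedBall z κ ⊆ ann δ 1 := fun w hw => by
    rw [mem_closedBall, dist_eq_norm] at hw
    have a1 := norm_sub_norm_le w z
    have a2 := norm_sub_norm_le z w
    rw [norm_sub_rev] at a2
    exact ⟨by linarith, by linarith⟩
  have hFK : IsCompact ((F₁ ∪ F₂) ∩ closedBall z κ) := by
    have e : (F₁ ∪ F₂) ∩ closedBall z κ =
        ((D ∪ (F₁ ∪ F₂)) ∩ closedBall z κ) ∩ ((E ∪ (F₁ ∪ F₂)) ∩ closedBall z κ) := by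
      ext w
      have hDE := fun hD : w ∈ D => disjoint_left.1 h.disjDE hD
      simp only [mem_inter_iff, mem_union] at hDE ⊢
      tauto
    rw [e]
    exact (h.isCompact_inter hK (isCompact_closedBall z κ)).inter
      (h.toTwoArcs.symm.isCompact_inter hK (isCompact_closedBall z κ))
  obtain ⟨y₀, hy₀, hy₀d⟩ := (infDist_lt_iff h.F_nonempty).1 hd
  obtain ⟨y, hy, hymin⟩ := hFK.exists_isMinOn
    ⟨y₀, hy₀, by rw [mem_closedBall, dist_comm]; exact hy₀d.le⟩
    (f := fun y => dist z y) (by fun_prop)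
  refine ⟨y, hy.1, ?_⟩
  rw [dist_comm]
  refine le_antisymm ?_ (infDist_le_dist_of_mem hy.1)
  rw [le_infDist h.F_nonempty]
  intro w hw
  by_cases hwK : w ∈ closedBall z κ
  · exact hymin ⟨hw, hwK⟩
  · rw [mem_closedBall, not_le, dist_comm] at hwK
    have := hy.2
    rw [mem_closedBall, dist_comm] at this
    linarith

/-- Move along a circle to a point at a given distance from the free boundary; the modulus of
`W + i c` changes by a bounded factor only. -/
lemma exists_chain (h : Potential δ D E F₁ F₂ f W) {z : ℂ} (hz : z ∈ D) {η : ℝ} (hη : 0 < η)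
    (h1 : η ≤ infDist z (F₁ ∪ F₂)) (h2 : η ≤ ‖z‖ - δ) (h3 : η ≤ 1 - ‖z‖) :
    ∃ z' ∈ D, ‖z'‖ = ‖z‖ ∧ infDist z' (F₁ ∪ F₂) = η ∧ ∀ c : ℝ,
      ‖W z + c * I‖ ≤ ‖W z' + c * I‖ * Real.exp (4 * Real.pi * ‖z‖ / η) ∧
      ‖W z' + c * I‖ ≤ ‖W z + c * I‖ * Real.exp (4 * Real.pi * ‖z‖ / η) := by
  set ρ := ‖z‖
  have hρδ : δ < ρ := (h.D_subset hz).1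
  have hρ1 : ρ < 1 := (h.D_subset hz).2
  have hρ0 : 0 < ρ := h.pos.trans hρδ
  obtain ⟨θ₀, hθ₀⟩ := exists_cir_eq z
  obtain ⟨y, hy, hyn⟩ := h.exists_norm_eq hρδ hρ1
  obtain ⟨θ', hθ'⟩ := exists_cir_eq y
  rw [hyn] at hθ'
  have hper : Function.Periodic (cir ρ) (2 * Real.pi) := cir_add_two_pi ρ
  obtain ⟨θ₁, ⟨hθ₁a, hθ₁b⟩, hθ₁⟩ := hper.exists_mem_Ico Real.two_pi_pos θ' θ₀
  set g : ℝ → ℝ := fun t => infDist (cir ρ t) (F₁ ∪ F₂)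
  have hg : Continuous g := (continuous_infDist_pt _).comp (continuous_cir ρ)
  have hg1 : g θ₁ = 0 := by
    simp only [g]
    rw [← hθ₁, hθ']
    exact infDist_zero_of_mem (Or.inl hy)
  set S : Set ℝ := Icc θ₀ θ₁ ∩ g ⁻¹' Iic η
  have hSc : IsCompact S := isCompact_Icc.inter_right (isClosed_Iic.preimage hg)
  obtain ⟨t, ht, htmin⟩ := hSc.exists_isLeast ⟨θ₁, ⟨hθ₁a, le_rfl⟩, by
    change g θ₁ ≤ η; rw [hg1]; exact hη.le⟩
  have hbig : ∀ s ∈ Ico θ₀ t, η < g s := fun s hs => by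
    by_contra! hcon
    exact absurd (htmin ⟨⟨hs.1, hs.2.le.trans ht.1.2⟩, hcon⟩) (not_le.2 hs.2)
  have hgt : g t = η := by
    refine le_antisymm ht.2 ?_
    rcases ht.1.1.eq_or_lt with h4 | h4
    · rw [← h4]; simp only [g]; rw [hθ₀]; exact h1
    · have : t ∈ closure (Ico θ₀ t) := by rw [closure_Ico h4.ne]; exact ⟨h4.le, le_rfl⟩
      exact closure_minimal (fun s hs => (hbig s hs).le) (isClosed_Ici.preimage hg) this
  have hge : ∀ s ∈ Icc θ₀ t, η ≤ g s := fun s hs => by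
    rcases hs.2.eq_or_lt with h4 | h4
    · rw [h4, hgt]
    · exact (hbig s ⟨hs.1, h4⟩).le
  have hD : ∀ s ∈ Icc θ₀ t, cir ρ s ∈ D := by
    have hsub := h.subset_D (C := cir ρ '' Icc θ₀ t)
      (isPreconnected_Icc.image _ (continuous_cir ρ).continuousOn) (by
        rintro _ ⟨s, -, rfl⟩
        exact ⟨by rw [norm_cir hρ0.le]; exact hρδ, by rw [norm_cir hρ0.le]; exact hρ1⟩) (by
        rw [disjoint_left]
        rintro _ ⟨s, hs, rfl⟩ hF
        have h4 := hge s hs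
        simp only [g] at h4
        rw [infDist_zero_of_mem hF] at h4
        linarith) ⟨θ₀, ⟨le_rfl, ht.1.1⟩, hθ₀⟩ hz
    exact fun s hs => hsub ⟨s, hs, rfl⟩
  have hbound : ∀ s ∈ Icc θ₀ t, ‖f (cir ρ s)‖ ≤ 2 * (W (cir ρ s)).re / η := fun s hs =>
    h.norm_f_le hη (h.ball_subset (hD s hs) hη (hge s hs) (by rw [norm_cir hρ0.le]; exact h2)
      (by rw [norm_cir hρ0.le]; exact h3))
  refine ⟨cir ρ t, hD t ⟨ht.1.1, le_rfl⟩, norm_cir hρ0.le t, hgt, fun c => ?_⟩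
  have key := norm_le_exp_mul_of_norm_deriv_le (A := fun s => W (cir ρ s) + c * I)
    (A' := fun s => cir ρ s * I * f (cir ρ s)) (K := 2 * ρ / η) ht.1.1
    (fun s hs => by
      have := (h.derivW _ (hD s hs)).scomp s (hasDerivAt_cir ρ s)
      rw [smul_eq_mul] at this
      exact this.add_const _)
    (fun s hs => by
      rw [norm_mul, norm_mul, norm_cir hρ0.le, norm_I, mul_one]
      have h4 := hbound s hs
      have h5 : (W (cir ρ s)).re ≤ ‖W (cir ρ s) + c * I‖ := by
        have := Complex.abs_re_le_norm (W (cir ρ s) + c * I)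
        simp only [add_re, mul_re, ofReal_re, I_re, mul_zero, ofReal_im, I_im, zero_mul,
          sub_self, add_zero] at this
        exact (le_abs_self _).trans this
      calc ρ * ‖f (cir ρ s)‖ ≤ ρ * (2 * (W (cir ρ s)).re / η) := mul_le_mul_of_nonneg_left h4 hρ0.le
        _ ≤ ρ * (2 * ‖W (cir ρ s) + c * I‖ / η) := by gcongr
        _ = 2 * ρ / η * ‖W (cir ρ s) + c * I‖ := by ring)
  have hexp : Real.exp (2 * ρ / η * (t - θ₀)) ≤ Real.exp (4 * Real.pi * ρ / η) := by
    rw [Real.exp_le_exp]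
    have h4 : t - θ₀ ≤ 2 * Real.pi := by linarith [ht.1.2]
    calc 2 * ρ / η * (t - θ₀) ≤ 2 * ρ / η * (2 * Real.pi) := by gcongr
      _ = 4 * Real.pi * ρ / η := by ring
  beta_reduce at key
  rw [show cir ρ θ₀ = z from hθ₀] at key
  exact ⟨key.2.trans (mul_le_mul_of_nonneg_left hexp (norm_nonneg _)),
    key.1.trans (mul_le_mul_of_nonneg_left hexp (norm_nonneg _))⟩

/-- The universal gradient bound away from the inner circle. -/
lemma grad_bound (h : Potential δ D E F₁ F₂ f W) {z : ℂ} (hz : z ∈ D) (h1 : 2 * δ ≤ ‖z‖)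
    (h2 : ‖z‖ ≤ 1 / 2) : ‖f z‖ ≤ gradBound ∧ (W z).re ≤ gradBound * ‖z‖ := by
  set ρ := ‖z‖ with hρ
  have hδ := h.pos
  have hρ0 : 0 < ρ := by linarith
  have near : ∀ x ∈ D, ‖x‖ = ρ → infDist x (F₁ ∪ F₂) ≤ ρ / 4 →
      (W x).re ≤ 2 * infDist x (F₁ ∪ F₂) ∧ ball x (infDist x (F₁ ∪ F₂)) ⊆ D := by
    intro x hx hxρ hxd
    have hb : ball x (infDist x (F₁ ∪ F₂)) ⊆ D :=
      h.ball_subset hx (h.infDist_pos hx) le_rfl (by rw [hxρ]; linarith) (by rw [hxρ]; linarith)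
    obtain ⟨y, hy, hyd⟩ := h.exists_nearest (z := x) (κ := ρ / 3) (by linarith)
      (by rw [hxρ]; linarith) (by rw [hxρ]; linarith)
    exact ⟨h.re_le_of_touching (h.infDist_pos hx) hb hy hyd.le, hb⟩
  by_cases hcase : infDist z (F₁ ∪ F₂) ≤ ρ / 4
  · obtain ⟨a1, a2⟩ := near z hz rfl hcase
    have hd := h.infDist_pos hz
    have a3 := h.norm_f_le hd a2
    constructor
    · refine a3.trans ?_
      rw [div_le_iff₀ hd]
      have := four_le_gradBound
      nlinarith
    · have := four_le_gradBound
      nlinarith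
  · rw [not_le] at hcase
    obtain ⟨z', hz', hz'n, hz'd, hc⟩ := h.exists_chain hz (η := ρ / 4) (by linarith) hcase.le
      (by linarith) (by linarith)
    have a1 := (near z' hz' hz'n hz'd.le).1
    rw [hz'd] at a1
    have a2 := (hc (-(W z').im)).1
    have e1 : 4 * Real.pi * ρ / (ρ / 4) = 16 * Real.pi := by field_simp; ring
    rw [← hρ, e1] at a2
    have e2 : W z' + ((-(W z').im : ℝ) : ℂ) * I = ((W z').re : ℂ) := by
      apply Complex.ext <;> simp
    rw [e2, Complex.norm_real, Real.norm_eq_abs, abs_of_pos (h.re_pos z' hz')] at a2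
    have a3 : (W z).re ≤ ‖W z + ((-(W z').im : ℝ) : ℂ) * I‖ := by
      have := Complex.abs_re_le_norm (W z + ((-(W z').im : ℝ) : ℂ) * I)
      simp only [add_re, mul_re, ofReal_re, I_re, mul_zero, ofReal_im, I_im, zero_mul,
        sub_self, add_zero] at this
      exact (le_abs_self _).trans this
    set X := Real.exp (16 * Real.pi)
    have hX : 0 < X := Real.exp_pos _
    have a4 : (W z).re ≤ 2 * (ρ / 4) * X :=
      a3.trans (a2.trans (mul_le_mul_of_nonneg_right a1 hX.le))
    have hC : gradBound = 4 * X := rfl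
    have hb : ball z (ρ / 4) ⊆ D :=
      h.ball_subset hz (by linarith) hcase.le (by linarith) (by linarith)
    have a5 := h.norm_f_le (by linarith : 0 < ρ / 4) hb
    constructor
    · refine a5.trans ?_
      rw [div_le_iff₀ (by linarith), hC]
      nlinarith
    · rw [hC]; nlinarith

/-- `W` varies at most by `gradBound * d` on a disc of radius `d` in `D` up to a touching
boundary point. -/
lemma dist_le_of_nearest (h : Potential δ D E F₁ F₂ f W) {z y : ℂ} {d : ℝ} (hd : 0 < d)
    (hb : ball z d ⊆ D) (hy : y ∈ F₁ ∪ F₂) (hyz : dist y z ≤ d) (h1 : 2 * δ + d ≤ ‖z‖)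
    (h2 : ‖z‖ + d ≤ 1 / 2) : dist (W z) (W y) ≤ gradBound * d := by
  have hball : ∀ x ∈ ball z d, ‖f x‖ ≤ gradBound := by
    intro x hx
    have hx' := hx
    rw [mem_ball, dist_eq_norm] at hx'
    have a1 := norm_sub_norm_le x z
    have a2 := norm_sub_norm_le z x
    rw [norm_sub_rev] at a2
    exact (h.grad_bound (hb hx) (by linarith) (by linarith)).1
  have hlip : ∀ x ∈ ball z d, dist (W z) (W x) ≤ gradBound * d := by
    intro x hx
    have := Convex.norm_image_sub_le_of_norm_hasDerivWithin_le (f := W) (f' := f) (s := ball z d)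
      (fun x hx => (h.derivW x (hb hx)).hasDerivWithinAt) hball (convex_ball z d)
      hx (mem_ball_self hd)
    rw [← dist_eq_norm, ← dist_eq_norm, dist_comm z x] at this
    refine this.trans (mul_le_mul_of_nonneg_left (le_of_lt hx) ?_)
    linarith [four_le_gradBound]
  have hcl : y ∈ closure (ball z d) := by
    rw [closure_ball z hd.ne']; exact hyz
  have hne := mem_closure_iff_nhdsWithin_neBot.1 hcl
  have ht : Tendsto (fun x => dist (W z) (W x)) (𝓝[ball z d] y) (𝓝 (dist (W z) (W y))) := by
    have : Tendsto W (𝓝[ball z d] y) (𝓝 (W y)) :=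
      (h.contW y (Or.inr hy)).mono_left (nhdsWithin_mono y (hb.trans subset_union_left))
    exact tendsto_const_nhds.dist this
  exact le_of_tendsto ht (by filter_upwards [self_mem_nhdsWithin] with x hx using hlip x hx)

lemma sub_const (h : Potential δ D E F₁ F₂ f W) (c : ℝ) :
    Potential δ D E F₁ F₂ f (fun z => W z - c * I) :=
  { h.toTwoArcs with
    contW := h.contW.sub continuousOn_const
    derivW := fun z hz => (h.derivW z hz).sub_const _
    re_pos := fun z hz => by simpa using h.re_pos z hz
    re_zero := fun z hz => by simpa using h.re_zero z hz
    star := fun y hy => by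
      obtain ⟨a, ha, hs⟩ := h.star y hy
      exact ⟨a, ha, fun ε hε => by
        obtain ⟨r, hr, hb⟩ := hs ε hε
        exact ⟨r, hr, fun z hz z' hz' => by rw [sub_sub_sub_cancel_right]; exact hb z hz z' hz'⟩⟩ }

end Potential

lemma eventually_norm_le_of_continuousWithinAt {X U : Set ℂ} {Q : ℂ → ℂ} {ζ : ℂ} {c ε : ℝ}
    (hQ : ContinuousWithinAt Q X ζ) (hU : U ⊆ X) (hc : ‖Q ζ‖ ≤ c) (hε : 0 < ε) :
    ∀ᶠ z in 𝓝[U] ζ, ‖Q z‖ ≤ c + ε := by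
  have h1 : Tendsto (fun z => ‖Q z‖) (𝓝[U] ζ) (𝓝 ‖Q ζ‖) :=
    (hQ.mono_left (nhdsWithin_mono ζ hU)).norm
  exact (h1.eventually_lt_const (by linarith : ‖Q ζ‖ < c + ε)).mono fun z hz => hz.le

namespace Cut

variable {δ : ℝ} {D E F₁ F₂ : Set ℂ} {f W : ℂ → ℂ} {y₁ y₂ : ℂ} {Γ G L : Set ℂ}

lemma sub_const (h : Cut δ D E F₁ F₂ f W y₁ y₂ Γ G L) (c : ℝ) :
    Cut δ D E F₁ F₂ f (fun z => W z - c * I) y₁ y₂ Γ G L :=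
  { h.toPotential.sub_const c with
    two_lt := h.two_lt
    arc := h.arc
    subΓ := h.subΓ
    memF₁ := h.memF₁
    memF₂ := h.memF₂
    memΓ₁ := h.memΓ₁
    memΓ₂ := h.memΓ₂
    openG := h.openG
    openL := h.openL
    disjGL := h.disjGL
    union_GL := h.union_GL
    innerG := h.innerG
    outerL := h.outerL }

lemma mem_of_mem_closure_G (h : Cut δ D E F₁ F₂ f W y₁ y₂ Γ G L) {z : ℂ} (hz : z ∈ closure G)
    (h1 : ‖z‖ < 1) : z ∈ G ∨ z ∈ Γ ∨ z ∈ F₁ ∪ F₂ := by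
  obtain ⟨a, ha, -, haG⟩ := h.innerG
  have h2 : a ≤ ‖z‖ := closure_minimal (fun x hx => (haG x hx).le)
    (isClosed_le continuous_const continuous_norm) hz
  rcases h.mem_union_of_mem_closure h.G_subset ⟨by linarith, h1⟩ hz with h3 | h3
  · by_cases hΓ : z ∈ Γ
    · exact Or.inr (Or.inl hΓ)
    · refine Or.inl ((h.mem_GL h3 hΓ).resolve_right fun hL => ?_)
      exact (h.disjGL.symm.closure_right h.openL).le_bot ⟨hL, hz⟩
  · exact Or.inr (Or.inr h3)

lemma mem_of_mem_closure_L (h : Cut δ D E F₁ F₂ f W y₁ y₂ Γ G L) {z : ℂ} (hz : z ∈ closure L)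
    (h1 : δ < ‖z‖) : z ∈ L ∨ z ∈ Γ ∨ z ∈ F₁ ∪ F₂ := by
  obtain ⟨b, hb, hbL⟩ := h.outerL
  have h2 : ‖z‖ ≤ b := closure_minimal (fun x hx => (hbL x hx).le)
    (isClosed_le continuous_norm continuous_const) hz
  rcases h.mem_union_of_mem_closure h.L_subset ⟨h1, by linarith⟩ hz with h3 | h3
  · by_cases hΓ : z ∈ Γ
    · exact Or.inr (Or.inl hΓ)
    · refine Or.inl ((h.mem_GL h3 hΓ).resolve_left fun hG => ?_)
      exact (h.disjGL.closure_right h.openG).le_bot ⟨hG, hz⟩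
  · exact Or.inr (Or.inr h3)

/-- The oscillation of `W` on the crosscut. -/
lemma dist_le_of_mem_Γ (h : Cut δ D E F₁ F₂ f W y₁ y₂ Γ G L) (hδ : 2 * δ ≤ 1 / 2) {z z' : ℂ}
    (hz : z ∈ Γ) (hz' : z' ∈ Γ) : dist (W z) (W z') ≤ 4 * Real.pi * gradBound * δ := by
  obtain ⟨α, β, hαβ, hβ, hΓ, hD⟩ := h.arc
  have hδ0 := h.pos
  have hC : 0 < gradBound := by linarith [four_le_gradBound]
  have hK : 0 ≤ gradBound * (2 * δ) := by positivity
  have hc : ContinuousOn (fun θ => W (cir (2 * δ) θ)) (closure (Ioo α β)) := by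
    rw [closure_Ioo hαβ.ne]
    refine h.contW.comp (continuous_cir _).continuousOn fun θ hθ => h.subΓ' ?_
    rw [hΓ]; exact ⟨θ, hθ, rfl⟩
  have hlip : LipschitzOnWith (Real.toNNReal (gradBound * (2 * δ))) (fun θ => W (cir (2 * δ) θ)) (Ioo α β) := by
    refine Convex.lipschitzOnWith_of_nnnorm_hasDerivWithin_le (𝕜 := ℝ) (convex_Ioo α β)
      (f' := fun θ => cir (2 * δ) θ * I * f (cir (2 * δ) θ)) (fun θ hθ => ?_) (fun θ hθ => ?_)
    · have := (h.derivW _ (hD θ hθ)).scomp θ (hasDerivAt_cir (2 * δ) θ)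
      rw [smul_eq_mul] at this
      exact this.hasDerivWithinAt
    · rw [← NNReal.coe_le_coe, coe_nnnorm, Real.coe_toNNReal _ hK, norm_mul, norm_mul, norm_I, mul_one,
        norm_cir (by linarith), mul_comm]
      have := (h.grad_bound (hD θ hθ) (by rw [norm_cir (by linarith)])
        (by rw [norm_cir (by linarith)]; exact hδ)).1
      gcongr
  rw [← lipschitzOnWith_closure_iff hc, closure_Ioo hαβ.ne] at hlip
  rw [hΓ] at hz hz'
  obtain ⟨θ, hθ, rfl⟩ := hz
  obtain ⟨θ', hθ', rfl⟩ := hz'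
  refine (hlip.dist_le_mul θ hθ θ' hθ').trans ?_
  rw [Real.coe_toNNReal _ hK]
  have : dist θ θ' ≤ 2 * Real.pi := (Real.dist_le_of_mem_Icc hθ hθ').trans (by linarith)
  calc gradBound * (2 * δ) * dist θ θ' ≤ gradBound * (2 * δ) * (2 * Real.pi) := by gcongr
    _ = _ := by ring

/-- The gradient bound holds on the whole of `G` away from the outer circle. -/
lemma norm_f_le_gradBound (h : Cut δ D E F₁ F₂ f W y₁ y₂ Γ G L) (hδ : 2 * δ < 1 / 2) {z : ℂ}
    (hz : z ∈ G) (hz2 : ‖z‖ < 1 / 2) : ‖f z‖ ≤ gradBound := by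
  have hsub : G ∩ ball 0 (1 / 2) ⊆ D := fun x hx => h.G_subset hx.1
  refine norm_le_of_frontier_limsup (U := G ∩ ball 0 (1 / 2)) (h.openG.inter isOpen_ball)
    (isBounded_ball.subset inter_subset_right) (h.differentiableOn_f.mono hsub) ?_
    ⟨hz, mem_ball_zero_iff.2 hz2⟩
  intro ζ hζ ε hε
  rw [(h.openG.inter isOpen_ball).frontier_eq] at hζ
  have hζ1 : ‖ζ‖ ≤ 1 / 2 := by
    have := closure_mono inter_subset_right hζ.1
    rw [closure_ball 0 (by norm_num)] at this
    exact mem_closedBall_zero_iff.1 this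
  have hD : ζ ∈ D → 2 * δ ≤ ‖ζ‖ → ∀ᶠ z in 𝓝[G ∩ ball 0 (1 / 2)] ζ, ‖f z‖ ≤ gradBound + ε :=
    fun h1 h2 => eventually_norm_le_of_continuousWithinAt
      (h.differentiableOn_f.continuousOn ζ h1) hsub (h.grad_bound h1 h2 hζ1).1 hε
  have hF : ζ ∈ F₁ ∪ F₂ → ∀ᶠ z in 𝓝[G ∩ ball 0 (1 / 2)] ζ, ‖f z‖ ≤ gradBound + ε := fun h1 => by
    obtain ⟨r, hr, -, -, hb⟩ := h.near_isometry h1 one_pos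
    filter_upwards [self_mem_nhdsWithin, mem_nhdsWithin_of_mem_nhds (ball_mem_nhds ζ hr)]
      with x hx1 hx2
    have := (hb x ⟨hsub hx1, hx2⟩).2
    linarith [four_le_gradBound]
  rcases h.mem_of_mem_closure_G (closure_mono inter_subset_left hζ.1) (by linarith)
    with h1 | h1 | h1
  · refine hD (h.G_subset h1) ?_
    by_contra! hlt
    exact hζ.2 ⟨h1, mem_ball_zero_iff.2 (by linarith)⟩
  · rcases h.subΓ' h1 with h2 | h2
    · exact hD h2 (h.norm_Γ h1).ge
    · exact hF h2
  · exact hF h1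

/-- The inner part stays close to the inner circle. -/
lemma norm_le_of_mem_L (h : Cut δ D E F₁ F₂ f W y₁ y₂ Γ G L) (hδ : 2 * δ ≤ 1 / 2) {z : ℂ}
    (hz : z ∈ L) : ‖z‖ ≤ 2 * gradBound * δ := by
  by_contra! hlt
  have hδ0 := h.pos
  have hC := four_le_gradBound
  obtain ⟨b, hb, hbL⟩ := h.outerL
  set X := L ∩ {z | 2 * δ < ‖z‖} with hX
  have hXo : IsOpen X := h.openL.inter (isOpen_lt continuous_const continuous_norm)
  have hXb : Bornology.IsBounded X := (isBounded_ball (x := (0 : ℂ)) (r := b)).subset fun x hx =>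
    mem_ball_zero_iff.2 (hbL x hx.1)
  have hXD : X ⊆ D := fun x hx => h.L_subset hx.1
  have hzX : z ∈ X := ⟨hz, show 2 * δ < ‖z‖ by nlinarith⟩
  obtain ⟨y, hyX, hymax⟩ := hXb.isCompact_closure.exists_isMaxOn ⟨z, subset_closure hzX⟩
    continuous_norm.continuousOn
  have hmax : ∀ x ∈ closure X, ‖x‖ ≤ ‖y‖ := fun x hx => hymax hx
  set R := ‖y‖ with hR
  have hRz : 2 * gradBound * δ < R := hlt.trans_le (hmax z (subset_closure hzX))
  have hR0 : 2 * δ < R := by nlinarith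
  have hcl : ∀ ζ ∈ closure X, 2 * δ ≤ ‖ζ‖ ∧ (ζ ∈ L ∨ ζ ∈ Γ ∨ ζ ∈ F₁ ∪ F₂) := by
    intro ζ hζ
    have h1 : 2 * δ ≤ ‖ζ‖ := closure_minimal (fun x hx => (show 2 * δ < ‖x‖ from hx.2).le)
      (isClosed_le continuous_const continuous_norm) hζ
    exact ⟨h1, h.mem_of_mem_closure_L (closure_mono inter_subset_left hζ) (by linarith)⟩
  have hyF : y ∈ F₁ ∪ F₂ := by
    rcases (hcl y hyX).2 with h1 | h1 | h1
    · exfalso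
      have ht : Tendsto (fun t : ℝ => (1 + t : ℂ) * y) (𝓝[>] 0) (𝓝 y) := by
        have : Continuous fun t : ℝ => (1 + t : ℂ) * y := by fun_prop
        have h2 := this.tendsto 0
        simp only [ofReal_zero, add_zero, one_mul] at h2
        exact h2.mono_left nhdsWithin_le_nhds
      obtain ⟨t, ht1, ht2⟩ := ((ht.eventually (hXo.mem_nhds ⟨h1, hR0⟩)).and
        self_mem_nhdsWithin).exists
      have ht2' : (0 : ℝ) < t := ht2
      have h3 := hmax _ (subset_closure ht1)
      rw [norm_mul, ← hR] at h3
      have h4 : ‖(1 + t : ℂ)‖ = 1 + t := by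
        rw [← ofReal_one, ← ofReal_add, Complex.norm_real, Real.norm_eq_abs,
          abs_of_pos (by linarith)]
      rw [h4] at h3
      nlinarith
    · have := h.norm_Γ h1
      linarith
    · exact h1
  -- a barrier for `Re W`
  set k := Real.log (R / (2 * δ)) / (2 * gradBound * δ) with hk
  have hRδ : gradBound < R / (2 * δ) := by rw [lt_div_iff₀ (by linarith)]; linarith
  have hlog : 13 / 10 < Real.log (R / (2 * δ)) := by
    have h1 : Real.log 4 < Real.log (R / (2 * δ)) :=
      Real.log_lt_log (by norm_num) (by linarith)
    have h2 : Real.log 4 = 2 * Real.log 2 := by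
      rw [show (4 : ℝ) = 2 ^ 2 by norm_num, Real.log_pow]; norm_num
    have := Real.log_two_gt_d9
    linarith
  have hCδ : 0 < 2 * gradBound * δ := by nlinarith
  have hk0 : 0 < k := div_pos (by linarith) hCδ
  have hkR : 13 / 10 < k * R := by
    rw [hk, div_mul_eq_mul_div, lt_div_iff₀ hCδ]
    nlinarith
  have hQ : ∀ x ∈ X, ‖Complex.exp (k * W x) * x‖ ≤ R := by
    have hcont : ContinuousOn (fun x => Complex.exp (k * W x) * x) (D ∪ (F₁ ∪ F₂)) :=
      ((continuousOn_const.mul h.contW).cexp).mul continuousOn_id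
    intro x hx
    refine norm_le_of_frontier_limsup (Q := fun x => Complex.exp (k * W x) * x) hXo hXb
      ((((differentiableOn_const _).mul (h.differentiableOn.mono hXD)).cexp).mul
        differentiableOn_id) ?_ hx
    intro ζ hζ ε hε
    rw [hXo.frontier_eq] at hζ
    have hnorm : ‖Complex.exp (k * W ζ) * ζ‖ = Real.exp (k * (W ζ).re) * ‖ζ‖ := by
      rw [norm_mul, Complex.norm_exp, re_ofReal_mul]
    obtain ⟨h1, h2⟩ := hcl ζ hζ.1
    have hFb : ζ ∈ F₁ ∪ F₂ → ‖Complex.exp (k * W ζ) * ζ‖ ≤ R := fun h3 => by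
      rw [hnorm, h.re_zero ζ h3, mul_zero, Real.exp_zero, one_mul]
      exact hmax ζ hζ.1
    have hDb : ζ ∈ D → ‖ζ‖ = 2 * δ → ‖Complex.exp (k * W ζ) * ζ‖ ≤ R := fun h3 h4 => by
      have h5 := (h.grad_bound h3 h4.ge (by linarith)).2
      rw [hnorm, h4]
      have h6 : Real.exp (k * (W ζ).re) ≤ R / (2 * δ) := by
        rw [← Real.exp_log (by linarith : 0 < R / (2 * δ)), Real.exp_le_exp]
        calc k * (W ζ).re ≤ k * (2 * gradBound * δ) :=
              mul_le_mul_of_nonneg_left (by rw [h4] at h5; linarith) hk0.le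
          _ = Real.log (R / (2 * δ)) := by rw [hk]; field_simp
      calc Real.exp (k * (W ζ).re) * (2 * δ) ≤ R / (2 * δ) * (2 * δ) := by gcongr
        _ = R := by field_simp
    have hmem : ζ ∈ D ∪ (F₁ ∪ F₂) ∧ ‖Complex.exp (k * W ζ) * ζ‖ ≤ R := by
      rcases h2 with h3 | h3 | h3
      · refine ⟨Or.inl (h.L_subset h3), hDb (h.L_subset h3) (le_antisymm ?_ h1)⟩
        by_contra! hcon
        exact hζ.2 ⟨h3, hcon⟩
      · rcases h.subΓ' h3 with h4 | h4
        · exact ⟨Or.inl h4, hDb h4 (h.norm_Γ h3)⟩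
        · exact ⟨Or.inr h4, hFb h4⟩
      · exact ⟨Or.inr h3, hFb h3⟩
    exact eventually_norm_le_of_continuousWithinAt (hcont ζ hmem.1)
      (hXD.trans subset_union_left) hmem.2 hε
  have hyΓ : y ∉ Γ := fun hc => by have := h.norm_Γ hc; linarith
  obtain ⟨r, hr, hadj⟩ := h.adjacent hyF hyΓ
  have hadjL : D ∩ ball y r ⊆ L := by
    refine hadj.resolve_left fun hG => ?_
    obtain ⟨x, hx1, hx2⟩ := mem_closure_iff_nhds.1 hyX _ (ball_mem_nhds y hr)
    exact disjoint_left.1 h.disjGL (hG ⟨hXD hx2, hx1⟩) hx2.1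
  obtain ⟨x, ⟨hxD, hxb⟩, hx⟩ := h.exists_steep_point hyF (ε := 1 / 10) (by norm_num)
    (r := min r (min (R / 10) (R - 2 * δ))) (by
      refine lt_min hr (lt_min ?_ ?_) <;> linarith)
  rw [mem_ball, lt_min_iff, lt_min_iff] at hxb
  have hxn : R - dist x y ≤ ‖x‖ := by
    have := norm_sub_norm_le y x
    rw [norm_sub_rev, ← dist_eq_norm] at this
    linarith
  have hxX : x ∈ X := ⟨hadjL ⟨hxD, hxb.1⟩, show 2 * δ < ‖x‖ by linarith [hxb.2.2]⟩
  have h1 := hQ x hxX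
  rw [norm_mul, Complex.norm_exp, re_ofReal_mul] at h1
  have hd : 0 < dist x y := dist_pos.2 fun hxy => h.notMem_F hxD (hxy ▸ hyF)
  have h2 : 1 + k * (W x).re ≤ Real.exp (k * (W x).re) := by
    linarith [Real.add_one_le_exp (k * (W x).re)]
  have hx0 : 0 < ‖x‖ := by linarith [hxb.2.2]
  have h3 : (1 + k * (W x).re) * ‖x‖ ≤ R := (mul_le_mul_of_nonneg_right h2 hx0.le).trans h1
  have h4 : k * (W x).re * ‖x‖ ≤ dist x y := by linarith
  have h5 : 9 / 10 * R ≤ ‖x‖ := by linarith [hxb.2.1]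
  have h6 : k * ((1 - 1 / 10) * dist x y) * (9 / 10 * R) ≤ k * (W x).re * ‖x‖ := by
    have : 0 ≤ k * (W x).re := mul_nonneg hk0.le (h.re_pos x hxD).le
    gcongr
  nlinarith

lemma norm_le_of_mem_F (h : Cut δ D E F₁ F₂ f W y₁ y₂ Γ G L) {A : ℝ} (hA : 2 * δ ≤ A)
    (hb : ∀ z ∈ Γ, ‖W z‖ ≤ A) {y : ℂ} (hy : y ∈ F₁ ∪ F₂) : ‖y‖ ≤ ‖W y‖ + 2 * A := by
  have key : ∀ y' ∈ Γ, dist y y' ≤ |(W y).im - (W y').im| → ‖y‖ ≤ ‖W y‖ + 2 * A := by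
    intro y' hy' h1
    have h2 := Complex.abs_im_le_norm (W y - W y')
    rw [sub_im] at h2
    have h3 := norm_sub_norm_le y y'
    rw [← dist_eq_norm, h.norm_Γ hy'] at h3
    linarith [norm_sub_le (W y) (W y'), hb y' hy']
  rcases hy with hy | hy
  · exact key y₁ h.memΓ₁ (h.dist_le₁ hy h.memF₁)
  · exact key y₂ h.memΓ₂ (h.dist_le₂ hy h.memF₂)

end Cut

lemma isPreconnected_ann {δ R : ℝ} (hδ : 0 < δ) : IsPreconnected (ann δ R) := by
  rcases le_or_gt R δ with hR | hR
  · have : ann δ R = ∅ := eq_empty_of_forall_notMem fun z hz => by linarith [hz.1, hz.2]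
    rw [this]; exact isPreconnected_empty
  have : ann δ R = Complex.exp '' (re ⁻¹' Ioo (Real.log δ) (Real.log R)) := by
    ext z
    constructor
    · intro hz
      have hz0 : 0 < ‖z‖ := hδ.trans hz.1
      refine ⟨Complex.log z, ?_, Complex.exp_log (norm_pos_iff.1 hz0)⟩
      rw [mem_preimage, Complex.log_re]
      exact ⟨Real.log_lt_log hδ hz.1, Real.log_lt_log hz0 hz.2⟩
    · rintro ⟨w, hw, rfl⟩
      refine ⟨?_, ?_⟩
      · rw [Complex.norm_exp, ← Real.log_lt_iff_lt_exp hδ]; exact hw.1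
      · rw [Complex.norm_exp, ← Real.lt_log_iff_exp_lt (hδ.trans hR)]; exact hw.2
  rw [this]
  have hconv : Convex ℝ (re ⁻¹' Ioo (Real.log δ) (Real.log R)) :=
    (convex_Ioo _ _).linear_preimage reLm
  exact hconv.isPreconnected.image _ Complex.continuous_exp.continuousOn

/-- The open half-annulus in the right half-plane. -/
def halfAnn (a b : ℝ) : Set ℂ := {w | 0 < w.re ∧ a < ‖w‖ ∧ ‖w‖ < b}

lemma isOpen_halfAnn (a b : ℝ) : IsOpen (halfAnn a b) :=
  (isOpen_lt continuous_const continuous_re).inter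
    ((isOpen_lt continuous_const continuous_norm).inter
      (isOpen_lt continuous_norm continuous_const))

lemma isPreconnected_halfAnn {a b : ℝ} (ha : 0 < a) : IsPreconnected (halfAnn a b) := by
  rcases le_or_gt b a with hb | hb
  · have : halfAnn a b = ∅ := eq_empty_of_forall_notMem fun z hz => by linarith [hz.2.1, hz.2.2]
    rw [this]; exact isPreconnected_empty
  have : halfAnn a b = Complex.exp '' (Ioo (Real.log a) (Real.log b) ×ℂ
      Ioo (-(Real.pi / 2)) (Real.pi / 2)) := by
    ext z
    constructor
    · intro hz
      have hz0 : 0 < ‖z‖ := ha.trans hz.2.1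
      refine ⟨Complex.log z, ?_, Complex.exp_log (norm_pos_iff.1 hz0)⟩
      rw [mem_reProdIm, Complex.log_re, Complex.log_im]
      refine ⟨⟨Real.log_lt_log ha hz.2.1, Real.log_lt_log hz0 hz.2.2⟩, ?_⟩
      have := (Complex.abs_arg_lt_pi_div_two_iff (z := z)).2 (Or.inl hz.1)
      exact abs_lt.1 this
    · rintro ⟨w, hw, rfl⟩
      rw [mem_reProdIm] at hw
      refine ⟨?_, ?_, ?_⟩
      · rw [Complex.exp_re]
        exact mul_pos (Real.exp_pos _) (Real.cos_pos_of_mem_Ioo hw.2)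
      · rw [Complex.norm_exp, ← Real.log_lt_iff_lt_exp ha]; exact hw.1.1
      · rw [Complex.norm_exp, ← Real.lt_log_iff_exp_lt (ha.trans hb)]; exact hw.1.2
  rw [this]
  have hconv : Convex ℝ (Ioo (Real.log a) (Real.log b) ×ℂ Ioo (-(Real.pi / 2)) (Real.pi / 2)) :=
    ((convex_Ioo _ _).linear_preimage reLm).inter ((convex_Ioo _ _).linear_preimage imLm)
  exact hconv.isPreconnected.image _ Complex.continuous_exp.continuousOn

lemma mem_closure_halfAnn {a b s : ℝ} (h1 : a < |s|) (h2 : |s| < b) :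
    (s : ℂ) * I ∈ closure (halfAnn a b) := by
  have ht : Tendsto (fun t : ℝ => (t : ℂ) + s * I) (𝓝[>] 0) (𝓝 (s * I)) := by
    have : Continuous fun t : ℝ => (t : ℂ) + s * I := by fun_prop
    have h2 := this.tendsto 0
    simp only [ofReal_zero, zero_add] at h2
    exact h2.mono_left nhdsWithin_le_nhds
  have hn : ‖(s : ℂ) * I‖ = |s| := by rw [norm_mul, norm_I, mul_one, Complex.norm_real]; rfl
  refine mem_closure_of_tendsto ht ?_
  filter_upwards [self_mem_nhdsWithin, ht.norm.eventually_lt_const (by rw [hn]; exact h2),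
    ht.norm.eventually_const_lt (by rw [hn]; exact h1)] with t h3 h4 h5
  exact ⟨by simpa using h3, h5, h4⟩

lemma Potential.not_eventually_eq {δ : ℝ} {D E F₁ F₂ : Set ℂ} {f W : ℂ → ℂ}
    (h : Potential δ D E F₁ F₂ f W) {z : ℂ} (hz : z ∈ D) : ¬ ∀ᶠ x in 𝓝 z, W x = W z := by
  intro hc
  obtain ⟨y, hy⟩ := h.F_nonempty
  have key := (isPreconnected_ann (R := 1) h.pos).iff_of_eventually_iff
    (p := fun x => ∀ᶠ x' in 𝓝 x, x' ∈ D ∧ W x' = W z) (fun x hx => ?_) (h.D_subset hz)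
    (h.F_subset hy)
  · exact h.notMem_F (key.1 ((h.openD.eventually_mem hz).and hc)).self_of_nhds.1 hy
  · refine Filter.Eventually.filter_mono nhdsWithin_le_nhds ?_
    by_cases hp : ∀ᶠ x' in 𝓝 x, x' ∈ D ∧ W x' = W z
    · exact hp.eventually_nhds.mono fun x' h1 => iff_of_true h1 hp
    · by_contra hcon
      have hf : ∃ᶠ x' in 𝓝 x, ∀ᶠ x'' in 𝓝 x', x'' ∈ D ∧ W x'' = W z := by
        refine (not_eventually.1 hcon).mono fun x' h1 => ?_
        by_contra h2
        exact h1 (iff_of_false h2 hp)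
      have hf' : ∃ᶠ x' in 𝓝 x, x' ∈ D ∧ W x' = W z := hf.mono fun x' h1 => h1.self_of_nhds
      have hxc : x ∈ closure D := mem_closure_iff_frequently.2 (hf'.mono fun _ h1 => h1.1)
      have hx' := h.mem_of_mem_closure hx hxc
      have hxz : W x = W z := by
        have hcl : x ∈ closure {x' ∈ D ∪ (F₁ ∪ F₂) | W x' = W z} :=
          mem_closure_iff_frequently.2 (hf'.mono fun _ h1 => ⟨Or.inl h1.1, h1.2⟩)
        by_contra hne
        have h2 : ∀ᶠ x' in 𝓝[D ∪ (F₁ ∪ F₂)] x, W x' ≠ W z :=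
          (h.contW x hx').eventually_ne hne
        rw [eventually_nhdsWithin_iff] at h2
        obtain ⟨x', h3, h4⟩ := (hf'.and_eventually h2).exists
        exact h4 (Or.inl h3.1) h3.2
      have hxD : x ∈ D := h.mem_D_of_re_pos hx' (by rw [hxz]; exact h.re_pos z hz)
      rcases (h.differentiableOn.analyticAt (h.openD.mem_nhds hxD)).eventually_eq_or_eventually_ne
        (analyticAt_const (v := W z)) with h1 | h1
      · exact hp ((h.openD.eventually_mem hxD).and h1)
      · rw [eventually_nhdsWithin_iff] at h1
        have h2 : ∃ᶠ x' in 𝓝 x, x' = x ∧ ∀ᶠ x'' in 𝓝 x', x'' ∈ D ∧ W x'' = W z := by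
          refine (hf.and_eventually h1).mono fun x' h3 => ⟨?_, h3.1⟩
          by_contra hne
          exact h3.2 hne h3.1.self_of_nhds.2
        obtain ⟨x', rfl, h3⟩ := h2.exists
        exact hp h3

lemma Potential.image_mem_nhds {δ : ℝ} {D E F₁ F₂ : Set ℂ} {f W : ℂ → ℂ}
    (h : Potential δ D E F₁ F₂ f W) {z : ℂ} (hz : z ∈ D) {V : Set ℂ} (hV : V ∈ 𝓝 z) :
    W '' V ∈ 𝓝 (W z) := by
  rcases (h.differentiableOn.analyticAt
    (h.openD.mem_nhds hz)).eventually_constant_or_nhds_le_map_nhds with h1 | h1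
  · exact absurd h1 (h.not_eventually_eq hz)
  · exact h1 (image_mem_map hV)

/-- A crosscut together with quantitative normalisations of the potential: it is at most `A` on
the crosscut and at least `c` on the circle of radius `1 / 4`. -/
structure Frame (δ A c : ℝ) (D E F₁ F₂ : Set ℂ) (f W : ℂ → ℂ) (y₁ y₂ : ℂ) (Γ G L : Set ℂ) : Prop
    extends Cut δ D E F₁ F₂ f W y₁ y₂ Γ G L where
  two_le : 2 * δ ≤ A
  c_le : c ≤ 1 / 16
  A_le : 8 * A ≤ c
  bndΓ : ∀ z ∈ Γ, ‖W z‖ ≤ A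
  low : ∀ z ∈ D, ‖z‖ = 1 / 4 → c ≤ ‖W z‖

/-- The part of `G` near the origin on which the potential is bounded by `c`. -/
def region (G : Set ℂ) (W : ℂ → ℂ) (c : ℝ) : Set ℂ := {z | z ∈ G ∧ ‖z‖ < 1 / 4 ∧ ‖W z‖ < c}

namespace Frame

variable {δ A c : ℝ} {D E F₁ F₂ : Set ℂ} {f W : ℂ → ℂ} {y₁ y₂ : ℂ} {Γ G L : Set ℂ}

lemma swap (h : Frame δ A c D E F₁ F₂ f W y₁ y₂ Γ G L) :
    Frame δ A c D E F₂ F₁ f W y₂ y₁ Γ G L :=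
  { h.toCut.swap with
    two_le := h.two_le
    c_le := h.c_le
    A_le := h.A_le
    bndΓ := h.bndΓ
    low := h.low }

lemma A_pos (h : Frame δ A c D E F₁ F₂ f W y₁ y₂ Γ G L) : 0 < A := by
  linarith [h.pos, h.two_le]

lemma c_pos (h : Frame δ A c D E F₁ F₂ f W y₁ y₂ Γ G L) : 0 < c := by
  linarith [h.A_pos, h.A_le]

lemma norm_eq_of_mem_F (h : Frame δ A c D E F₁ F₂ f W y₁ y₂ Γ G L) {y : ℂ} (hy : y ∈ F₁ ∪ F₂) :
    ‖W y‖ = |(W y).im| := by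
  rw [← Complex.re_add_im (W y), h.re_zero y hy]
  simp

lemma abs_im₁_le (h : Frame δ A c D E F₁ F₂ f W y₁ y₂ Γ G L) : |(W y₁).im| ≤ A := by
  rw [← h.norm_eq_of_mem_F (Or.inl h.memF₁)]
  exact h.bndΓ _ h.memΓ₁

lemma abs_im₂_le (h : Frame δ A c D E F₁ F₂ f W y₁ y₂ Γ G L) : |(W y₂).im| ≤ A :=
  h.swap.abs_im₁_le

lemma norm_le_of_mem_F (h : Frame δ A c D E F₁ F₂ f W y₁ y₂ Γ G L) {y : ℂ} (hy : y ∈ F₁ ∪ F₂) :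
    ‖y‖ ≤ ‖W y‖ + 2 * A :=
  h.toCut.norm_le_of_mem_F h.two_le h.bndΓ hy

lemma region_subset (h : Frame δ A c D E F₁ F₂ f W y₁ y₂ Γ G L) : region G W c ⊆ D :=
  fun _ hz => h.G_subset hz.1

lemma isOpen_region (h : Frame δ A c D E F₁ F₂ f W y₁ y₂ Γ G L) (c' : ℝ) :
    IsOpen (region G W c') := by
  have h1 : IsOpen (G ∩ (fun z => ‖W z‖) ⁻¹' Iio c') :=
    (h.differentiableOn.continuousOn.mono h.G_subset).norm.isOpen_inter_preimage h.openG isOpen_Iio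
  have h2 : region G W c' = (G ∩ (fun z => ‖W z‖) ⁻¹' Iio c') ∩ ball 0 (1 / 4) := by
    ext z
    rw [mem_inter_iff, mem_inter_iff, mem_ball_zero_iff]
    exact ⟨fun h => ⟨⟨h.1, h.2.2⟩, h.2.1⟩, fun h => ⟨h.1.1, h.2, h.1.2⟩⟩
  rw [h2]
  exact h1.inter isOpen_ball

lemma isBounded_region : Bornology.IsBounded (region G W c) :=
  (isBounded_ball (x := (0 : ℂ)) (r := 1 / 4)).subset fun _ hz => mem_ball_zero_iff.2 hz.2.1

lemma closure_region (h : Frame δ A c D E F₁ F₂ f W y₁ y₂ Γ G L) {c' : ℝ} {ζ : ℂ}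
    (hζ : ζ ∈ closure (region G W c')) : ζ ∈ closure G ∧ ‖ζ‖ ≤ 1 / 4 ∧ ζ ∈ D ∪ (F₁ ∪ F₂) ∧
      ‖W ζ‖ ≤ c' ∧ (ζ ∈ G ∨ ζ ∈ Γ ∨ ζ ∈ F₁ ∪ F₂) := by
  have h1 : ζ ∈ closure G := closure_mono (fun z hz => hz.1) hζ
  have h2 : ‖ζ‖ ≤ 1 / 4 := closure_minimal (fun z hz => hz.2.1.le)
    (isClosed_le continuous_norm continuous_const) hζ
  have h3 := h.mem_of_mem_closure_G h1 (by linarith)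
  have h4 : ζ ∈ D ∪ (F₁ ∪ F₂) := by
    rcases h3 with h5 | h5 | h5
    exacts [Or.inl (h.G_subset h5), h.subΓ' h5, Or.inr h5]
  refine ⟨h1, h2, h4, ?_, h3⟩
  have hne := mem_closure_iff_nhdsWithin_neBot.1 hζ
  have ht : Tendsto (fun z => ‖W z‖) (𝓝[region G W c'] ζ) (𝓝 ‖W ζ‖) :=
    ((h.contW ζ h4).mono_left (nhdsWithin_mono ζ fun z hz => Or.inl (h.G_subset hz.1))).norm
  exact le_of_tendsto ht (by filter_upwards [self_mem_nhdsWithin] with z hz using hz.2.2.le)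

lemma closure_region_subset (h : Frame δ A c D E F₁ F₂ f W y₁ y₂ Γ G L) {c' : ℝ} :
    closure (region G W c') ⊆ D ∪ (F₁ ∪ F₂) := fun _ hζ => (h.closure_region hζ).2.2.1

lemma norm_lt_of_mem (h : Frame δ A c D E F₁ F₂ f W y₁ y₂ Γ G L) {ζ : ℂ}
    (hζ : ζ ∈ D ∪ (F₁ ∪ F₂)) (h1 : ‖ζ‖ ≤ 1 / 4) (h2 : ‖W ζ‖ < c) : ‖ζ‖ < 1 / 4 := by
  refine lt_of_le_of_ne h1 fun h3 => ?_
  rcases hζ with h4 | h4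
  · linarith [h.low ζ h4 h3]
  · have := h.norm_le_of_mem_F h4
    linarith [h.A_le, h.c_le]

lemma mem_region_of_closure (h : Frame δ A c D E F₁ F₂ f W y₁ y₂ Γ G L) {ζ : ℂ}
    (hζ : ζ ∈ closure (region G W c)) (h1 : 0 < (W ζ).re) (h2 : A < ‖W ζ‖) (h3 : ‖W ζ‖ < c) :
    ζ ∈ region G W c := by
  obtain ⟨-, h4, h5, -, h6⟩ := h.closure_region hζ
  refine ⟨?_, h.norm_lt_of_mem h5 h4 h3, h3⟩
  rcases h6 with h6 | h6 | h6
  · exact h6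
  · linarith [h.bndΓ ζ h6]
  · linarith [h.re_zero ζ h6]

lemma mem_F_of_closure (h : Frame δ A c D E F₁ F₂ f W y₁ y₂ Γ G L) {ζ : ℂ}
    (hζ : ζ ∈ closure (region G W c)) (h1 : (W ζ).re = 0) : ζ ∈ F₁ ∪ F₂ :=
  h.mem_F_of_re_zero (h.closure_region hζ).2.2.1 h1

lemma exists_mem_closure (h : Frame δ A c D E F₁ F₂ f W y₁ y₂ Γ G L) {w : ℂ}
    (hw : w ∈ closure (W '' region G W c)) : ∃ ζ ∈ closure (region G W c), W ζ = w := by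
  have hc : IsCompact (W '' closure (region G W c)) :=
    isBounded_region.isCompact_closure.image_of_continuousOn
      (h.contW.mono h.closure_region_subset)
  exact closure_minimal (image_mono subset_closure) hc.isClosed hw

/-- Every point of the half-annulus is a value of the potential in the region. -/
theorem halfAnn_subset (h : Frame δ A c D E F₁ F₂ f W y₁ y₂ Γ G L) :
    halfAnn A c ⊆ W '' region G W c := by
  have hA := h.A_pos
  have hA8 := h.A_le
  have hc16 := h.c_le
  have hopen : IsOpen (W '' region G W c) := by
    rw [isOpen_iff_mem_nhds]
    rintro _ ⟨z, hz, rfl⟩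
    exact h.image_mem_nhds (h.region_subset hz) ((h.isOpen_region c).mem_nhds hz)
  have hclosed : IsClosed (W '' closure (region G W c)) :=
    (isBounded_region.isCompact_closure.image_of_continuousOn
      (h.contW.mono h.closure_region_subset)).isClosed
  refine (isPreconnected_halfAnn hA).subset_left_of_subset_union hopen hclosed.isOpen_compl
    (disjoint_left.2 fun w h1 h2 => h2 (image_mono subset_closure h1)) ?_ ?_
  · intro w hw
    by_cases h1 : w ∈ W '' closure (region G W c)
    · obtain ⟨ζ, hζ, rfl⟩ := h1
      exact Or.inl ⟨ζ, h.mem_region_of_closure hζ hw.1 hw.2.1 hw.2.2, rfl⟩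
    · exact Or.inr h1
  · obtain ⟨τ, hτ, -, hex⟩ := h.one_sided
    obtain ⟨y, hy, hyG, hys⟩ := hex (c / 2) (by linarith) (by linarith [h.two_le])
    have him := h.abs_im₁_le
    rw [abs_le] at him
    have hWy : ‖W y‖ = |(W y).im| := h.norm_eq_of_mem_F (Or.inl hy)
    have hWy2 : A < ‖W y‖ ∧ ‖W y‖ < c := by
      rw [hWy, lt_abs, abs_lt]
      rcases hτ with rfl | rfl
      · exact ⟨Or.inl (by linarith), by linarith, by linarith⟩
      · exact ⟨Or.inr (by linarith), by linarith, by linarith⟩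
    have hyΓ : y ∉ Γ := fun hc => by linarith [h.bndΓ y hc]
    have hy4 : ‖y‖ < 1 / 4 := by linarith [h.norm_le_of_mem_F (Or.inl hy : y ∈ F₁ ∪ F₂)]
    obtain ⟨r, hr, hadj⟩ := h.adjacent (Or.inl hy) hyΓ
    have hadjG : D ∩ ball y r ⊆ G :=
      hadj.resolve_right fun hL => h.notMem_closure_of_ball hL (mem_ball_self hr) hyG
    obtain ⟨η, hη, himg⟩ := h.local_image (Or.inl hy) (lt_min hr (sub_pos.2 hy4))
    have hcl : W y ∈ closure (halfAnn A c) := by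
      have : W y = ((W y).im : ℂ) * I := by
        apply Complex.ext <;> simp [h.re_zero y (Or.inl hy)]
      rw [this]
      exact mem_closure_halfAnn (hWy ▸ hWy2.1) (hWy ▸ hWy2.2)
    obtain ⟨w, hw, hwd⟩ := Metric.mem_closure_iff.1 hcl η hη
    obtain ⟨z, ⟨hz, hzb⟩, rfl⟩ := himg w hw.1.le (by rw [dist_comm]; exact hwd)
    rw [mem_ball, lt_min_iff, dist_eq_norm] at hzb
    have hzD := h.mem_D_of_re_pos hz hw.1
    refine ⟨W z, hw, z, ⟨hadjG ⟨hzD, ?_⟩, ?_, hw.2.2⟩, rfl⟩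
    · rw [mem_ball, dist_eq_norm]; exact hzb.1
    · linarith [norm_sub_norm_le z y, hzb.2]

end Frame

/-- A frame in which `F₁` is mapped to the upper and `F₂` to the lower imaginary half-axis. -/
structure OFrame (δ A c : ℝ) (D E F₁ F₂ : Set ℂ) (f W : ℂ → ℂ) (y₁ y₂ : ℂ) (Γ G L : Set ℂ) : Prop
    extends Frame δ A c D E F₁ F₂ f W y₁ y₂ Γ G L where
  up₁ : ∀ y ∈ F₁, y ∈ closure G → (W y₁).im ≤ (W y).im
  down₂ : ∀ y ∈ F₂, y ∈ closure G → (W y).im ≤ (W y₂).im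

theorem Frame.exists_oFrame {δ A c : ℝ} {D E F₁ F₂ : Set ℂ} {f W : ℂ → ℂ} {y₁ y₂ : ℂ}
    {Γ G L : Set ℂ} (h : Frame δ A c D E F₁ F₂ f W y₁ y₂ Γ G L) :
    OFrame δ A c D E F₁ F₂ f W y₁ y₂ Γ G L ∨ OFrame δ A c D E F₂ F₁ f W y₂ y₁ Γ G L := by
  have hA := h.A_pos
  have hA8 := h.A_le
  obtain ⟨τ₁, hτ₁, hs₁, -⟩ := h.one_sided
  obtain ⟨τ₂, hτ₂, hs₂, -⟩ := h.swap.one_sided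
  have hkey : ∀ σ : ℝ, |σ| = 1 → ∃ ζ ∈ F₁ ∪ F₂, ζ ∈ closure G ∧ (W ζ).im = σ * (c / 2) := by
    intro σ hσ
    have habs : |σ * (c / 2)| = c / 2 := by rw [abs_mul, hσ, one_mul, abs_of_pos]; linarith
    obtain ⟨ζ, hζ, hW⟩ := h.exists_mem_closure (w := ((σ * (c / 2) : ℝ) : ℂ) * I)
      (closure_mono h.halfAnn_subset
        (mem_closure_halfAnn (by rw [habs]; linarith) (by rw [habs]; linarith)))
    refine ⟨ζ, h.mem_F_of_closure hζ (by rw [hW]; simp), (h.closure_region hζ).1, ?_⟩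
    rw [hW, mul_im, I_re, I_im, ofReal_re, mul_zero, mul_one, add_zero]
  have h1 := abs_le.1 h.abs_im₁_le
  have h2 := abs_le.1 h.abs_im₂_le
  rcases hτ₁ with rfl | rfl <;> rcases hτ₂ with rfl | rfl
  · exfalso
    obtain ⟨ζ, hζ | hζ, hG, him⟩ := hkey (-1) (by norm_num)
    · have := hs₁ ζ hζ hG; linarith
    · have := hs₂ ζ hζ hG; linarith
  · exact Or.inl { h with
      up₁ := fun y hy hG => by have := hs₁ y hy hG; linarith
      down₂ := fun y hy hG => by have := hs₂ y hy hG; linarith }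
  · exact Or.inr { h.swap with
      up₁ := fun y hy hG => by have := hs₂ y hy hG; linarith
      down₂ := fun y hy hG => by have := hs₁ y hy hG; linarith }
  · exfalso
    obtain ⟨ζ, hζ | hζ, hG, him⟩ := hkey 1 (by norm_num)
    · have := hs₁ ζ hζ hG; linarith
    · have := hs₂ ζ hζ hG; linarith

/-- `w` is a value taken at a critical point or at two distinct points of `U`. -/
def Collision (U : Set ℂ) (f W : ℂ → ℂ) (w : ℂ) : Prop :=
  ∃ z ∈ U, ∃ z' ∈ U, W z = w ∧ W z' = w ∧ (f z = 0 ∨ z' ≠ z)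

namespace Frame

variable {δ A c : ℝ} {D E F₁ F₂ : Set ℂ} {f W : ℂ → ℂ} {y₁ y₂ : ℂ} {Γ G L : Set ℂ}

/-- A limit of collision values comes from two distinct points of the closure or from
collisions near a single point. -/
lemma exists_collision_limit (h : Frame δ A c D E F₁ F₂ f W y₁ y₂ Γ G L) {w : ℂ}
    (hf : ∃ᶠ w' in 𝓝 w, Collision (region G W c) f W w') :
    ∃ ζ ∈ closure (region G W c), ∃ ζ' ∈ closure (region G W c), W ζ = w ∧ W ζ' = w ∧
      (ζ' ≠ ζ ∨ ∀ r > 0, ∃ z ∈ region G W c ∩ ball ζ r, ∃ z' ∈ region G W c ∩ ball ζ r,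
        W z = W z' ∧ (f z = 0 ∨ z' ≠ z)) := by
  obtain ⟨ws, hws, hcol⟩ := exists_seq_forall_of_frequently hf
  choose z hz z' hz' hWz hWz' hne using hcol
  have hK : IsCompact (closure (region G W c) ×ˢ closure (region G W c)) :=
    isBounded_region.isCompact_closure.prod isBounded_region.isCompact_closure
  obtain ⟨⟨ζ, ζ'⟩, ⟨hζ, hζ'⟩, φ, hφ, hlim⟩ := hK.tendsto_subseq (x := fun n => (z n, z' n))
    fun n => ⟨subset_closure (hz n), subset_closure (hz' n)⟩
  have hl1 : Tendsto (fun n => z (φ n)) atTop (𝓝 ζ) := (continuous_fst.tendsto _).comp hlim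
  have hl2 : Tendsto (fun n => z' (φ n)) atTop (𝓝 ζ') := (continuous_snd.tendsto _).comp hlim
  have hlw : Tendsto (fun n => ws (φ n)) atTop (𝓝 w) := hws.comp hφ.tendsto_atTop
  have hlimW : ∀ x : ℕ → ℂ, (∀ n, x n ∈ region G W c) → ∀ ξ ∈ closure (region G W c),
      Tendsto (fun n => x (φ n)) atTop (𝓝 ξ) → (∀ n, W (x n) = ws n) → W ξ = w := by
    intro x hx ξ hξ ht hWx
    have h1 : Tendsto (fun n => W (x (φ n))) atTop (𝓝 (W ξ)) :=
      (h.contW ξ (h.closure_region_subset hξ)).tendsto.comp (tendsto_nhdsWithin_iff.2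
        ⟨ht, Eventually.of_forall fun n => Or.inl (h.region_subset (hx _))⟩)
    refine tendsto_nhds_unique h1 ?_
    simpa only [hWx] using hlw
  refine ⟨ζ, hζ, ζ', hζ', hlimW z hz ζ hζ hl1 hWz, hlimW z' hz' ζ' hζ' hl2 hWz', ?_⟩
  by_cases hζζ : ζ' = ζ
  · right
    subst hζζ
    intro r hr
    obtain ⟨n, h1, h2⟩ := ((hl1.eventually (ball_mem_nhds _ hr)).and
      (hl2.eventually (ball_mem_nhds _ hr))).exists
    exact ⟨z (φ n), ⟨hz _, h1⟩, z' (φ n), ⟨hz' _, h2⟩, by rw [hWz, hWz'], hne _⟩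
  · exact Or.inl hζζ

lemma collision_of_limit (h : Frame δ A c D E F₁ F₂ f W y₁ y₂ Γ G L) {w : ℂ}
    (hw : w ∈ halfAnn A c) (hf : ∃ᶠ w' in 𝓝 w, Collision (region G W c) f W w') :
    Collision (region G W c) f W w := by
  obtain ⟨ζ, hζ, ζ', hζ', hW, hW', hor⟩ := h.exists_collision_limit hf
  have hm : ∀ x ∈ closure (region G W c), W x = w → x ∈ region G W c := fun x hx hxw =>
    h.mem_region_of_closure hx (by rw [hxw]; exact hw.1) (by rw [hxw]; exact hw.2.1)
      (by rw [hxw]; exact hw.2.2)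
  refine ⟨ζ, hm ζ hζ hW, ζ', hm ζ' hζ' hW', hW, hW', ?_⟩
  rcases hor with h1 | h1
  · exact Or.inr h1
  · left
    by_contra hfz
    have hζD := h.region_subset (hm ζ hζ hW)
    have hinv := ((h.hasStrictDerivAt hζD).hasStrictFDerivAt_equiv hfz).eventually_left_inverse
    have hfc : ∀ᶠ x in 𝓝 ζ, f x ≠ 0 :=
      ((h.differentiableOn_f.continuousOn).continuousAt (h.openD.mem_nhds hζD)).eventually_ne hfz
    obtain ⟨r, hr, hb⟩ := Metric.eventually_nhds_iff_ball.1 (hinv.and hfc)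
    obtain ⟨z, hz, z', hz', hzz, h2⟩ := h1 r hr
    rcases h2 with h2 | h2
    · exact (hb z hz.2).2 h2
    · exact h2 (by rw [← (hb z' hz'.2).1, ← hzz, (hb z hz.2).1])

lemma eventually_collision (h : Frame δ A c D E F₁ F₂ f W y₁ y₂ Γ G L) {w : ℂ}
    (hw : Collision (region G W c) f W w) : ∀ᶠ w' in 𝓝 w, Collision (region G W c) f W w' := by
  obtain ⟨z, hz, z', hz', hWz, hWz', hor⟩ := id hw
  have hzD := h.region_subset hz
  have hzD' := h.region_subset hz'
  have hU := h.isOpen_region c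
  rcases hor with h1 | h1
  · have h2 := exists_two_preimages_of_deriv_eq_zero
      (h.differentiableOn.analyticAt (h.openD.mem_nhds hzD)) (by rw [h.deriv_eq hzD, h1])
      (h.not_eventually_eq hzD) (hU.mem_nhds hz)
    rw [hWz, eventually_nhdsWithin_iff] at h2
    filter_upwards [h2] with w' hw'
    by_cases hww : w' = w
    · rw [hww]; exact hw
    · obtain ⟨x, hx, x', hx', hne, h3, h4⟩ := hw' hww
      exact ⟨x, hx, x', hx', h3, h4, Or.inr hne.symm⟩
  · obtain ⟨V, V', hV, hV', hzV, hzV', hd⟩ := t2_separation h1.symm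
    have h2 := h.image_mem_nhds hzD (inter_mem (hU.mem_nhds hz) (hV.mem_nhds hzV))
    have h3 := h.image_mem_nhds hzD' (inter_mem (hU.mem_nhds hz') (hV'.mem_nhds hzV'))
    rw [hWz] at h2
    rw [hWz'] at h3
    filter_upwards [h2, h3] with w' h4 h5
    obtain ⟨x, hx, rfl⟩ := h4
    obtain ⟨x', hx', h6⟩ := h5
    exact ⟨x, hx.1, x', hx'.1, rfl, h6, Or.inr fun hxx =>
      disjoint_left.1 hd hx.2 (hxx ▸ hx'.2)⟩

end Frame

namespace OFrame

variable {δ A c : ℝ} {D E F₁ F₂ : Set ℂ} {f W : ℂ → ℂ} {y₁ y₂ : ℂ} {Γ G L : Set ℂ}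

/-- The potential is a conformal bijection from its preimage in the region onto the
half-annulus. -/
theorem not_collision (h : OFrame δ A c D E F₁ F₂ f W y₁ y₂ Γ G L) {w : ℂ}
    (hw : w ∈ halfAnn A c) : ¬ Collision (region G W c) f W w := by
  intro hcol
  have hA := h.A_pos
  have hA8 := h.A_le
  have hall : ∀ w' ∈ halfAnn A c, Collision (region G W c) f W w' := fun w' hw' =>
    ((isPreconnected_halfAnn hA).iff_of_eventually_iff
      (p := fun w => Collision (region G W c) f W w) (fun x hx => by
        refine Filter.Eventually.filter_mono nhdsWithin_le_nhds ?_
        by_cases hp : Collision (region G W c) f W x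
        · exact (h.eventually_collision hp).mono fun y hy => iff_of_true hy hp
        · by_contra hcon
          refine hp (h.collision_of_limit hx ((not_eventually.1 hcon).mono fun y hy => ?_))
          by_contra hy2
          exact hy (iff_of_false hy2 hp)) hw hw').1 hcol
  have habs : |c / 2| = c / 2 := abs_of_pos (by linarith)
  have hcl : ((c / 2 : ℝ) : ℂ) * I ∈ closure (halfAnn A c) :=
    mem_closure_halfAnn (by rw [habs]; linarith) (by rw [habs]; linarith)
  obtain ⟨ζ, hζ, ζ', hζ', hW, hW', hor⟩ := h.exists_collision_limit
    ((mem_closure_iff_frequently.1 hcl).mono hall)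
  have hm : ∀ x ∈ closure (region G W c), W x = ((c / 2 : ℝ) : ℂ) * I → x ∈ F₁ := by
    intro x hx hxw
    refine (h.mem_F_of_closure hx (by rw [hxw]; simp)).resolve_right fun hF => ?_
    have h1 := h.down₂ x hF (h.closure_region hx).1
    rw [hxw, mul_im, I_re, I_im, ofReal_re, mul_zero, mul_one, add_zero] at h1
    linarith [(abs_le.1 h.abs_im₂_le).2]
  have hζF := hm ζ hζ hW
  rcases hor with h1 | h1
  · apply h1
    have := h.dist_le₁ (hm ζ' hζ' hW') hζF
    rw [hW, hW', sub_self, abs_zero] at this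
    exact dist_le_zero.1 this
  · obtain ⟨r, hr, -, hiso, hfr⟩ := h.near_isometry (Or.inl hζF) (ε := 1 / 2) (by norm_num)
    obtain ⟨z, hz, z', hz', hzz, h2⟩ := h1 r hr
    have hzD := h.region_subset hz.1
    have hzD' := h.region_subset hz'.1
    rcases h2 with h2 | h2
    · have := (hfr z ⟨hzD, hz.2⟩).1
      rw [h2, norm_zero] at this
      norm_num at this
    · have := (hiso z' ⟨Or.inl hzD', hz'.2⟩ z ⟨Or.inl hzD, hz.2⟩).1
      rw [hzz, dist_self] at this
      exact h2 (dist_le_zero.1 (by linarith))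

lemma f_ne_zero (h : OFrame δ A c D E F₁ F₂ f W y₁ y₂ Γ G L) {z : ℂ} (hz : z ∈ region G W c)
    (hA : A < ‖W z‖) : f z ≠ 0 := fun hf =>
  h.not_collision (w := W z) ⟨h.re_pos z (h.region_subset hz), hA, hz.2.2⟩
    ⟨z, hz, z, hz, rfl, rfl, Or.inl hf⟩

lemma eq_of_eq (h : OFrame δ A c D E F₁ F₂ f W y₁ y₂ Γ G L) {z z' : ℂ} (hz : z ∈ region G W c)
    (hz' : z' ∈ region G W c) (hA : A < ‖W z‖) (heq : W z' = W z) : z' = z := by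
  by_contra hne
  exact h.not_collision (w := W z) ⟨h.re_pos z (h.region_subset hz), hA, hz.2.2⟩
    ⟨z, hz, z', hz', rfl, heq, Or.inr hne⟩

end OFrame

lemma norm_le_norm_add_ofReal {w : ℂ} {t : ℝ} (hw : 0 ≤ w.re) (ht : 0 ≤ t) :
    ‖w‖ ≤ ‖w + t‖ ∧ t ≤ ‖w + t‖ := by
  constructor
  · rw [← sq_le_sq₀ (norm_nonneg _) (norm_nonneg _), Complex.sq_norm, Complex.sq_norm,
      normSq_apply, normSq_apply]
    simp only [add_re, ofReal_re, add_im, ofReal_im, add_zero]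
    nlinarith
  · have := Complex.re_le_norm (w + t)
    rw [add_re, ofReal_re] at this
    linarith

lemma cpow_half_re {w : ℂ} (hw : 0 ≤ w.re) :
    √2 / 2 * √‖w‖ ≤ (w ^ ((1 / 2 : ℝ) : ℂ)).re ∧ (w ^ ((1 / 2 : ℝ) : ℂ)).re ≤ √‖w‖ := by
  rw [Complex.cpow_ofReal_re, ← Real.sqrt_eq_rpow]
  have h1 := Complex.abs_arg_le_pi_div_two_iff.2 hw
  have h2 : √2 / 2 ≤ Real.cos (arg w * (1 / 2)) := by
    rw [← Real.cos_pi_div_four, ← Real.cos_abs (arg w * (1 / 2))]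
    refine Real.cos_le_cos_of_nonneg_of_le_pi (abs_nonneg _) (by linarith [Real.pi_pos]) ?_
    rw [abs_mul, abs_of_pos (by norm_num : (0 : ℝ) < 1 / 2)]
    linarith
  have h3 := Real.cos_le_one (arg w * (1 / 2))
  have h4 := Real.sqrt_nonneg ‖w‖
  constructor <;> nlinarith

/-- The part of the region on which the potential has modulus between `a` and `b`. -/
def shell (G : Set ℂ) (W : ℂ → ℂ) (c a b : ℝ) : Set ℂ :=
  {z | z ∈ region G W c ∧ a < ‖W z‖ ∧ ‖W z‖ < b}

namespace Frame

variable {δ A c : ℝ} {D E F₁ F₂ : Set ℂ} {f W : ℂ → ℂ} {y₁ y₂ : ℂ} {Γ G L : Set ℂ}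

lemma re_nonneg (h : Frame δ A c D E F₁ F₂ f W y₁ y₂ Γ G L) {z : ℂ} (hz : z ∈ D ∪ (F₁ ∪ F₂)) :
    0 ≤ (W z).re := by
  rcases hz with hz | hz
  · exact (h.re_pos z hz).le
  · exact (h.re_zero z hz).ge

/-- A crude bound for the inverse of the potential. -/
lemma norm_le_of_mem_region (h : Frame δ A c D E F₁ F₂ f W y₁ y₂ Γ G L) {z : ℂ}
    (hz : z ∈ region G W c) : c * ‖z‖ ≤ ‖W z‖ + 3 * A := by
  have hA := h.A_pos
  have hc := h.c_pos
  have hc16 := h.c_le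
  have hbd : ∀ x ∈ D ∪ (F₁ ∪ F₂), ‖W x‖ ≤ ‖W x + (3 * A : ℝ)‖ ∧ 3 * A ≤ ‖W x + (3 * A : ℝ)‖ :=
    fun x hx => norm_le_norm_add_ofReal (h.re_nonneg hx) (by linarith)
  have hne : ∀ x ∈ D ∪ (F₁ ∪ F₂), W x + (3 * A : ℝ) ≠ 0 := fun x hx => by
    rw [← norm_pos_iff]; linarith [(hbd x hx).2]
  have hcont : ContinuousOn (fun x => x / (W x + (3 * A : ℝ))) (D ∪ (F₁ ∪ F₂)) :=
    continuousOn_id.div (h.contW.add continuousOn_const) hne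
  have key : ‖z / (W z + (3 * A : ℝ))‖ ≤ 1 / c := by
    refine norm_le_of_frontier_limsup (Q := fun x => x / (W x + (3 * A : ℝ))) (h.isOpen_region c)
      isBounded_region (differentiableOn_id.div
        ((h.differentiableOn.mono h.region_subset).add_const _)
        fun x hx => hne x (Or.inl (h.region_subset hx))) ?_ hz
    intro ζ hζ ε hε
    rw [(h.isOpen_region c).frontier_eq] at hζ
    obtain ⟨-, h4, h5, h6, h7⟩ := h.closure_region hζ.1
    refine eventually_norm_le_of_continuousWithinAt (hcont ζ h5)
      (h.region_subset.trans subset_union_left) ?_ hε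
    obtain ⟨h8, h9⟩ := hbd ζ h5
    rw [norm_div, div_le_div_iff₀ (by linarith) hc, one_mul]
    rcases h7 with h7 | h7 | h7
    · have : c ≤ ‖W ζ‖ := by
        by_contra! hlt
        exact hζ.2 ⟨h7, h.norm_lt_of_mem h5 h4 hlt, hlt⟩
      nlinarith
    · rw [h.norm_Γ h7]
      have := h.two_le
      nlinarith [h.pos]
    · have h10 := h.norm_le_of_mem_F h7
      nlinarith [norm_nonneg ζ]
  rw [norm_div, div_le_div_iff₀ (by linarith [(hbd z (Or.inl (h.region_subset hz))).2]) hc,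
    one_mul] at key
  have h1 := norm_add_le (W z) (3 * A : ℝ)
  rw [Complex.norm_real, Real.norm_eq_abs, abs_of_pos (by linarith : 0 < 3 * A)] at h1
  linarith

lemma isOpen_shell (h : Frame δ A c D E F₁ F₂ f W y₁ y₂ Γ G L) (a b : ℝ) :
    IsOpen (shell G W c a b) := by
  have := ((h.differentiableOn.continuousOn.mono
    h.region_subset).norm).isOpen_inter_preimage (h.isOpen_region c) (isOpen_Ioo (a := a) (b := b))
  exact this

lemma shell_subset (h : Frame δ A c D E F₁ F₂ f W y₁ y₂ Γ G L) {a b : ℝ} :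
    shell G W c a b ⊆ D := fun _ hz => h.region_subset hz.1

/-- Holomorphic functions on the region that are bounded by `B` on the free boundary are nearly
bounded by `B` at intermediate scales. -/
theorem norm_le_of_shell (h : Frame δ A c D E F₁ F₂ f W y₁ y₂ Γ G L) {a b : ℝ} (ha : A < a)
    (hab : a < b) (hb : b < c) {Q : ℂ → ℂ} {B M : ℝ} (hB : 0 ≤ B) (hM : 0 ≤ M)
    (hQ : DifferentiableOn ℂ Q (shell G W c A c))
    (hF : ∀ ζ ∈ F₁ ∪ F₂, ζ ∈ closure G → a ≤ ‖W ζ‖ → ‖W ζ‖ ≤ b → ∀ ε > 0,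
      ∀ᶠ z in 𝓝[shell G W c a b] ζ, ‖Q z‖ ≤ B + ε)
    (hE : ∀ ζ ∈ shell G W c A c, ‖W ζ‖ = a ∨ ‖W ζ‖ = b → ‖Q ζ‖ ≤ B * Real.exp M)
    {z : ℂ} (hz : z ∈ shell G W c a b) :
    ‖Q z‖ ≤ B * Real.exp (M * (2 * √(‖W z‖ / b) + 2 * √(a / ‖W z‖))) := by
  have hA := h.A_pos
  have ha0 : 0 < a := hA.trans ha
  have hb0 : 0 < b := ha0.trans hab
  have hsub : shell G W c a b ⊆ shell G W c A c := fun x hx =>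
    ⟨hx.1, ha.trans hx.2.1, hx.2.2.trans hb⟩
  set H : ℂ → ℂ := fun x => (√2 : ℂ) * (W x / b) ^ ((1 / 2 : ℝ) : ℂ) +
    2 * (a / (W x + a)) ^ ((1 / 2 : ℝ) : ℂ) with hH
  set l : ℝ → ℝ := fun t => √(t / b) + √(2 * a / (t + a)) with hl
  have hs2 : √2 * √2 = 2 := Real.mul_self_sqrt (by norm_num)
  have hre1 : ∀ x ∈ D, 0 < (W x / b).re := fun x hx => by
    rw [div_ofReal_re]; exact div_pos (h.re_pos x hx) hb0
  have hre2 : ∀ x ∈ D, 0 < (a / (W x + a)).re := fun x hx => by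
    rw [Complex.div_re, ofReal_re, ofReal_im, zero_mul, zero_div, add_zero]
    have h1 : 0 < (W x + a).re := by rw [add_re, ofReal_re]; linarith [h.re_pos x hx]
    exact div_pos (mul_pos ha0 h1) (normSq_pos.2 fun h0 => by rw [h0] at h1; simp at h1)
  have hHre : ∀ x, (H x).re = √2 * ((W x / b) ^ ((1 / 2 : ℝ) : ℂ)).re +
      2 * ((a / (W x + a)) ^ ((1 / 2 : ℝ) : ℂ)).re := fun x => by
    have h2 : (2 : ℂ) = ((2 : ℝ) : ℂ) := by norm_num
    simp only [hH]
    rw [add_re, re_ofReal_mul, h2, re_ofReal_mul]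
  have hnb : ∀ x, ‖W x / b‖ = ‖W x‖ / b := fun x => by
    rw [norm_div, Complex.norm_real, Real.norm_eq_abs, abs_of_pos hb0]
  have hna : ∀ x, ‖(a : ℂ) / (W x + a)‖ = a / ‖W x + a‖ := fun x => by
    rw [norm_div, Complex.norm_real, Real.norm_eq_abs, abs_of_pos ha0]
  have hlow : ∀ x ∈ D, l ‖W x‖ ≤ (H x).re := by
    intro x hx
    have h1 := (cpow_half_re (hre1 x hx).le).1
    have h2 := (cpow_half_re (hre2 x hx).le).1
    rw [hnb] at h1
    rw [hna] at h2
    have h3 : √(2 * a / (‖W x‖ + a)) ≤ √2 * √(a / ‖W x + a‖) := by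
      rw [← Real.sqrt_mul (by norm_num), mul_div_assoc]
      apply Real.sqrt_le_sqrt
      have h4 := norm_add_le (W x) a
      rw [Complex.norm_real, Real.norm_eq_abs, abs_of_pos ha0] at h4
      have h5 := (norm_le_norm_add_ofReal (h.re_pos x hx).le ha0.le).2
      have : 0 < ‖W x + a‖ := by linarith
      gcongr
    rw [hHre]
    simp only [hl]
    have h6 := mul_le_mul_of_nonneg_left h1 (Real.sqrt_nonneg 2)
    have h7 : √2 * (√2 / 2 * √(‖W x‖ / b)) = √(‖W x‖ / b) := by
      rw [← mul_assoc, ← mul_div_assoc, hs2]; ring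
    linarith
  have hup : ∀ x ∈ D, (H x).re ≤ 2 * √(‖W x‖ / b) + 2 * √(a / ‖W x‖) := by
    intro x hx
    have h1 := (cpow_half_re (hre1 x hx).le).2
    have h2 := (cpow_half_re (hre2 x hx).le).2
    rw [hnb] at h1
    rw [hna] at h2
    have h3 : √(a / ‖W x + a‖) ≤ √(a / ‖W x‖) := by
      apply Real.sqrt_le_sqrt
      have h5 := (norm_le_norm_add_ofReal (h.re_pos x hx).le ha0.le).1
      have : 0 < ‖W x‖ := by linarith [h.re_pos x hx, Complex.re_le_norm (W x)]
      gcongr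
    have h4 : √2 ≤ 2 := by
      rw [Real.sqrt_le_left (by norm_num)]; norm_num
    rw [hHre]
    have h6 : 0 ≤ √2 := Real.sqrt_nonneg 2
    have h7 := Real.sqrt_nonneg (‖W x‖ / b)
    nlinarith
  have hHd : DifferentiableOn ℂ H D := by
    have e1 : DifferentiableOn ℂ (fun x => W x / b) D := h.differentiableOn.div_const _
    have e2 : DifferentiableOn ℂ (fun x => a / (W x + a)) D :=
      (differentiableOn_const _).div (h.differentiableOn.add_const _) fun x hx h0 => by
        have h1 := hre2 x hx
        rw [h0, div_zero, zero_re] at h1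
        exact lt_irrefl _ h1
    exact ((differentiableOn_const _).mul (e1.cpow_const fun x hx => Or.inl (hre1 x hx))).add
      ((differentiableOn_const _).mul (e2.cpow_const fun x hx => Or.inl (hre2 x hx)))
  have hnorm : ∀ x, ‖Q x * Complex.exp (-(M * H x))‖ = ‖Q x‖ * Real.exp (-(M * (H x).re)) :=
    fun x => by rw [norm_mul, Complex.norm_exp, neg_re, re_ofReal_mul]
  have hnorm_le : ∀ x ∈ D, ‖Q x * Complex.exp (-(M * H x))‖ ≤
      ‖Q x‖ * Real.exp (-(M * l ‖W x‖)) := fun x hx => by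
    rw [hnorm]
    have := mul_le_mul_of_nonneg_left (hlow x hx) hM
    gcongr
  have key : ‖Q z * Complex.exp (-(M * H z))‖ ≤ B := by
    refine norm_le_of_frontier_limsup (Q := fun x => Q x * Complex.exp (-(M * H x)))
      (h.isOpen_shell a b) (isBounded_region.subset fun x hx => hx.1)
      ((hQ.mono hsub).mul (((differentiableOn_const _).mul
        (hHd.mono h.shell_subset)).neg.cexp)) ?_ hz
    intro ζ hζ ε hε
    rw [(h.isOpen_shell a b).frontier_eq] at hζ
    have hcl : ζ ∈ closure (region G W b) :=
      closure_mono (fun x (hx : x ∈ shell G W c a b) =>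
        (⟨hx.1.1, hx.1.2.1, hx.2.2⟩ : x ∈ region G W b)) hζ.1
    obtain ⟨hG, h4, h5, h6, h7⟩ := h.closure_region hcl
    have h8 : a ≤ ‖W ζ‖ := by
      have hne := mem_closure_iff_nhdsWithin_neBot.1 hζ.1
      have ht : Tendsto (fun z => ‖W z‖) (𝓝[shell G W c a b] ζ) (𝓝 ‖W ζ‖) :=
        ((h.contW ζ h5).mono_left (nhdsWithin_mono ζ
          (h.shell_subset.trans subset_union_left))).norm
      exact ge_of_tendsto ht (by filter_upwards [self_mem_nhdsWithin] with z hz using hz.2.1.le)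
    rcases h7 with h7 | h7 | h7
    · have hreg : ζ ∈ region G W c := ⟨h7, h.norm_lt_of_mem h5 h4 (by linarith), by linarith⟩
      have hsh : ζ ∈ shell G W c A c := ⟨hreg, by linarith, by linarith⟩
      have hor : ‖W ζ‖ = a ∨ ‖W ζ‖ = b := by
        by_contra! hcon
        exact hζ.2 ⟨hreg, lt_of_le_of_ne h8 hcon.1.symm, lt_of_le_of_ne h6 hcon.2⟩
      have hl1 : 1 ≤ l ‖W ζ‖ := by
        rcases hor with h9 | h9
        · simp only [hl]
          rw [h9, show 2 * a / (a + a) = 1 by field_simp; norm_num, Real.sqrt_one]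
          linarith [Real.sqrt_nonneg (a / b)]
        · simp only [hl]
          rw [h9, div_self hb0.ne', Real.sqrt_one]
          linarith [Real.sqrt_nonneg (2 * a / (b + a))]
      have hWc : ContinuousAt W ζ := (h.derivW ζ (h.G_subset h7)).continuousAt
      have hQc : ContinuousAt Q ζ := hQ.continuousOn.continuousAt ((h.isOpen_shell A c).mem_nhds hsh)
      have hlc : ContinuousAt (fun x => l ‖W x‖) ζ := by
        have h10 : ContinuousAt (fun x => ‖W x‖) ζ := hWc.norm
        refine (h10.div_const b).sqrt.add (ContinuousAt.sqrt ?_)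
        exact continuousAt_const.div (h10.add continuousAt_const) (by positivity)
      have ht : Tendsto (fun x => ‖Q x‖ * Real.exp (-(M * l ‖W x‖))) (𝓝 ζ)
          (𝓝 (‖Q ζ‖ * Real.exp (-(M * l ‖W ζ‖)))) :=
        hQc.norm.tendsto.mul
          ((Real.continuous_exp.tendsto _).comp (hlc.tendsto.const_mul M).neg)
      have hlim : ‖Q ζ‖ * Real.exp (-(M * l ‖W ζ‖)) < B + ε := by
        have h10 : ‖Q ζ‖ * Real.exp (-(M * l ‖W ζ‖)) ≤ B * Real.exp M * Real.exp (-(M * 1)) := by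
          have := mul_le_mul_of_nonneg_left hl1 hM
          have := hE ζ hsh hor
          gcongr
        rw [mul_assoc, ← Real.exp_add, mul_one, add_neg_cancel, Real.exp_zero, mul_one] at h10
        linarith
      filter_upwards [self_mem_nhdsWithin, mem_nhdsWithin_of_mem_nhds (ht.eventually_lt_const hlim)]
        with x hx1 hx2
      exact (hnorm_le x (h.shell_subset hx1)).trans hx2.le
    · linarith [h.bndΓ ζ h7]
    · filter_upwards [self_mem_nhdsWithin, hF ζ h7 hG h8 h6 ε hε] with x hx1 hx2
      refine (hnorm_le x (h.shell_subset hx1)).trans (le_trans ?_ hx2)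
      refine mul_le_of_le_one_right (norm_nonneg _) ?_
      rw [Real.exp_le_one_iff, neg_nonpos]
      exact mul_nonneg hM (add_nonneg (Real.sqrt_nonneg _) (Real.sqrt_nonneg _))
  rw [hnorm, Real.exp_neg, ← div_eq_mul_inv, div_le_iff₀ (Real.exp_pos _)] at key
  refine key.trans ?_
  have := mul_le_mul_of_nonneg_left (hup z (h.shell_subset hz)) hM
  gcongr

end Frame

lemma exists_exp_scale_le (M : ℝ) (hM : 0 ≤ M) {η : ℝ} (hη : 0 < η) :
    ∃ N : ℝ, 10 ≤ N ∧ ∀ a b t : ℝ, 0 < a → N * a ≤ t → N * t ≤ b →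
      Real.exp (M * (2 * √(t / b) + 2 * √(a / t))) ≤ 1 + η := by
  have hlog : 0 < Real.log (1 + η) := Real.log_pos (by linarith)
  set q := 4 * M / Real.log (1 + η)
  refine ⟨max 10 (q ^ 2), le_max_left _ _, fun a b t ha hat htb => ?_⟩
  set N := max 10 (q ^ 2) with hN
  have hN10 : 10 ≤ N := le_max_left _ _
  have hN0 : 0 < N := by linarith
  have ht : 0 < t := by nlinarith
  have hb : 0 < b := by nlinarith
  have hq : q ≤ √N := by
    refine Real.le_sqrt_of_sq_le (le_max_right _ _)
  have hsN : 0 < √N := Real.sqrt_pos.2 hN0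
  have h1 : √(t / b) ≤ 1 / √N := by
    rw [← Real.sqrt_one, ← Real.sqrt_div zero_le_one]
    apply Real.sqrt_le_sqrt
    rw [div_le_div_iff₀ hb hN0]; linarith
  have h2 : √(a / t) ≤ 1 / √N := by
    rw [← Real.sqrt_one, ← Real.sqrt_div zero_le_one]
    apply Real.sqrt_le_sqrt
    rw [div_le_div_iff₀ ht hN0]; linarith
  rw [← Real.le_log_iff_exp_le (by linarith)]
  calc M * (2 * √(t / b) + 2 * √(a / t)) ≤ M * (2 * (1 / √N) + 2 * (1 / √N)) := by gcongr
    _ = 4 * M / √N := by ring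
    _ ≤ Real.log (1 + η) := by
      rw [div_le_iff₀ hsN]
      have : q * Real.log (1 + η) = 4 * M := by simp only [q]; field_simp
      nlinarith

lemma log_nonneg_of_pos_le_one {c k : ℝ} (hc : 0 < c) (hk : c ≤ k) : 0 ≤ Real.log (k / c) :=
  Real.log_nonneg (by rw [le_div_iff₀ hc]; linarith)

namespace OFrame

variable {δ A c : ℝ} {D E F₁ F₂ : Set ℂ} {f W : ℂ → ℂ} {y₁ y₂ : ℂ} {Γ G L : Set ℂ}

lemma dist_le_of_opposite (h : OFrame δ A c D E F₁ F₂ f W y₁ y₂ Γ G L) {y y' : ℂ} (hy : y ∈ F₁)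
    (hyG : y ∈ closure G) (hy' : y' ∈ F₂) (hyG' : y' ∈ closure G) :
    dist y y' ≤ (W y).im - (W y').im + 4 * A := by
  have h1 := h.dist_le₁ hy h.memF₁
  have h2 := h.dist_le₂ h.memF₂ hy'
  have h3 := h.up₁ y hy hyG
  have h4 := h.down₂ y' hy' hyG'
  rw [abs_of_nonneg (by linarith)] at h1 h2
  have h5 : dist y₁ y₂ ≤ 4 * δ := by
    have := dist_le_norm_add_norm y₁ y₂
    rw [h.norm_Γ h.memΓ₁, h.norm_Γ h.memΓ₂] at this
    linarith
  have h6 := dist_triangle4 y y₁ y₂ y'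
  linarith [(abs_le.1 h.abs_im₁_le).1, (abs_le.1 h.abs_im₂_le).2, h.two_le]

/-- On the free boundary adjacent to `G`, distances are almost bounded by arclength
differences. -/
lemma dist_le_of_mem_F (h : OFrame δ A c D E F₁ F₂ f W y₁ y₂ Γ G L) {y ζ : ℂ} {N : ℝ}
    (hN : 1 < N) (hy : y ∈ F₁ ∪ F₂) (hyG : y ∈ closure G) (hyN : N * A ≤ ‖W y‖)
    (hζ : ζ ∈ F₁ ∪ F₂) (hζG : ζ ∈ closure G) :
    dist ζ y ≤ (1 + 4 / (N - 1)) * dist (W ζ) (W y) := by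
  have hA := h.A_pos
  have hN1 : 0 < N - 1 := by linarith
  have hdist : dist (W ζ) (W y) = |(W ζ).im - (W y).im| := by
    rw [Complex.dist_eq_re_im, h.re_zero ζ hζ, h.re_zero y hy, sub_self, zero_pow (by norm_num),
      zero_add, Real.sqrt_sq_eq_abs]
  have hfac : 1 ≤ 1 + 4 / (N - 1) := by
    have : 0 < 4 / (N - 1) := by positivity
    linarith
  have hopp : ∀ d, (N - 1) * A ≤ d → dist ζ y ≤ d + 4 * A → dist ζ y ≤ (1 + 4 / (N - 1)) * d := by
    intro d hd h1
    have : 4 * A ≤ 4 / (N - 1) * d := by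
      rw [div_mul_eq_mul_div, le_div_iff₀ hN1]; linarith
    linarith
  have hsame : dist ζ y ≤ |(W ζ).im - (W y).im| →
      dist ζ y ≤ (1 + 4 / (N - 1)) * |(W ζ).im - (W y).im| := fun h1 =>
    h1.trans (le_mul_of_one_le_left (abs_nonneg _) hfac)
  rw [hdist]
  rw [h.norm_eq_of_mem_F hy] at hyN
  have b1 := abs_le.1 h.abs_im₁_le
  have b2 := abs_le.1 h.abs_im₂_le
  rcases hy with hy | hy <;> rcases hζ with hζ | hζ
  · exact hsame (h.dist_le₁ hζ hy)
  · have h1 := h.up₁ y hy hyG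
    have h2 := h.down₂ ζ hζ hζG
    have h3 : N * A ≤ (W y).im := by
      rcases le_abs.1 hyN with h3 | h3
      · exact h3
      · nlinarith
    rw [abs_sub_comm, abs_of_nonneg (by nlinarith)]
    refine hopp _ (by linarith) ?_
    rw [dist_comm]
    exact h.dist_le_of_opposite hy hyG hζ hζG
  · have h1 := h.down₂ y hy hyG
    have h2 := h.up₁ ζ hζ hζG
    have h3 : N * A ≤ -(W y).im := by
      rcases le_abs.1 hyN with h3 | h3
      · nlinarith
      · exact h3
    rw [abs_of_nonneg (by nlinarith)]
    exact hopp _ (by linarith) (h.dist_le_of_opposite hζ hζG hy hyG)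
  · exact hsame (h.dist_le₂ hζ hy)

/-- Distances to a free boundary point are controlled by the potential. -/
lemma norm_sub_le_of_mem_F (h : OFrame δ A c D E F₁ F₂ f W y₁ y₂ Γ G L) {y z : ℂ} {N : ℝ}
    (hN : 10 ≤ N) (hy : y ∈ F₁ ∪ F₂) (hyG : y ∈ closure G) (hyN : N * A ≤ ‖W y‖)
    (hyc : ‖W y‖ ≤ c / 4) (hz : z ∈ shell G W c (2 * A) (c / 2)) :
    ‖z - y‖ ≤ (1 + 4 / (N - 1)) * Real.exp (Real.log (2 / c) *
      (2 * √(‖W z‖ / (c / 2)) + 2 * √(2 * A / ‖W z‖))) * ‖W z - W y‖ := by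
  have hA := h.A_pos
  have hA8 := h.A_le
  have hc := h.c_pos
  have hc16 := h.c_le
  have hB : 1 ≤ 1 + 4 / (N - 1) := by
    have : 0 < 4 / (N - 1) := div_pos (by norm_num) (by linarith)
    linarith
  have hy10 : 10 * A ≤ ‖W y‖ := by nlinarith
  have hne : ∀ x ∈ D, W x - W y ≠ 0 := fun x hx h0 => by
    have h1 := h.re_pos x hx
    rw [sub_eq_zero.1 h0, h.re_zero y hy] at h1
    exact lt_irrefl _ h1
  have hzD := h.shell_subset hz
  have key := h.norm_le_of_shell (a := 2 * A) (b := c / 2) (by linarith) (by linarith)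
    (by linarith) (Q := fun x => (x - y) / (W x - W y)) (B := 1 + 4 / (N - 1))
    (M := Real.log (2 / c)) (by linarith) (log_nonneg_of_pos_le_one hc (by linarith))
    ((differentiableOn_id.sub_const _).div ((h.differentiableOn.mono h.shell_subset).sub_const _)
      fun x hx => hne x (h.shell_subset hx)) ?_ ?_ hz
  · rw [norm_div, div_le_iff₀ (norm_pos_iff.2 (hne z hzD))] at key
    exact key
  · intro ζ hζ hζG ha hb ε hε
    by_cases hζy : ζ = y
    · subst hζy
      obtain ⟨r, hr, -, hiso, -⟩ := h.near_isometry hζ (ε := ε / (1 + ε)) (by positivity)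
      filter_upwards [self_mem_nhdsWithin, mem_nhdsWithin_of_mem_nhds (ball_mem_nhds ζ hr)]
        with x hx1 hx2
      have hxD := h.shell_subset hx1
      have h1 := (hiso x ⟨Or.inl hxD, hx2⟩ ζ ⟨Or.inr hζ, mem_ball_self hr⟩).1
      rw [show 1 - ε / (1 + ε) = 1 / (1 + ε) by field_simp; ring, one_div,
        inv_mul_le_iff₀ (by linarith)] at h1
      rw [norm_div, div_le_iff₀ (norm_pos_iff.2 (hne x hxD)), ← dist_eq_norm, ← dist_eq_norm]
      refine h1.trans ?_
      gcongr
    · have h1 := h.dist_le_of_mem_F (by linarith) hy hyG hyN hζ hζG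
      have h2 : W ζ - W y ≠ 0 := fun h0 => by
        rw [dist_eq_norm (W ζ), h0, norm_zero, mul_zero] at h1
        exact hζy (dist_le_zero.1 h1)
      refine eventually_norm_le_of_continuousWithinAt (X := D ∪ (F₁ ∪ F₂))
        (Q := fun x => (x - y) / (W x - W y))
        ((continuousWithinAt_id.sub continuousWithinAt_const).div
          ((h.contW ζ (Or.inr hζ)).sub continuousWithinAt_const) h2)
        (h.shell_subset.trans subset_union_left) ?_ hε
      rw [norm_div, div_le_iff₀ (norm_pos_iff.2 h2), ← dist_eq_norm, ← dist_eq_norm]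
      exact h1
  · intro ζ hζ hor
    have hζD := h.shell_subset hζ
    have hyn := h.norm_le_of_mem_F hy
    rw [Real.exp_log (by positivity), norm_div, div_le_iff₀ (norm_pos_iff.2 (hne ζ hζD))]
    have h1 := norm_sub_le ζ y
    suffices hs : ‖ζ - y‖ ≤ 2 / c * ‖W ζ - W y‖ by
      refine hs.trans ?_
      have : 0 ≤ 2 / c * ‖W ζ - W y‖ := by positivity
      nlinarith
    rw [div_mul_eq_mul_div, le_div_iff₀ hc]
    rcases hor with h2 | h2
    · have h3 := h.norm_le_of_mem_region hζ.1
      have h4 := norm_sub_norm_le (W y) (W ζ)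
      rw [norm_sub_rev] at h4
      rw [h2] at h3 h4
      nlinarith [norm_nonneg y, norm_nonneg ζ]
    · have h4 := norm_sub_norm_le (W ζ) (W y)
      have h5 := hζ.1.2.1
      nlinarith

/-- The potential is almost an isometry from below at intermediate scales, given control at the
free boundary. -/
lemma norm_sub_le_of_shell (h : OFrame δ A c D E F₁ F₂ f W y₁ y₂ Γ G L) {a b B : ℝ}
    (ha : 10 * A ≤ a) (hab : a < b) (hb : b < c) (hB : 1 ≤ B) {z' : ℂ} (hz' : z' ∈ region G W c)
    (ha' : 2 * a ≤ ‖W z'‖) (hb' : 2 * ‖W z'‖ ≤ b)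
    (hF : ∀ y ∈ F₁ ∪ F₂, y ∈ closure G → a ≤ ‖W y‖ → ‖W y‖ ≤ b →
      ‖z' - y‖ ≤ B * ‖W z' - W y‖) {z : ℂ} (hz : z ∈ shell G W c a b) :
    ‖(dslope W z' z)⁻¹‖ ≤
      B * Real.exp (Real.log (5 / c) * (2 * √(‖W z‖ / b) + 2 * √(a / ‖W z‖))) := by
  have hA := h.A_pos
  have hc := h.c_pos
  have hc16 := h.c_le
  have hsh : z' ∈ shell G W c A c := ⟨hz', by linarith, hz'.2.2⟩
  have hzD' := h.region_subset hz'
  have hslope : ∀ x, x ≠ z' → (dslope W z' x)⁻¹ = (x - z') / (W x - W z') := fun x hx => by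
    rw [dslope_of_ne _ hx, slope_def_field, inv_div]
  have hne0 : ∀ x ∈ shell G W c A c, dslope W z' x ≠ 0 := by
    intro x hx
    by_cases hxz : x = z'
    · rw [hxz, dslope_same, h.deriv_eq hzD']
      exact h.f_ne_zero hz' hsh.2.1
    · rw [dslope_of_ne _ hxz, slope_def_field]
      refine div_ne_zero (sub_ne_zero.2 fun h0 => hxz ?_) (sub_ne_zero.2 hxz)
      exact h.eq_of_eq hz' hx.1 hsh.2.1 h0
  refine h.norm_le_of_shell (by linarith) hab hb (Q := fun x => (dslope W z' x)⁻¹)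
    (B := B) (M := Real.log (5 / c)) (by linarith) (log_nonneg_of_pos_le_one hc (by linarith))
    (DifferentiableOn.inv ((differentiableOn_dslope ((h.isOpen_shell A c).mem_nhds hsh)).2
      (h.differentiableOn.mono h.shell_subset)) hne0) ?_ ?_ hz
  · intro ζ hζ hζG h1 h2 ε hε
    have hζz : ζ ≠ z' := fun h0 => h.notMem_F hzD' (h0 ▸ hζ)
    have hWne : W ζ - W z' ≠ 0 := fun h0 => by
      have h3 := h.re_pos z' hzD'
      rw [← sub_eq_zero.1 h0, h.re_zero ζ hζ] at h3
      exact lt_irrefl _ h3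
    have h3 := eventually_norm_le_of_continuousWithinAt (X := D ∪ (F₁ ∪ F₂))
        (U := shell G W c a b) (Q := fun x => (x - z') / (W x - W z')) (c := B)
        ((continuousWithinAt_id.sub continuousWithinAt_const).div
          ((h.contW ζ (Or.inr hζ)).sub continuousWithinAt_const) hWne)
        (h.shell_subset.trans subset_union_left) (by
          rw [norm_div, div_le_iff₀ (norm_pos_iff.2 hWne)]
          have := hF ζ hζ hζG h1 h2
          rwa [norm_sub_rev, norm_sub_rev (W ζ)]) hε
    filter_upwards [h3, mem_nhdsWithin_of_mem_nhds (isOpen_ne.mem_nhds hζz)] with x hx1 hx2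
    rw [hslope x hx2]
    exact hx1
  · intro ζ hζ hor
    have hζz : ζ ≠ z' := fun h0 => by
      rw [h0] at hor
      rcases hor with h1 | h1 <;> linarith
    have hWne : W ζ - W z' ≠ 0 := fun h0 => hζz (h.eq_of_eq hz' hζ.1 hsh.2.1 (sub_eq_zero.1 h0))
    rw [hslope ζ hζz, Real.exp_log (by positivity), norm_div, div_le_iff₀ (norm_pos_iff.2 hWne)]
    suffices hs : ‖ζ - z'‖ ≤ 5 / c * ‖W ζ - W z'‖ by
      refine hs.trans ?_
      have : 0 ≤ 5 / c * ‖W ζ - W z'‖ := by positivity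
      nlinarith
    rw [div_mul_eq_mul_div, le_div_iff₀ hc]
    have h1 := norm_sub_le ζ z'
    have h2 := h.norm_le_of_mem_region hζ.1
    have h3 := h.norm_le_of_mem_region hz'
    have h4 := norm_sub_norm_le (W ζ) (W z')
    have h5 := norm_sub_norm_le (W z') (W ζ)
    rw [norm_sub_rev (W z')] at h5
    have h6 : ‖ζ - z'‖ * c ≤ ‖W ζ‖ + ‖W z'‖ + 6 * A := by nlinarith
    rcases hor with h7 | h7 <;> rw [h7] at h4 h5 h6 <;> linarith

end OFrame

lemma OFrame.norm_f_le_of_shell {δ A c : ℝ} {D E F₁ F₂ : Set ℂ} {f W : ℂ → ℂ} {y₁ y₂ : ℂ}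
    {Γ G L : Set ℂ} (h : OFrame δ A c D E F₁ F₂ f W y₁ y₂ Γ G L) {z : ℂ}
    (hz : z ∈ shell G W c (2 * A) (c / 2)) :
    ‖f z‖ ≤ Real.exp (Real.log gradBound *
      (2 * √(‖W z‖ / (c / 2)) + 2 * √(2 * A / ‖W z‖))) := by
  have hA := h.A_pos
  have hA8 := h.A_le
  have hc16 := h.c_le
  have hC := four_le_gradBound
  have key := h.norm_le_of_shell (a := 2 * A) (b := c / 2) (by linarith) (by linarith)
    (by linarith) (Q := f) (B := 1) (M := Real.log gradBound) zero_le_one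
    (Real.log_nonneg (by linarith)) (h.differentiableOn_f.mono h.shell_subset) ?_ ?_ hz
  · rwa [one_mul] at key
  · intro ζ hζ _ _ _ ε hε
    obtain ⟨r, hr, -, -, hb⟩ := h.near_isometry hζ hε
    filter_upwards [self_mem_nhdsWithin, mem_nhdsWithin_of_mem_nhds (ball_mem_nhds ζ hr)]
      with x hx1 hx2
    exact (hb x ⟨h.shell_subset hx1, hx2⟩).2
  · intro ζ hζ _
    rw [one_mul, Real.exp_log (by linarith)]
    exact h.norm_f_le_gradBound (by linarith [h.two_le]) hζ.1.1 (by linarith [hζ.1.2.1])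

set_option maxHeartbeats 800000 in
/-- At intermediate scales the potential is almost isometric. -/
theorem exists_scale_almost_isometry {c η : ℝ} (hc : 0 < c) (hη : 0 < η) :
    ∃ N : ℝ, 10 ≤ N ∧ ∀ (δ A : ℝ) (D E F₁ F₂ : Set ℂ) (f W : ℂ → ℂ) (y₁ y₂ : ℂ) (Γ G L : Set ℂ),
      OFrame δ A c D E F₁ F₂ f W y₁ y₂ Γ G L →
      ∀ z ∈ region G W c, N * A ≤ ‖W z‖ → N * ‖W z‖ ≤ c →
        (‖f z‖ ≤ 1 + η ∧ 1 ≤ (1 + η) * ‖f z‖) ∧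
        ∀ z' ∈ region G W c, N * A ≤ ‖W z'‖ → N * ‖W z'‖ ≤ c →
          ‖z - z'‖ ≤ (1 + η) * ‖W z - W z'‖ := by
  have hC := four_le_gradBound
  set κ := min η 1 / 4 with hκ
  have hm0 : 0 < min η 1 := lt_min hη one_pos
  have hm1 : min η 1 ≤ 1 := min_le_right _ _
  have hm2 : min η 1 ≤ η := min_le_left _ _
  have hκ0 : 0 < κ := by positivity
  have hκsq : (1 + κ) * (1 + κ) ≤ 1 + η := by nlinarith
  have hκsq' : (1 + κ / 4) * (1 + κ / 4) ≤ 1 + κ := by nlinarith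
  obtain ⟨n₁, hn₁, hn₁'⟩ := exists_exp_scale_le (max (Real.log (2 / c)) 0) (le_max_right _ _)
    (η := κ / 4) (by linarith)
  obtain ⟨n₂, hn₂, hn₂'⟩ := exists_exp_scale_le (max (Real.log (5 / c)) 0) (le_max_right _ _) hκ0
  obtain ⟨n₃, hn₃, hn₃'⟩ := exists_exp_scale_le (Real.log gradBound)
    (Real.log_nonneg (by linarith)) hη
  obtain ⟨N₁, hN₁⟩ : ∃ N₁, N₁ = 2 * n₁ + 16 / κ + 1 := ⟨_, rfl⟩
  have hκinv : 0 < 16 / κ := by positivity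
  have hN₁0 : 20 ≤ N₁ := by linarith
  have hN₁κ : 4 / (N₁ - 1) ≤ κ / 4 := by
    rw [div_le_div_iff₀ (by linarith) (by norm_num)]
    have : 16 / κ * κ = 16 := by field_simp
    nlinarith
  obtain ⟨N, hN⟩ : ∃ N, N = N₁ * n₂ + 2 * n₃ := ⟨_, rfl⟩
  have hN200 : 200 ≤ N₁ * n₂ := by nlinarith
  refine ⟨N, by linarith, ?_⟩
  intro δ A D E F₁ F₂ f W y₁ y₂ Γ G L h z hz hzA hzc
  have hA := h.A_pos
  have hc16 := h.c_le
  have hshell : ∀ x ∈ region G W c, N₁ * A ≤ ‖W x‖ → N₁ * ‖W x‖ ≤ c →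
      x ∈ shell G W c (2 * A) (c / 2) := fun x hx h1 h2 =>
    ⟨hx, by linarith [mul_le_mul_of_nonneg_right hN₁0 hA.le],
      by linarith [mul_le_mul_of_nonneg_right hN₁0 (norm_nonneg (W x))]⟩
  have hweak : ∀ t : ℝ, 0 ≤ t → N * A ≤ t → N * t ≤ c → N₁ * A ≤ t ∧ N₁ * t ≤ c ∧
      n₂ * (N₁ * A) ≤ t ∧ n₂ * t ≤ c / N₁ ∧ n₃ * (2 * A) ≤ t ∧ n₃ * t ≤ c / 2 := by
    intro t ht h1 h2
    have e1 : N₁ ≤ N₁ * n₂ := le_mul_of_one_le_right (by linarith) (by linarith)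
    have e2 : N₁ ≤ N := by linarith
    have e3 : N₁ * n₂ ≤ N := by linarith
    have e4 : 2 * n₃ ≤ N := by linarith
    refine ⟨(mul_le_mul_of_nonneg_right e2 hA.le).trans h1,
      (mul_le_mul_of_nonneg_right e2 ht).trans h2, ?_, ?_, ?_, ?_⟩
    · have := mul_le_mul_of_nonneg_right e3 hA.le
      linarith
    · rw [le_div_iff₀ (by linarith)]
      have := mul_le_mul_of_nonneg_right e3 ht
      linarith
    · have := mul_le_mul_of_nonneg_right e4 hA.le
      linarith
    · have := mul_le_mul_of_nonneg_right e4 ht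
      linarith
  have hlog2 : max (Real.log (2 / c)) 0 = Real.log (2 / c) :=
    max_eq_left (log_nonneg_of_pos_le_one hc (by linarith))
  have hlog5 : max (Real.log (5 / c)) 0 = Real.log (5 / c) :=
    max_eq_left (log_nonneg_of_pos_le_one hc (by linarith))
  rw [hlog2] at hn₁'
  rw [hlog5] at hn₂'
  have hF : ∀ y ∈ F₁ ∪ F₂, y ∈ closure G → N₁ * A ≤ ‖W y‖ → ‖W y‖ ≤ c / 4 →
      ∀ x ∈ region G W c, N₁ * A ≤ ‖W x‖ → N₁ * ‖W x‖ ≤ c →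
        ‖x - y‖ ≤ (1 + κ) * ‖W x - W y‖ := by
    intro y hy hyG h1 h2 x hx h3 h4
    have h5 := h.norm_sub_le_of_mem_F (N := N₁) (by linarith) hy hyG h1 h2 (hshell x hx h3 h4)
    refine h5.trans (mul_le_mul_of_nonneg_right ?_ (norm_nonneg _))
    refine le_trans ?_ hκsq'
    refine mul_le_mul (by linarith) (hn₁' _ _ _ (by linarith) ?_ ?_) (Real.exp_pos _).le
      (by linarith)
    · linarith [mul_le_mul_of_nonneg_right (by linarith : 2 * n₁ ≤ N₁) hA.le]
    · linarith [mul_le_mul_of_nonneg_right (by linarith : 2 * n₁ ≤ N₁) (norm_nonneg (W x))]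
  have hds : ∀ z' ∈ region G W c, N * A ≤ ‖W z'‖ → N * ‖W z'‖ ≤ c →
      ‖(dslope W z' z)⁻¹‖ ≤ 1 + η := by
    intro z' hz' h1 h2
    obtain ⟨a1, a2, a3, a4, -, -⟩ := hweak _ (norm_nonneg _) h1 h2
    obtain ⟨b1, b2, b3, b4, -, -⟩ := hweak _ (norm_nonneg _) hzA hzc
    have hap : 0 < N₁ * A := by positivity
    have hcN : c / N₁ ≤ c / 4 := div_le_div_of_nonneg_left hc.le (by norm_num) (by linarith)
    have hp : 0 < ‖W z‖ := by linarith
    have hp' : 0 < ‖W z'‖ := by linarith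
    have c1 := (mul_le_mul_of_nonneg_right hn₂ hap.le).trans a3
    have c2 := (mul_le_mul_of_nonneg_right hn₂ hp'.le).trans a4
    have c3 := (mul_le_mul_of_nonneg_right hn₂ hap.le).trans b3
    have c4 := (mul_le_mul_of_nonneg_right hn₂ hp.le).trans b4
    have c5 : 10 * A ≤ N₁ * A := mul_le_mul_of_nonneg_right (by linarith) hA.le
    have h3 := h.norm_sub_le_of_shell (a := N₁ * A) (b := c / N₁) (B := 1 + κ) c5
      (by linarith) (by linarith) (by linarith) hz' (by linarith) (by linarith)
      (fun y hy hyG h4 h5 => hF y hy hyG h4 (by linarith) z' hz' a1 a2)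
      (z := z) ⟨hz, by linarith, by linarith⟩
    refine h3.trans (le_trans ?_ hκsq)
    exact mul_le_mul_of_nonneg_left (hn₂' _ _ _ hap b3 b4) (by linarith)
  obtain ⟨b1, b2, -, -, b5, b6⟩ := hweak _ (norm_nonneg _) hzA hzc
  have hAz : A < ‖W z‖ := by linarith [mul_le_mul_of_nonneg_right hN₁0 hA.le]
  refine ⟨⟨(h.norm_f_le_of_shell (hshell z hz b1 b2)).trans
    (hn₃' _ _ _ (by linarith) b5 b6), ?_⟩, ?_⟩
  · have h1 := hds z hz hzA hzc
    have h2 := norm_pos_iff.2 (h.f_ne_zero hz hAz)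
    rw [dslope_same, h.deriv_eq (h.region_subset hz), norm_inv, inv_le_iff_one_le_mul₀ h2] at h1
    exact h1
  · intro z' hz' h1 h2
    by_cases hzz : z = z'
    · rw [hzz, sub_self, sub_self, norm_zero, mul_zero]
    · have h3 := hds z' hz' h1 h2
      have hW : W z - W z' ≠ 0 := fun h0 =>
        hzz (h.eq_of_eq hz hz' hAz (sub_eq_zero.1 h0).symm).symm
      rw [dslope_of_ne _ hzz, slope_def_field, inv_div, norm_div,
        div_le_iff₀ (norm_pos_iff.2 hW)] at h3
      exact h3

/-- A conformal map whose derivative has modulus close to `1` is close to a rotation. -/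
lemma exists_near_rotation {g k : ℂ → ℂ} {O S : Set ℂ} {η d R : ℝ} (hO : IsOpen O)
    (hg : ∀ w ∈ O, HasDerivAt g (k w) w) (hη : 0 < η)
    (hk : ∀ w ∈ O, 1 - η ≤ ‖k w‖ ∧ ‖k w‖ ≤ 1 + η) (hS : Convex ℝ S) (hd : 0 < d)
    (hSO : ∀ w ∈ S, ball w d ⊆ O) (hdiam : ∀ w ∈ S, ∀ w' ∈ S, ‖w - w'‖ ≤ R) {w₀ : ℂ}
    (hw₀ : w₀ ∈ S) : ∃ θ : ℝ, ∀ w ∈ S,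
      ‖(g w - Complex.exp (θ * I) * w) - (g w₀ - Complex.exp (θ * I) * w₀)‖ ≤
        (6 * η / d * R + η) * R := by
  have hSub : S ⊆ O := fun w hw => hSO w hw (mem_ball_self hd)
  have hkd : DifferentiableOn ℂ k O := by
    have h1 : DifferentiableOn ℂ g O := fun w hw => (hg w hw).differentiableAt.differentiableWithinAt
    exact (h1.deriv hO).congr fun w hw => (hg w hw).deriv.symm
  have hk' : ∀ w ∈ S, ‖deriv k w‖ ≤ 6 * η / d := by
    intro w hw
    set e := Complex.exp (-(arg (k w) * I)) with he
    have hen : ‖e‖ = 1 := by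
      rw [he, ← neg_mul, ← ofReal_neg]; exact Complex.norm_exp_ofReal_mul_I _
    have hek : e * k w = (‖k w‖ : ℂ) := by
      conv_lhs => rw [← Complex.norm_mul_exp_arg_mul_I (k w)]
      rw [he, mul_left_comm, ← Complex.exp_add, neg_add_cancel, Complex.exp_zero, mul_one]
    have hX : DifferentiableOn ℂ (fun v => ((1 + 2 * η : ℝ) : ℂ) - e * k v) (ball w d) :=
      (differentiableOn_const _).sub ((differentiableOn_const _).mul (hkd.mono (hSO w hw)))
    have h1 := norm_deriv_le_of_re_pos hd hX fun v hv => by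
      have h2 := (hk v (hSO w hw hv)).2
      have h3 : (e * k v).re ≤ ‖k v‖ := by
        have := Complex.re_le_norm (e * k v)
        rwa [norm_mul, hen, one_mul] at this
      rw [sub_re, ofReal_re]
      linarith
    have hkw : HasDerivAt k (deriv k w) w :=
      (hkd.differentiableAt (hO.mem_nhds (hSub hw))).hasDerivAt
    have h2 : deriv (fun v => ((1 + 2 * η : ℝ) : ℂ) - e * k v) w = -(e * deriv k w) :=
      ((hkw.const_mul e).const_sub _).deriv
    rw [h2, norm_neg, norm_mul, hen, one_mul, hek, sub_re, ofReal_re, ofReal_re] at h1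
    refine h1.trans ?_
    have h3 := (hk w (hSub hw)).1
    rw [div_le_div_iff_of_pos_right hd]
    linarith
  refine ⟨arg (k w₀), fun w hw => ?_⟩
  set e := Complex.exp (arg (k w₀) * I) with he
  have hke : ‖k w₀ - e‖ ≤ η := by
    have h1 : k w₀ - e = ((‖k w₀‖ - 1 : ℝ) : ℂ) * e := by
      conv_lhs => rw [← Complex.norm_mul_exp_arg_mul_I (k w₀)]
      push_cast; ring
    rw [h1, norm_mul, he, Complex.norm_exp_ofReal_mul_I, mul_one, Complex.norm_real,
      Real.norm_eq_abs, abs_le]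
    have := hk w₀ (hSub hw₀)
    exact ⟨by linarith, by linarith⟩
  have hR : 0 ≤ R := (norm_nonneg _).trans (hdiam w₀ hw₀ w₀ hw₀)
  have hkk : ∀ v ∈ S, ‖k v - e‖ ≤ 6 * η / d * R + η := by
    intro v hv
    have h1 := hS.norm_image_sub_le_of_norm_hasDerivWithin_le (f := k) (f' := deriv k)
      (fun x hx => (hkd.differentiableAt (hO.mem_nhds (hSub hx))).hasDerivAt.hasDerivWithinAt)
      hk' hw₀ hv
    have h2 : 6 * η / d * ‖v - w₀‖ ≤ 6 * η / d * R := by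
      have := hdiam v hv w₀ hw₀
      gcongr
    have h3 := norm_sub_le_norm_sub_add_norm_sub (k v) (k w₀) e
    linarith
  have h1 := hS.norm_image_sub_le_of_norm_hasDerivWithin_le (f := fun v => g v - e * v)
    (f' := fun v => k v - e) (fun x hx => by
      have h2 := (hg x (hSub hx)).sub ((hasDerivAt_id x).const_mul e)
      rw [mul_one] at h2
      exact h2.hasDerivWithinAt) hkk hw₀ hw
  refine h1.trans ?_
  have h2 := hdiam w hw w₀ hw₀
  have h3 : 0 ≤ 6 * η / d * R + η := by positivity
  gcongr

namespace OFrame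

variable {δ A c : ℝ} {D E F₁ F₂ : Set ℂ} {f W : ℂ → ℂ} {y₁ y₂ : ℂ} {Γ G L : Set ℂ}

/-- The inverse of the potential at intermediate scales. -/
lemma exists_inverse (h : OFrame δ A c D E F₁ F₂ f W y₁ y₂ Γ G L) {N K : ℝ} (hN : 10 ≤ N)
    (hlip : ∀ z ∈ region G W c, N * A ≤ ‖W z‖ → N * ‖W z‖ ≤ c → ∀ z' ∈ region G W c,
      N * A ≤ ‖W z'‖ → N * ‖W z'‖ ≤ c → ‖z - z'‖ ≤ K * ‖W z - W z'‖) :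
    ∃ g : ℂ → ℂ, (∀ w ∈ halfAnn (N * A) (c / N), g w ∈ region G W c ∧ W (g w) = w ∧
      HasDerivAt g (f (g w))⁻¹ w) ∧
      ∀ z ∈ region G W c, N * A < ‖W z‖ → ‖W z‖ < c / N → g (W z) = z := by
  have hA := h.A_pos
  have hc := h.c_pos
  have hN0 : 0 < N := by linarith
  have hsub : halfAnn (N * A) (c / N) ⊆ halfAnn A c := fun w hw => by
    refine ⟨hw.1, ?_, ?_⟩
    · have := hw.2.1; nlinarith
    · refine hw.2.2.trans_le (div_le_self hc.le (by linarith))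
  choose! g hg using fun w (hw : w ∈ halfAnn A c) => h.halfAnn_subset hw
  have hbd : ∀ w ∈ halfAnn (N * A) (c / N), N * A ≤ ‖W (g w)‖ ∧ N * ‖W (g w)‖ ≤ c := by
    intro w hw
    rw [(hg w (hsub hw)).2]
    have := hw.2.2
    rw [lt_div_iff₀ hN0] at this
    exact ⟨hw.2.1.le, by linarith⟩
  have hO := isOpen_halfAnn (N * A) (c / N)
  refine ⟨g, fun w hw => ⟨(hg w (hsub hw)).1, (hg w (hsub hw)).2, ?_⟩, fun z hz h1 h2 => ?_⟩
  · have hcont : ContinuousAt g w := by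
      rw [Metric.continuousAt_iff']
      intro ε hε
      have hlim : Tendsto (fun v => K * ‖v - w‖) (𝓝 w) (𝓝 0) := by
        have : Continuous fun v : ℂ => K * ‖v - w‖ := by fun_prop
        have h2 := this.tendsto w
        rwa [sub_self, norm_zero, mul_zero] at h2
      filter_upwards [hO.mem_nhds hw, hlim.eventually_lt_const hε] with v hv hv2
      rw [dist_eq_norm]
      have h3 := hlip _ (hg v (hsub hv)).1 (hbd v hv).1 (hbd v hv).2 _ (hg w (hsub hw)).1
        (hbd w hw).1 (hbd w hw).2
      rw [(hg v (hsub hv)).2, (hg w (hsub hw)).2] at h3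
      exact h3.trans_lt hv2
    have hAw : A < ‖W (g w)‖ := by rw [(hg w (hsub hw)).2]; exact (hsub hw).2.1
    refine HasDerivAt.of_local_left_inverse hcont
      (h.derivW _ (h.region_subset (hg w (hsub hw)).1)) (h.f_ne_zero (hg w (hsub hw)).1 hAw) ?_
    filter_upwards [hO.mem_nhds hw] with v hv using (hg v (hsub hv)).2
  · have hw : W z ∈ halfAnn A c :=
      hsub ⟨h.re_pos z (h.region_subset hz), h1, h2⟩
    exact h.eq_of_eq hz (hg _ hw).1 hw.2.1 (hg _ hw).2

lemma isPreconnected_shell (h : OFrame δ A c D E F₁ F₂ f W y₁ y₂ Γ G L) {N K a b : ℝ}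
    (hN : 10 ≤ N)
    (hlip : ∀ z ∈ region G W c, N * A ≤ ‖W z‖ → N * ‖W z‖ ≤ c → ∀ z' ∈ region G W c,
      N * A ≤ ‖W z'‖ → N * ‖W z'‖ ≤ c → ‖z - z'‖ ≤ K * ‖W z - W z'‖)
    (ha : N * A ≤ a) (hb : b ≤ c / N) : IsPreconnected (shell G W c a b) := by
  have hA := h.A_pos
  have hc := h.c_pos
  obtain ⟨g, hg, hginv⟩ := h.exists_inverse hN hlip
  have hsub : halfAnn a b ⊆ halfAnn (N * A) (c / N) := fun w hw =>
    ⟨hw.1, ha.trans_lt hw.2.1, hw.2.2.trans_le hb⟩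
  have himg : shell G W c a b = g '' halfAnn a b := by
    ext z
    constructor
    · intro hz
      exact ⟨W z, ⟨h.re_pos z (h.region_subset hz.1), hz.2⟩,
        hginv z hz.1 (ha.trans_lt hz.2.1) (hz.2.2.trans_le hb)⟩
    · rintro ⟨w, hw, rfl⟩
      obtain ⟨h1, h2, -⟩ := hg w (hsub hw)
      exact ⟨h1, by rw [h2]; exact hw.2⟩
  rw [himg]
  exact (isPreconnected_halfAnn (by nlinarith)).image g fun w hw =>
    (hg w (hsub hw)).2.2.continuousAt.continuousWithinAt

end OFrame

set_option maxHeartbeats 800000 in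
/-- At every intermediate scale the potential is close to a rotation, and its level shells are
connected. -/
theorem exists_scale_flat {c σ : ℝ} (hc : 0 < c) (hc16 : c ≤ 1 / 16) (hσ : 0 < σ) (hσ1 : σ ≤ 1) :
    ∃ K : ℝ, 10 ≤ K ∧ ∀ (δ A : ℝ) (D E F₁ F₂ : Set ℂ) (f W : ℂ → ℂ) (y₁ y₂ : ℂ) (Γ G L : Set ℂ),
      OFrame δ A c D E F₁ F₂ f W y₁ y₂ Γ G L →
      (∀ a b, K * A ≤ a → K * b ≤ c → IsPreconnected (shell G W c a b)) ∧
      ∀ ρ, K * A ≤ ρ → K * ρ ≤ c → ∃ θ : ℝ, ∀ z ∈ region G W c, ‖W z‖ ≤ ρ →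
        ‖z - Complex.exp (θ * I) * W z‖ ≤ σ * ρ := by
  obtain ⟨s, hs⟩ : ∃ s, s = σ * c / 200 := ⟨_, rfl⟩
  have hs0 : 0 < s := by rw [hs]; positivity
  have hs1 : s ≤ 1 / 1000 := by rw [hs]; nlinarith
  have hsc : 200 * s = σ * c := by rw [hs]; ring
  obtain ⟨η, hηs⟩ : ∃ η, η = s ^ 2 := ⟨_, rfl⟩
  have hη0 : 0 < η := by rw [hηs]; positivity
  have hη1 : η ≤ s / 1000 := by rw [hηs]; nlinarith
  obtain ⟨N, hN, hiso⟩ := exists_scale_almost_isometry hc hη0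
  have hN0 : 0 < N := by linarith
  obtain ⟨K, hK⟩ : ∃ K, K = 10 * N / s := ⟨_, rfl⟩
  have hKs : K * s = 10 * N := by rw [hK]; field_simp
  have hKN : 10 * N ≤ K := by rw [hK, le_div_iff₀ hs0]; nlinarith
  refine ⟨K, by linarith, ?_⟩
  intro δ A D E F₁ F₂ f W y₁ y₂ Γ G L h
  have hA := h.A_pos
  have hlip := fun z hz h1 h2 => (hiso δ A D E F₁ F₂ f W y₁ y₂ Γ G L h z hz h1 h2).2
  have hfb := fun z hz h1 h2 => (hiso δ A D E F₁ F₂ f W y₁ y₂ Γ G L h z hz h1 h2).1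
  refine ⟨fun a b ha hb => ?_, fun ρ hρA hρc => ?_⟩
  · rcases le_or_gt b 0 with hb0 | hb0
    · have : shell G W c a b = ∅ := eq_empty_of_forall_notMem fun z hz => by
        linarith [norm_nonneg (W z), hz.2.2]
      rw [this]; exact isPreconnected_empty
    refine h.isPreconnected_shell hN hlip (le_trans ?_ ha) ?_
    · exact mul_le_mul_of_nonneg_right (by linarith) hA.le
    · rw [le_div_iff₀ hN0]
      have := mul_le_mul_of_nonneg_right (by linarith : N ≤ K) hb0.le
      linarith
  have hKA : 0 < K * A := mul_pos (by linarith) hA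
  have hρ0 : 0 < ρ := by linarith
  have hsρ : 0 < s * ρ := by positivity
  have hNA : 10 * (N * A) ≤ s * ρ := by
    have := mul_le_mul_of_nonneg_left hρA hs0.le
    have e : s * (K * A) = 10 * (N * A) := by
      calc s * (K * A) = K * s * A := by ring
        _ = _ := by rw [hKs]; ring
    linarith
  have hNρ : 10 * (N * ρ) ≤ c := by
    have := mul_le_mul_of_nonneg_right hKN hρ0.le
    linarith
  have hAs : 3 * A ≤ s * ρ := by
    have := mul_le_mul_of_nonneg_right hN hA.le
    linarith
  have hNAp : 0 < N * A := by positivity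
  obtain ⟨g, hg, hginv⟩ := h.exists_inverse hN hlip
  set O := halfAnn (N * A) (c / N) with hOdef
  have hmemO : ∀ w : ℂ, 0 < w.re → N * A < ‖w‖ → ‖w‖ < 10 * ρ → w ∈ O := by
    intro w h1 h2 h3
    refine ⟨h1, h2, ?_⟩
    rw [lt_div_iff₀ hN0]
    have := mul_lt_mul_of_pos_left h3 hN0
    linarith
  set S : Set ℂ := {w | 2 * s * ρ ≤ w.re} ∩ closedBall 0 (2 * ρ) with hSdef
  have hSc : Convex ℝ S :=
    (convex_halfSpace_re_ge _).inter (convex_closedBall _ _)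
  have hSO : ∀ w ∈ S, ball w (s * ρ) ⊆ O := by
    intro w hw v hv
    have h1 : 2 * s * ρ ≤ w.re := hw.1
    have h2 : ‖w‖ ≤ 2 * ρ := mem_closedBall_zero_iff.1 hw.2
    rw [mem_ball, dist_eq_norm] at hv
    have h3 := (abs_le.1 ((Complex.abs_re_le_norm (v - w)).trans hv.le)).1
    rw [sub_re] at h3
    have h5 := norm_sub_norm_le v w
    have h6 := Complex.re_le_norm v
    have h7 : s * ρ ≤ ρ := by nlinarith
    have h8 : w.re - s * ρ < v.re := by
      have := (abs_lt.1 ((Complex.abs_re_le_norm (v - w)).trans_lt hv)).1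
      rw [sub_re] at this
      linarith
    exact hmemO v (by linarith) (by linarith) (by linarith)
  have hw₀ : ((2 * s * ρ : ℝ) : ℂ) ∈ S := by
    refine ⟨by rw [mem_ofPred_eq, ofReal_re], ?_⟩
    rw [mem_closedBall_zero_iff, Complex.norm_real, Real.norm_eq_abs, abs_of_pos (by linarith)]
    nlinarith
  have hbnd : ∀ w ∈ O, N * A ≤ ‖W (g w)‖ ∧ N * ‖W (g w)‖ ≤ c := by
    intro w hw
    rw [(hg w hw).2.1]
    have h3 := hw.2.2
    rw [lt_div_iff₀ hN0] at h3
    exact ⟨hw.2.1.le, by linarith⟩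
  obtain ⟨θ, hθ⟩ := exists_near_rotation (g := g) (k := fun w => (f (g w))⁻¹) (η := η)
    (d := s * ρ) (R := 4 * ρ) (isOpen_halfAnn _ _) (fun w hw => (hg w hw).2.2) hη0
    (fun w hw => by
      obtain ⟨h1, h2⟩ := hfb _ (hg w hw).1 (hbnd w hw).1 (hbnd w hw).2
      have hp : 0 < ‖f (g w)‖ := by nlinarith [norm_nonneg (f (g w))]
      rw [norm_inv]
      constructor
      · rw [le_inv_comm₀ (by linarith) hp, inv_eq_one_div, le_div_iff₀ (by linarith)]
        nlinarith
      · rw [inv_le_iff_one_le_mul₀ hp]; linarith)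
    hSc hsρ hSO (fun w hw w' hw' => by
      have h1 := mem_closedBall_zero_iff.1 hw.2
      have h2 := mem_closedBall_zero_iff.1 hw'.2
      linarith [norm_sub_le w w']) hw₀
  refine ⟨θ, ?_⟩
  set e := Complex.exp (θ * I) with he
  have hen : ‖e‖ = 1 := Complex.norm_exp_ofReal_mul_I _
  have hconst : (6 * η / (s * ρ) * (4 * ρ) + η) * (4 * ρ) ≤ 97 * (s * ρ) := by
    have e1 : 6 * η / (s * ρ) * (4 * ρ) = 24 * s := by rw [hηs]; field_simp; ring
    rw [e1]
    nlinarith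
  have hsmall : ∀ z ∈ region G W c, ‖W z‖ ≤ 2 * s * ρ →
      c * ‖z - e * W z‖ ≤ 4 * (s * ρ) := by
    intro z hz h1
    have h2 := h.norm_le_of_mem_region hz
    have h3 := norm_sub_le z (e * W z)
    rw [norm_mul, hen, one_mul] at h3
    have h4 := mul_le_mul_of_nonneg_left h3 hc.le
    have h5 : c * ‖W z‖ ≤ 1 / 16 * ‖W z‖ := mul_le_mul_of_nonneg_right hc16 (norm_nonneg _)
    linarith
  have hO₀ := hSO _ hw₀ (mem_ball_self hsρ)
  have hS : ∀ w ∈ S, c * ‖g w - e * w‖ ≤ 12 * (s * ρ) := by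
    intro w hw
    have h1 := (hθ w hw).trans hconst
    have h2 := hsmall _ (hg _ hO₀).1 (by
      rw [(hg _ hO₀).2.1, Complex.norm_real, Real.norm_eq_abs, abs_of_pos (by linarith)])
    rw [(hg _ hO₀).2.1] at h2
    have h3 := norm_sub_norm_le (g w - e * w) (g ((2 * s * ρ : ℝ) : ℂ) - e * ((2 * s * ρ : ℝ) : ℂ))
    have h4 : c * ‖g w - e * w‖ ≤
        c * (97 * (s * ρ)) + c * ‖g ((2 * s * ρ : ℝ) : ℂ) - e * ((2 * s * ρ : ℝ) : ℂ)‖ := by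
      rw [← mul_add]
      exact mul_le_mul_of_nonneg_left (by linarith) hc.le
    have h5 : c * (97 * (s * ρ)) ≤ 1 / 16 * (97 * (s * ρ)) := by gcongr
    linarith
  intro z hz hzρ
  suffices hfin : c * ‖z - e * W z‖ ≤ 200 * s * ρ by
    rw [hsc] at hfin
    nlinarith
  rcases le_or_gt ‖W z‖ (2 * s * ρ) with h1 | h1
  · linarith [hsmall z hz h1]
  · have hre := h.re_pos z (h.region_subset hz)
    set w := W z + ((2 * s * ρ : ℝ) : ℂ) with hw
    have hwn : ‖w‖ ≤ 2 * ρ := by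
      have := norm_add_le (W z) ((2 * s * ρ : ℝ) : ℂ)
      rw [Complex.norm_real, Real.norm_eq_abs, abs_of_pos (by linarith)] at this
      nlinarith
    have hwS : w ∈ S := by
      refine ⟨?_, mem_closedBall_zero_iff.2 hwn⟩
      rw [mem_ofPred_eq, hw, add_re, ofReal_re]
      linarith
    have hwO := hSO w hwS (mem_ball_self hsρ)
    have h2 := hlip z hz (by linarith) (by
      have := mul_le_mul_of_nonneg_left hzρ hN0.le
      linarith) (g w) (hg w hwO).1 (hbnd w hwO).1 (hbnd w hwO).2
    have hWw : ‖W z - w‖ = 2 * s * ρ := by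
      rw [hw, sub_add_cancel_left, norm_neg, Complex.norm_real, Real.norm_eq_abs,
        abs_of_pos (by linarith)]
    rw [(hg w hwO).2.1, hWw] at h2
    have h3 := hS w hwS
    have h4 : z - e * W z = (z - g w) + (g w - e * w) - e * (W z - w) := by ring
    have h5 : ‖z - e * W z‖ ≤ ‖z - g w‖ + ‖g w - e * w‖ + 2 * s * ρ := by
      rw [h4]
      refine (norm_sub_le _ _).trans ?_
      rw [norm_mul, hen, one_mul, hWw]
      linarith [norm_add_le (z - g w) (g w - e * w)]
    have h6 : ‖z - g w‖ ≤ 4 * (s * ρ) := by nlinarith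
    have h7 := mul_le_mul_of_nonneg_left h5 hc.le
    have h8 : c * (4 * (s * ρ) + 2 * s * ρ) ≤ 1 / 16 * (4 * (s * ρ) + 2 * s * ρ) := by
      apply mul_le_mul_of_nonneg_right hc16; linarith
    have h9 : c * ‖z - g w‖ ≤ c * (4 * (s * ρ)) := mul_le_mul_of_nonneg_left h6 hc.le
    linarith

/-- A universal lower bound for the normalised potential on the circle of radius `1 / 4`. -/
noncomputable def potBound : ℝ := Real.exp (-(16 * Real.pi * gradBound)) / 16

lemma potBound_pos : 0 < potBound := div_pos (Real.exp_pos _) (by norm_num)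

lemma potBound_le : potBound ≤ 1 / 16 := by
  have : Real.exp (-(16 * Real.pi * gradBound)) ≤ 1 := by
    rw [Real.exp_le_one_iff, neg_nonpos]
    have := four_le_gradBound
    positivity
  unfold potBound
  linarith

lemma Cut.potBound_le_norm {δ A : ℝ} {D E F₁ F₂ : Set ℂ} {f W : ℂ → ℂ} {y₁ y₂ : ℂ}
    {Γ G L : Set ℂ} (h : Cut δ D E F₁ F₂ f W y₁ y₂ Γ G L) (hδ : 2 * δ ≤ A) (hA : A ≤ 1 / 128)
    (hb : ∀ z ∈ Γ, ‖W z‖ ≤ A) {z : ℂ} (hz : z ∈ D) (hz4 : ‖z‖ = 1 / 4) :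
    potBound ≤ ‖W z‖ := by
  have hC := four_le_gradBound
  have hδ0 := h.pos
  set η := 1 / (16 * gradBound) with hη
  have hη0 : 0 < η := by positivity
  have hη1 : η ≤ 1 / 64 := by
    rw [hη, div_le_div_iff₀ (by positivity) (by norm_num)]; linarith
  have hηC : gradBound * η = 1 / 16 := by rw [hη]; field_simp
  have near : ∀ x ∈ D, ‖x‖ = 1 / 4 → infDist x (F₁ ∪ F₂) ≤ η → 1 / 8 ≤ ‖W x‖ := by
    intro x hx hx4 hxd
    have hd := h.infDist_pos hx
    obtain ⟨y, hy, hyd⟩ := h.exists_nearest (z := x) (κ := 1 / 8) (by linarith)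
      (by rw [hx4]; linarith) (by rw [hx4]; norm_num)
    have hball := h.ball_subset hx hd le_rfl (by rw [hx4]; linarith) (by rw [hx4]; linarith)
    have h1 := h.dist_le_of_nearest hd hball hy hyd.le (by rw [hx4]; linarith)
      (by rw [hx4]; linarith)
    have h2 := h.norm_le_of_mem_F hδ hb hy
    have h3 : gradBound * infDist x (F₁ ∪ F₂) ≤ 1 / 16 := by
      rw [← hηC]; gcongr
    have h4 := norm_sub_norm_le x y
    rw [← dist_eq_norm, dist_comm, hyd, hx4] at h4
    have h5 := norm_sub_norm_le (W y) (W x)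
    rw [← dist_eq_norm, dist_comm] at h5
    linarith
  have hexp1 : Real.exp (-(16 * Real.pi * gradBound)) ≤ 1 := by
    rw [Real.exp_le_one_iff, neg_nonpos]; positivity
  rcases le_or_gt (infDist z (F₁ ∪ F₂)) η with h1 | h1
  · linarith [near z hz hz4 h1, potBound_le]
  · obtain ⟨z', hz', hzn, hzd, hc⟩ := h.exists_chain hz hη0 h1.le (by rw [hz4]; linarith)
      (by rw [hz4]; linarith)
    have h2 := near z' hz' (hzn.trans hz4) hzd.le
    have h3 := (hc 0).2
    have e1 : 4 * Real.pi * ‖z‖ / η = 16 * Real.pi * gradBound := by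
      rw [hz4, hη]; field_simp
    rw [ofReal_zero, zero_mul, add_zero, add_zero, e1] at h3
    have h4 : 1 / 8 * Real.exp (-(16 * Real.pi * gradBound)) ≤ ‖W z‖ := by
      rw [Real.exp_neg, ← div_eq_mul_inv, div_le_iff₀ (Real.exp_pos _)]
      linarith
    unfold potBound
    linarith [Real.exp_pos (-(16 * Real.pi * gradBound))]

/-- Every potential on a thick annulus has an oriented frame. -/
theorem Potential.exists_oFrame {δ : ℝ} {D E F₁ F₂ : Set ℂ} {f W : ℂ → ℂ}
    (h : Potential δ D E F₁ F₂ f W) (hδ : 8 * (4 * Real.pi * gradBound * δ) ≤ potBound) :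
    ∃ F₁' F₂' W' y₁ y₂ Γ G L,
      OFrame δ (4 * Real.pi * gradBound * δ) potBound D E F₁' F₂' f W' y₁ y₂ Γ G L ∧
      ∀ z, (W' z).re = (W z).re := by
  have hC := four_le_gradBound
  have hpi := Real.pi_gt_three
  have hδ0 := h.pos
  have hc := potBound_le
  have hCpi : 12 ≤ Real.pi * gradBound := by nlinarith
  have h2A : 2 * δ ≤ 4 * Real.pi * gradBound * δ := by nlinarith
  obtain ⟨y₁, y₂, Γ, G, L, hcut⟩ := h.exists_cut (by linarith)
  set κ := (W y₂).im with hκ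
  have hcut' := hcut.sub_const κ
  have hy₂ : W y₂ - κ * I = 0 := by
    apply Complex.ext <;> simp [h.re_zero y₂ (Or.inr hcut.memF₂), hκ]
  have hb : ∀ z ∈ Γ, ‖W z - κ * I‖ ≤ 4 * Real.pi * gradBound * δ := fun z hz => by
    have h1 := hcut'.dist_le_of_mem_Γ (by linarith) hz hcut.memΓ₂
    rwa [hy₂, dist_zero_right] at h1
  have hframe : Frame δ (4 * Real.pi * gradBound * δ) potBound D E F₁ F₂ f
      (fun z => W z - κ * I) y₁ y₂ Γ G L :=
    { hcut' with
      two_le := h2A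
      c_le := hc
      A_le := hδ
      bndΓ := hb
      low := fun z hz hz4 => hcut'.potBound_le_norm h2A (by linarith) hb hz hz4 }
  rcases hframe.exists_oFrame with h1 | h1
  · exact ⟨_, _, _, _, _, _, _, _, h1, fun z => by simp⟩
  · exact ⟨_, _, _, _, _, _, _, _, h1, fun z => by simp⟩

/-- A component of the positive phase in a smaller disc reaches the boundary of that disc. -/
lemma TwoArcs.not_component_subset_closedBall {δ : ℝ} {D E F₁ F₂ : Set ℂ}
    (h : TwoArcs δ D E F₁ F₂) {R R' : ℝ} (hRR : R' < R) (hR : R ≤ 1) {z₀ : ℂ}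
    (hz₀ : z₀ ∈ D ∩ ball 0 R) :
    ¬ connectedComponentIn (D ∩ ball 0 R) z₀ ⊆ closedBall 0 R' := by
  intro hsub
  set T := connectedComponentIn (D ∩ ball 0 R) z₀ with hT
  have hSo : IsOpen (D ∩ ball 0 R) := h.openD.inter isOpen_ball
  have hTo : IsOpen T := hSo.connectedComponentIn
  have hTS : T ⊆ D ∩ ball 0 R := connectedComponentIn_subset _ _
  have hzT : z₀ ∈ T := mem_connectedComponentIn hz₀
  have hTc : IsPreconnected T := isPreconnected_connectedComponentIn
  have hclb : closure T ⊆ closedBall 0 R' := closure_minimal hsub isClosed_closedBall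
  have habs : ∀ X : Set ℂ, IsPreconnected X → X ⊆ D ∩ ball 0 R → (X ∩ T).Nonempty → X ⊆ T := by
    rintro X hX hXS ⟨x, hx, hxT⟩
    have h1 := hX.subset_connectedComponentIn hx hXS
    rwa [← connectedComponentIn_eq hxT] at h1
  have hcl : ∀ ζ ∈ closure T, ζ ∈ D → ζ ∈ T := by
    intro ζ hζ hζD
    have h1 : ζ ∈ D ∩ ball 0 R := ⟨hζD, mem_ball_zero_iff.2
      ((mem_closedBall_zero_iff.1 (hclb hζ)).trans_lt hRR)⟩
    obtain ⟨r, hr, hb⟩ := Metric.isOpen_iff.1 hSo ζ h1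
    refine habs _ (convex_ball ζ r).isPreconnected hb ?_ (mem_ball_self hr)
    exact mem_closure_iff_nhds.1 hζ _ (ball_mem_nhds ζ hr)
  have hF : ∀ M : Set ℂ, M ⊆ F₁ ∪ F₂ → IsPreconnected M → (closure M ∩ sphere 0 1).Nonempty →
      ∀ y ∈ M, y ∉ closure T := by
    intro M hM hMc hMo y hy hyT
    have hall : M ⊆ closedBall 0 R' := fun y' hy' => hclb <| by
      refine (hMc.iff_of_eventually_iff (p := fun y => y ∈ closure T) (fun x hx => ?_) hy hy').1 hyT
      by_cases hxT : x ∈ closure T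
      · have hxR : x ∈ ball (0 : ℂ) R := mem_ball_zero_iff.2
          ((mem_closedBall_zero_iff.1 (hclb hxT)).trans_lt hRR)
        obtain ⟨r, hr, hb⟩ := Metric.isOpen_iff.1 isOpen_ball x hxR
        obtain ⟨r', hr', C, hCs, hCc, hC⟩ := h.locD x (hM hx) r hr
        have hCT : C ⊆ T := by
          refine habs C hCc (fun z hz => ⟨(hCs hz).1, hb (hCs hz).2⟩) ?_
          obtain ⟨z, hz1, hz2⟩ := mem_closure_iff_nhds.1 hxT _ (ball_mem_nhds x hr')
          exact ⟨z, hC ⟨(hTS hz2).1, hz1⟩, hz2⟩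
        filter_upwards [self_mem_nhdsWithin, mem_nhdsWithin_of_mem_nhds (ball_mem_nhds x hr')]
          with x' h1 h2
        refine iff_of_true ?_ hxT
        rw [mem_closure_iff_nhds]
        intro t ht
        obtain ⟨z, hz1, hz2⟩ := mem_closure_iff_nhds.1 (h.clD (hM h1)) _
          (inter_mem ht (isOpen_ball.mem_nhds h2))
        exact ⟨z, hz1.1, hCT (hC ⟨hz2, hz1.2⟩)⟩
      · filter_upwards [mem_nhdsWithin_of_mem_nhds (isClosed_closure.isOpen_compl.mem_nhds hxT)]
          with x' h1
        exact iff_of_false h1 hxT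
    obtain ⟨q, hq1, hq2⟩ := hMo
    have h1 := mem_closedBall_zero_iff.1 (closure_minimal hall isClosed_closedBall hq1)
    rw [mem_sphere_zero_iff_norm] at hq2
    linarith
  have hann : ann δ 1 ⊆ T := by
    refine (isPreconnected_ann h.pos).subset_of_closure_inter_subset hTo
      ⟨z₀, h.D_subset hz₀.1, hzT⟩ ?_
    rintro ζ ⟨hζT, hζ⟩
    rcases h.mem_of_mem_closure hζ (closure_mono (fun z hz => (hTS hz).1) hζT) with h1 | h1 | h1
    · exact hcl ζ hζT h1
    · exact absurd hζT (hF F₁ subset_union_left h.conn₁ h.outer₁ ζ h1)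
    · exact absurd hζT (hF F₂ subset_union_right h.conn₂ h.outer₂ ζ h1)
  obtain ⟨m, hm1, hm2⟩ := exists_between h.lt_one
  obtain ⟨y, hy, -⟩ := h.exists_norm_eq hm1 hm2
  exact disjoint_left.1 h.disjDF (hTS (hann (h.F_subset (Or.inl hy)))).1 (Or.inl hy)

open scoped ComplexConjugate

namespace OFrame

variable {δ A c : ℝ} {D E F₁ F₂ : Set ℂ} {f W : ℂ → ℂ} {y₁ y₂ : ℂ} {Γ G L : Set ℂ}

/-- The component of the positive phase in a disc that accumulates at the inner circle: it lies
in `G` up to the scale of the inner circle, its potential is controlled, and it contains the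
shells of the potential below the scale of the disc. -/
lemma component_spec (h : OFrame δ A c D E F₁ F₂ f W y₁ y₂ Γ G L) {K R κ : ℝ} (hK : 10 ≤ K)
    (hL : ∀ z ∈ L, ‖z‖ ≤ A)
    (hconn : ∀ a b, K * A ≤ a → K * b ≤ c → IsPreconnected (shell G W c a b))
    (hflat : ∀ ρ, K * A ≤ ρ → K * ρ ≤ c → ∃ θ : ℝ, ∀ z ∈ region G W c, ‖W z‖ ≤ ρ →
        ‖z - Complex.exp (θ * I) * W z‖ ≤ 1 / 100 * ρ)
    (hR : K * (3 * R) ≤ c) (hκ : (K + 4) * A ≤ κ * c) (hκR : 4 * κ < R)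
    {T : Set ℂ} {z₀ : ℂ} (hz₀ : z₀ ∈ D ∩ ball 0 R)
    (hT : T = connectedComponentIn (D ∩ ball 0 R) z₀)
    (hTδ : (closure T ∩ sphere 0 δ).Nonempty) :
    (∀ z ∈ T, z ∈ G ∨ ‖z‖ ≤ A) ∧
    (∀ z ∈ T, z ∈ G → z ∈ region G W c ∧ (‖W z‖ ≤ K * A ∨ ‖W z‖ ≤ 2 * ‖z‖)) ∧
    shell G W c (K * A) (R / 2) ⊆ T := by
  have hA := h.A_pos
  have hA8 := h.A_le
  have hc := h.c_pos
  have hc16 := h.c_le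
  have hκA : 64 * A ≤ κ := by nlinarith
  have hKA : K * A ≤ κ := by nlinarith
  have hR0 : 0 < R := by linarith
  have hRc : 30 * R ≤ c := by nlinarith
  have hTS : T ⊆ D ∩ ball 0 R := hT ▸ connectedComponentIn_subset _ _
  have hTc : IsPreconnected T := hT ▸ isPreconnected_connectedComponentIn
  have habs : ∀ X : Set ℂ, IsPreconnected X → X ⊆ D ∩ ball 0 R → (X ∩ T).Nonempty → X ⊆ T := by
    rintro X hX hXS ⟨x, hx, hxT⟩
    have h1 := hX.subset_connectedComponentIn hx hXS
    rw [hT] at hxT ⊢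
    rwa [← connectedComponentIn_eq hxT] at h1
  have hout : ∀ R' < R, ∃ z ∈ T, R' < ‖z‖ := by
    intro R' hR'
    have h1 := h.not_component_subset_closedBall hR' (by linarith) hz₀
    rw [← hT, not_subset] at h1
    obtain ⟨z, hz, hz2⟩ := h1
    exact ⟨z, hz, by rwa [mem_closedBall_zero_iff, not_le] at hz2⟩
  have hcases : ∀ z ∈ T, z ∈ G ∨ ‖z‖ ≤ A := by
    intro z hz
    by_cases hΓ : z ∈ Γ
    · right; rw [h.norm_Γ hΓ]; exact h.two_le
    · rcases h.mem_GL (hTS hz).1 hΓ with h1 | h1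
      exacts [Or.inl h1, Or.inr (hL z h1)]
  obtain ⟨q, hqT, hqΓ⟩ : ∃ q ∈ T, q ∈ Γ := by
    by_contra! hcon
    rcases h.subset_or hTc (fun z hz => ⟨(hTS hz).1, hcon z hz⟩) with h1 | h1
    · obtain ⟨a, ha, -, haG⟩ := h.innerG
      obtain ⟨x, hx1, hx2⟩ := hTδ
      have h2 : a ≤ ‖x‖ := closure_minimal (fun y hy => (haG y (h1 hy)).le)
        (isClosed_le continuous_const continuous_norm) hx1
      rw [mem_sphere_zero_iff_norm] at hx2
      linarith
    · obtain ⟨z, hz, hz2⟩ := hout A (by linarith)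
      linarith [hL z (h1 hz)]
  have hlow : ∀ z ∈ region G W c, K * A ≤ ‖W z‖ → K * ‖W z‖ ≤ c → 99 / 100 * ‖W z‖ ≤ ‖z‖ := by
    intro z hz h1 h2
    obtain ⟨θ, hθ⟩ := hflat _ h1 h2
    have h3 := hθ z hz le_rfl
    have h4 := norm_sub_norm_le (Complex.exp (θ * I) * W z) z
    rw [norm_mul, Complex.norm_exp_ofReal_mul_I, one_mul, norm_sub_rev] at h4
    linarith
  have hTnorm : ∀ z ∈ T, ‖z‖ < R := fun z hz => mem_ball_zero_iff.1 (hTS hz).2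
  have hcontW : ContinuousOn (fun z => ‖W z‖) D := h.differentiableOn.continuousOn.norm
  have hTW : ∀ z ∈ T, z ∈ G → ‖W z‖ < 3 * R := by
    have hU1 : IsOpen (G ∩ (fun z => ‖W z‖) ⁻¹' Ioi (3 * R)) :=
      (hcontW.mono h.G_subset).isOpen_inter_preimage h.openG isOpen_Ioi
    have hU2 : IsOpen (L ∪ D ∩ (fun z => ‖W z‖) ⁻¹' Iio (3 * R)) :=
      h.openL.union (hcontW.isOpen_inter_preimage h.openD isOpen_Iio)
    have hT2 : T ⊆ L ∪ D ∩ (fun z => ‖W z‖) ⁻¹' Iio (3 * R) := by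
      refine hTc.subset_left_of_subset_union hU2 hU1 ?_ ?_ ?_
      · rw [disjoint_left]
        rintro z (h1 | h1) h2
        · exact disjoint_left.1 h.disjGL h2.1 h1
        · exact lt_asymm (show ‖W z‖ < 3 * R from h1.2) h2.2
      · intro z hz
        have hzD := (hTS hz).1
        by_cases hΓ : z ∈ Γ
        · exact Or.inl (Or.inr ⟨hzD, show ‖W z‖ < 3 * R by linarith [h.bndΓ z hΓ]⟩)
        rcases h.mem_GL hzD hΓ with h1 | h1
        · rcases lt_trichotomy ‖W z‖ (3 * R) with h2 | h2 | h2
          · exact Or.inl (Or.inr ⟨hzD, h2⟩)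
          · exfalso
            have h3 := hlow z ⟨h1, by linarith [hTnorm z hz], by linarith⟩ (by linarith)
              (by rw [h2]; exact hR)
            linarith [hTnorm z hz]
          · exact Or.inr ⟨h1, h2⟩
        · exact Or.inl (Or.inl h1)
      · exact ⟨q, hqT, Or.inr ⟨(hTS hqT).1, show ‖W q‖ < 3 * R by linarith [h.bndΓ q hqΓ]⟩⟩
    intro z hz hzG
    rcases hT2 hz with h1 | h1
    · exact absurd h1 (disjoint_left.1 h.disjGL hzG)
    · exact h1.2
  have hreg : ∀ z ∈ T, z ∈ G → z ∈ region G W c ∧ (‖W z‖ ≤ K * A ∨ ‖W z‖ ≤ 2 * ‖z‖) := by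
    intro z hz hzG
    have h1 := hTW z hz hzG
    have h2 : z ∈ region G W c := ⟨hzG, by linarith [hTnorm z hz], by linarith⟩
    refine ⟨h2, ?_⟩
    rcases le_or_gt ‖W z‖ (K * A) with h3 | h3
    · exact Or.inl h3
    · right
      have h4 := hlow z h2 h3.le (le_trans (mul_le_mul_of_nonneg_left h1.le (by linarith)) hR)
      linarith [norm_nonneg z]
  refine ⟨hcases, hreg, ?_⟩
  obtain ⟨z₁, hz₁T, hz₁⟩ : ∃ z₁ ∈ T, ‖z₁‖ = κ := by
    obtain ⟨z, hz, hzκ⟩ := hout κ (by linarith)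
    have h1 := hTc.intermediate_value hqT hz continuous_norm.continuousOn
    exact h1 ⟨by rw [h.norm_Γ hqΓ]; linarith [h.two_le], hzκ.le⟩
  have hz₁G : z₁ ∈ G := (hcases z₁ hz₁T).resolve_right fun h1 => by linarith
  obtain ⟨hz₁reg, hz₁W⟩ := hreg z₁ hz₁T hz₁G
  have hz₁sh : z₁ ∈ shell G W c (K * A) (R / 2) := by
    refine ⟨hz₁reg, ?_, ?_⟩
    · have h1 := h.norm_le_of_mem_region hz₁reg
      rw [hz₁] at h1
      linarith
    · rcases hz₁W with h1 | h1 <;> linarith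
  refine habs _ (hconn _ _ le_rfl (by nlinarith)) (fun z hz => ⟨h.shell_subset hz, ?_⟩)
    ⟨z₁, hz₁sh, hz₁T⟩
  obtain ⟨θ, hθ⟩ := hflat (R / 2) (by linarith) (by nlinarith)
  have h3 := hθ z hz.1 hz.2.2.le
  have h4 := norm_sub_norm_le z (Complex.exp (θ * I) * W z)
  rw [norm_mul, Complex.norm_exp_ofReal_mul_I, one_mul] at h4
  rw [mem_ball_zero_iff]
  linarith [hz.2.2]

/-- If the potential is close to the rotation by `e` up to the scale `ρ`, then the half-disc of
radius `ρ / 3` in direction `e` lies in the region, up to a thin strip. -/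
lemma halfDisc_subset_region (h : OFrame δ A c D E F₁ F₂ f W y₁ y₂ Γ G L) {σ ρ : ℝ} {e : ℂ}
    (he : ‖e‖ = 1) (hσ1 : σ ≤ 1 / 100) (hAρ : A ≤ σ * ρ) (hρ0 : 0 < ρ) (hρc : ρ < c)
    (hflat : ∀ z ∈ region G W c, ‖W z‖ ≤ ρ → ‖z - e * W z‖ ≤ σ * ρ) {z : ℂ}
    (hz : z ∈ region G W c) (hzW : ‖W z‖ < ρ) (hzY : σ * ρ < (conj e * z).re)
    (hzρ : ‖z‖ < ρ / 3) :
    {x | σ * ρ < (conj e * x).re} ∩ ball 0 (ρ / 3) ⊆ region G W ρ := by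
  have hc16 := h.c_le
  have hee : conj e * e = 1 := by
    rw [mul_comm, Complex.mul_conj, Complex.normSq_eq_norm_sq, he]; norm_num
  have hen : ‖conj e‖ = 1 := by rw [RCLike.norm_conj, he]
  have hconv : Convex ℝ ({x | σ * ρ < (conj e * x).re} ∩ ball (0 : ℂ) (ρ / 3)) := by
    refine Convex.inter ?_ (convex_ball _ _)
    exact (convex_Ioi (σ * ρ)).linear_preimage (reLm ∘ₗ LinearMap.mulLeft ℝ (conj e))
  refine hconv.isPreconnected.subset_of_closure_inter_subset (h.isOpen_region ρ)
    ⟨z, ⟨hzY, mem_ball_zero_iff.2 hzρ⟩, ⟨hz.1, hz.2.1, hzW⟩⟩ ?_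
  rintro ζ ⟨hζ, hζY, hζb⟩
  rw [mem_ball_zero_iff] at hζb
  have hζY' : σ * ρ < (conj e * ζ).re := hζY
  obtain ⟨-, h4, h5, h6, h7⟩ := h.closure_region hζ
  have hζflat : ‖ζ - e * W ζ‖ ≤ σ * ρ := by
    have hne := mem_closure_iff_nhdsWithin_neBot.1 hζ
    have hW : Tendsto W (𝓝[region G W ρ] ζ) (𝓝 (W ζ)) := (h.contW ζ h5).mono_left
      (nhdsWithin_mono ζ fun z hz => Or.inl (h.G_subset hz.1))
    have hid : Tendsto (fun x : ℂ => x) (𝓝[region G W ρ] ζ) (𝓝 ζ) :=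
      tendsto_id.mono_left nhdsWithin_le_nhds
    refine le_of_tendsto (hid.sub (hW.const_mul e)).norm ?_
    filter_upwards [self_mem_nhdsWithin] with x hx
    exact hflat x ⟨hx.1, hx.2.1, hx.2.2.trans hρc⟩ hx.2.2.le
  have hlow : ‖W ζ‖ ≤ ‖ζ‖ + σ * ρ := by
    have h8 := norm_sub_norm_le (e * W ζ) ζ
    rw [norm_mul, he, one_mul, norm_sub_rev] at h8
    linarith
  rcases h7 with h7 | h7 | h7
  · refine ⟨h7, by linarith, ?_⟩
    nlinarith
  · exfalso
    have h8 := Complex.re_le_norm (conj e * ζ)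
    rw [norm_mul, hen, one_mul, h.norm_Γ h7] at h8
    linarith [h.two_le]
  · exfalso
    have h8 := Complex.re_le_norm (conj e * (ζ - e * W ζ))
    rw [norm_mul, hen, one_mul, mul_sub, ← mul_assoc, hee, one_mul, sub_re, h.re_zero ζ h7] at h8
    linarith

/-- Flatness of the component at a fixed scale. -/
theorem component_flat (h : OFrame δ A c D E F₁ F₂ f W y₁ y₂ Γ G L) {K R r σ θ : ℝ}
    (hK : 10 ≤ K) (hσ1 : σ ≤ 1 / 100) {T : Set ℂ} {z₀ : ℂ}
    (hT : T = connectedComponentIn (D ∩ ball 0 R) z₀)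
    (hcases : ∀ z ∈ T, z ∈ G ∨ ‖z‖ ≤ A)
    (hreg : ∀ z ∈ T, z ∈ G → z ∈ region G W c ∧ (‖W z‖ ≤ K * A ∨ ‖W z‖ ≤ 2 * ‖z‖))
    (hshell : shell G W c (K * A) (R / 2) ⊆ T) (hrR : r ≤ R) (hKr : 16 * (K * A) < r)
    (hAr : A ≤ σ * (3 * r)) (hrc : 3 * r < c)
    (hflat : ∀ z ∈ region G W c, ‖W z‖ ≤ 3 * r →
      ‖z - Complex.exp (θ * I) * W z‖ ≤ σ * (3 * r)) {u : ℂ → ℝ}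
    (hu : ∀ z ∈ D, (W z).re = u z) {x : ℂ} (hx : ‖x‖ < r) (hxA : A < ‖x‖) :
    |Set.indicator T u (rot θ x) - Pfun x| ≤ σ * (3 * r) := by
  have hA := h.A_pos
  have hKA : 0 < K * A := mul_pos (by linarith) hA
  have hr0 : 0 < r := by linarith
  set e := Complex.exp (θ * I) with hedef
  have he : ‖e‖ = 1 := Complex.norm_exp_ofReal_mul_I _
  have hee : conj e * e = 1 := by
    rw [mul_comm, Complex.mul_conj, Complex.normSq_eq_norm_sq, he]; norm_num
  have hen : ‖conj e‖ = 1 := by rw [RCLike.norm_conj, he]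
  have hrot : rot θ x = e * x := rfl
  have hxe : conj e * (e * x) = x := by rw [← mul_assoc, hee, one_mul]
  have hnx : ‖e * x‖ = ‖x‖ := by rw [norm_mul, he, one_mul]
  have hTS : T ⊆ D ∩ ball 0 R := hT ▸ connectedComponentIn_subset _ _
  have hσr : 0 < σ * (3 * r) := by linarith
  rw [hrot]
  by_cases hz : e * x ∈ T
  · rw [indicator_of_mem hz]
    have hzG : e * x ∈ G := (hcases _ hz).resolve_right fun h1 => by
      rw [hnx] at h1; linarith
    obtain ⟨h1, h2⟩ := hreg _ hz hzG
    have h3 := hflat _ h1 (by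
      rw [hnx] at h2
      rcases h2 with h2 | h2 <;> linarith)
    have h4 := Complex.abs_re_le_norm (conj e * (e * x - e * W (e * x)))
    rw [norm_mul, hen, one_mul, mul_sub, hxe, ← mul_assoc, hee, one_mul, sub_re,
      hu _ (h.G_subset hzG)] at h4
    have hpos : 0 < u (e * x) := by
      rw [← hu _ (h.G_subset hzG)]; exact h.re_pos _ (h.G_subset hzG)
    have h5 := abs_le.1 (h4.trans h3)
    unfold Pfun
    rw [abs_le]
    rcases le_total x.re 0 with h6 | h6
    · rw [max_eq_right h6]; constructor <;> linarith
    · rw [max_eq_left h6]; constructor <;> linarith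
  · rw [indicator_of_notMem hz, zero_sub, abs_neg, abs_of_nonneg (le_max_right _ _)]
    refine max_le ?_ hσr.le
    by_contra! hlt
    apply hz
    -- a point of the component in the half-disc
    have hw : ((3 * r / 16 : ℝ) : ℂ) ∈ halfAnn A c := by
      refine ⟨by rw [ofReal_re]; linarith, ?_, ?_⟩ <;>
        rw [Complex.norm_real, Real.norm_eq_abs, abs_of_pos (by linarith)]
      · nlinarith
      · linarith
    obtain ⟨p, hp, hpW⟩ := h.halfAnn_subset hw
    have hpn : ‖W p‖ = 3 * r / 16 := by
      rw [hpW, Complex.norm_real, Real.norm_eq_abs, abs_of_pos (by linarith)]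
    have hpT : p ∈ T := hshell ⟨hp, by rw [hpn]; linarith, by rw [hpn]; linarith⟩
    have hpf := hflat p hp (by rw [hpn]; linarith)
    have hpb : ‖p‖ < r := by
      have h1 := norm_sub_norm_le p (e * W p)
      rw [norm_mul, he, one_mul, hpn] at h1
      nlinarith
    have hpY : σ * (3 * r) < (conj e * p).re := by
      have h1 := (abs_le.1 (Complex.abs_re_le_norm (conj e * (p - e * W p)))).1
      rw [norm_mul, hen, one_mul, mul_sub, ← mul_assoc, hee, one_mul, sub_re] at h1
      have h2 : (W p).re = 3 * r / 16 := by rw [hpW, ofReal_re]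
      have h4 : σ * (3 * r) ≤ 1 / 100 * (3 * r) := mul_le_mul_of_nonneg_right hσ1 (by linarith)
      linarith
    have h3r : 3 * r / 3 = r := by ring
    have hsub := h.halfDisc_subset_region he hσ1 hAr (by linarith) hrc hflat hp
      (by rw [hpn]; linarith) hpY (by rw [h3r]; exact hpb)
    rw [h3r] at hsub
    have hconv : Convex ℝ ({x | σ * (3 * r) < (conj e * x).re} ∩ ball (0 : ℂ) r) := by
      refine Convex.inter ?_ (convex_ball _ _)
      exact (convex_Ioi (σ * (3 * r))).linear_preimage (reLm ∘ₗ LinearMap.mulLeft ℝ (conj e))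
    have h1 := hconv.isPreconnected.subset_connectedComponentIn (F := D ∩ ball 0 R)
      ⟨hpY, mem_ball_zero_iff.2 hpb⟩ fun y hy =>
        ⟨h.G_subset (hsub hy).1, ball_subset_ball hrR hy.2⟩
    rw [hT] at hpT ⊢
    rw [← connectedComponentIn_eq hpT] at h1
    exact h1 ⟨by rw [mem_ofPred_eq, hxe]; exact hlt, by rw [mem_ball_zero_iff, hnx]; exact hx⟩

end OFrame

/-- flatness of the free boundary at all scales `Cδ < r ≤ 1/C`
under condition (A). -/
theorem flatness_all_scales :
    ∀ ε : ℝ, 0 < ε → ∃ δ₀ C : ℝ, 0 < δ₀ ∧ δ₀ < 1 ∧ 1 < C ∧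
    ∀ δ : ℝ, 0 < δ → δ < δ₀ →
    ∀ u : ℂ → ℝ, IsClassicalSolution (ann δ 1) u → ConditionA δ 1 u →
    ∀ T : Set ℂ,
      (∃ z₀ ∈ {z : ℂ | δ < ‖z‖ ∧ ‖z‖ < 1 / C ∧ 0 < u z},
        T = connectedComponentIn {z : ℂ | δ < ‖z‖ ∧ ‖z‖ < 1 / C ∧ 0 < u z} z₀) →
      (closure T ∩ Metric.sphere 0 δ).Nonempty →
      ∀ r : ℝ, C * δ < r → r ≤ 1 / C →
        ∃ θ : ℝ, ∀ x ∈ Metric.ball (0 : ℂ) r \ Metric.ball 0 (C * δ),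
          |Set.indicator T u (rot θ x) - Pfun x| ≤ ε * r := by
  intro ε hε
  have hC0 := four_le_gradBound
  have hc := potBound_pos
  have hc16 := potBound_le
  obtain ⟨σ, hσdef⟩ : ∃ σ, σ = min ε 1 / 100 := ⟨_, rfl⟩
  have hm0 : 0 < min ε 1 := lt_min hε one_pos
  have hσ0 : 0 < σ := by rw [hσdef]; positivity
  have hσ1 : σ ≤ 1 / 100 := by rw [hσdef]; linarith [min_le_right ε 1]
  have hσε : 3 * σ ≤ ε := by rw [hσdef]; linarith [min_le_left ε 1]
  obtain ⟨K, hK, hscale⟩ := exists_scale_flat hc hc16 hσ0 (by linarith)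
  obtain ⟨B, hB⟩ : ∃ B, B = 4 * Real.pi * gradBound := ⟨_, rfl⟩
  have hBC : 12 * gradBound ≤ B := by
    rw [hB]; exact mul_le_mul_of_nonneg_right (by linarith [Real.pi_gt_three]) (by linarith)
  have hB48 : 48 ≤ B := by linarith
  obtain ⟨C, hC⟩ : ∃ C, C = 3 * K / potBound + 16 * K * B + B / σ + 1 := ⟨_, rfl⟩
  have hCpos1 : 0 < 3 * K / potBound := div_pos (by linarith) hc
  have hCpos2 : 0 < B / σ := div_pos (by linarith) hσ0
  have hKB : 480 ≤ K * B := by nlinarith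
  have hC1 : 3 * K ≤ C * potBound := by
    rw [← div_le_iff₀ hc]; linarith
  have hC2 : 16 * (K * B) ≤ C := by linarith
  have hC3 : B ≤ σ * C := by
    rw [mul_comm, ← div_le_iff₀ hσ0]; linarith
  have hC0' : 0 < C := by linarith
  obtain ⟨K₃, hK₃⟩ : ∃ K₃, K₃ = (K + 4) / potBound := ⟨_, rfl⟩
  have hK₃c : K₃ * potBound = K + 4 := by rw [hK₃]; field_simp
  have hK₃1 : 64 ≤ K₃ := by
    rw [hK₃, le_div_iff₀ hc]; linarith
  have hX : 1 < 8 * C * B * K₃ := by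
    have h1 : 1 ≤ C * B := by nlinarith
    nlinarith
  refine ⟨1 / (8 * C * B * K₃), C, by positivity, ?_, by linarith, ?_⟩
  · rw [div_lt_one (by linarith)]; exact hX
  intro δ hδ0 hδ u hsol hcA T hT hTδ r hr1 hr2
  rw [lt_div_iff₀ (by linarith)] at hδ
  obtain ⟨A, hA⟩ : ∃ A, A = B * δ := ⟨_, rfl⟩
  have hA0 : 0 < A := by rw [hA]; positivity
  have hsmall : 8 * (K₃ * A) < 1 / C := by
    rw [lt_div_iff₀ hC0', hA]; linarith
  have hRC : 1 / C * C = 1 := by field_simp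
  have hR0 : 0 < 1 / C := by positivity
  have hRc : K * (3 * (1 / C)) ≤ potBound := by
    have h1 : K * (3 * (1 / C)) = 3 * K / C := by ring
    rw [h1, div_le_iff₀ hC0']; linarith
  have hKR : 10 * (3 * (1 / C)) ≤ K * (3 * (1 / C)) :=
    mul_le_mul_of_nonneg_right hK (by linarith)
  have hK₃A : 64 * A ≤ K₃ * A := mul_le_mul_of_nonneg_right hK₃1 hA0.le
  have hAc : 8 * A ≤ potBound := by linarith
  have hδ1 : δ < 1 := by
    have : δ ≤ A := by rw [hA]; nlinarith
    linarith
  obtain ⟨F₁, F₂, f, W, hpot, hWu⟩ := hsol.exists_potential hδ0 hδ1 hcA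
  obtain ⟨F₁', F₂', W', y₁, y₂, Γ, G, L, hfr, hre⟩ := hpot.exists_oFrame (by
    rw [← hB, ← hA]; exact hAc)
  rw [← hB, ← hA] at hfr
  obtain ⟨hconn, hflat⟩ := hscale _ _ _ _ _ _ _ _ _ _ _ _ _ hfr
  have hL : ∀ z ∈ L, ‖z‖ ≤ A := fun z hz => by
    have h1 := hfr.norm_le_of_mem_L (by linarith [hfr.two_le]) hz
    refine h1.trans ?_
    rw [hA]
    exact mul_le_mul_of_nonneg_right (by linarith) hδ0.le
  have hset : {z : ℂ | δ < ‖z‖ ∧ ‖z‖ < 1 / C ∧ 0 < u z} =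
      posSet (ann δ 1) u ∩ ball 0 (1 / C) := by
    ext z
    rw [mem_inter_iff, mem_ball_zero_iff]
    constructor
    · rintro ⟨h1, h2, h3⟩
      exact ⟨⟨⟨h1, by linarith⟩, h3⟩, h2⟩
    · rintro ⟨⟨⟨h1, -⟩, h3⟩, h2⟩
      exact ⟨h1, h2, h3⟩
  rw [hset] at hT
  obtain ⟨z₀, hz₀, hTz₀⟩ := hT
  obtain ⟨hcases, hreg, hshell⟩ := hfr.component_spec (κ := K₃ * A) hK hL hconn
    (fun ρ h1 h2 => by
      obtain ⟨θ, hθ⟩ := hflat ρ h1 h2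
      refine ⟨θ, fun z hz hzρ => (hθ z hz hzρ).trans ?_⟩
      have hρ : 0 ≤ ρ := (mul_pos (by linarith) hA0).le.trans h1
      exact mul_le_mul_of_nonneg_right hσ1 hρ) hRc
    (by rw [mul_right_comm, hK₃c]) (by linarith) hz₀ hTz₀ hTδ
  have hAC : 16 * (K * A) ≤ C * δ := by
    rw [hA]
    have := mul_le_mul_of_nonneg_right hC2 hδ0.le
    linarith
  have hKA : 10 * A ≤ K * A := mul_le_mul_of_nonneg_right hK hA0.le
  have hr0 : 0 < r := by linarith
  have hKr : K * (3 * r) ≤ potBound :=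
    (mul_le_mul_of_nonneg_left (by linarith) (by linarith)).trans hRc
  obtain ⟨θ, hθ⟩ := hflat (3 * r) (by linarith) hKr
  refine ⟨θ, fun x hx => ?_⟩
  have hx1 : ‖x‖ < r := mem_ball_zero_iff.1 hx.1
  have hx2 : C * δ ≤ ‖x‖ := by
    have := hx.2
    rwa [mem_ball_zero_iff, not_lt] at this
  have hAr : A ≤ σ * (3 * r) := by
    have h1 := mul_le_mul_of_nonneg_right hC3 hδ0.le
    have h2 : σ * (C * δ) ≤ σ * r := mul_le_mul_of_nonneg_left hr1.le hσ0.le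
    have h3 : 0 ≤ σ * r := by positivity
    rw [hA]
    linarith
  refine (hfr.component_flat hK hσ1 hTz₀ hcases hreg hshell hr2 (by linarith) hAr (by linarith) hθ
    (fun z hz => by rw [hre]; exact hWu z hz) hx1 (by linarith)).trans ?_
  have := mul_le_mul_of_nonneg_right hσε hr0.le
  linarith
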